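/- Let 0 < λ ≤ 4 with λ ≠ 2, and let u be a solution of the mean field equation Δu = λ(1−e^u) on S². Then u ≡ 0. -/

import Mathlib

open Real MeasureTheory

noncomputable section

/-- Euclidean Laplacian on ℝ² via the second iterated derivative. -/
def lap (w : ℝ × ℝ → ℝ) (y : ℝ × ℝ) : ℝ :=
  iteratedFDeriv ℝ 2 w y ![(1, 0), (1, 0)] + iteratedFDeriv ℝ 2 w y ![(0, 1), (0, 1)]

/-- The unit sphere S² ⊂ ℝ³ (vectors encoded as functions `Fin 3 → ℝ`). -/
def sphere3 : Set (Fin 3 → ℝ) := {x | x 0 ^ 2 + x 1 ^ 2 + x 2 ^ 2 = 1}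

/-- Inverse stereographic projection from the north pole. -/
def stereoN (y : ℝ × ℝ) : Fin 3 → ℝ :=
  ![2 * y.1 / (1 + y.1 ^ 2 + y.2 ^ 2), 2 * y.2 / (1 + y.1 ^ 2 + y.2 ^ 2),
    (y.1 ^ 2 + y.2 ^ 2 - 1) / (1 + y.1 ^ 2 + y.2 ^ 2)]

/-- South-pole parametrization of the sphere. -/
def stereoS (y : ℝ × ℝ) : Fin 3 → ℝ :=
  ![2 * y.1 / (1 + y.1 ^ 2 + y.2 ^ 2), 2 * y.2 / (1 + y.1 ^ 2 + y.2 ^ 2),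
    (1 - y.1 ^ 2 - y.2 ^ 2) / (1 + y.1 ^ 2 + y.2 ^ 2)]

/-- `u` is a solution of the mean field equation `Δu = lam (1 - e^u)` on `S²`,
expressed in the two stereographic charts. -/
def IsMFSolution (lam : ℝ) (u : (Fin 3 → ℝ) → ℝ) : Prop :=
  ContinuousOn u sphere3 ∧
  ContDiff ℝ 2 (fun y => u (stereoN y)) ∧
  ContDiff ℝ 2 (fun y => u (stereoS y)) ∧
  (∀ y : ℝ × ℝ, lap (fun z => u (stereoN z)) y =
    4 * lam * (1 - Real.exp (u (stereoN y))) / (1 + y.1 ^ 2 + y.2 ^ 2) ^ 2) ∧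
  (∀ y : ℝ × ℝ, lap (fun z => u (stereoS z)) y =
    4 * lam * (1 - Real.exp (u (stereoS y))) / (1 + y.1 ^ 2 + y.2 ^ 2) ^ 2)

/-- `u` is axially symmetric on `S²`: constant on the level sets of `⟨·, e⟩`
for some unit vector `e`. -/
def AxiallySymmetric (u : (Fin 3 → ℝ) → ℝ) : Prop :=
  ∃ e : Fin 3 → ℝ, e 0 ^ 2 + e 1 ^ 2 + e 2 ^ 2 = 1 ∧
    ∀ x ∈ sphere3, ∀ x' ∈ sphere3,
      x 0 * e 0 + x 1 * e 1 + x 2 * e 2 = x' 0 * e 0 + x' 1 * e 1 + x' 2 * e 2 →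
      u x = u x'

/-- Surface integral over `S²`, written in the north-pole stereographic chart. -/
def sphereIntegral (f : (Fin 3 → ℝ) → ℝ) : ℝ :=
  ∫ y : ℝ × ℝ, f (stereoN y) * (4 / (1 + y.1 ^ 2 + y.2 ^ 2) ^ 2)

namespace MF
open Complex (I)
open scoped ComplexConjugate

/-- twice the d-bar operator -/
def db (f : ℂ → ℂ) (x : ℂ) : ℂ := fderiv ℝ f x 1 + I * fderiv ℝ f x I

theorem integral_fderiv_zero {f : ℂ → ℂ} (hf : ContDiff ℝ 1 f) (hc : HasCompactSupport f) (v : ℂ) :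
    ∫ x, fderiv ℝ f x v = 0 := by
  have h := integral_bilinear_fderiv_right_eq_neg_left_of_integrable (μ := (volume : Measure ℂ))
    (f := fun _ : ℂ => (1:ℝ)) (g := f) (v := v) (B := ContinuousLinearMap.lsmul ℝ ℝ) (by simp)
    (by
      simp only [ContinuousLinearMap.lsmul_apply, one_smul]
      exact ((hf.continuous_fderiv (by norm_num)).clm_apply continuous_const).integrable_of_hasCompactSupport
        (hc.fderiv_apply (𝕜 := ℝ) v))
    (by
      simp only [ContinuousLinearMap.lsmul_apply, one_smul]
      exact hf.continuous.integrable_of_hasCompactSupport hc)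
    (fun x _ => by fun_prop) (fun x _ => hf.differentiable (by norm_num) x)
  simpa using h

theorem integral_db_zero {f : ℂ → ℂ} (hf : ContDiff ℝ 1 f) (hc : HasCompactSupport f) :
    ∫ x, db f x = 0 := by
  unfold db
  have hi : ∀ v, Integrable (fun x => fderiv ℝ f x v) := fun v =>
    ((hf.continuous_fderiv (by norm_num)).clm_apply continuous_const).integrable_of_hasCompactSupport
        (hc.fderiv_apply (𝕜 := ℝ) v)
  rw [integral_add (hi 1) ((hi I).const_mul I), integral_const_mul,
    integral_fderiv_zero hf hc, integral_fderiv_zero hf hc]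
  simp

theorem db_mul {f g : ℂ → ℂ} {x : ℂ} (hf : DifferentiableAt ℝ f x) (hg : DifferentiableAt ℝ g x) :
    db (fun z => f z * g z) x = db f x * g x + f x * db g x := by
  unfold db
  rw [fderiv_fun_mul hf hg]
  simp
  ring

theorem db_holo {g : ℂ → ℂ} {x : ℂ} (hg : DifferentiableAt ℂ g x) : db g x = 0 := by
  unfold db
  rw [hg.fderiv_restrictScalars ℝ]
  simp only [ContinuousLinearMap.coe_restrictScalars']
  have : fderiv ℂ g x I = I * fderiv ℂ g x 1 := by
    rw [← smul_eq_mul, ← map_smul]; simp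
  rw [this, ← mul_assoc, Complex.I_mul_I]; ring

theorem clm_form (L : ℂ →L[ℝ] ℂ) (w : ℂ) :
    L w + I * L (w * I) = (L 1 + I * L I) * conj w := by
  have hw : ∀ w : ℂ, L w = w.re * L 1 + w.im * L I := by
    intro w
    have : w = w.re • (1:ℂ) + w.im • I := by
      apply Complex.ext <;> simp
    conv_lhs => rw [this]
    rw [map_add, map_smul, map_smul]; simp
  rw [hw w, hw (w * I)]
  have : conj w = w.re - w.im * I := by
    apply Complex.ext <;> simp
  rw [this]
  simp
  ring_nf
  simp

theorem db_comp {κ F : ℂ → ℂ} {G x : ℂ} (hκ : DifferentiableAt ℝ κ (F x)) (hF : HasDerivAt F G x) :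
    db (fun z => κ (F z)) x = db κ (F x) * conj G := by
  have h1 : HasFDerivAt F ((ContinuousLinearMap.toSpanSingleton ℂ G).restrictScalars ℝ) x :=
    hF.hasFDerivAt.restrictScalars ℝ
  have h2 := hκ.hasFDerivAt.comp x h1
  unfold db
  have h3 : fderiv ℝ (fun z => κ (F z)) x = _ := h2.fderiv
  rw [h3]
  simp only [ContinuousLinearMap.comp_apply, ContinuousLinearMap.coe_restrictScalars',
    ContinuousLinearMap.toSpanSingleton_apply, smul_eq_mul]
  rw [mul_comm I G, one_mul, clm_form]

def kap (ε : ℝ) (z : ℂ) : ℂ := conj z ^ 2 / (z * conj z + ε)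
def kap1 (ε : ℝ) (z : ℂ) : ℂ := 2 * (conj z ^ 2 * z + 2 * ε * conj z) / (z * conj z + ε) ^ 2
def kap2 (ε : ℝ) (z : ℂ) : ℂ := 8 * ε ^ 2 / (z * conj z + ε) ^ 3

theorem den_ne {ε : ℝ} (hε : 0 < ε) (z : ℂ) : z * conj z + ε ≠ 0 := by
  rw [Complex.mul_conj]
  have := Complex.normSq_nonneg z
  exact_mod_cast (by positivity : Complex.normSq z + ε ≠ 0)

theorem den_ne' {ε : ℝ} (hε : 0 < ε) (z : ℂ) : conj z * z + ε ≠ 0 := by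
  rw [mul_comm]; exact den_ne hε z

theorem hasFDerivAt_conj' (z : ℂ) : HasFDerivAt (fun z : ℂ => conj z)
    (Complex.conjCLE : ℂ →L[ℝ] ℂ) z := Complex.conjCLE.hasFDerivAt

theorem contDiff_conj' {n} : ContDiff ℝ n (fun z : ℂ => conj z) := Complex.conjCLE.contDiff

theorem contDiff_den (ε : ℝ) : ContDiff ℝ 1 (fun z : ℂ => z * conj z + (ε:ℂ)) :=
  (contDiff_id.mul contDiff_conj').add contDiff_const

theorem contDiff_kap {ε : ℝ} (hε : 0 < ε) : ContDiff ℝ 1 (kap ε) := by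
  unfold kap
  simp only [div_eq_mul_inv]
  exact (contDiff_conj'.pow 2).mul ((contDiff_den ε).inv (den_ne hε))

theorem contDiff_kap1 {ε : ℝ} (hε : 0 < ε) : ContDiff ℝ 1 (kap1 ε) := by
  unfold kap1
  simp only [div_eq_mul_inv]
  exact (contDiff_const.mul (((contDiff_conj'.pow 2).mul contDiff_id).add
    (contDiff_const.mul contDiff_conj'))).mul
    (((contDiff_den ε).pow 2).inv (fun z => pow_ne_zero _ (den_ne hε z)))

theorem db_eq {f : ℂ → ℂ} {f' : ℂ →L[ℝ] ℂ} {x : ℂ} (h : HasFDerivAt f f' x) :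
    db f x = f' 1 + I * f' I := by unfold db; rw [h.fderiv]

theorem db_conj (z : ℂ) : db (fun z => conj z) z = 2 := by
  rw [db_eq (hasFDerivAt_conj' z)]
  simp; norm_num

theorem db_den (ε : ℝ) (z : ℂ) : db (fun z => z * conj z + (ε:ℂ)) z = 2 * z := by
  have h : HasFDerivAt (fun z : ℂ => z * conj z + (ε:ℂ)) _ z :=
    ((hasFDerivAt_id (𝕜 := ℝ) z).mul (hasFDerivAt_conj' z)).add_const (ε:ℂ)
  rw [db_eq h]
  simp
  ring_nf
  simp
  ring

theorem db_kap {ε : ℝ} (hε : 0 < ε) (z : ℂ) : db (kap ε) z = kap1 ε z := by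
  have hd := den_ne hε z
  have hd' := den_ne' hε z
  have e1 : (fun z => kap ε z * (z * conj z + (ε:ℂ))) = fun z => conj z * conj z := by
    funext z; unfold kap; have := den_ne' hε z; field_simp
  have e2 := db_mul (((contDiff_kap hε).differentiable (by norm_num)) z)
    (((contDiff_den ε).differentiable (by norm_num)) z)
  rw [e1, db_mul (hasFDerivAt_conj' z).differentiableAt (hasFDerivAt_conj' z).differentiableAt,
    db_conj, db_den] at e2
  have e3 : db (kap ε) z = (2 * conj z + conj z * 2 - kap ε z * (2 * z)) / (z * conj z + (ε:ℂ)) := by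
    rw [eq_div_iff hd]; linear_combination -e2
  rw [e3]; unfold kap kap1
  field_simp
  ring

theorem db_kap1 {ε : ℝ} (hε : 0 < ε) (z : ℂ) : db (kap1 ε) z = kap2 ε z := by
  have hd := den_ne hε z
  have hd' := den_ne' hε z
  have hdd := ((contDiff_den ε).differentiable (by norm_num)) z
  have hc := (hasFDerivAt_conj' z).differentiableAt
  have hcon : ∀ c : ℂ, DifferentiableAt ℂ (fun _ : ℂ => c) z := fun c => by fun_prop
  have hid : DifferentiableAt ℂ (fun z : ℂ => z) z := by fun_prop
  have e1 : (fun z => kap1 ε z * ((z * conj z + (ε:ℂ)) * (z * conj z + (ε:ℂ)))) = 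
      fun z => (2 * conj z) * ((z * conj z + (ε:ℂ)) + (ε:ℂ)) := by
    funext z; unfold kap1; have := den_ne' hε z; field_simp; ring
  have e2 := db_mul (((contDiff_kap1 hε).differentiable (by norm_num)) z) (hdd.mul hdd)
  have e4 : ∀ z : ℂ, (z * conj z + (ε:ℂ)) + (ε:ℂ) = z * conj z + ((2 * ε : ℝ) : ℂ) := by
    intro z; push_cast; ring
  have hdd2 := ((contDiff_den (2 * ε)).differentiable (by norm_num)) z
  simp only [Pi.mul_apply] at e2
  simp only [e4] at e1
  rw [e1] at e2
  have e5 := db_mul hdd hdd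
  have e6 := db_mul (hcon 2 |>.restrictScalars ℝ) hc
  have e7 := db_mul (((hcon 2).restrictScalars ℝ).fun_mul hc) hdd2
  rw [e6, db_holo (hcon 2), db_conj, db_den] at e7
  rw [db_den] at e5
  rw [show ((fun z : ℂ => z * conj z + (ε:ℂ)) * fun z => z * conj z + (ε:ℂ)) =
    fun z => (z * conj z + (ε:ℂ)) * (z * conj z + (ε:ℂ)) from rfl, e5, e7] at e2
  have e3 : db (kap1 ε) z = (2 * 2 * (z * conj z + 2 * ε) + 2 * conj z * (2 * z)
      - kap1 ε z * (2 * (z * conj z + (ε:ℂ)) * (2 * z))) / (z * conj z + (ε:ℂ)) ^ 2 := by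
    rw [eq_div_iff (pow_ne_zero 2 hd)]; push_cast at e2; linear_combination -e2
  rw [e3]; unfold kap1 kap2
  field_simp
  ring

theorem norm_kap_le {ε : ℝ} (hε : 0 < ε) (z : ℂ) : ‖kap ε z‖ ≤ 1 := by
  unfold kap
  rw [Complex.mul_conj, norm_div, norm_pow, Complex.norm_conj]
  have : (Complex.normSq z : ℂ) + ε = ((Complex.normSq z + ε : ℝ) : ℂ) := by push_cast; rfl
  rw [this, Complex.norm_real, Complex.normSq_eq_norm_sq, Real.norm_eq_abs, abs_of_pos (by positivity)]
  apply div_le_one_of_le₀ <;> [linarith; positivity]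

theorem kap2_eq (ε : ℝ) (z : ℂ) : kap2 ε z = ((8 * ε ^ 2 / (‖z‖ ^ 2 + ε) ^ 3 : ℝ) : ℂ) := by
  unfold kap2
  rw [Complex.mul_conj, Complex.normSq_eq_norm_sq]; push_cast; rfl

theorem norm_db_le {ψ : ℂ → ℝ} {x : ℂ} (h : DifferentiableAt ℝ ψ x) :
    ‖db (fun z => (ψ z : ℂ)) x‖ ≤ ‖fderiv ℝ ψ x‖ := by
  have h1 : HasFDerivAt (fun z => (ψ z : ℂ)) (Complex.ofRealCLM.comp (fderiv ℝ ψ x)) x :=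
    Complex.ofRealCLM.hasFDerivAt.comp x h.hasFDerivAt
  rw [db_eq h1]
  simp only [ContinuousLinearMap.comp_apply, Complex.ofRealCLM_apply]
  set L := fderiv ℝ ψ x
  set a := L 1
  set b := L I
  have e1 : L (a + b * I) = a * a + b * b := by
    have : (a + b * I : ℂ) = a • (1:ℂ) + b • I := by simp
    rw [this, map_add, map_smul, map_smul]; rfl
  have e2 := L.le_opNorm (a + b * I)
  have e3 : ‖(a + b * I : ℂ)‖ ^ 2 = a * a + b * b := by
    rw [← Complex.normSq_eq_norm_sq, Complex.normSq_add_mul_I]; ring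
  have : (a + I * b : ℂ) = a + b * I := by ring
  rw [this]
  rw [e1, ← e3, Real.norm_eq_abs, abs_of_nonneg (by positivity)] at e2
  by_cases h0 : ‖(a + b * I : ℂ)‖ = 0
  · rw [h0]; positivity
  · have : 0 < ‖(a + b * I : ℂ)‖ := lt_of_le_of_ne (norm_nonneg _) (Ne.symm h0)
    nlinarith

end MF

namespace MF
open Complex (I)
open scoped ComplexConjugate

theorem radial_integral {c : ℝ} (hc : 0 < c) :
    Integrable (fun s : ℂ => 2 / ((c * ‖s‖) ^ 2 + 1) ^ 3) ∧
    ∫ s : ℂ, 2 / ((c * ‖s‖) ^ 2 + 1) ^ 3 = π / c ^ 2 := by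
  have hd : ∀ r ∈ Set.Ioi (0:ℝ), HasDerivAt (fun r : ℝ => -(1 / (2 * c ^ 2)) * (((c * r) ^ 2 + 1) ^ 2)⁻¹)
      (r ^ (Module.finrank ℝ ℂ - 1) • (2 / ((c * r) ^ 2 + 1) ^ 3)) r := by
    intro r _
    have h1 : HasDerivAt (fun r : ℝ => ((c * r) ^ 2 + 1) ^ 2) _ r :=
      ((((hasDerivAt_id r).const_mul c).pow 2).add_const 1).pow 2
    have h2 : ((c * r) ^ 2 + 1) ^ 2 ≠ 0 := by positivity
    have h3 : HasDerivAt (fun r : ℝ => -(1 / (2 * c ^ 2)) * (((c * r) ^ 2 + 1) ^ 2)⁻¹) _ r :=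
      (h1.fun_inv h2).const_mul (-(1 / (2 * c ^ 2)))
    refine h3.congr_deriv ?_
    have : (c * r) ^ 2 + 1 ≠ 0 := by positivity
    have : c ^ 2 * r ^ 2 + 1 ≠ 0 := by positivity
    simp [Complex.finrank_real_complex]
    field_simp
  have hcont : ContinuousWithinAt (fun r : ℝ => -(1 / (2 * c ^ 2)) * (((c * r) ^ 2 + 1) ^ 2)⁻¹)
      (Set.Ici 0) 0 := by
    apply Continuous.continuousWithinAt
    apply Continuous.mul continuous_const
    apply Continuous.inv₀ (by fun_prop)
    intro r; positivity
  have hlim : Filter.Tendsto (fun r : ℝ => -(1 / (2 * c ^ 2)) * (((c * r) ^ 2 + 1) ^ 2)⁻¹) Filter.atTop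
      (nhds (-(1 / (2 * c ^ 2)) * 0)) := by
    apply Filter.Tendsto.const_mul
    apply Filter.Tendsto.inv_tendsto_atTop
    apply Filter.Tendsto.comp (Filter.tendsto_pow_atTop (by norm_num))
    apply Filter.tendsto_atTop_add_const_right
    apply Filter.Tendsto.comp (Filter.tendsto_pow_atTop (by norm_num))
    exact Filter.tendsto_id.const_mul_atTop hc
  have hi := integrableOn_Ioi_deriv_of_nonneg hcont hd (by
    intro r hr
    have : (0:ℝ) < r := hr
    simp only [smul_eq_mul]; positivity) hlim
  have hv := integral_Ioi_of_hasDerivAt_of_tendsto hcont hd hi hlim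
  constructor
  · exact (integrable_fun_norm_addHaar (volume : Measure ℂ) (f := fun r => 2 / ((c * r) ^ 2 + 1) ^ 3)).2 hi
  · rw [integral_fun_norm_addHaar (volume : Measure ℂ) (fun r => 2 / ((c * r) ^ 2 + 1) ^ 3), hv]
    simp [Measure.real, Complex.finrank_real_complex]
    field_simp

theorem hcs_prod {f g : ℂ → ℂ} {h : ℂ × ℂ → ℂ} (hf : HasCompactSupport f) (hg : HasCompactSupport g) :
    HasCompactSupport (fun p : ℂ × ℂ => f p.1 * g p.2 * h p) := by
  apply HasCompactSupport.intro (hf.isCompact.prod hg.isCompact)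
  intro p hp
  rw [Set.mem_prod, not_and_or] at hp
  rcases hp with hp | hp <;> simp [image_eq_zero_of_notMem_tsupport hp]

theorem kernel_eps {ψ : ℂ → ℝ} {F G : ℂ → ℂ} (hψ : ContDiff ℝ 1 ψ) (hc : HasCompactSupport ψ)
    (h0 : ∀ x, 0 ≤ ψ x) (hF : ∀ z, HasDerivAt F (G z) z) (hG : Differentiable ℂ G)
    {ε : ℝ} (hε : 0 < ε) :
    ∫ x, ∫ y, ψ x * ψ y * ‖G x‖ ^ 2 * ‖G y‖ ^ 2 * (8 * ε ^ 2 / (‖F y - F x‖ ^ 2 + ε) ^ 3) ≤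
      (∫ x, ‖fderiv ℝ ψ x‖ * ‖G x‖) ^ 2 := by
  set Ψ : ℂ → ℂ := fun z => (ψ z : ℂ) with hΨ
  have hΨ1 : ContDiff ℝ 1 Ψ := Complex.ofRealCLM.contDiff.comp hψ
  have hΨc : HasCompactSupport Ψ := hc.comp_left (g := fun r : ℝ => (r : ℂ)) (by simp)
  have hFd : Differentiable ℂ F := fun z => (hF z).differentiableAt
  have hF1 : ContDiff ℝ 1 F := (hFd.contDiff (n := 1)).restrict_scalars ℝ
  have hG1 : ContDiff ℝ 1 G := (hG.contDiff (n := 1)).restrict_scalars ℝ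
  have hdbc : Continuous (db Ψ) := by
    unfold db
    have := hΨ1.continuous_fderiv (by norm_num)
    fun_prop
  have hdbs : HasCompactSupport (db Ψ) := by
    unfold db
    exact ((hΨc.fderiv_apply (𝕜 := ℝ) 1)).add ((hΨc.fderiv_apply (𝕜 := ℝ) I).mul_left)
  -- general integration by parts
  have ibp : ∀ K : ℂ → ℂ, ContDiff ℝ 1 K → 
      ∫ y, db Ψ y * G y * K y = - ∫ y, Ψ y * G y * db K y := by
    intro K hK
    have h := integral_db_zero (f := fun y => (Ψ y * G y) * K y) ((hΨ1.mul hG1).mul hK)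
      (hΨc.mul_right.mul_right)
    have e : ∀ y, db (fun y => (Ψ y * G y) * K y) y = db Ψ y * G y * K y + Ψ y * G y * db K y := by
      intro y
      have d1 := hΨ1.differentiable (by norm_num) y
      have d2 := hG1.differentiable (by norm_num) y
      rw [db_mul (d1.fun_mul d2) (hK.differentiable (by norm_num) y), db_mul d1 d2, db_holo (hG y)]
      ring
    simp_rw [e] at h
    have hdK : Continuous (db K) := by
      unfold db
      have := hK.continuous_fderiv (by norm_num)
      fun_prop
    rw [integral_add] at h
    · exact eq_neg_of_add_eq_zero_left h
    · exact ((hdbc.mul hG1.continuous).mul hK.continuous).integrable_of_hasCompactSupport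
        hdbs.mul_right.mul_right
    · exact ((hΨ1.continuous.mul hG1.continuous).mul hdK).integrable_of_hasCompactSupport
        hΨc.mul_right.mul_right
  have hk := contDiff_kap hε
  have hk1 := contDiff_kap1 hε
  have hFc := hF1.continuous
  have hGc := hG1.continuous
  have hΨcc := hΨ1.continuous
  have i1 : ∀ x, ∫ y, db Ψ y * G y * kap ε (F x - F y) = ∫ y, Ψ y * G y * (conj (G y) * kap1 ε (F x - F y)) := by
    intro x
    rw [ibp (fun y => kap ε (F x - F y)) (hk.comp (contDiff_const.sub hF1)), ← integral_neg]
    congr 1; funext y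
    rw [db_comp (κ := kap ε) (F := fun y => F x - F y) (hk.differentiable (by norm_num) _)
      ((hF y).const_sub (F x)), db_kap hε, map_neg]
    ring
  have i2 : ∀ y, ∫ x, db Ψ x * G x * kap1 ε (F x - F y) = - ∫ x, Ψ x * G x * (conj (G x) * kap2 ε (F x - F y)) := by
    intro y
    rw [ibp (fun x => kap1 ε (F x - F y)) (hk1.comp (hF1.sub contDiff_const))]
    congr 2; funext x
    rw [db_comp (κ := kap1 ε) (F := fun x => F x - F y) (hk1.differentiable (by norm_num) _)
      ((hF x).sub_const (F y)), db_kap1 hε]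
    ring
  have key : ∫ x, ∫ y, (db Ψ x * db Ψ y * (G x * G y * kap ε (F x - F y))) = 
     - ∫ y, ∫ x, Ψ x * Ψ y * (G x * conj (G x) * G y * conj (G y) * kap2 ε (F x - F y)) := by
    calc _ = ∫ x, db Ψ x * G x * ∫ y, db Ψ y * G y * kap ε (F x - F y) := by
            congr 1; funext x; rw [← integral_const_mul]; congr 1; funext y; ring
      _ = ∫ x, db Ψ x * G x * ∫ y, Ψ y * G y * (conj (G y) * kap1 ε (F x - F y)) := by
            simp_rw [i1]
      _ = ∫ x, ∫ y, db Ψ x * Ψ y * (G x * G y * conj (G y) * kap1 ε (F x - F y)) := by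
            congr 1; funext x; rw [← integral_const_mul]; congr 1; funext y; ring
      _ = ∫ y, ∫ x, db Ψ x * Ψ y * (G x * G y * conj (G y) * kap1 ε (F x - F y)) := by
            apply integral_integral_swap_of_hasCompactSupport
            · have := hk1.continuous
              have : Continuous (fun z : ℂ => conj z) := contDiff_conj'.continuous (𝕜 := ℝ) (n := 0)
              unfold Function.uncurry
              fun_prop
            · exact hcs_prod hdbs hΨc
      _ = ∫ y, Ψ y * G y * conj (G y) * ∫ x, db Ψ x * G x * kap1 ε (F x - F y) := by
            congr 1; funext y; rw [← integral_const_mul]; congr 1; funext x; ring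
      _ = _ := by
            simp_rw [i2]
            rw [← integral_neg]; congr 1; funext y; rw [mul_neg, ← integral_const_mul]
            congr 2; funext x; ring
  have hreal : ∀ x y, Ψ x * Ψ y * (G x * conj (G x) * G y * conj (G y) * kap2 ε (F x - F y)) =
      ((ψ y * ψ x * ‖G y‖ ^ 2 * ‖G x‖ ^ 2 * (8 * ε ^ 2 / (‖F x - F y‖ ^ 2 + ε) ^ 3) : ℝ) : ℂ) := by
    intro x y
    rw [Complex.mul_conj, mul_assoc _ (G y), Complex.mul_conj, kap2_eq,
      Complex.normSq_eq_norm_sq, Complex.normSq_eq_norm_sq]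
    push_cast; ring
  simp_rw [hreal, integral_complex_ofReal] at key
  set X := ∫ x, ∫ y, ψ x * ψ y * ‖G x‖ ^ 2 * ‖G y‖ ^ 2 * (8 * ε ^ 2 / (‖F y - F x‖ ^ 2 + ε) ^ 3)
  have hb : ‖-(X:ℂ)‖ ≤ (∫ x, ‖fderiv ℝ ψ x‖ * ‖G x‖) ^ 2 := by
    rw [← key]
    have hfc : Continuous (fun x => fderiv ℝ ψ x) := hψ.continuous_fderiv (by norm_num)
    have hfi : Integrable (fun x => ‖fderiv ℝ ψ x‖ * ‖G x‖) :=
      (hfc.norm.mul hGc.norm).integrable_of_hasCompactSupport ((hc.fderiv (𝕜 := ℝ)).norm.mul_right)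
    have hin : ∀ x, ‖∫ y, (db Ψ x * db Ψ y * (G x * G y * kap ε (F x - F y)))‖ ≤
        (‖fderiv ℝ ψ x‖ * ‖G x‖) * ∫ y, ‖fderiv ℝ ψ y‖ * ‖G y‖ := by
      intro x
      rw [← integral_const_mul]
      apply norm_integral_le_of_norm_le (hfi.const_mul _)
      refine Filter.Eventually.of_forall (fun y => ?_)
      simp only [norm_mul]
      have a1 := norm_db_le (hψ.differentiable (by norm_num) x)
      have a2 := norm_db_le (hψ.differentiable (by norm_num) y)
      have a3 := norm_kap_le hε (F x - F y)
      calc ‖db Ψ x‖ * ‖db Ψ y‖ * (‖G x‖ * ‖G y‖ * ‖kap ε (F x - F y)‖) 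
          ≤ ‖fderiv ℝ ψ x‖ * ‖fderiv ℝ ψ y‖ * (‖G x‖ * ‖G y‖ * 1) := by gcongr
        _ = _ := by ring
    refine (norm_integral_le_of_norm_le (hfi.mul_const _) (Filter.Eventually.of_forall hin)).trans ?_
    rw [integral_mul_const, sq]
  rw [norm_neg, Complex.norm_real] at hb
  exact (le_abs_self _).trans hb

end MF

namespace MF
open Complex (I)
open scoped ComplexConjugate
open Filter Topology

theorem kernel_ineq {ψ : ℂ → ℝ} {F G : ℂ → ℂ} (hψ : ContDiff ℝ 1 ψ) (hc : HasCompactSupport ψ)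
    (h0 : ∀ x, 0 ≤ ψ x) (hF : ∀ z, HasDerivAt F (G z) z) (hG : Differentiable ℂ G)
    (hG0 : ∀ z, G z ≠ 0) :
    4 * π * ∫ x, ψ x ^ 2 * ‖G x‖ ^ 2 ≤ (∫ x, ‖fderiv ℝ ψ x‖ * ‖G x‖) ^ 2 := by
  set M := (∫ x, ‖fderiv ℝ ψ x‖ * ‖G x‖) ^ 2 with hM
  have hFd : Differentiable ℂ F := fun z => (hF z).differentiableAt
  have hFc := hFd.continuous
  have hGc := hG.continuous
  have hψc := hψ.continuous
  let Φ : ℝ → ℂ × ℂ → ℝ := fun δ p => ψ p.1 * ψ (p.1 + δ • p.2) * ‖G p.1‖ ^ 2 * ‖G (p.1 + δ • p.2)‖ ^ 2 *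
    (8 / ((‖F (p.1 + δ • p.2) - F p.1‖ / δ) ^ 2 + 1) ^ 3)
  have hΦ0 : ∀ δ p, 0 ≤ Φ δ p := fun δ p => by
    have := h0 p.1
    have := h0 (p.1 + δ • p.2)
    positivity
  have hΦc : ∀ δ, Continuous (Φ δ) := by
    intro δ
    have : ∀ p : ℂ × ℂ, ((‖F (p.1 + δ • p.2) - F p.1‖ / δ) ^ 2 + 1) ^ 3 ≠ 0 := fun p => by positivity
    have h2 : Continuous (fun p : ℂ × ℂ => p.1 + δ • p.2) := by fun_prop
    refine Continuous.mul ?_ (Continuous.div continuous_const ?_ this)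
    · fun_prop
    · simp only [div_eq_mul_inv]; fun_prop
  have hΦs : ∀ δ, 0 < δ → HasCompactSupport (Φ δ) := by
    intro δ hδ
    have hK : IsCompact ((fun p : ℂ × ℂ => (p.1, δ⁻¹ • (p.2 - p.1))) '' (tsupport ψ ×ˢ tsupport ψ)) :=
      (hc.isCompact.prod hc.isCompact).image (by fun_prop)
    apply HasCompactSupport.intro hK
    intro p hp
    by_contra hne
    apply hp
    refine ⟨(p.1, p.1 + δ • p.2), ⟨?_, ?_⟩, ?_⟩
    · by_contra h
      exact hne (by simp [Φ, image_eq_zero_of_notMem_tsupport h])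
    · by_contra h
      exact hne (by simp only [Φ, image_eq_zero_of_notMem_tsupport h]; simp)
    · ext1 <;> simp [smul_smul, hδ.ne']
  have hintg : ∀ δ, 0 < δ → ∫ p, Φ δ p ≤ M := by
    intro δ hδ
    rw [show (volume : Measure (ℂ × ℂ)) = volume.prod volume from rfl,
      integral_prod _ ((hΦc δ).integrable_of_hasCompactSupport (hΦs δ hδ))]
    refine le_trans (le_of_eq ?_) (kernel_eps hψ hc h0 hF hG (ε := δ ^ 2) (by positivity))
    congr 1; funext x
    have e := Measure.integral_comp_smul (volume : Measure ℂ) (fun s => ψ x * ψ (x + s) * ‖G x‖ ^ 2 * ‖G (x + s)‖ ^ 2 *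
      (8 * δ ^ 4 / (‖F (x + s) - F x‖ ^ 2 + δ ^ 2) ^ 3)) δ
    rw [integral_add_left_eq_self (μ := volume) (fun y => ψ x * ψ y * ‖G x‖ ^ 2 * ‖G y‖ ^ 2 *
      (8 * δ ^ 4 / (‖F y - F x‖ ^ 2 + δ ^ 2) ^ 3)) x] at e
    have hfr : |(δ ^ Module.finrank ℝ ℂ)⁻¹| = (δ ^ 2)⁻¹ := by
      rw [Complex.finrank_real_complex]; exact abs_of_pos (by positivity)
    rw [hfr, smul_eq_mul, eq_comm, inv_mul_eq_iff_eq_mul₀ (by positivity), ← integral_const_mul] at e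
    calc ∫ y, Φ δ (x, y) = ∫ s, δ ^ 2 * (ψ x * ψ (x + δ • s) * ‖G x‖ ^ 2 * ‖G (x + δ • s)‖ ^ 2 *
      (8 * δ ^ 4 / (‖F (x + δ • s) - F x‖ ^ 2 + δ ^ 2) ^ 3)) := by
          congr 1; funext s; simp only [Φ]
          have h1 : ‖F (x + δ • s) - F x‖ ^ 2 + δ ^ 2 ≠ 0 := by positivity
          have : 8 / ((‖F (x + δ • s) - F x‖ / δ) ^ 2 + 1) ^ 3 =
              δ ^ 2 * (8 * δ ^ 4 / (‖F (x + δ • s) - F x‖ ^ 2 + δ ^ 2) ^ 3) := by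
            rw [show (‖F (x + δ • s) - F x‖ / δ) ^ 2 + 1 = (‖F (x + δ • s) - F x‖ ^ 2 + δ ^ 2) / δ ^ 2 by field_simp]
            field_simp
          rw [this]; ring
      _ = _ := by
          rw [← e]; congr 1; funext y
          rw [show (δ ^ 2) ^ 2 = δ ^ 4 by ring]
  -- Fatou
  let δ : ℕ → ℝ := fun n => 1 / ((n : ℝ) + 1)
  have hδ : ∀ n, 0 < δ n := fun n => by positivity
  have hδ0 : Tendsto δ atTop (𝓝[≠] 0) := by
    rw [tendsto_nhdsWithin_iff]
    exact ⟨tendsto_one_div_add_atTop_nhds_zero_nat, Eventually.of_forall fun n => (hδ n).ne'⟩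
  let Φ0 : ℂ × ℂ → ℝ := fun p => ψ p.1 ^ 2 * ‖G p.1‖ ^ 4 * (8 / ((‖G p.1‖ * ‖p.2‖) ^ 2 + 1) ^ 3)
  have hlim : ∀ p, Tendsto (fun n => Φ (δ n) p) atTop (𝓝 (Φ0 p)) := by
    rintro ⟨x, s⟩
    have t1 : Tendsto (fun n => x + δ n • s) atTop (𝓝 (x + (0:ℝ) • s)) :=
      tendsto_const_nhds.add ((hδ0.mono_right nhdsWithin_le_nhds).smul_const s)
    rw [zero_smul, add_zero] at t1
    have t2 : Tendsto (fun n => (δ n)⁻¹ • (F (x + δ n • s) - F x)) atTop (𝓝 (G x * s)) := by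
      have h1 : HasFDerivAt F ((ContinuousLinearMap.toSpanSingleton ℂ (G x)).restrictScalars ℝ) x :=
        (hF x).hasFDerivAt.restrictScalars ℝ
      have h2 : HasLineDerivAt ℝ F _ x s := h1.hasLineDerivAt s
      have h3 := hasLineDerivAt_iff_tendsto_slope_zero.1 h2
      have h4 := h3.comp hδ0
      simpa [mul_comm, Function.comp_def] using h4
    have t3 := t2.norm
    have t4 : ∀ n, ‖(δ n)⁻¹ • (F (x + δ n • s) - F x)‖ = ‖F (x + δ n • s) - F x‖ / δ n := by
      intro n
      rw [norm_smul, norm_inv, Real.norm_eq_abs, abs_of_pos (hδ n), div_eq_inv_mul]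
    simp_rw [t4, norm_mul] at t3
    have t5 : Tendsto (fun n => 8 / ((‖F (x + δ n • s) - F x‖ / δ n) ^ 2 + 1) ^ 3) atTop
        (𝓝 (8 / ((‖G x‖ * ‖s‖) ^ 2 + 1) ^ 3)) :=
      tendsto_const_nhds.div (((t3.pow 2).add_const 1).pow 3) (by positivity)
    have t6 := ((tendsto_const_nhds (x := ψ x)).mul ((hψc.tendsto x).comp t1)).mul
      (tendsto_const_nhds (x := ‖G x‖ ^ 2)) |>.mul ((((hGc.tendsto x).comp t1).norm).pow 2) |>.mul t5
    have e0 : Φ0 (x, s) = ψ x * ψ x * ‖G x‖ ^ 2 * ‖G x‖ ^ 2 * (8 / ((‖G x‖ * ‖s‖) ^ 2 + 1) ^ 3) := by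
      simp only [Φ0]; ring
    rw [e0]
    exact t6
  have hfat := lintegral_liminf_le (μ := (volume : Measure (ℂ × ℂ))) (u := atTop)
    (f := fun n p => ENNReal.ofReal (Φ (δ n) p)) (fun n => (hΦc (δ n)).measurable.ennreal_ofReal)
  have hl1 : ∀ p, liminf (fun n => ENNReal.ofReal (Φ (δ n) p)) atTop = ENNReal.ofReal (Φ0 p) := fun p =>
    ((ENNReal.continuous_ofReal.tendsto _).comp (hlim p)).liminf_eq
  have hl2 : ∀ n, ∫⁻ p, ENNReal.ofReal (Φ (δ n) p) ≤ ENNReal.ofReal M := by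
    intro n
    rw [← ofReal_integral_eq_lintegral_ofReal ((hΦc _).integrable_of_hasCompactSupport (hΦs _ (hδ n)))
      (Eventually.of_forall (hΦ0 _))]
    exact ENNReal.ofReal_le_ofReal (hintg _ (hδ n))
  have hl3 : ∫⁻ p, ENNReal.ofReal (Φ0 p) ≤ ENNReal.ofReal M := by
    simp_rw [hl1] at hfat
    refine hfat.trans ?_
    refine (liminf_le_liminf (v := fun _ => ENNReal.ofReal M) (Eventually.of_forall hl2)).trans ?_
    simp
  have hΦ0c : Continuous Φ0 := by
    have : ∀ p : ℂ × ℂ, ((‖G p.1‖ * ‖p.2‖) ^ 2 + 1) ^ 3 ≠ 0 := fun p => by positivity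
    refine Continuous.mul (by fun_prop) (Continuous.div continuous_const (by fun_prop) this)
  rw [show (volume : Measure (ℂ × ℂ)) = volume.prod volume from rfl,
    lintegral_prod _ (hΦ0c.measurable.ennreal_ofReal.aemeasurable)] at hl3
  have hl4 : ∀ x, ∫⁻ s, ENNReal.ofReal (Φ0 (x, s)) = ENNReal.ofReal (4 * π * (ψ x ^ 2 * ‖G x‖ ^ 2)) := by
    intro x
    have hg : 0 < ‖G x‖ := norm_pos_iff.2 (hG0 x)
    obtain ⟨r1, r2⟩ := radial_integral hg
    have e : ∀ s, Φ0 (x, s) = (4 * ψ x ^ 2 * ‖G x‖ ^ 4) * (2 / ((‖G x‖ * ‖s‖) ^ 2 + 1) ^ 3) := by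
      intro s; simp only [Φ0]; ring
    simp_rw [e]
    rw [← ofReal_integral_eq_lintegral_ofReal (r1.const_mul _) (Eventually.of_forall fun s => by positivity),
      integral_const_mul, r2]
    congr 1; field_simp
  simp_rw [hl4] at hl3
  rw [← ofReal_integral_eq_lintegral_ofReal _ (Eventually.of_forall fun s => by positivity)] at hl3
  · rw [ENNReal.ofReal_le_ofReal_iff (by positivity), integral_const_mul] at hl3
    exact hl3
  · refine Integrable.const_mul ?_ _
    refine Continuous.integrable_of_hasCompactSupport (by fun_prop) ?_
    have : HasCompactSupport (fun x => ψ x ^ 2) := hc.comp_left (g := fun r => r ^ 2) (by simp)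
    exact this.mul_right

end MF

namespace MF
open Complex (I)
open Filter Topology

/-- Laplacian on the complex plane -/
def Lp (f : ℂ → ℝ) (x : ℂ) : ℝ :=
  fderiv ℝ (fun y => fderiv ℝ f y 1) x 1 + fderiv ℝ (fun y => fderiv ℝ f y I) x I

/-- inner product of gradients -/
def gr (f g : ℂ → ℝ) (x : ℂ) : ℝ :=
  fderiv ℝ f x 1 * fderiv ℝ g x 1 + fderiv ℝ f x I * fderiv ℝ g x I

theorem integral_fderiv_zero' {f : ℂ → ℝ} (hf : ContDiff ℝ 1 f) (hc : HasCompactSupport f) (v : ℂ) :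
    ∫ x, fderiv ℝ f x v = 0 := by
  have h := integral_bilinear_fderiv_right_eq_neg_left_of_integrable (μ := (volume : Measure ℂ))
    (f := fun _ : ℂ => (1:ℝ)) (g := f) (v := v) (B := ContinuousLinearMap.lsmul ℝ ℝ) (by simp)
    (by
      simp only [ContinuousLinearMap.lsmul_apply, one_smul]
      exact ((hf.continuous_fderiv (by norm_num)).clm_apply continuous_const).integrable_of_hasCompactSupport
        (hc.fderiv_apply (𝕜 := ℝ) v))
    (by
      simp only [ContinuousLinearMap.lsmul_apply, one_smul]
      exact hf.continuous.integrable_of_hasCompactSupport hc)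
    (fun x _ => by fun_prop) (fun x _ => hf.differentiable (by norm_num) x)
  simpa using h

theorem contDiff_fderiv_apply {f : ℂ → ℝ} (hf : ContDiff ℝ 2 f) (v : ℂ) :
    ContDiff ℝ 1 (fun y => fderiv ℝ f y v) :=
  (hf.fderiv_right (m := 1) (by norm_num)).clm_apply contDiff_const

theorem continuous_fderiv_apply {f : ℂ → ℝ} (hf : ContDiff ℝ 1 f) (v : ℂ) :
    Continuous (fun y => fderiv ℝ f y v) :=
  (hf.continuous_fderiv (by norm_num)).clm_apply continuous_const

theorem continuous_Lp {f : ℂ → ℝ} (hf : ContDiff ℝ 2 f) : Continuous (Lp f) :=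
  (continuous_fderiv_apply (contDiff_fderiv_apply hf 1) 1).add
    (continuous_fderiv_apply (contDiff_fderiv_apply hf I) I)

theorem continuous_gr {f g : ℂ → ℝ} (hf : ContDiff ℝ 1 f) (hg : ContDiff ℝ 1 g) :
    Continuous (gr f g) :=
  ((continuous_fderiv_apply hf 1).mul (continuous_fderiv_apply hg 1)).add
    ((continuous_fderiv_apply hf I).mul (continuous_fderiv_apply hg I))

theorem green {ψ φ : ℂ → ℝ} (hψ : ContDiff ℝ 1 ψ) (hc : HasCompactSupport ψ) (hφ : ContDiff ℝ 2 φ) :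
    ∫ x, gr ψ φ x = - ∫ x, ψ x * Lp φ x := by
  have key : ∀ v, ∫ x, (fderiv ℝ ψ x v * fderiv ℝ φ x v + ψ x * fderiv ℝ (fun y => fderiv ℝ φ y v) x v) = 0 := by
    intro v
    rw [← integral_fderiv_zero' (f := fun x => ψ x * fderiv ℝ φ x v) (hψ.mul (contDiff_fderiv_apply hφ v))
      hc.mul_right v]
    congr 1; funext x
    rw [fderiv_fun_mul (hψ.differentiable (by norm_num) x)
      ((contDiff_fderiv_apply hφ v).differentiable (by norm_num) x)]
    simp; ring
  have hφ1 : ContDiff ℝ 1 φ := hφ.of_le (by norm_num)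
  have i1 : ∀ v, Integrable (fun x => fderiv ℝ ψ x v * fderiv ℝ φ x v) := fun v =>
    ((continuous_fderiv_apply hψ v).mul (continuous_fderiv_apply hφ1 v)).integrable_of_hasCompactSupport
      (hc.fderiv_apply (𝕜 := ℝ) v).mul_right
  have i2 : ∀ v, Integrable (fun x => ψ x * fderiv ℝ (fun y => fderiv ℝ φ y v) x v) := fun v =>
    (hψ.continuous.mul (continuous_fderiv_apply (contDiff_fderiv_apply hφ v) v)).integrable_of_hasCompactSupport
      hc.mul_right
  have k1 := key 1
  have k2 := key I
  rw [integral_add (i1 _) (i2 _)] at k1 k2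
  unfold gr Lp
  rw [integral_add (i1 _) (i1 _)]
  simp_rw [mul_add]
  rw [integral_add (i2 _) (i2 _)]
  linarith

theorem clm_real_form (L : ℂ →L[ℝ] ℝ) (w : ℂ) : L w = w.re * L 1 + w.im * L I := by
  have : w = w.re • (1:ℂ) + w.im • I := by
    apply Complex.ext <;> simp
  conv_lhs => rw [this]
  rw [map_add, map_smul, map_smul]; simp

theorem norm_clm_sq (L : ℂ →L[ℝ] ℝ) : ‖L‖ ^ 2 = L 1 * L 1 + L I * L I := by
  set a := L 1 with ha
  set b := L I with hb
  have hn : 0 ≤ a * a + b * b := add_nonneg (mul_self_nonneg a) (mul_self_nonneg b)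
  apply le_antisymm
  · have : ‖L‖ ≤ √(a * a + b * b) := by
      apply ContinuousLinearMap.opNorm_le_bound _ (Real.sqrt_nonneg _)
      intro w
      rw [clm_real_form L w, ← ha, ← hb, Real.norm_eq_abs]
      have hw : ‖w‖ ^ 2 = w.re ^ 2 + w.im ^ 2 := by
        rw [← Complex.normSq_eq_norm_sq, Complex.normSq_apply]; ring
      apply abs_le_of_sq_le_sq _ (by positivity)
      rw [mul_pow, Real.sq_sqrt hn, hw]
      nlinarith [sq_nonneg (w.re * b - w.im * a)]
    calc ‖L‖ ^ 2 ≤ √(a * a + b * b) ^ 2 := by gcongr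
      _ = _ := Real.sq_sqrt hn
  · have e1 : L (a + b * I) = a * a + b * b := by
      rw [clm_real_form]; simp [ha, hb]
    have e2 := L.le_opNorm (a + b * I)
    have e3 : ‖(a + b * I : ℂ)‖ ^ 2 = a * a + b * b := by
      rw [← Complex.normSq_eq_norm_sq, Complex.normSq_add_mul_I]; ring
    rw [e1, ← e3, Real.norm_eq_abs, abs_of_nonneg (by positivity)] at e2
    rw [← e3]
    by_cases h0 : ‖(a + b * I : ℂ)‖ = 0
    · rw [h0, zero_pow two_ne_zero]; positivity
    · have h1 : 0 < ‖(a + b * I : ℂ)‖ := lt_of_le_of_ne (norm_nonneg _) (Ne.symm h0)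
      have : ‖(a + b * I : ℂ)‖ ≤ ‖L‖ := by nlinarith
      gcongr

theorem norm_fderiv_sq (f : ℂ → ℝ) (x : ℂ) : ‖fderiv ℝ f x‖ ^ 2 = gr f f x := norm_clm_sq _

/-- Cauchy-Schwarz via discriminants -/
theorem cs_of_quad {A B C : ℝ} (h : ∀ t : ℝ, 0 ≤ A * t ^ 2 - 2 * B * t + C) : B ^ 2 ≤ A * C := by
  have := discrim_le_zero (a := A) (b := -2 * B) (c := C) (fun t => by have := h t; nlinarith)
  unfold discrim at this
  nlinarith

theorem cs_integral {h f g : ℂ → ℝ} (hh : Continuous h) (hc : HasCompactSupport h) (h0 : ∀ x, 0 ≤ h x)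
    (hf : Continuous f) (hg : Continuous g) :
    (∫ x, h x * (f x * g x)) ^ 2 ≤ (∫ x, h x * f x ^ 2) * ∫ x, h x * g x ^ 2 := by
  apply cs_of_quad
  intro t
  have i : ∀ k : ℂ → ℝ, Continuous k → Integrable (fun x => h x * k x) := fun k hk =>
    (hh.mul hk).integrable_of_hasCompactSupport hc.mul_right
  have : 0 ≤ ∫ x, h x * (t * f x - g x) ^ 2 := integral_nonneg fun x => by
    have := h0 x; positivity
  have e : ∀ x, h x * (t * f x - g x) ^ 2 = t ^ 2 * (h x * f x ^ 2) - 2 * t * (h x * (f x * g x)) + h x * g x ^ 2 := by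
    intro x; ring
  simp_rw [e] at this
  rw [integral_add, integral_sub, integral_const_mul, integral_const_mul] at this
  · linarith
  · exact (i _ (by fun_prop)).const_mul _
  · exact (i _ (by fun_prop)).const_mul _
  · exact ((i _ (by fun_prop)).const_mul _).sub ((i _ (by fun_prop)).const_mul _)
  · exact (i _ (by fun_prop))

/-- C¹ cutoff functions with almost optimal slope -/
theorem exists_cutoff {δ : ℝ} (hδ : 0 < δ) : ∃ S S' : ℝ → ℝ, Continuous S' ∧ (∀ x, HasDerivAt S (S' x) x) ∧
    (∀ x, 0 ≤ S' x) ∧ (∀ x, S' x ≤ 1 + δ) ∧ (∀ x ≤ 0, S x = 0) ∧ (∀ x ≤ 0, S' x = 0) ∧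
    (∀ x ≥ 1, S x = 1) ∧ (∀ x ≥ 1, S' x = 0) ∧ (∀ x, 0 ≤ S x) ∧ (∀ x, S x ≤ 1) := by
  obtain ⟨m, hm⟩ := exists_nat_one_div_lt hδ
  set n : ℕ := 2 * (m + 1) with hn
  have hn1 : ((m:ℝ) + 1) ≤ n := by rw [hn]; push_cast; linarith [(Nat.cast_nonneg m : (0:ℝ) ≤ m)]
  have hn0 : (0:ℝ) < n := by positivity
  set C : ℝ := 1 + 1 / n with hC
  have hC0 : 0 < C := by positivity
  have hC1 : C ≤ 1 + δ := by
    have : 1 / (n:ℝ) ≤ 1 / ((m:ℝ) + 1) := by gcongr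
    rw [hC]; linarith
  set S' : ℝ → ℝ := fun t => C * max 0 (1 - (2 * t - 1) ^ n) with hS'
  have hc : Continuous S' := by fun_prop
  have hpow : ∀ t : ℝ, t ≤ 0 ∨ 1 ≤ t → 1 ≤ (2 * t - 1) ^ n := by
    intro t ht
    rw [hn, pow_mul]
    apply one_le_pow₀
    rcases ht with h | h <;> nlinarith
  have hpow0 : ∀ t : ℝ, 0 ≤ (2 * t - 1) ^ n := by
    intro t; rw [hn, pow_mul]; positivity
  have hz : ∀ t : ℝ, t ≤ 0 ∨ 1 ≤ t → S' t = 0 := by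
    intro t ht
    have := hpow t ht
    simp only [hS', max_eq_left (by linarith : 1 - (2 * t - 1) ^ n ≤ 0), mul_zero]
  have hnn : ∀ t, 0 ≤ S' t := fun t => by simp only [hS']; positivity
  have hintg : ∀ a b, IntervalIntegrable S' volume a b := fun a b => hc.intervalIntegrable a b
  have h01 : ∫ t in (0:ℝ)..1, S' t = 1 := by
    have : ∫ t in (0:ℝ)..1, S' t = ∫ t in (0:ℝ)..1, C * (1 - (2 * t - 1) ^ n) := by
      apply intervalIntegral.integral_congr
      intro t ht
      rw [Set.uIcc_of_le zero_le_one] at ht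
      have : (2 * t - 1) ^ n ≤ 1 := by
        rw [hn, pow_mul]
        apply pow_le_one₀ (by positivity)
        nlinarith [ht.1, ht.2]
      simp only [hS']; rw [max_eq_right (by linarith)]
    rw [this, intervalIntegral.integral_const_mul, intervalIntegral.integral_sub (by simp) 
      (Continuous.intervalIntegrable (by fun_prop) _ _)]
    have := intervalIntegral.integral_comp_mul_sub (fun t : ℝ => t ^ n) (c := 2) (by norm_num) (1:ℝ) (a := 0) (b := 1)
    rw [this]
    have hodd : (-1:ℝ) ^ (n + 1) = -1 := by
      apply Odd.neg_one_pow; rw [hn]; exact ⟨m + 1, by ring⟩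
    rw [integral_pow]
    norm_num [hodd, hC]
    field_simp
    ring
  refine ⟨fun x => ∫ t in (0:ℝ)..x, S' t, S', hc, fun x => hc.integral_hasStrictDerivAt 0 x |>.hasDerivAt, hnn,
    ?_, ?_, fun x hx => hz x (Or.inl hx), ?_, fun x hx => hz x (Or.inr hx), ?_, ?_⟩
  · intro t
    have : max 0 (1 - (2 * t - 1) ^ n) ≤ 1 := max_le zero_le_one (by linarith [hpow0 t])
    calc S' t ≤ C * 1 := by simp only [hS']; gcongr
      _ ≤ _ := by linarith
  · intro x hx
    show ∫ t in (0:ℝ)..x, S' t = 0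
    rw [intervalIntegral.integral_congr (g := fun _ => 0), intervalIntegral.integral_zero]
    intro t ht
    rw [Set.uIcc_of_ge hx] at ht
    exact hz t (Or.inl ht.2)
  · intro x hx
    show ∫ t in (0:ℝ)..x, S' t = 1
    rw [← intervalIntegral.integral_add_adjacent_intervals (hintg 0 1) (hintg 1 x), h01,
      intervalIntegral.integral_congr (g := fun _ => 0) (a := 1), intervalIntegral.integral_zero, add_zero]
    intro t ht
    rw [Set.uIcc_of_le hx] at ht
    exact hz t (Or.inr ht.1)
  · intro x
    rcases le_total x 0 with hx | hx
    · show 0 ≤ ∫ t in (0:ℝ)..x, S' t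
      rw [intervalIntegral.integral_congr (g := fun _ => 0), intervalIntegral.integral_zero]
      intro t ht
      rw [Set.uIcc_of_ge hx] at ht
      exact hz t (Or.inl ht.2)
    · exact intervalIntegral.integral_nonneg hx fun t _ => hnn t
  · intro x
    show ∫ t in (0:ℝ)..x, S' t ≤ 1
    rcases le_total x 1 with hx | hx
    · rw [← h01, ← intervalIntegral.integral_add_adjacent_intervals (hintg 0 x) (hintg x 1)]
      have := intervalIntegral.integral_nonneg hx (f := S') (μ := volume) fun t _ => hnn t
      linarith
    · rw [← intervalIntegral.integral_add_adjacent_intervals (hintg 0 1) (hintg 1 x), h01,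
        intervalIntegral.integral_congr (g := fun _ => 0) (a := 1), intervalIntegral.integral_zero, add_zero]
      intro t ht
      rw [Set.uIcc_of_le hx] at ht
      exact hz t (Or.inr ht.1)

end MF

namespace MF
open Complex (I)
open Filter Topology

/-- cut off composition -/
def cut (K : Set ℂ) (S : ℝ → ℝ) (φ : ℂ → ℝ) : ℂ → ℝ := K.indicator (fun x => S (φ x))

theorem cut_eventually {K : Set ℂ} (hK : IsClosed K) {φ : ℂ → ℝ} (hφ : Continuous φ) {s : ℝ}
    (hfr : ∀ x ∈ frontier K, φ x < s) {S : ℝ → ℝ} (hS : ∀ x ≤ s, S x = 0) (x : ℂ) :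
    (x ∈ K ∧ cut K S φ =ᶠ[𝓝 x] (fun x => S (φ x))) ∨
    ((x ∉ K ∨ φ x < s) ∧ cut K S φ =ᶠ[𝓝 x] (fun _ => 0)) := by
  by_cases h1 : x ∈ interior K
  · left
    refine ⟨interior_subset h1, ?_⟩
    filter_upwards [mem_interior_iff_mem_nhds.1 h1] with y hy
    simp [cut, hy]
  · by_cases h2 : x ∈ K
    · right
      have : x ∈ frontier K := ⟨subset_closure h2, h1⟩
      refine ⟨Or.inr (hfr x this), ?_⟩
      filter_upwards [hφ.continuousAt.eventually (gt_mem_nhds (hfr x this))] with y hy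
      by_cases hyK : y ∈ K
      · simp [cut, hyK, hS _ hy.le]
      · simp [cut, hyK]
    · right
      refine ⟨Or.inl h2, ?_⟩
      filter_upwards [hK.isOpen_compl.mem_nhds h2] with y hy
      simp only [Set.mem_compl_iff] at hy
      simp [cut, hy]

theorem cut_continuous {K : Set ℂ} (hK : IsClosed K) {φ : ℂ → ℝ} (hφ : Continuous φ) {s : ℝ}
    (hfr : ∀ x ∈ frontier K, φ x < s) {S : ℝ → ℝ} (hS : ∀ x ≤ s, S x = 0) (hSc : Continuous S) :
    Continuous (cut K S φ) := by
  rw [continuous_iff_continuousAt]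
  intro x
  rcases cut_eventually hK hφ hfr hS x with ⟨_, h⟩ | ⟨_, h⟩
  · exact (hSc.comp hφ).continuousAt.congr h.symm
  · exact continuousAt_const.congr h.symm

theorem cut_compact {K : Set ℂ} (hK : IsCompact K) (S : ℝ → ℝ) (φ : ℂ → ℝ) :
    HasCompactSupport (cut K S φ) :=
  HasCompactSupport.intro hK fun x hx => by simp [cut, hx]

theorem cut_hasFDerivAt {K : Set ℂ} (hK : IsClosed K) {φ : ℂ → ℝ} (hφ : ContDiff ℝ 1 φ) {s : ℝ}
    (hfr : ∀ x ∈ frontier K, φ x < s) {S S' : ℝ → ℝ} (hS : ∀ x ≤ s, S x = 0) (hS' : ∀ x ≤ s, S' x = 0)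
    (hd : ∀ x, HasDerivAt S (S' x) x) (x : ℂ) :
    HasFDerivAt (cut K S φ) (cut K S' φ x • fderiv ℝ φ x) x := by
  rcases cut_eventually hK hφ.continuous hfr hS x with ⟨hx, h⟩ | ⟨hx, h⟩
  · have : cut K S' φ x = S' (φ x) := by simp [cut, hx]
    rw [this]
    refine HasFDerivAt.congr_of_eventuallyEq ?_ h
    exact (hd (φ x)).comp_hasFDerivAt x (hφ.differentiable (by norm_num) x).hasFDerivAt
  · have : cut K S' φ x = 0 := by
      rcases hx with hx | hx
      · simp [cut, hx]
      · by_cases hxK : x ∈ K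
        · simp [cut, hxK, hS' _ hx.le]
        · simp [cut, hxK]
    rw [this, zero_smul]
    exact (hasFDerivAt_const (0:ℝ) x).congr_of_eventuallyEq h

theorem cut_contDiff {K : Set ℂ} (hK : IsClosed K) {φ : ℂ → ℝ} (hφ : ContDiff ℝ 1 φ) {s : ℝ}
    (hfr : ∀ x ∈ frontier K, φ x < s) {S S' : ℝ → ℝ} (hS : ∀ x ≤ s, S x = 0) (hS' : ∀ x ≤ s, S' x = 0)
    (hd : ∀ x, HasDerivAt S (S' x) x) (hc : Continuous S') : ContDiff ℝ 1 (cut K S φ) := by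
  rw [contDiff_one_iff_hasFDerivAt]
  exact ⟨_, (cut_continuous hK hφ.continuous hfr hS' hc).smul (hφ.continuous_fderiv (by norm_num)),
    cut_hasFDerivAt hK hφ hfr hS hS' hd⟩

/-- The basic layer inequality. -/
theorem layer_ineq {K : Set ℂ} (hK : IsCompact K) {φ : ℂ → ℝ} (hφ : ContDiff ℝ 2 φ) {s s' : ℝ} (hss : s < s')
    (hfr : ∀ x ∈ frontier K, φ x < s) {ρ : ℂ → ℝ} (hρ : Continuous ρ) (hρ0 : ∀ x ∈ K, s < φ x → 0 ≤ ρ x)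
    (hρφ : ∀ x ∈ K, s < φ x → - Lp φ x ≤ ρ x)
    {F G : ℂ → ℂ} (hF : ∀ z, HasDerivAt F (G z) z) (hG : Differentiable ℂ G) (hG0 : ∀ z, G z ≠ 0) :
    4 * π * (s' - s) * ∫ x in K ∩ {x | s' ≤ φ x}, ‖G x‖ ^ 2 ≤
      (∫ x in K ∩ {x | s < φ x}, ρ x) * ∫ x in K ∩ {x | s < φ x ∧ φ x < s'}, ‖G x‖ ^ 2 := by
  have hφ1 : ContDiff ℝ 1 φ := hφ.of_le (by norm_num)
  have hφc := hφ.continuous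
  have hGc := hG.continuous
  set ε := s' - s with hε
  have hε0 : 0 < ε := by linarith
  have hKm := hK.measurableSet
  set R := ∫ x in K ∩ {x | s < φ x}, ρ x with hR
  set m1 := ∫ x in K ∩ {x | s' ≤ φ x}, ‖G x‖ ^ 2
  set m2 := ∫ x in K ∩ {x | s < φ x ∧ φ x < s'}, ‖G x‖ ^ 2
  have hm1m : MeasurableSet (K ∩ {x | s' ≤ φ x}) := hKm.inter (measurableSet_le measurable_const hφc.measurable)
  have hm2m : MeasurableSet (K ∩ {x | s < φ x ∧ φ x < s'}) := hKm.inter 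
    ((measurableSet_lt measurable_const hφc.measurable).inter (measurableSet_lt hφc.measurable measurable_const))
  have hm3m : MeasurableSet (K ∩ {x | s < φ x}) := hKm.inter (measurableSet_lt measurable_const hφc.measurable)
  have hio : ∀ (f : ℂ → ℝ), Continuous f → ∀ A ⊆ K, IntegrableOn f A := fun f hf A hA =>
    (hf.continuousOn.integrableOn_compact hK).mono_set hA
  have hR0 : 0 ≤ R := setIntegral_nonneg hm3m fun x hx => hρ0 x hx.1 hx.2
  have hm20 : 0 ≤ m2 := setIntegral_nonneg hm2m fun x _ => by positivity
  have main : ∀ δ > 0, 4 * π * ε * m1 ≤ R * ((1 + δ) * m2) := by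
    intro δ hδ
    obtain ⟨S, S', hSc, hSd, h1, h2, h3, h4, h5, h6, h7, h8⟩ := exists_cutoff hδ
    set T : ℝ → ℝ := fun y => S ((y - s) / ε) with hT
    set T' : ℝ → ℝ := fun y => S' ((y - s) / ε) / ε with hT'
    have hle : ∀ y ≤ s, (y - s) / ε ≤ 0 := fun y hy => div_nonpos_of_nonpos_of_nonneg (by linarith) hε0.le
    have hge : ∀ y ≥ s', (y - s) / ε ≥ 1 := fun y hy => by
      rw [ge_iff_le, le_div_iff₀ hε0]; linarith
    have hT0 : ∀ y ≤ s, T y = 0 := fun y hy => h3 _ (hle y hy)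
    have hT0' : ∀ y ≤ s, T' y = 0 := fun y hy => by simp [hT', h4 _ (hle y hy)]
    have hTd : ∀ y, HasDerivAt T (T' y) y := fun y => by
      have := (hSd ((y - s) / ε)).comp y (((hasDerivAt_id y).sub_const s).div_const ε)
      refine this.congr_deriv ?_
      simp [hT', div_eq_mul_inv]
    have hTc : Continuous T' := by fun_prop
    set ψ := cut K T φ with hψ
    set h := cut K T' φ with hh
    have hψ1 : ContDiff ℝ 1 ψ := cut_contDiff hK.isClosed hφ1 hfr hT0 hT0' hTd hTc
    have hψd : ∀ x, fderiv ℝ ψ x = h x • fderiv ℝ φ x := fun x =>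
      (cut_hasFDerivAt hK.isClosed hφ1 hfr hT0 hT0' hTd x).fderiv
    have hψc : HasCompactSupport ψ := cut_compact hK _ _
    have hhc : HasCompactSupport h := cut_compact hK _ _
    have hhcont : Continuous h := cut_continuous hK.isClosed hφc hfr hT0' hTc
    have hψ0 : ∀ x, 0 ≤ ψ x := fun x => Set.indicator_nonneg (fun x _ => h7 _) x
    have hh0 : ∀ x, 0 ≤ h x := fun x => Set.indicator_nonneg (fun x _ => div_nonneg (h1 _) hε0.le) x
    have hker := kernel_ineq hψ1 hψc hψ0 hF hG hG0
    have e1 : ∀ x, ‖fderiv ℝ ψ x‖ * ‖G x‖ = h x * (‖fderiv ℝ φ x‖ * ‖G x‖) := by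
      intro x
      rw [hψd, norm_smul, Real.norm_eq_abs, abs_of_nonneg (hh0 x)]; ring
    simp_rw [e1] at hker
    have hfc : Continuous (fun x => ‖fderiv ℝ φ x‖) := (hφ1.continuous_fderiv (by norm_num)).norm
    have hcs := cs_integral hhcont hhc hh0 hfc hGc.norm
    -- left
    have l1 : m1 ≤ ∫ x, ψ x ^ 2 * ‖G x‖ ^ 2 := by
      show ∫ x in K ∩ {x | s' ≤ φ x}, ‖G x‖ ^ 2 ≤ _
      rw [← integral_indicator hm1m]
      apply integral_mono
      · exact (integrable_indicator_iff hm1m).2 (hio _ (by fun_prop) _ Set.inter_subset_left)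
      · exact Continuous.integrable_of_hasCompactSupport (by fun_prop)
          (hψc.comp_left (g := fun r => r ^ 2) (by simp)).mul_right
      · intro x
        apply Set.indicator_le' (s := K ∩ {x | s' ≤ φ x}) (f := fun x => ‖G x‖ ^ 2) (g := fun x => ψ x ^ 2 * ‖G x‖ ^ 2)
        · intro x hx
          have : ψ x = 1 := by
            simp only [hψ, cut, Set.indicator_of_mem hx.1, hT]
            exact h5 _ (hge _ hx.2)
          simp [this]
        · intro x _
          positivity
    -- energy
    have e2 : ∫ x, h x * ‖fderiv ℝ φ x‖ ^ 2 ≤ R := by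
      have e3 : ∀ x, h x * ‖fderiv ℝ φ x‖ ^ 2 = gr ψ φ x := by
        intro x
        rw [norm_fderiv_sq]; unfold gr; rw [hψd]; simp; ring
      simp_rw [e3]
      rw [green hψ1 hψc hφ, ← integral_neg]
      show _ ≤ ∫ x in K ∩ {x | s < φ x}, ρ x
      rw [← integral_indicator hm3m]
      have hLc := continuous_Lp hφ
      apply integral_mono
      · exact (Continuous.integrable_of_hasCompactSupport (hψ1.continuous.mul hLc) hψc.mul_right).neg
      · exact (integrable_indicator_iff hm3m).2 (hio _ hρ _ Set.inter_subset_left)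
      · intro x
        by_cases hx : x ∈ K ∩ {x | s < φ x}
        · simp only [Set.indicator_of_mem hx]
          have a1 := hρφ x hx.1 hx.2
          have a2 := hρ0 x hx.1 hx.2
          have a3 : ψ x ≤ 1 := by
            simp only [hψ, cut, Set.indicator_of_mem hx.1, hT]; exact h8 _
          nlinarith [hψ0 x]
        · simp only [Set.indicator_of_notMem hx]
          have : ψ x = 0 := by
            by_cases hxK : x ∈ K
            · simp only [hψ, cut, Set.indicator_of_mem hxK]
              apply hT0
              by_contra hlt
              exact hx ⟨hxK, not_le.1 hlt⟩
            · simp [hψ, cut, hxK]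
          simp [this]
    have e4 : ∫ x, h x * ‖G x‖ ^ 2 ≤ (1 + δ) / ε * m2 := by
      show _ ≤ (1 + δ) / ε * ∫ x in K ∩ {x | s < φ x ∧ φ x < s'}, ‖G x‖ ^ 2
      rw [← integral_indicator hm2m, ← integral_const_mul]
      apply integral_mono
      · exact Continuous.integrable_of_hasCompactSupport (by fun_prop) hhc.mul_right
      · exact ((integrable_indicator_iff hm2m).2 (hio _ (by fun_prop) _ Set.inter_subset_left)).const_mul _
      · intro x
        by_cases hx : x ∈ K ∩ {x | s < φ x ∧ φ x < s'}
        · simp only [Set.indicator_of_mem hx]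
          have : h x ≤ (1 + δ) / ε := by
            simp only [hh, cut, Set.indicator_of_mem hx.1, hT']
            have := h2 ((φ x - s) / ε)
            gcongr
          gcongr
        · simp only [Set.indicator_of_notMem hx]
          have : h x = 0 := by
            by_cases hxK : x ∈ K
            · simp only [hh, cut, Set.indicator_of_mem hxK]
              by_cases hs : φ x ≤ s
              · exact hT0' _ hs
              · have : s' ≤ φ x := by
                  by_contra hlt
                  exact hx ⟨hxK, not_le.1 hs, not_le.1 hlt⟩
                simp [hT', h6 _ (hge _ this)]
            · simp [hh, cut, hxK]
          simp [this]
    have e5 : 0 ≤ ∫ x, h x * ‖G x‖ ^ 2 := integral_nonneg fun x => by have := hh0 x; positivity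
    have e6 : 4 * π * m1 ≤ R * ((1 + δ) / ε * m2) := by
      calc 4 * π * m1 ≤ 4 * π * ∫ x, ψ x ^ 2 * ‖G x‖ ^ 2 := by gcongr
        _ ≤ _ := hker.trans hcs
        _ ≤ R * ((1 + δ) / ε * m2) := by gcongr
    calc 4 * π * ε * m1 = ε * (4 * π * m1) := by ring
      _ ≤ ε * (R * ((1 + δ) / ε * m2)) := by gcongr
      _ = _ := by field_simp
  apply le_of_forall_pos_le_add
  intro e he
  have := main (e / (R * m2 + 1)) (by positivity)
  refine this.trans ?_
  have h2 : R * m2 * (e / (R * m2 + 1)) ≤ e := by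
    have : 0 ≤ R * m2 := by positivity
    rw [mul_div_assoc', div_le_iff₀ (by positivity)]
    nlinarith
  nlinarith

end MF

namespace MF
open Complex (I)
open Filter Topology

theorem Lp_add {f g : ℂ → ℝ} (hf : ContDiff ℝ 2 f) (hg : ContDiff ℝ 2 g) (x : ℂ) :
    Lp (fun y => f y + g y) x = Lp f x + Lp g x := by
  have d1 : ∀ v, (fun y => fderiv ℝ (fun y => f y + g y) y v) = fun y => fderiv ℝ f y v + fderiv ℝ g y v := by
    intro v; funext y
    rw [fderiv_fun_add (hf.differentiable (by norm_num) y) (hg.differentiable (by norm_num) y)]; rfl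
  unfold Lp
  rw [d1, d1]
  have e : ∀ {k : ℂ → ℝ}, ContDiff ℝ 2 k → ∀ v, DifferentiableAt ℝ (fun y => fderiv ℝ k y v) x := 
    fun hk v => (contDiff_fderiv_apply hk v).differentiable (by norm_num) x
  rw [fderiv_fun_add (e hf 1) (e hg 1), fderiv_fun_add (e hf I) (e hg I)]
  simp; ring

theorem Lp_const_mul {f : ℂ → ℝ} (hf : ContDiff ℝ 2 f) (c : ℝ) (x : ℂ) :
    Lp (fun y => c * f y) x = c * Lp f x := by
  have d1 : ∀ v, (fun y => fderiv ℝ (fun y => c * f y) y v) = fun y => c * fderiv ℝ f y v := by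
    intro v; funext y
    rw [fderiv_const_mul (hf.differentiable (by norm_num) y)]; rfl
  unfold Lp
  rw [d1, d1]
  have e : ∀ {k : ℂ → ℝ}, ContDiff ℝ 2 k → ∀ v, DifferentiableAt ℝ (fun y => fderiv ℝ k y v) x := 
    fun hk v => (contDiff_fderiv_apply hk v).differentiable (by norm_num) x
  rw [fderiv_const_mul (e hf 1), fderiv_const_mul (e hf I)]
  simp; ring

theorem Lp_const (c : ℝ) (x : ℂ) : Lp (fun _ => c) x = 0 := by
  unfold Lp; simp

theorem Lp_sub {f g : ℂ → ℝ} (hf : ContDiff ℝ 2 f) (hg : ContDiff ℝ 2 g) (x : ℂ) :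
    Lp (fun y => f y - g y) x = Lp f x - Lp g x := by
  have : (fun y => f y - g y) = fun y => f y + (-1) * g y := by funext y; ring
  rw [this, Lp_add hf (contDiff_const.mul hg), Lp_const_mul hg]; ring

theorem contDiff_re {h : ℂ → ℂ} (hh : Differentiable ℂ h) : ContDiff ℝ 2 (fun z => (h z).re) :=
  Complex.reCLM.contDiff.comp ((hh.contDiff (n := 2)).restrict_scalars ℝ)

theorem fderiv_re {h : ℂ → ℂ} {y : ℂ} (hh : DifferentiableAt ℂ h y) (v : ℂ) :
    fderiv ℝ (fun z => (h z).re) y v = (deriv h y * v).re := by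
  have h1 : HasFDerivAt h ((ContinuousLinearMap.toSpanSingleton ℂ (deriv h y)).restrictScalars ℝ) y :=
    hh.hasDerivAt.hasFDerivAt.restrictScalars ℝ
  have h2 : HasFDerivAt (fun z => (h z).re) _ y := Complex.reCLM.hasFDerivAt.comp y h1
  rw [h2.fderiv]
  simp [mul_comm]

theorem Lp_re {h : ℂ → ℂ} (hh : Differentiable ℂ h) (x : ℂ) : Lp (fun z => (h z).re) x = 0 := by
  have hd : Differentiable ℂ (deriv h) := hh.deriv
  have e : ∀ v, (fun y => fderiv ℝ (fun z => (h z).re) y v) = fun y => (deriv h y * v).re := by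
    intro v; funext y; exact fderiv_re (hh y) v
  unfold Lp
  rw [e, e, fderiv_re (h := fun y => deriv h y * 1) (by fun_prop), 
    fderiv_re (h := fun y => deriv h y * I) (by fun_prop)]
  simp only [mul_one]
  rw [deriv_mul_const (hd x), mul_assoc, Complex.I_mul_I]
  simp

theorem telescope {N H : ℝ → ℝ} {α β c C ε0 : ℝ} (hαβ : α < β) (hε0 : 0 < ε0) 
    (h : ∀ s ε, 0 < ε → ε ≤ ε0 → α ≤ s → s + ε ≤ β → 
      c * ε - ε * (H s - H (s + ε)) - C * ε ^ 2 ≤ N s - N (s + ε)) :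
    N β + c * (β - α) ≤ N α := by
  have key : ∀ n : ℕ, (β - α) / ε0 ≤ (n : ℝ) + 1 → 
     c * (β - α) - (β - α) / ((n:ℝ) + 1) * (H α - H β) - C * (β - α) * ((β - α) / ((n:ℝ) + 1)) ≤ N α - N β := by
    intro n hn
    set ε := (β - α) / ((n:ℝ) + 1) with hε
    have hn1 : (0:ℝ) < (n:ℝ) + 1 := by positivity
    have hεp : 0 < ε := div_pos (by linarith) hn1
    have hεle : ε ≤ ε0 := by
      rw [hε, div_le_iff₀ hn1]; rw [div_le_iff₀ hε0] at hn; linarith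
    have hnε : ((n:ℝ) + 1) * ε = β - α := by rw [hε]; field_simp
    have ind : ∀ j : ℕ, j ≤ n + 1 → 
      c * (j * ε) - ε * (H α - H (α + j * ε)) - C * ε ^ 2 * j ≤ N α - N (α + j * ε) := by
      intro j
      induction j with
      | zero => intro _; simp
      | succ j ih =>
        intro hj
        have ih := ih (by omega)
        have hj' : ((j:ℝ) + 1) ≤ (n:ℝ) + 1 := by exact_mod_cast hj
        have e : α + j * ε + ε = α + ((j + 1 : ℕ) : ℝ) * ε := by push_cast; ring
        have := h (α + j * ε) ε hεp hεle (by have : (0:ℝ) ≤ j * ε := by positivity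
                                             linarith) (by
            have : ((j:ℝ) + 1) * ε ≤ ((n:ℝ) + 1) * ε := by gcongr
            linarith)
        rw [e] at this
        push_cast at this ⊢
        linarith
    have := ind (n + 1) le_rfl
    push_cast at this
    rw [hnε, show α + (β - α) = β by ring] at this
    have e2 : C * ε ^ 2 * ((n:ℝ) + 1) = C * (β - α) * ε := by rw [← hnε]; ring
    linarith
  have t0 : Tendsto (fun n : ℕ => (β - α) / ((n:ℝ) + 1)) atTop (𝓝 0) := by
    have := (tendsto_one_div_add_atTop_nhds_zero_nat (𝕜 := ℝ)).const_mul (β - α)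
    simpa [div_eq_mul_inv] using this
  have t1 : Tendsto (fun n : ℕ => c * (β - α) - (β - α) / ((n:ℝ) + 1) * (H α - H β) - C * (β - α) * ((β - α) / ((n:ℝ) + 1)))
      atTop (𝓝 (c * (β - α) - 0 * (H α - H β) - C * (β - α) * 0)) :=
    (tendsto_const_nhds.sub (t0.mul_const _)).sub (t0.const_mul _)
  have := le_of_tendsto t1 (b := N α - N β) (by
    obtain ⟨n0, hn0⟩ := exists_nat_ge ((β - α) / ε0)
    filter_upwards [eventually_ge_atTop n0] with n hn
    apply key
    have : (n0:ℝ) ≤ n := by exact_mod_cast hn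
    linarith)
  linarith

theorem exp_sub_one_le {x : ℝ} (h0 : 0 ≤ x) (h1 : x ≤ 1) : Real.exp x - 1 ≤ x + x ^ 2 := by
  have := Real.abs_exp_sub_one_sub_id_le (x := x) (by rw [abs_of_nonneg h0]; exact h1)
  have := le_abs_self (Real.exp x - 1 - x)
  linarith

end MF

namespace MF
open Complex (I)
open Filter Topology

theorem bol_step {k μ μ' a a' E E' EM M ε : ℝ} (hk : 0 ≤ k) (ha' : 0 ≤ a') (haa : a' ≤ a) (haM : a' ≤ M)
    (hE : 0 < E) (hEM : E ≤ EM) (hε : 0 < ε) (hε1 : ε ≤ 1/2) (hEE : E ≤ E') (hE' : E' ≤ E * (1 + 2 * ε + 4 * ε^2))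
    (hμ' : E' * a' ≤ μ') (h1 : E * (a - a') ≤ μ - μ') (h2 : μ - μ' ≤ E' * (a - a'))
    (hl : 4 * π * ε * a' ≤ k * μ * (a - a')) :
    0 * ε - ε * ((8 * π * EM * a + 2 * π * μ) - (8 * π * EM * a' + 2 * π * μ')) - (8 * π * EM * M) * ε ^ 2 ≤
     (k * μ^2/2 + 2*π*a*E - 2*π*μ) - (k * μ'^2/2 + 2*π*a'*E' - 2*π*μ') := by
  have hπ := Real.pi_pos
  have hμ'0 : 0 ≤ μ' := le_trans (mul_nonneg (hE.le.trans hEE) ha') hμ'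
  have hd : 0 ≤ a - a' := by linarith
  have hdμ : 0 ≤ μ - μ' := le_trans (mul_nonneg hE.le hd) h1
  have hEa : E * a' ≤ μ' := le_trans (mul_le_mul_of_nonneg_right hEE ha') hμ'
  have key : 4 * π * ε * (E * a') - 2 * π * ε * (μ - μ') ≤ k * (μ + μ') * (μ - μ') / 2 := by
    rcases (hμ'0.trans (by linarith : μ' ≤ μ)).eq_or_lt with h | h
    · have : μ' = 0 := by linarith
      have h3 : E * a' = 0 := le_antisymm (by linarith) (by positivity)
      rw [h3, ← h, this]; simp
    · have hX : 4 * π * ε * (E * a') ≤ k * μ * (μ - μ') := by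
        calc 4 * π * ε * (E * a') = E * (4 * π * ε * a') := by ring
          _ ≤ E * (k * μ * (a - a')) := by gcongr
          _ = k * μ * (E * (a - a')) := by ring
          _ ≤ _ := by gcongr
      have hX2 : 4 * π * ε * (E * a') ≤ 4 * π * ε * μ := by gcongr; linarith
      refine le_of_mul_le_mul_left ?_ h
      set X := 4 * π * ε * (E * a')
      have i1 := mul_le_mul_of_nonneg_left hX (by linarith : 0 ≤ (μ + μ')/2)
      have i2 := mul_le_mul_of_nonneg_right hX2 hdμ
      nlinarith
  have hEd : E' - E ≤ E * (2 * ε + 4 * ε ^ 2) := by linarith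
  have k1 : (E' - E) * a' ≤ E * (2 * ε + 4 * ε ^ 2) * a' := by gcongr
  have k2 : (E' - E) * (a - a') ≤ EM * (4 * ε) * (a - a') := by
    gcongr
    refine hEd.trans ?_
    have : 2 * ε + 4 * ε ^ 2 ≤ 4 * ε := by nlinarith
    have h4 : 0 ≤ 2 * ε + 4 * ε ^ 2 := by positivity
    exact mul_le_mul hEM this h4 (hE.le.trans hEM)
  have k3 : E * ε^2 * a' ≤ EM * ε^2 * M := by
    have : 0 ≤ EM := hE.le.trans hEM
    gcongr
  have g1 := mul_le_mul_of_nonneg_left k1 hπ.le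
  have g2 := mul_le_mul_of_nonneg_left k2 hπ.le
  have g3 := mul_le_mul_of_nonneg_left k3 hπ.le
  have g4 := mul_le_mul_of_nonneg_left h2 hπ.le
  nlinarith

theorem sint_nonneg {f : ℂ → ℝ} (h0 : ∀ x, 0 ≤ f x) (S : Set ℂ) : 0 ≤ ∫ x in S, f x :=
  integral_nonneg fun x => h0 x

theorem sint_mono {K : Set ℂ} (hK : IsCompact K) {f : ℂ → ℝ} (hf : Continuous f) (h0 : ∀ x, 0 ≤ f x) {S T : Set ℂ}
    (hST : S ⊆ T) (hT : T ⊆ K) : ∫ x in S, f x ≤ ∫ x in T, f x :=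
  setIntegral_mono_set ((hf.continuousOn.integrableOn_compact hK).mono_set hT) 
    (Eventually.of_forall h0) (Eventually.of_forall hST)

theorem sint_diff {K : Set ℂ} (hK : IsCompact K) {f : ℂ → ℝ} (hf : Continuous f) {S T : Set ℂ}
    (hS : MeasurableSet S)
    (hST : S ⊆ T) (hT : T ⊆ K) : ∫ x in T \ S, f x = (∫ x in T, f x) - ∫ x in S, f x :=
  setIntegral_sdiff hS ((hf.continuousOn.integrableOn_compact hK).mono_set hT) hST

theorem sint_le {K : Set ℂ} (hK : IsCompact K) {f g : ℂ → ℝ} (hf : Continuous f) (hg : Continuous g)  {S : Set ℂ}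
    (hS : MeasurableSet S) (hT : S ⊆ K) (c : ℝ) (h : ∀ x ∈ S, f x ≤ c * g x) : ∫ x in S, f x ≤ c * ∫ x in S, g x := by
  rw [← integral_const_mul]
  exact setIntegral_mono_on ((hf.continuousOn.integrableOn_compact hK).mono_set hT) 
   (((continuous_const.mul hg).continuousOn.integrableOn_compact hK).mono_set hT) hS h

theorem sint_ge {K : Set ℂ} (hK : IsCompact K) {f g : ℂ → ℝ} (hf : Continuous f) (hg : Continuous g)  {S : Set ℂ}
    (hS : MeasurableSet S) (hT : S ⊆ K) (c : ℝ) (h : ∀ x ∈ S, c * g x ≤ f x) : c * ∫ x in S, g x ≤ ∫ x in S, f x := by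
  rw [← integral_const_mul]
  exact setIntegral_mono_on (((continuous_const.mul hg).continuousOn.integrableOn_compact hK).mono_set hT) 
    ((hf.continuousOn.integrableOn_compact hK).mono_set hT) hS h

theorem norm_exp_sq (z : ℂ) : ‖Complex.exp z‖ ^ 2 = Real.exp (2 * z.re) := by
  rw [Complex.norm_exp, ← Real.exp_nat_mul]; norm_num

theorem exists_prim {h : ℂ → ℂ} (hh : Differentiable ℂ h) : 
    ∃ F : ℂ → ℂ, ∀ z, HasDerivAt F (Complex.exp (h z)) z := by
  have : Differentiable ℂ (fun z => Complex.exp (h z)) := hh.cexp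
  obtain ⟨F, hF⟩ := this.isExactOn_univ
  exact ⟨F, fun z => hF z trivial⟩

/-- Bol/Suzuki inequality. -/
theorem bol {K : Set ℂ} (hK : IsCompact K) {w : ℂ → ℝ} (hw : ContDiff ℝ 2 w) {h : ℂ → ℂ} (hh : Differentiable ℂ h)
    {k s0 : ℝ} (hk : 0 ≤ k) (hfr : ∀ x ∈ frontier K, w x - (h x).re < s0)
    (hLw : ∀ x ∈ K, - Lp w x ≤ k * Real.exp (2 * w x)) :
    4 * π * (∫ x in K, Real.exp (2 * w x)) - k * (∫ x in K, Real.exp (2 * w x)) ^ 2 ≤ 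
      4 * π * Real.exp (2 * s0) * ∫ x in K, Real.exp (2 * (h x).re) := by
  have hre := contDiff_re hh
  obtain ⟨F, hF⟩ := exists_prim hh
  set q : ℂ → ℝ := fun x => w x - (h x).re with hq
  have hq2 : ContDiff ℝ 2 q := hw.sub hre
  have hqc := hq2.continuous
  have hLq : ∀ x ∈ K, - Lp q x ≤ k * Real.exp (2 * w x) := by
    intro x hx
    rw [hq, Lp_sub hw hre, Lp_re hh]; simpa using hLw x hx
  have hwc := hw.continuous
  have hrc := hre.continuous
  set f : ℂ → ℝ := fun x => Real.exp (2 * w x) with hf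
  set g : ℂ → ℝ := fun x => Real.exp (2 * (h x).re) with hg
  have hfc : Continuous f := by fun_prop
  have hgc : Continuous g := by fun_prop
  have hf0 : ∀ x, 0 ≤ f x := fun x => (Real.exp_pos _).le
  have hg0 : ∀ x, 0 ≤ g x := fun x => (Real.exp_pos _).le
  have hfg : ∀ x, f x = Real.exp (2 * q x) * g x := by
    intro x; simp only [hf, hg, hq, ← Real.exp_add]; congr 1; ring
  set P : ℝ → Set ℂ := fun s => K ∩ {x | s < q x} with hP
  have hPm : ∀ s, MeasurableSet (P s) := fun s => hK.measurableSet.inter (measurableSet_lt measurable_const hqc.measurable)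
  have hPK : ∀ s, P s ⊆ K := fun s => Set.inter_subset_left
  have hPP : ∀ s s', s ≤ s' → P s' ⊆ P s := fun s s' hs x hx => ⟨hx.1, lt_of_le_of_lt hs hx.2⟩
  set μ : ℝ → ℝ := fun s => ∫ x in P s, f x with hμ
  set a : ℝ → ℝ := fun s => ∫ x in P s, g x with ha
  obtain ⟨T, hT0, hT⟩ : ∃ T, s0 < T ∧ ∀ x ∈ K, q x ≤ T := by
    obtain ⟨T, hT⟩ := hK.bddAbove_image hqc.continuousOn
    refine ⟨max T (s0 + 1), by simp, fun x hx => le_max_of_le_left (hT ⟨x, hx, rfl⟩)⟩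
  have hPT : P T = ∅ := by
    ext x; simp only [hP, Set.mem_inter_iff, Set.mem_ofPred_eq, Set.mem_empty_iff_false, iff_false, not_and, not_lt]
    exact hT x
  set M := ∫ x in K, g x with hM
  have step : ∀ s ε, 0 < ε → ε ≤ 1/2 → s0 ≤ s → s + ε ≤ T →
      0 * ε - ε * ((8 * π * Real.exp (2*T) * a s + 2 * π * μ s) - (8 * π * Real.exp (2*T) * a (s+ε) + 2 * π * μ (s+ε))) - (8 * π * Real.exp (2*T) * M) * ε ^ 2 ≤
     (k * μ s^2/2 + 2*π*a s*Real.exp (2*s) - 2*π*μ s) - (k * μ (s+ε)^2/2 + 2*π*a (s+ε)*Real.exp (2*(s+ε)) - 2*π*μ (s+ε)) := by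
    intro s ε hε hε1 hs hsT
    have hss : s ≤ s + ε := by linarith
    have hlay := layer_ineq hK hq2 (by linarith : s < s + ε) (fun x hx => (hfr x hx).trans_le hs) 
      (ρ := fun x => k * f x) (by fun_prop) (fun x _ _ => mul_nonneg hk (hf0 x)) (fun x hx _ => hLq x hx) hF hh.cexp 
      (fun z => Complex.exp_ne_zero _)
    simp only [norm_exp_sq, add_sub_cancel_left] at hlay
    rw [integral_const_mul] at hlay
    have hD : (P s \ P (s+ε)) ⊆ K := Set.sdiff_subset.trans (hPK s)
    have hDm := (hPm s).diff (hPm (s+ε))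
    have d1 := sint_diff hK hfc (hPm (s+ε)) (hPP _ _ hss) (hPK s)
    have d2 := sint_diff hK hgc (hPm (s+ε)) (hPP _ _ hss) (hPK s)
    apply bol_step hk (sint_nonneg hg0 _) (sint_mono hK hgc hg0 (hPP _ _ hss) (hPK s)) 
      (sint_mono hK hgc hg0 (hPK _) subset_rfl) (Real.exp_pos _) (Real.exp_le_exp.2 (by linarith)) hε hε1 
      (Real.exp_le_exp.2 (by linarith))
    · rw [mul_add, Real.exp_add]
      gcongr
      have := exp_sub_one_le (x := 2 * ε) (by linarith) (by linarith)
      linarith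
    · apply sint_ge hK hfc hgc (hPm _) (hPK _)
      intro x hx
      rw [hfg]
      have := hx.2
      simp only [Set.mem_ofPred_eq] at this
      exact mul_le_mul_of_nonneg_right (Real.exp_le_exp.2 (by linarith)) (hg0 x)
    · simp only [hμ, ha]
      rw [← d1, ← d2]
      apply sint_ge hK hfc hgc hDm hD
      intro x hx
      rw [hfg]
      have := hx.1.2
      simp only [Set.mem_ofPred_eq] at this
      exact mul_le_mul_of_nonneg_right (Real.exp_le_exp.2 (by linarith)) (hg0 x)
    · simp only [hμ, ha]
      rw [← d1, ← d2]
      apply sint_le hK hfc hgc hDm hD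
      intro x hx
      rw [hfg]
      have : q x ≤ s + ε := by
        by_contra hc
        exact hx.2 ⟨hx.1.1, not_le.1 hc⟩
      exact mul_le_mul_of_nonneg_right (Real.exp_le_exp.2 (by linarith)) (hg0 x)
    · calc 4 * π * ε * a (s+ε) ≤ 4 * π * ε * ∫ x in K ∩ {x | s + ε ≤ q x}, g x := by
            gcongr
            exact sint_mono hK hgc hg0 (fun x hx => ⟨hx.1, show s + ε ≤ q x from le_of_lt hx.2⟩) Set.inter_subset_left
        _ ≤ _ := hlay
        _ ≤ k * μ s * (a s - a (s+ε)) := by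
            simp only [hμ, ha]
            rw [← d2]
            refine mul_le_mul_of_nonneg_left ?_ (mul_nonneg hk (sint_nonneg hf0 (P s)))
            refine sint_mono hK hgc hg0 ?_ hD
            intro x hx
            exact ⟨⟨hx.1, hx.2.1⟩, fun hc => lt_asymm (show q x < s + ε from hx.2.2) hc.2⟩
  have tel := telescope (N := fun s => k * μ s^2/2 + 2*π*a s*Real.exp (2*s) - 2*π*μ s) 
    (H := fun s => 8 * π * Real.exp (2*T) * a s + 2 * π * μ s) (c := 0) hT0 (by norm_num : (0:ℝ) < 1/2) step
  have hμT : μ T = 0 := by simp [hμ, hPT]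
  have haT : a T = 0 := by simp [ha, hPT]
  simp only [hμT, haT] at tel
  have d1 := sint_diff hK hfc (hPm s0) (hPK s0) subset_rfl
  have d2 := sint_diff hK hgc (hPm s0) (hPK s0) subset_rfl
  have d3 : ∫ x in K \ P s0, f x ≤ Real.exp (2 * s0) * ∫ x in K \ P s0, g x := by
    apply sint_le hK hfc hgc (hK.measurableSet.diff (hPm _)) Set.sdiff_subset
    intro x hx
    rw [hfg]
    have : q x ≤ s0 := by
      by_contra hc
      exact hx.2 ⟨hx.1, not_le.1 hc⟩
    exact mul_le_mul_of_nonneg_right (Real.exp_le_exp.2 (by linarith)) (hg0 x)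
  have hμ0 : 0 ≤ μ s0 := sint_nonneg hf0 _
  have hμA : μ s0 ≤ ∫ x in K, f x := sint_mono hK hfc hf0 (hPK _) subset_rfl
  rw [d1, d2] at d3
  change (∫ x in K, f x) - μ s0 ≤ Real.exp (2 * s0) * (M - a s0) at d3
  have hπ := Real.pi_pos
  have g1 := mul_le_mul_of_nonneg_left d3 hπ.le
  have g2 : k * μ s0 ^2 ≤ k * (∫ x in K, f x)^2 := by gcongr
  nlinarith

end MF

namespace MF
open Complex (I)
open Filter Topology

theorem leaf_key {Y Y' d Z ε C3 EM W R : ℝ} (hε : 0 < ε) (hC3 : 0 ≤ C3) (hEM : 0 ≤ EM)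
    (hY : 0 ≤ Y) (hY' : 0 ≤ Y') (hYY : Y' ≤ Y) (hd : 0 ≤ d) (hW : 0 ≤ W) (hZW : Z ≤ W) (hR : 0 ≤ R) (hZR : Z ≤ R * Y)
    (hdY : Y - Y' ≤ EM * d)
    (hl : ε * Z ≤ (1 + C3 * ε) * (Y * d)) :
    2 * ε * Z - 2 * C3 * W * ε ^ 2 - EM * R * ε * d ≤ (Y + Y') * d := by
  have hYd : 0 ≤ Y * d := by positivity
  have hp1 : 0 ≤ (Y + Y') * d := by positivity
  have hp2 : 0 ≤ 2 * C3 * W * ε ^ 2 := by positivity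
  have hp3 : 0 ≤ EM * R * ε * d := by positivity
  rcases le_or_gt Z 0 with hZ0 | hZ0
  · have : ε * Z ≤ 0 := mul_nonpos_of_nonneg_of_nonpos hε.le hZ0
    linarith
  have hYpos : 0 < Y := by
    rcases hY.eq_or_lt with h | h
    · rw [← h] at hZR; simp at hZR; linarith
    · exact h
  have hεZ : 0 < ε * Z := mul_pos hε hZ0
  have i3 : ε * Z - C3 * ε ^ 2 * Z ≤ Y * d := by
    have h2 : ε * Z * (1 - C3 * ε) ≤ Y * d := by
      rcases le_or_gt (1 - C3 * ε) 0 with h | h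
      · exact (mul_nonpos_of_nonneg_of_nonpos hεZ.le h).trans hYd
      · have h1 := mul_le_mul_of_nonneg_right hl h.le
        have h3 : 0 ≤ (Y * d) * (C3 * ε)^2 := by positivity
        have h4 : (1 + C3 * ε) * (Y * d) * (1 - C3 * ε) = Y * d - (Y * d) * (C3 * ε)^2 := by ring
        linarith
    have h5 : ε * Z * (1 - C3 * ε) = ε * Z - C3 * ε ^ 2 * Z := by ring
    linarith
  refine le_of_mul_le_mul_left ?_ hYpos
  have q1 := mul_le_mul_of_nonneg_left i3 (by linarith : 0 ≤ Y + Y')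
  have q2 := mul_le_mul_of_nonneg_right (by linarith : 2 * Y - EM * d ≤ Y + Y') hεZ.le
  have q4 := mul_le_mul_of_nonneg_right (by linarith : Y + Y' ≤ 2 * Y) (by positivity : 0 ≤ C3 * ε^2 * Z)
  have i5 : Y * (C3 * ε^2 * Z) ≤ Y * (C3 * ε^2 * W) := by gcongr
  have i6 : EM * d * (ε * Z) ≤ EM * d * (ε * (R * Y)) := by gcongr
  have e1 : (Y + Y') * (ε * Z - C3 * ε ^ 2 * Z) = (Y + Y') * (ε * Z) - (Y+Y') * (C3 * ε ^ 2 * Z) := by ring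
  have e2 : (2 * Y - EM * d) * (ε * Z) = Y * (2 * ε * Z) - EM * d * (ε * Z) := by ring
  have e3 : Y * (2 * ε * Z - 2 * C3 * W * ε ^ 2 - EM * R * ε * d) = 
     Y * (2 * ε * Z) - 2 * (Y * (C3 * ε^2 * W)) - EM * d * (ε * (R * Y)) := by ring
  have e4 : 2 * Y * (C3 * ε ^ 2 * Z) = 2 * (Y * (C3 * ε^2 * Z)) := by ring
  have e5 : Y * ((Y + Y') * d) = (Y + Y') * (Y * d) := by ring
  rw [e3, e5]
  linarith

theorem leaf_step {A A' B B' E E' k α ε C3 A0 EM c : ℝ} (hk0 : 0 ≤ k)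
    (hα : 0 < α) (hε : 0 < ε) (hε1 : ε ≤ 1/2) (hC3 : 0 ≤ C3) (hA' : 0 ≤ A') (hAA : A' ≤ A) (hA0 : A ≤ A0)
    (hE1 : 1 + 2 * α ≤ E) (hEE : E * (1 + 2 * ε) ≤ E') (hEM : E' ≤ EM) (hE' : E' ≤ E * (1 + 2 * ε + 4 * ε^2))
    (hB' : E' * A' ≤ B') (hB : E * A ≤ B) (h1 : E * (A - A') ≤ B - B') (h2 : B - B' ≤ E' * (A - A'))
    (hc : c ≤ 2 * E * ((1 - k) * A'^2))
    (hl : ε * (A' * (4 * π - k * A')) ≤ (1 + C3 * ε) * ((B - A) * (A - A'))) :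
    c * ε - ε * ((EM^2*(2*π/α)+16*π*EM) * A - (EM^2*(2*π/α)+16*π*EM) * A')
     - (8 * π * C3 * EM * A0 + 4 * EM * A0 * (4 * π + A0)) * ε ^ 2 ≤
     (E * (A * (4 * π - A)) - B * (4 * π - B)) - (E' * (A' * (4 * π - A')) - B' * (4 * π - B')) := by
  have hπ := Real.pi_pos
  obtain ⟨d, hd⟩ : ∃ d, d = A - A' := ⟨_, rfl⟩
  obtain ⟨Z, hZ⟩ : ∃ Z, Z = A' * (4 * π - k * A') := ⟨_, rfl⟩
  rw [← hd] at h1 h2 hl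
  rw [← hZ] at hl
  have hd0 : 0 ≤ d := by linarith
  have hA : 0 ≤ A := by linarith
  have hE0 : 0 < E := by linarith
  have hEε : 0 < E * ε := by positivity
  have hEE0 : E ≤ E' := by linarith
  have hEMp : 0 < EM := by linarith
  have hE0' : 1 ≤ E' := by linarith
  have hkA : 0 ≤ k * A' ^ 2 := by positivity
  have hZ2 : Z ≤ 4 * π * A' := by rw [hZ]; linarith
  have hA00 : 0 ≤ A0 := by linarith
  have hY : 2 * α * A' ≤ B - A := by
    have i1 : (1 + 2 * α) * A ≤ E * A := by gcongr
    have i2 : 2 * α * A' ≤ 2 * α * A := by gcongr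
    linarith
  have hY' : 0 ≤ B' - A' := by
    have : 1 * A' ≤ E' * A' := by gcongr
    linarith
  have hYp : 0 ≤ B - A := le_trans (by positivity) hY
  have hZ4 : Z ≤ 4 * π * A0 := by
    have : 4 * π * A' ≤ 4 * π * A0 := by gcongr; linarith
    linarith
  have hZY : Z ≤ 2 * π / α * (B - A) := by
    have : 2 * π / α * (2 * α * A') ≤ 2 * π / α * (B - A) := by gcongr
    have e : 2 * π / α * (2 * α * A') = 4 * π * A' := by field_simp; ring
    linarith
  have hEd : E * 1 * d ≤ E * d := by simp
  have h1d : 1 * d ≤ E * d := by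
    refine mul_le_mul_of_nonneg_right ?_ hd0; linarith
  have hEMd : E' * d ≤ EM * d := by gcongr
  have key := leaf_key (Y := B - A) (Y' := B' - A') (d := d) (Z := Z) (W := 4 * π * A0) (R := 2 * π / α) hε hC3 hEMp.le hYp hY'
    (by linarith) hd0 (by positivity) hZ4 (by positivity) hZY (by linarith) hl
  have f1 := mul_le_mul_of_nonneg_left key hE0.le
  have hEEM : E ≤ EM := hEE0.trans hEM
  have f2 : E * (2 * C3 * (4 * π * A0) * ε ^ 2) ≤ EM * (2 * C3 * (4 * π * A0) * ε ^ 2) := by gcongr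
  have f3 : E * (EM * (2 * π / α) * ε * d) ≤ EM * (EM * (2 * π / α) * ε * d) := by gcongr
  have hr0 : 0 ≤ (B - B') - E * d := by linarith
  have hε2 : ε ^ 2 ≤ ε / 2 := by nlinarith
  have hr1 : (B - B') - E * d ≤ 4 * ε * EM * d := by
    have : E' - E ≤ E * (4 * ε) := by
      have := mul_le_mul_of_nonneg_left hε2 hE0.le
      linarith
    have h4 : E * (4 * ε) ≤ EM * (4 * ε) := by gcongr
    have h5 : (E' - E) * d ≤ EM * (4 * ε) * d := by
      refine mul_le_mul_of_nonneg_right ?_ hd0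
      linarith
    linarith
  have hBp : 0 ≤ B := le_trans (by positivity) hB
  have hBp' : 0 ≤ B' := le_trans (by positivity) hB'
  have f4 : ((B - B') - E * d) * (4 * π - B - B') ≤ 4 * ε * EM * d * (4 * π) := by
    have : ((B - B') - E * d) * (4 * π - B - B') ≤ ((B - B') - E * d) * (4 * π) := by
      refine mul_le_mul_of_nonneg_left ?_ hr0; linarith
    refine this.trans ?_
    gcongr
  have f5 : (E' - E - 2 * ε * E) * (A' * (4 * π - A')) ≤ 4 * ε^2 * EM * (A0 * (4 * π + A0)) := by
    have h : 0 ≤ (E' - E - 2 * ε * E) := by linarith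
    have h7 : A' * (4 * π - A') ≤ A0 * (4 * π + A0) := by
      have : A' * (4 * π - A') ≤ A' * (4 * π + A0) := by gcongr; linarith
      refine this.trans ?_
      gcongr; linarith
    have h8 : E' - E - 2 * ε * E ≤ 4 * ε^2 * EM := by
      have := mul_le_mul_of_nonneg_left hEEM (sq_nonneg ε)
      linarith
    have h9 : 0 ≤ A0 * (4 * π + A0) := by positivity
    exact mul_le_mul_of_nonneg_left h7 h |>.trans (mul_le_mul_of_nonneg_right h8 h9)
  have f6 := mul_le_mul_of_nonneg_right hc hε.le
  have hA2 : A = A' + d := by linarith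
  rw [hZ] at f1
  subst hA2
  linarith

end MF

namespace MF
open Complex (I)
open Filter Topology

theorem exists_dom {K : Set ℂ} (hK : IsCompact K) {f g : ℂ → ℝ} (hf : Continuous f) (hg : Continuous g)
    (hg0 : ∀ x ∈ K, 0 < g x) : ∃ C > 0, ∀ x ∈ K, |f x| < C * g x := by
  have : ContinuousOn (fun x => |f x| / g x) K := 
    (hf.abs.continuousOn).div hg.continuousOn fun x hx => (hg0 x hx).ne'
  obtain ⟨C, hC⟩ := hK.bddAbove_image this
  refine ⟨max C 0 + 1, by positivity, fun x hx => ?_⟩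
  have h1 : |f x| / g x ≤ C := hC ⟨x, hx, rfl⟩
  rw [div_le_iff₀ (hg0 x hx)] at h1
  have := hg0 x hx
  have h2 : C * g x ≤ max C 0 * g x := by gcongr; exact le_max_left _ _
  linarith

theorem leaf_tele {O : Set ℂ} {w1 w2 f : ℂ → ℝ} (hw1 : ContDiff ℝ 2 w1) (hw2 : ContDiff ℝ 2 w2) {k : ℝ}
    (hk0 : 0 ≤ k) (hk1 : k < 1)
    (hKc : ∀ t > 0, IsCompact (O ∩ {x | t ≤ w2 x - w1 x}))
    (hfr : ∀ t > 0, ∀ x ∈ frontier (O ∩ {x | t ≤ w2 x - w1 x}), w2 x - w1 x = t)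
    (hL1 : ∀ x ∈ O, Lp w1 x = f x - Real.exp (2 * w1 x)) (hL2 : ∀ x ∈ O, Lp w2 x = f x - Real.exp (2 * w2 x))
    (hkf : ∀ x ∈ O, (1 - k) * Real.exp (2 * w1 x) ≤ f x)
    (happ : ∀ t > 0, ∀ g : ℂ → ℝ, ContDiff ℝ 2 g → 
      (∀ z ∈ O ∩ {x | t ≤ w2 x - w1 x}, 0 < g z ∧ |Lp w1 z| < - Lp g z) → 
      ∃ h : ℂ → ℂ, Differentiable ℂ h ∧ ∀ z ∈ O ∩ {x | t ≤ w2 x - w1 x}, |w1 z - (h z).re| ≤ g z)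
    {A B Q : ℝ → ℝ} (hA : ∀ t, A t = ∫ x in O ∩ {x | t ≤ w2 x - w1 x}, Real.exp (2 * w1 x))
    (hB : ∀ t, B t = ∫ x in O ∩ {x | t ≤ w2 x - w1 x}, Real.exp (2 * w2 x))
    (hQ : ∀ t, Q t = Real.exp (2 * t) * (A t * (4 * π - A t)) - B t * (4 * π - B t))
    {α β : ℝ} (hα : 0 < α) (hαβ : α < β) : 
    Q β + 2 * (1 - k) * A β ^ 2 * (β - α) ≤ Q α := by
  obtain ⟨v, hv⟩ : ∃ v : ℂ → ℝ, v = fun x => w2 x - w1 x := ⟨_, rfl⟩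
  have hv' : ∀ x, w2 x - w1 x = v x := fun x => by rw [hv]
  simp only [hv'] at hKc hfr happ hA hB
  have hv2 : ContDiff ℝ 2 v := by rw [hv]; exact hw2.sub hw1
  have hvc := hv2.continuous
  have hw1c := hw1.continuous
  have hw2c := hw2.continuous
  obtain ⟨K, hK⟩ : ∃ K : ℝ → Set ℂ, K = fun t => O ∩ {x | t ≤ v x} := ⟨_, rfl⟩
  have hK' : ∀ t, O ∩ {x | t ≤ v x} = K t := fun t => by rw [hK]
  simp only [hK'] at hKc hfr happ hA hB
  have hKO : ∀ t x, x ∈ K t → x ∈ O := fun t x hx => by rw [hK] at hx; exact hx.1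
  have hKv : ∀ t x, x ∈ K t → t ≤ v x := fun t x hx => by rw [hK] at hx; exact hx.2
  have hKi : ∀ t x, x ∈ O → t ≤ v x → x ∈ K t := fun t x hx h => by rw [hK]; exact ⟨hx, h⟩
  have hKm : ∀ s t, s ≤ t → K t ⊆ K s := fun s t hst x hx => hKi _ _ (hKO t x hx) (hst.trans (hKv t x hx))
  have hLv : ∀ x ∈ O, - Lp v x = Real.exp (2 * w2 x) - Real.exp (2 * w1 x) := by
    intro x hx
    rw [hv, Lp_sub hw2 hw1, hL1 x hx, hL2 x hx]; ring
  have hvp : ∀ t > 0, ∀ x ∈ K t, 0 < - Lp v x := by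
    intro t ht x hx
    rw [hLv x (hKO t x hx)]
    have := hKv t x hx
    rw [← hv'] at this
    have : Real.exp (2 * w1 x) < Real.exp (2 * w2 x) := Real.exp_lt_exp.2 (by linarith)
    linarith
  obtain ⟨C, hC0, hC⟩ := exists_dom (hKc (α/2) (by linarith)) (continuous_Lp hw1) (g := fun x => - Lp v x) 
     (continuous_Lp hv2).neg (hvp (α/2) (by linarith))
  set f1 : ℂ → ℝ := fun x => Real.exp (2 * w1 x) with hf1
  set f2 : ℂ → ℝ := fun x => Real.exp (2 * w2 x) with hf2
  have hf1c : Continuous f1 := by fun_prop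
  have hf2c : Continuous f2 := by fun_prop
  have hf10 : ∀ x, 0 ≤ f1 x := fun x => (Real.exp_pos _).le
  have hf20 : ∀ x, 0 ≤ f2 x := fun x => (Real.exp_pos _).le
  have hff : ∀ x, f2 x = Real.exp (2 * v x) * f1 x := by
    intro x; simp only [hf1, hf2, ← hv', ← Real.exp_add]; congr 1; ring
  set C2 := 8 * C + 8 with hC2
  set ε0 := min (min (α/2) (1/2)) (1/C2) with hε0
  have hε0p : 0 < ε0 := by positivity
  refine telescope (N := Q) (H := fun t => ((Real.exp (2*β))^2*(2*π/α)+16*π*(Real.exp (2*β))) * A t) hαβ hε0p 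
    (C := 8 * π * (2 * C2) * Real.exp (2*β) * A α + 4 * Real.exp (2*β) * A α * (4 * π + A α)) ?_
  intro t ε hε hεε0 hαt htβ
  have hεα : ε ≤ α/2 := hεε0.trans ((min_le_left _ _).trans (min_le_left _ _))
  have hε12 : ε ≤ 1/2 := hεε0.trans ((min_le_left _ _).trans (min_le_right _ _))
  have hεC : C2 * ε ≤ 1 := by
    have := hεε0.trans (min_le_right _ _)
    rw [le_div_iff₀ (by positivity)] at this
    linarith
  have ht0 : 0 < t := by linarith
  have htt : t ≤ t + ε := by linarith
  have htm : 0 < t - ε := by linarith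
  have hcK := hKc t ht0
  have hmK : MeasurableSet (K (t+ε)) := (hKc (t+ε) (by linarith)).measurableSet
  have hsub := hKm _ _ htt
  have hD : K t \ K (t+ε) ⊆ K t := Set.sdiff_subset
  have hDm := hcK.measurableSet.diff hmK
  have d1 := sint_diff hcK hf1c hmK hsub subset_rfl
  have d2 := sint_diff hcK hf2c hmK hsub subset_rfl
  have hDv : ∀ x ∈ K t \ K (t+ε), v x ≤ t + ε := by
    intro x hx
    by_contra hc
    exact hx.2 (hKi _ _ (hKO _ _ hx.1) (not_le.1 hc).le)
  rw [← hA t, ← hA (t+ε)] at d1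
  rw [← hB t, ← hB (t+ε)] at d2
  have hA'0 : 0 ≤ A (t+ε) := by rw [hA]; exact sint_nonneg hf10 _
  rw [hQ, hQ]
  apply leaf_step hk0 hα hε hε12 (C3 := 2 * C2) (by positivity) hA'0
  · rw [hA, hA]; exact sint_mono hcK hf1c hf10 hsub subset_rfl
  · rw [hA, hA]; exact sint_mono (hKc α hα) hf1c hf10 (hKm _ _ hαt) subset_rfl
  · have := Real.add_one_le_exp (2 * t)
    linarith
  · rw [mul_add 2 t, Real.exp_add]
    have := Real.add_one_le_exp (2 * ε)
    gcongr
    linarith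
  · exact Real.exp_le_exp.2 (by linarith)
  · rw [mul_add 2 t, Real.exp_add]
    gcongr
    have := exp_sub_one_le (x := 2 * ε) (by linarith) (by linarith)
    linarith
  · rw [hA, hB]
    apply sint_ge (hKc (t+ε) (by linarith)) hf2c hf1c hmK subset_rfl
    intro x hx
    rw [hff]
    have := hKv _ _ hx
    exact mul_le_mul_of_nonneg_right (Real.exp_le_exp.2 (by linarith)) (hf10 x)
  · rw [hA, hB]
    apply sint_ge hcK hf2c hf1c hcK.measurableSet subset_rfl
    intro x hx
    rw [hff]
    have := hKv _ _ hx
    exact mul_le_mul_of_nonneg_right (Real.exp_le_exp.2 (by linarith)) (hf10 x)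
  · rw [← d1, ← d2]
    apply sint_ge hcK hf2c hf1c hDm hD
    intro x hx
    rw [hff]
    have := hKv _ _ hx.1
    exact mul_le_mul_of_nonneg_right (Real.exp_le_exp.2 (by linarith)) (hf10 x)
  · rw [← d1, ← d2]
    apply sint_le hcK hf2c hf1c hDm hD
    intro x hx
    rw [hff]
    have := hDv _ hx
    exact mul_le_mul_of_nonneg_right (Real.exp_le_exp.2 (by linarith)) (hf10 x)
  · have hAβ : A β ≤ A (t+ε) := by
      rw [hA, hA]; exact sint_mono (hKc (t+ε) (by linarith)) hf1c hf10 (hKm _ _ htβ) subset_rfl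
    have hAβ0 : 0 ≤ A β := by rw [hA]; exact sint_nonneg hf10 _
    have hE1 : 1 ≤ Real.exp (2 * t) := Real.one_le_exp (by linarith)
    have h1k : 0 ≤ 1 - k := by linarith
    calc 2 * (1 - k) * A β ^ 2 ≤ 2 * (1 - k) * A (t+ε) ^ 2 := by gcongr
      _ = 2 * 1 * ((1 - k) * A (t+ε) ^ 2) := by ring
      _ ≤ _ := by gcongr
  · -- main inequality
    obtain ⟨h, hh, hha⟩ := happ (t - ε) htm (fun x => C * (v x - (t - ε)) + ε) 
      ((contDiff_const.mul (hv2.sub contDiff_const)).add contDiff_const) (by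
        intro z hz
        have hz1 := hKv _ _ hz
        constructor
        · have : 0 ≤ C * (v z - (t - ε)) := mul_nonneg hC0.le (by linarith)
          linarith
        · have e : Lp (fun x => C * (v x - (t - ε)) + ε) z = C * Lp v z := by
            rw [Lp_add (contDiff_const.mul (hv2.sub contDiff_const)) contDiff_const,
              Lp_const_mul (hv2.sub contDiff_const), Lp_sub hv2 contDiff_const, Lp_const, Lp_const]
            ring
          rw [e]
          have := hC z (hKm _ _ (by linarith) hz)
          linarith)
    obtain ⟨F, hF⟩ := exists_prim hh
    have hrc := (contDiff_re hh).continuous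
    have hlay := layer_ineq (hKc _ htm) hv2 (by linarith : t < t + ε) 
      (fun x hx => by rw [hfr _ htm x hx]; linarith) 
      (ρ := fun x => f2 x - f1 x) (by fun_prop) (fun x hx ht => by
        have := hvp _ htm x hx
        rw [hLv x (hKO _ _ hx)] at this
        exact this.le) (fun x hx _ => by rw [hLv x (hKO _ _ hx)]) hF hh.cexp 
      (fun z => Complex.exp_ne_zero _)
    simp only [norm_exp_sq, add_sub_cancel_left] at hlay
    set g : ℂ → ℝ := fun x => Real.exp (2 * (h x).re) with hg
    have hgc : Continuous g := by fun_prop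
    have hg0 : ∀ x, 0 ≤ g x := fun x => (Real.exp_pos _).le
    set s0 := (2 * C + 2) * ε with hs0
    have hbol := bol (hKc (t+ε) (by linarith)) hw1 hh hk0 (s0 := s0) (by
      intro x hx
      have hx1 := hfr _ (by linarith) x hx
      have hx2 : x ∈ K (t - ε) := hKm _ _ (by linarith) ((hKc (t+ε) (by linarith)).isClosed.frontier_subset hx)
      have hx3 := (le_abs_self _).trans (hha x hx2)
      rw [hx1] at hx3
      rw [hs0]; linarith) (by
      intro x hx
      have h1 := hL1 x (hKO _ _ hx)
      have h2 := hkf x (hKO _ _ hx)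
      rw [h1]; linarith)
    rw [← hA] at hbol
    have s1 : K (t - ε) ∩ {x | t + ε ≤ v x} = K (t+ε) := by
      ext x; constructor
      · intro hx; exact hKi _ _ (hKO _ _ hx.1) hx.2
      · intro hx; exact ⟨hKm _ _ (by linarith) hx, hKv _ _ hx⟩
    rw [s1] at hlay
    set m := ∫ x in K (t+ε), g x with hm
    have l1 : ∫ x in K (t - ε) ∩ {x | t < v x}, (f2 x - f1 x) ≤ B t - A t := by
      have : (∫ x in K t, (f2 x - f1 x)) = B t - A t := by
        rw [hA, hB]
        exact integral_sub (hf2c.continuousOn.integrableOn_compact hcK) (hf1c.continuousOn.integrableOn_compact hcK)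
      rw [← this]
      refine setIntegral_mono_set (((hf2c.sub hf1c).continuousOn.integrableOn_compact hcK)) ?_ ?_
      · refine (ae_restrict_iff' hcK.measurableSet).2 (Eventually.of_forall fun x hx => ?_)
        have := hvp _ ht0 x hx
        rw [hLv x (hKO _ _ hx)] at this
        exact this.le
      · refine Eventually.of_forall fun x hx => ?_
        exact hKi _ _ (hKO _ _ hx.1) (le_of_lt hx.2)
    have l2 : ∫ x in K (t - ε) ∩ {x | t < v x ∧ v x < t + ε}, g x ≤ Real.exp (2 * s0) * (A t - A (t+ε)) := by
      have l3 : ∫ x in K (t - ε) ∩ {x | t < v x ∧ v x < t + ε}, g x ≤ ∫ x in K t \ K (t+ε), g x := by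
        refine sint_mono hcK hgc hg0 ?_ hD
        intro x hx
        have h5 : t < v x ∧ v x < t + ε := hx.2
        exact ⟨hKi _ _ (hKO _ _ hx.1) h5.1.le, fun hc => by have := hKv _ _ hc; linarith⟩
      refine l3.trans ?_
      rw [← d1]
      apply sint_le hcK hgc hf1c hDm hD
      intro x hx
      simp only [hg, hf1, ← Real.exp_add]
      apply Real.exp_le_exp.2
      have h6 := (abs_le.1 (hha x (hKm _ _ (by linarith) hx.1))).1
      have h7 := hDv x hx
      have h8 : C * (v x - (t - ε)) ≤ C * (2 * ε) := by gcongr; linarith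
      rw [hs0]; linarith
    have hR0 : 0 ≤ ∫ x in K (t - ε) ∩ {x | t < v x}, (f2 x - f1 x) := by
      refine setIntegral_nonneg ((hKc _ htm).measurableSet.inter (measurableSet_lt measurable_const hvc.measurable)) ?_
      intro x hx
      have := hvp _ htm x hx.1
      rw [hLv x (hKO _ _ hx.1)] at this
      exact this.le
    have hAd : 0 ≤ A t - A (t+ε) := by rw [← d1]; exact sint_nonneg hf10 _
    have hBA : 0 ≤ B t - A t := hR0.trans l1
    have e1 : Real.exp (2 * s0) * Real.exp (2 * s0) ≤ 1 + 2 * C2 * ε := by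
      rw [← Real.exp_add]
      have e : 2 * s0 + 2 * s0 = C2 * ε := by rw [hs0, hC2]; ring
      rw [e]
      have h0 : 0 ≤ C2 * ε := by positivity
      have := exp_sub_one_le h0 hεC
      nlinarith
    calc ε * (A (t+ε) * (4 * π - k * A (t+ε))) = ε * (4 * π * A (t+ε) - k * A (t+ε) ^ 2) := by ring
      _ ≤ ε * (4 * π * Real.exp (2 * s0) * m) := by gcongr
      _ = Real.exp (2 * s0) * (4 * π * ε * m) := by ring
      _ ≤ Real.exp (2 * s0) * ((B t - A t) * (Real.exp (2 * s0) * (A t - A (t+ε)))) := by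
        refine mul_le_mul_of_nonneg_left (hlay.trans ?_) (Real.exp_pos _).le
        exact mul_le_mul l1 l2 (sint_nonneg hg0 _) hBA
      _ = Real.exp (2 * s0) * Real.exp (2 * s0) * ((B t - A t) * (A t - A (t+ε))) := by ring
      _ ≤ _ := by gcongr

/-- Sphere covering on a leaf. -/
theorem leaf_mass {O : Set ℂ} (hO : IsOpen O) (hOne : O.Nonempty) 
    {w1 w2 f : ℂ → ℝ} (hw1 : ContDiff ℝ 2 w1) (hw2 : ContDiff ℝ 2 w2) {k : ℝ}
    (hk0 : 0 ≤ k) (hk1 : k < 1) (hpos : ∀ x ∈ O, 0 < w2 x - w1 x) (hOb : Bornology.IsBounded O)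
    (hKc : ∀ t > 0, IsCompact (O ∩ {x | t ≤ w2 x - w1 x}))
    (hfr : ∀ t > 0, ∀ x ∈ frontier (O ∩ {x | t ≤ w2 x - w1 x}), w2 x - w1 x = t)
    (hL1 : ∀ x ∈ O, Lp w1 x = f x - Real.exp (2 * w1 x)) (hL2 : ∀ x ∈ O, Lp w2 x = f x - Real.exp (2 * w2 x))
    (hkf : ∀ x ∈ O, (1 - k) * Real.exp (2 * w1 x) ≤ f x)
    (happ : ∀ t > 0, ∀ g : ℂ → ℝ, ContDiff ℝ 2 g → 
      (∀ z ∈ O ∩ {x | t ≤ w2 x - w1 x}, 0 < g z ∧ |Lp w1 z| < - Lp g z) → 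
      ∃ h : ℂ → ℂ, Differentiable ℂ h ∧ ∀ z ∈ O ∩ {x | t ≤ w2 x - w1 x}, |w1 z - (h z).re| ≤ g z) :
    ∃ t > 0, 4 * π < (∫ x in O ∩ {x | t ≤ w2 x - w1 x}, Real.exp (2 * w1 x)) + 
      ∫ x in O ∩ {x | t ≤ w2 x - w1 x}, Real.exp (2 * w2 x) := by
  by_contra! hcon
  obtain ⟨A, hA⟩ : ∃ A : ℝ → ℝ, ∀ t, A t = ∫ x in O ∩ {x | t ≤ w2 x - w1 x}, Real.exp (2 * w1 x) := ⟨_, fun _ => rfl⟩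
  obtain ⟨B, hB⟩ : ∃ B : ℝ → ℝ, ∀ t, B t = ∫ x in O ∩ {x | t ≤ w2 x - w1 x}, Real.exp (2 * w2 x) := ⟨_, fun _ => rfl⟩
  obtain ⟨Q, hQ⟩ : ∃ Q : ℝ → ℝ, ∀ t, Q t = Real.exp (2 * t) * (A t * (4 * π - A t)) - B t * (4 * π - B t) := ⟨_, fun _ => rfl⟩
  have htele := fun {α β : ℝ} (hα : 0 < α) (hαβ : α < β) => 
    leaf_tele hw1 hw2 hk0 hk1 hKc hfr hL1 hL2 hkf happ hA hB hQ hα hαβ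
  simp only [← hA, ← hB] at hcon
  have hvc : Continuous (fun x => w2 x - w1 x) := hw2.continuous.sub hw1.continuous
  obtain ⟨z0, hz0⟩ := hOne
  set γ := (w2 z0 - w1 z0) / 2 with hγ
  have hγ0 : 0 < γ := by have := hpos z0 hz0; positivity
  have hw1c := hw1.continuous
  have hw2c := hw2.continuous
  have hAγ : 0 < A γ := by
    rw [hA]
    have hU : (O ∩ {x | γ < w2 x - w1 x}) ⊆ O ∩ {x | γ ≤ w2 x - w1 x} := fun x hx => ⟨hx.1, show γ ≤ w2 x - w1 x from le_of_lt hx.2⟩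
    have hUo : IsOpen (O ∩ {x | γ < w2 x - w1 x}) := hO.inter (isOpen_lt continuous_const hvc)
    have hUn : (O ∩ {x | γ < w2 x - w1 x}).Nonempty := ⟨z0, hz0, by
      show γ < w2 z0 - w1 z0
      have := hpos z0 hz0; linarith⟩
    rw [integral_pos_iff_support_of_nonneg (fun x => (Real.exp_pos _).le)]
    · have : Function.support (fun x => Real.exp (2 * w1 x)) = Set.univ := by
        ext x; simp [(Real.exp_pos _).ne']
      rw [this, Measure.restrict_apply_univ]
      exact (hUo.measure_pos volume hUn).trans_le (measure_mono hU)
    · have : Continuous fun x => Real.exp (2 * w1 x) := by fun_prop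
      exact this.continuousOn.integrableOn_compact (hKc γ hγ0)
  obtain ⟨T, hT⟩ : ∃ T, ∀ x ∈ O, w2 x - w1 x < T := by
    have hcb : IsCompact (closure O) := hOb.isCompact_closure
    obtain ⟨T, hT⟩ := hcb.bddAbove_image hvc.continuousOn
    exact ⟨T + 1, fun x hx => by have := hT ⟨x, subset_closure hx, rfl⟩; linarith⟩
  have hTγ : γ < T := by have := hT z0 hz0; have := hpos z0 hz0; linarith
  have hKT : O ∩ {x | T ≤ w2 x - w1 x} = ∅ := by
    ext x; constructor
    · intro hx; exact absurd (hT x hx.1) (not_lt.2 hx.2)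
    · intro hx; exact hx.elim
  have hAT : A T = 0 := by rw [hA, hKT]; simp
  have hBT : B T = 0 := by rw [hB, hKT]; simp
  have hQγ : 0 ≤ Q γ := by
    have := htele hγ0 hTγ
    rw [hQ T, hAT, hBT] at this
    simpa using this
  have hpi := Real.pi_pos
  have hc0 : 0 < (1 - k) * A γ ^ 2 * γ := by
    have : 0 < 1 - k := by linarith
    positivity
  have main : ∀ α, 0 < α → α ≤ γ / 2 → (1 - k) * A γ ^ 2 * γ ≤ (Real.exp (2 * α) - 1) * (4 * π ^ 2) := by
    intro α hα hαγ
    have h1 := htele hα (by linarith : α < γ)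
    have h2 := hcon α hα
    have hA0 : 0 ≤ A α := by rw [hA]; exact sint_nonneg (fun x => (Real.exp_pos _).le) _
    have hBA : A α ≤ B α := by
      rw [hA, hB]
      have := sint_ge (K := O ∩ {x | α ≤ w2 x - w1 x}) (f := fun x => Real.exp (2 * w2 x)) (g := fun x => Real.exp (2 * w1 x))
        (hKc α hα) (by fun_prop) (by fun_prop) 
        (hKc α hα).measurableSet subset_rfl 1 (by
          intro x hx
          rw [one_mul]
          have := hpos x hx.1
          exact Real.exp_le_exp.2 (by linarith))
      simpa using this
    have h3 : (1 - k) * A γ ^ 2 * γ ≤ 2 * (1 - k) * A γ ^ 2 * (γ - α) := by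
      have : 0 ≤ (1 - k) * A γ ^ 2 := by have : 0 < 1 - k := by linarith
                                         positivity
      nlinarith
    have h4 : (1 - k) * A γ ^ 2 * γ ≤ Q α := by linarith
    rw [hQ] at h4
    have h5 : (B α - A α) * (A α + B α - 4 * π) ≤ 0 := mul_nonpos_of_nonneg_of_nonpos (by linarith) (by linarith)
    have h6 : A α * (4 * π - A α) ≤ 4 * π ^ 2 := by nlinarith [sq_nonneg (A α - 2 * π)]
    have h7 : 1 ≤ Real.exp (2 * α) := Real.one_le_exp (by linarith)
    have h8 : (Real.exp (2 * α) - 1) * (A α * (4 * π - A α)) ≤ (Real.exp (2 * α) - 1) * (4 * π ^ 2) := by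
      gcongr
    nlinarith
  have ht : Tendsto (fun α : ℝ => (Real.exp (2 * α) - 1) * (4 * π ^ 2)) (𝓝[>] 0) (𝓝 0) := by
    have : Continuous (fun α : ℝ => (Real.exp (2 * α) - 1) * (4 * π ^ 2)) := by fun_prop
    have := (this.tendsto 0).mono_left (nhdsWithin_le_nhds (s := Set.Ioi 0))
    simpa using this
  have := ge_of_tendsto ht (b := (1 - k) * A γ ^ 2 * γ) (by
    filter_upwards [Ioc_mem_nhdsGT (by linarith : (0:ℝ) < γ / 2)] with α hα
    exact main α hα.1 hα.2)
  linarith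

end MF

namespace MF
open Complex (I)
open Filter Topology

theorem hasFDerivAt_normSq (x : ℂ) : HasFDerivAt (fun z : ℂ => Complex.normSq z) 
    ((2 * x.re) • Complex.reCLM + (2 * x.im) • Complex.imCLM) x := by
  have h1 := (Complex.reCLM.hasFDerivAt (x := x)).mul (Complex.reCLM.hasFDerivAt (x := x))
  have h2 := (Complex.imCLM.hasFDerivAt (x := x)).mul (Complex.imCLM.hasFDerivAt (x := x))
  refine (h1.add h2).congr_fderiv ?_
  ext <;> simp <;> ring

theorem fderiv_radial {k k1 : ℝ → ℝ} (hk : ∀ t, 0 ≤ t → HasDerivAt k (k1 t) t) (x v : ℂ) :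
    fderiv ℝ (fun z : ℂ => k (Complex.normSq z)) x v = 
      k1 (Complex.normSq x) * (2 * x.re * v.re + 2 * x.im * v.im) := by
  have h := ((hk _ (Complex.normSq_nonneg x)).comp_hasFDerivAt x (hasFDerivAt_normSq x)).fderiv
  change fderiv ℝ (fun z : ℂ => k (Complex.normSq z)) x = _ at h
  rw [h]
  simp; ring

theorem Lp_radial {k k1 k2 : ℝ → ℝ} (hk : ∀ t, 0 ≤ t → HasDerivAt k (k1 t) t) 
    (hk1 : ∀ t, 0 ≤ t → HasDerivAt k1 (k2 t) t) (x : ℂ) :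
    Lp (fun z : ℂ => k (Complex.normSq z)) x = 
      4 * (Complex.normSq x * k2 (Complex.normSq x) + k1 (Complex.normSq x)) := by
  unfold Lp
  simp_rw [fderiv_radial hk]
  have h1 := (hk1 _ (Complex.normSq_nonneg x)).comp_hasFDerivAt x (hasFDerivAt_normSq x)
  have a : ∀ v : ℂ, HasFDerivAt (fun z : ℂ => 2 * z.re * v.re + 2 * z.im * v.im) 
      ((2 * v.re) • Complex.reCLM + (2 * v.im) • Complex.imCLM) x := by
    intro v
    have := ((Complex.reCLM.hasFDerivAt (x := x)).const_mul (2 * v.re)).add ((Complex.imCLM.hasFDerivAt (x := x)).const_mul (2 * v.im))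
    refine this.congr_of_eventuallyEq (Eventually.of_forall fun z => ?_)
    simp; ring
  have b := fun v => (h1.fun_mul (a v)).fderiv
  simp only [Function.comp_apply] at b
  rw [b 1, b I]
  simp [Complex.normSq_apply]
  ring

theorem contDiff_two_real {k k1 k2 : ℝ → ℝ} (hk : ∀ t, HasDerivAt k (k1 t) t) (hk1 : ∀ t, HasDerivAt k1 (k2 t) t)
    (hk2 : Continuous k2) : ContDiff ℝ 2 k := by
  have e1 : deriv k = k1 := funext fun t => (hk t).deriv
  have e2 : deriv k1 = k2 := funext fun t => (hk1 t).deriv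
  have : ContDiff ℝ (1 + 1) k := by
    rw [contDiff_succ_iff_deriv]
    refine ⟨fun t => (hk t).differentiableAt, by simp, ?_⟩
    rw [e1, contDiff_one_iff_deriv, e2]
    exact ⟨fun t => (hk1 t).differentiableAt, hk2⟩
  exact this.of_le (by norm_num)

theorem contDiff_normSq {n} : ContDiff ℝ n (fun z : ℂ => Complex.normSq z) := by
  have : (fun z : ℂ => Complex.normSq z) = fun z : ℂ => Complex.reCLM z * Complex.reCLM z + Complex.imCLM z * Complex.imCLM z := by
    funext z; simp [Complex.normSq_apply]
  rw [this]
  exact (Complex.reCLM.contDiff.mul Complex.reCLM.contDiff).add (Complex.imCLM.contDiff.mul Complex.imCLM.contDiff)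

theorem exists_k : ∃ k k1 k2 : ℝ → ℝ, (∀ t, HasDerivAt k (k1 t) t) ∧ (∀ t, HasDerivAt k1 (k2 t) t) ∧ Continuous k2 ∧
   (∀ t ≥ 1, k t = 1/2 * Real.log t) ∧ (∀ t, 0 ≤ t * k2 t + k1 t) ∧ (∀ t ≥ 1, t * k2 t + k1 t = 0) ∧ 
    (∃ t > 0, 0 < t * k2 t + k1 t) := by
  obtain ⟨S, S', hSc, hSd, h1, -, h3, h4, h5, h6, h7, -⟩ := exists_cutoff one_pos
  set b : ℝ → ℝ := fun t => 1/2 * S (2 * t - 1) with hb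
  set b' : ℝ → ℝ := fun t => S' (2 * t - 1) with hb'
  have hbd : ∀ t, HasDerivAt b (b' t) t := by
    intro t
    have h := (((hSd (2 * t - 1)).comp t (((hasDerivAt_id t).const_mul 2).sub_const 1)).const_mul (1/2))
    refine h.congr_deriv ?_
    simp [hb']; ring
  have hb'c : Continuous b' := by fun_prop
  set k1 : ℝ → ℝ := fun t => b t / t with hk1
  set k2 : ℝ → ℝ := fun t => (b' t * t - b t) / t ^ 2 with hk2
  have hz : ∀ t ≤ 1/2, b t = 0 := fun t ht => by simp [hb, h3 (2 * t - 1) (by linarith)]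
  have hz' : ∀ t ≤ 1/2, b' t = 0 := fun t ht => by simp [hb', h4 (2 * t - 1) (by linarith)]
  have hk1d : ∀ t, HasDerivAt k1 (k2 t) t := by
    intro t
    rcases lt_or_ge t (1/2) with h | h
    · have e : k2 t = 0 := by simp [hk2, hz t h.le, hz' t h.le]
      rw [e]
      refine (hasDerivAt_const t (0:ℝ)).congr_of_eventuallyEq ?_
      filter_upwards [gt_mem_nhds h] with y hy
      simp [hk1, hz y hy.le]
    · have ht : t ≠ 0 := by linarith
      have := (hbd t).div (hasDerivAt_id t) ht
      refine this.congr_deriv ?_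
      simp [hk2]
  have hk2c : Continuous k2 := by
    rw [continuous_iff_continuousAt]
    intro t
    rcases lt_or_ge t (1/2) with h | h
    · have : ContinuousAt (fun _ : ℝ => (0:ℝ)) t := continuousAt_const
      refine this.congr ?_
      filter_upwards [gt_mem_nhds h] with y hy
      simp [hk2, hz y hy.le, hz' y hy.le]
    · have ht : t ≠ 0 := by linarith
      have hbc : Continuous b := continuous_iff_continuousAt.2 fun t => (hbd t).continuousAt
      exact ((hb'c.mul continuous_id).sub hbc).continuousAt.div (continuous_pow 2).continuousAt (by positivity)
  have hk1c : Continuous k1 := continuous_iff_continuousAt.2 fun t => (hk1d t).continuousAt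
  have hkey : ∀ t, t * k2 t + k1 t = b' t := by
    intro t
    rcases eq_or_ne t 0 with h | h
    · subst h; simp [hk1, hz' 0 (by norm_num)]
    · simp only [hk1, hk2]; field_simp; ring
  refine ⟨fun t => ∫ s in (1:ℝ)..t, k1 s, k1, k2, fun t => hk1c.integral_hasStrictDerivAt 1 t |>.hasDerivAt, hk1d, hk2c, ?_, ?_, ?_, ?_⟩
  · intro t ht
    have : ∫ s in (1:ℝ)..t, k1 s = ∫ s in (1:ℝ)..t, 1/2 * s⁻¹ := by
      apply intervalIntegral.integral_congr
      intro s hs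
      rw [Set.uIcc_of_le ht] at hs
      simp [hk1, hb, h5 (2 * s - 1) (by linarith [hs.1]), div_eq_mul_inv]
    show ∫ s in (1:ℝ)..t, k1 s = _
    rw [this, intervalIntegral.integral_const_mul, integral_inv_of_pos one_pos (by linarith)]
    simp
  · intro t; rw [hkey]; exact h1 _
  · intro t ht; rw [hkey]; exact h6 _ (by linarith)
  · obtain ⟨c, hc, he⟩ := exists_hasDerivAt_eq_slope S S' (zero_lt_one (α := ℝ)) 
      (continuous_iff_continuousAt.2 fun t => (hSd t).continuousAt).continuousOn (fun x _ => hSd x)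
    refine ⟨(c + 1) / 2, by linarith [hc.1], ?_⟩
    rw [hkey]
    simp only [hb']
    rw [show 2 * ((c+1)/2) - 1 = c by ring, he, h3 0 le_rfl, h5 1 le_rfl]
    norm_num

theorem exists_J {ρ : ℝ} (hρ : 0 < ρ) : ∃ J : ℂ → ℝ, ContDiff ℝ 2 J ∧ (∀ x, ρ ≤ ‖x‖ → J x = Real.log ‖x‖ - Real.log ρ) ∧
    (∀ x, 0 ≤ Lp J x) ∧ (∀ x, ρ ≤ ‖x‖ → Lp J x = 0) ∧ ∃ x, 0 < Lp J x := by
  obtain ⟨k, k1, k2, hk, hk1, hk2, ha, hb, hc, t0, ht0, hd⟩ := exists_k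
  set κ : ℝ → ℝ := fun t => k (t / ρ^2) with hκ
  have hρ2 : 0 < ρ^2 := by positivity
  have d1 : ∀ t, HasDerivAt κ (k1 (t / ρ^2) / ρ^2) t := by
    intro t
    refine ((hk (t/ρ^2)).comp t ((hasDerivAt_id t).div_const (ρ^2))).congr_deriv ?_
    simp [div_eq_mul_inv]
  have d2 : ∀ t, HasDerivAt (fun t => k1 (t / ρ^2) / ρ^2) (k2 (t / ρ^2) / ρ^2 / ρ^2) t := by
    intro t
    refine (((hk1 (t/ρ^2)).comp t ((hasDerivAt_id t).div_const (ρ^2))).div_const (ρ^2)).congr_deriv ?_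
    simp [div_eq_mul_inv]
  have hL : ∀ x, Lp (fun z => κ (Complex.normSq z)) x = 
     4 / ρ^2 * (Complex.normSq x / ρ^2 * k2 (Complex.normSq x / ρ^2) + k1 (Complex.normSq x / ρ^2)) := by
    intro x
    rw [Lp_radial (fun t _ => d1 t) (fun t _ => d2 t)]
    field_simp
  have hge : ∀ x : ℂ, ρ ≤ ‖x‖ → 1 ≤ Complex.normSq x / ρ^2 := by
    intro x hx
    rw [le_div_iff₀ hρ2, Complex.normSq_eq_norm_sq, one_mul]
    gcongr
  refine ⟨fun z => κ (Complex.normSq z), (contDiff_two_real d1 d2 (by fun_prop)).comp contDiff_normSq, ?_, ?_, ?_, ?_⟩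
  · intro x hx
    simp only [hκ]
    rw [ha _ (hge x hx), Complex.normSq_eq_norm_sq, ← div_pow, Real.log_pow, Real.log_div (by linarith) hρ.ne']
    push_cast; ring
  · intro x; rw [hL]; exact mul_nonneg (by positivity) (hb _)
  · intro x hx; rw [hL, hc _ (hge x hx), mul_zero]
  · refine ⟨((ρ * √t0 : ℝ) : ℂ), ?_⟩
    rw [hL]
    have : Complex.normSq ((ρ * √t0 : ℝ) : ℂ) / ρ^2 = t0 := by
      rw [Complex.normSq_ofReal]
      have := Real.mul_self_sqrt ht0.le
      field_simp
      nlinarith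
    rw [this]; positivity

end MF

namespace MF
open Complex (I)
open Filter Topology

theorem green' {ψ φ : ℂ → ℝ} (hψ : ContDiff ℝ 1 ψ) (hφ : ContDiff ℝ 2 φ) (hc : HasCompactSupport φ) :
    ∫ x, gr ψ φ x = - ∫ x, ψ x * Lp φ x := by
  have hcv : ∀ v, HasCompactSupport (fun x => fderiv ℝ φ x v) := fun v => hc.fderiv_apply (𝕜 := ℝ) v
  have key : ∀ v, ∫ x, (fderiv ℝ ψ x v * fderiv ℝ φ x v + ψ x * fderiv ℝ (fun y => fderiv ℝ φ y v) x v) = 0 := by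
    intro v
    rw [← integral_fderiv_zero' (f := fun x => ψ x * fderiv ℝ φ x v) (hψ.mul (contDiff_fderiv_apply hφ v))
      (hcv v).mul_left v]
    congr 1; funext x
    rw [fderiv_fun_mul (hψ.differentiable (by norm_num) x)
      ((contDiff_fderiv_apply hφ v).differentiable (by norm_num) x)]
    simp; ring
  have hφ1 : ContDiff ℝ 1 φ := hφ.of_le (by norm_num)
  have i1 : ∀ v, Integrable (fun x => fderiv ℝ ψ x v * fderiv ℝ φ x v) := fun v =>
    ((continuous_fderiv_apply hψ v).mul (continuous_fderiv_apply hφ1 v)).integrable_of_hasCompactSupport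
      (hcv v).mul_left
  have i2 : ∀ v, Integrable (fun x => ψ x * fderiv ℝ (fun y => fderiv ℝ φ y v) x v) := fun v =>
    (hψ.continuous.mul (continuous_fderiv_apply (contDiff_fderiv_apply hφ v) v)).integrable_of_hasCompactSupport
      ((hcv v).fderiv_apply (𝕜 := ℝ) v).mul_left
  have k1 := key 1
  have k2 := key I
  rw [integral_add (i1 _) (i2 _)] at k1 k2
  unfold gr Lp
  rw [integral_add (i1 _) (i1 _)]
  simp_rw [mul_add]
  rw [integral_add (i2 _) (i2 _)]
  linarith

theorem gr_comm (f g : ℂ → ℝ) (x : ℂ) : gr f g x = gr g f x := by unfold gr; ring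

/-- second Green identity -/
theorem green2 {ψ φ : ℂ → ℝ} (hψ : ContDiff ℝ 2 ψ) (hc : HasCompactSupport ψ) (hφ : ContDiff ℝ 2 φ) :
    ∫ x, φ x * Lp ψ x = ∫ x, ψ x * Lp φ x := by
  have h1 := green (hψ.of_le (by norm_num)) hc hφ
  have h2 := green' (hφ.of_le (by norm_num)) hψ hc
  simp_rw [gr_comm φ ψ] at h2
  linarith

variable {E : Type*} [NormedAddCommGroup E] 

/-- translates of a function restricted to K -/
def tr (K : Set ℂ) (f : ℂ → E) (hf : Continuous f) (x : ℂ) : C(K, E) :=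
  ⟨fun z => f (x - z), by fun_prop⟩

theorem tr_continuous (K : Set ℂ) {f : ℂ → E} (hf : Continuous f) : Continuous (tr K f hf) := by
  let G : C(ℂ × K, E) := ⟨fun p => f (p.1 - p.2), by fun_prop⟩
  exact G.curry.continuous

theorem tr_bound {K : Set ℂ} [CompactSpace K] {f : ℂ → ℝ} (hf : ContDiff ℝ 1 f) (x : ℂ) {ε : ℝ} (hε : 0 < ε) :
    ∃ δ > 0, ∀ x', dist x' x < δ → ∀ z : K, 
      |f (x' - z) - f (x - z) - fderiv ℝ f (x - z) (x' - x)| ≤ ε * ‖x' - x‖ := by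
  have hc := tr_continuous K (hf.continuous_fderiv (by norm_num))
  obtain ⟨δ, hδ, h⟩ := Metric.continuous_iff.1 hc x ε hε
  refine ⟨δ, hδ, fun x' hx' z => ?_⟩
  have hb : ∀ y ∈ Metric.ball (x - z : ℂ) δ, ‖fderiv ℝ f y - fderiv ℝ f (x - z)‖ ≤ ε := by
    intro y hy
    have h1 := h (y + z) (by rw [Metric.mem_ball] at hy; rw [dist_eq_norm] at hy ⊢; convert hy using 2; ring)
    have h2 := (ContinuousMap.dist_apply_le_dist (f := tr K (fderiv ℝ f) (hf.continuous_fderiv (by norm_num)) (y+z)) (g := tr K (fderiv ℝ f) (hf.continuous_fderiv (by norm_num)) x) z)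
    rw [dist_eq_norm] at h2
    simp only [tr, ContinuousMap.coe_mk, add_sub_cancel_right] at h2
    exact h2.trans h1.le
  have := (convex_ball (x - z : ℂ) δ).norm_image_sub_le_of_norm_fderiv_le' (𝕜 := ℝ) (f := f) (φ := fderiv ℝ f (x - z)) (C := ε)
    (fun y _ => hf.differentiable (by norm_num) y) hb (Metric.mem_ball_self hδ) 
    (y := x' - z) (by rw [Metric.mem_ball, dist_eq_norm]; rw [dist_eq_norm] at hx'; convert hx' using 2; ring)
  rw [Real.norm_eq_abs] at this
  have e : (x' - z : ℂ) - (x - z) = x' - x := by ring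
  rw [e] at this
  exact this

theorem tr_hasFDeriv {K : Set ℂ} [CompactSpace K] {f : ℂ → ℝ} (hf : ContDiff ℝ 1 f) (L : C(K, ℝ) →L[ℝ] ℝ) (x : ℂ) :
    HasFDerivAt (fun x => L (tr K f hf.continuous x)) 
     ((L (tr K (fun y => fderiv ℝ f y 1) (continuous_fderiv_apply hf 1) x)) • Complex.reCLM + 
      (L (tr K (fun y => fderiv ℝ f y I) (continuous_fderiv_apply hf I) x)) • Complex.imCLM) x := by
  rw [hasFDerivAt_iff_isLittleO, Asymptotics.isLittleO_iff]
  intro c hc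
  obtain ⟨δ, hδ, h⟩ := tr_bound (K := K) hf x (ε := c / (‖L‖ + 1)) (by positivity)
  filter_upwards [Metric.ball_mem_nhds x hδ] with x' hx'
  set R : C(K, ℝ) := tr K f hf.continuous x' - tr K f hf.continuous x - 
    ((x' - x).re • tr K (fun y => fderiv ℝ f y 1) (continuous_fderiv_apply hf 1) x + 
     (x' - x).im • tr K (fun y => fderiv ℝ f y I) (continuous_fderiv_apply hf I) x) with hR
  have e : L (tr K f hf.continuous x') - L (tr K f hf.continuous x) - 
     ((L (tr K (fun y => fderiv ℝ f y 1) (continuous_fderiv_apply hf 1) x)) • Complex.reCLM + 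
      (L (tr K (fun y => fderiv ℝ f y I) (continuous_fderiv_apply hf I) x)) • Complex.imCLM) (x' - x) = L R := by
    simp [hR]; ring
  rw [e]
  have hRn : ‖R‖ ≤ c / (‖L‖ + 1) * ‖x' - x‖ := by
    rw [ContinuousMap.norm_le _ (by positivity)]
    intro z
    have := h x' hx' z
    rw [Real.norm_eq_abs]
    convert this using 2
    rw [clm_real_form (fderiv ℝ f (x - z)) (x' - x)]
    simp [hR, tr]
  calc ‖L R‖ ≤ ‖L‖ * ‖R‖ := L.le_opNorm R
    _ ≤ (‖L‖ + 1) * (c / (‖L‖ + 1) * ‖x' - x‖) := by gcongr; linarith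
    _ = c * ‖x' - x‖ := by field_simp

theorem tr_contDiff1 {K : Set ℂ} [CompactSpace K] {f : ℂ → ℝ} (hf : ContDiff ℝ 1 f) (L : C(K, ℝ) →L[ℝ] ℝ) :
    ContDiff ℝ 1 (fun x => L (tr K f hf.continuous x)) := by
  rw [contDiff_one_iff_hasFDerivAt]
  refine ⟨_, ?_, tr_hasFDeriv hf L⟩
  have h1 := L.continuous.comp (tr_continuous K (continuous_fderiv_apply hf 1))
  have h2 := L.continuous.comp (tr_continuous K (continuous_fderiv_apply hf I))
  exact (h1.smul continuous_const).add (h2.smul continuous_const)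

theorem tr_fderiv {K : Set ℂ} [CompactSpace K] {f : ℂ → ℝ} (hf : ContDiff ℝ 1 f) (L : C(K, ℝ) →L[ℝ] ℝ) (x v : ℂ) :
    fderiv ℝ (fun x => L (tr K f hf.continuous x)) x v = 
      v.re * L (tr K (fun y => fderiv ℝ f y 1) (continuous_fderiv_apply hf 1) x) + 
      v.im * L (tr K (fun y => fderiv ℝ f y I) (continuous_fderiv_apply hf I) x) := by
  rw [(tr_hasFDeriv hf L x).fderiv]; simp; ring

theorem tr_contDiff2 {K : Set ℂ} [CompactSpace K] {f : ℂ → ℝ} (hf : ContDiff ℝ 2 f) (L : C(K, ℝ) →L[ℝ] ℝ) :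
    ContDiff ℝ 2 (fun x => L (tr K f hf.continuous x)) := by
  have hf1 : ContDiff ℝ 1 f := hf.of_le (by norm_num)
  have : ContDiff ℝ (1+1) (fun x => L (tr K f hf.continuous x)) := by
    refine (contDiff_succ_iff_hasFDerivAt (𝕜 := ℝ) (n := 1)).2 ?_
    refine ⟨_, ?_, tr_hasFDeriv hf1 L⟩
    have h1 := tr_contDiff1 (contDiff_fderiv_apply hf 1) L
    have h2 := tr_contDiff1 (contDiff_fderiv_apply hf I) L
    exact (h1.smul contDiff_const).add (h2.smul contDiff_const)
  exact this.of_le (by norm_num)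

theorem tr_Lp {K : Set ℂ} [CompactSpace K] {f : ℂ → ℝ} (hf : ContDiff ℝ 2 f) (L : C(K, ℝ) →L[ℝ] ℝ) (x : ℂ) :
    Lp (fun x => L (tr K f hf.continuous x)) x = L (tr K (Lp f) (continuous_Lp hf) x) := by
  have hf1 : ContDiff ℝ 1 f := hf.of_le (by norm_num)
  unfold Lp
  have e1 : (fun y => fderiv ℝ (fun x => L (tr K f hf.continuous x)) y 1) = 
    fun y => L (tr K (fun y => fderiv ℝ f y 1) (continuous_fderiv_apply hf1 1) y) := by
    funext y; rw [tr_fderiv hf1]; simp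
  have e2 : (fun y => fderiv ℝ (fun x => L (tr K f hf.continuous x)) y I) = 
    fun y => L (tr K (fun y => fderiv ℝ f y I) (continuous_fderiv_apply hf1 I) y) := by
    funext y; rw [tr_fderiv hf1]; simp
  rw [e1, e2, tr_fderiv (contDiff_fderiv_apply hf 1), tr_fderiv (contDiff_fderiv_apply hf I)]
  simp only [Complex.one_re, Complex.one_im, Complex.I_re, Complex.I_im, one_mul, zero_mul, add_zero, zero_add]
  rw [← map_add]
  rfl

/-- pairing of L with translates against a continuous function -/
theorem tr_integral {K : Set ℂ} [CompactSpace K] {χ : ℂ → ℝ} (hχ : Continuous χ) (hχc : HasCompactSupport χ) 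
    (L : C(K, ℝ) →L[ℝ] ℝ)
    {f : ℂ → ℝ} (hf : Continuous f) : ∃ c : C(K, ℝ), (∀ z : K, c z = ∫ x, f x * χ (x - z)) ∧ 
      ∫ x, f x * L (tr K χ hχ x) = L c := by
  have hcont : Continuous (fun x => f x • tr K χ hχ x) := hf.smul (tr_continuous K hχ)
  have hcs : HasCompactSupport (fun x => f x • tr K χ hχ x) := by
    have hKc : IsCompact (K : Set ℂ) := isCompact_iff_compactSpace.2 inferInstance
    refine HasCompactSupport.intro (hχc.isCompact.add hKc) fun x hx => ?_
    ext z
    show f x * χ (x - z) = 0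
    by_contra hne
    replace hne : χ (x - z) ≠ 0 := fun h => hne (by rw [h, mul_zero])
    exact hx ⟨x - z, subset_tsupport _ hne, z, z.2, by simp⟩
  have hi : Integrable (fun x => f x • tr K χ hχ x) := hcont.integrable_of_hasCompactSupport hcs
  refine ⟨∫ x, f x • tr K χ hχ x, fun z => ?_, ?_⟩
  · have := (ContinuousMap.evalCLM ℝ z).integral_comp_comm hi
    rw [ContinuousMap.evalCLM_apply] at this
    rw [← this]
    rfl
  · rw [← L.integral_comp_comm hi]
    simp

end MF

namespace MF
open Complex (I)
open Filter Topology

/-- `b` is uniformly approximable on `K` by exponentials of entire functions -/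
def Good (K : Set ℂ) (b : ℂ → ℂ) : Prop :=
  ∀ ε : ℝ, 0 < ε → ∃ h : ℂ → ℂ, Differentiable ℂ h ∧ ∀ z ∈ K, ‖b z * Complex.exp (-h z) - 1‖ < ε

theorem good_const {K : Set ℂ} {c : ℂ} (hc : c ≠ 0) : Good K (fun _ => c) := by
  intro ε hε
  refine ⟨fun _ => Complex.log c, differentiable_const _, fun z _ => ?_⟩
  rw [Complex.exp_neg, Complex.exp_log hc, mul_inv_cancel₀ hc]
  simpa using hε

theorem differentiable_logTaylor (n : ℕ) : Differentiable ℂ (Complex.logTaylor (n+1)) := 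
  fun z => (Complex.hasDerivAt_logTaylor n z).differentiableAt

theorem good_add {K : Set ℂ} {b y0 : ℂ → ℂ} (hb : Good K b) (hy0 : Differentiable ℂ y0) 
    (hle : ∀ z ∈ K, ‖y0 z‖ ≤ ‖b z‖ / 4) : Good K (fun z => b z + y0 z) := by
  intro ε hε
  obtain ⟨δ, hδ⟩ : ∃ δ : ℝ, δ = min (1/4) (ε / 16) := ⟨_, rfl⟩
  have hδ0 : 0 < δ := by rw [hδ]; positivity
  have hδ1 : δ ≤ 1/4 := by rw [hδ]; exact min_le_left _ _
  have hδ2 : δ ≤ ε/16 := by rw [hδ]; exact min_le_right _ _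
  obtain ⟨h0, hh0, H⟩ := hb δ hδ0
  obtain ⟨n, hn⟩ := exists_pow_lt_of_lt_one hδ0 (by norm_num : (1/2:ℝ) < 1)
  refine ⟨fun z => h0 z + Complex.logTaylor (n+1) (y0 z * Complex.exp (-h0 z)), 
    hh0.add ((differentiable_logTaylor n).comp (hy0.mul hh0.neg.cexp)), fun z hz => ?_⟩
  obtain ⟨A, hA⟩ : ∃ A, A = b z * Complex.exp (-h0 z) := ⟨_, rfl⟩
  obtain ⟨y, hy⟩ : ∃ y, y = y0 z * Complex.exp (-h0 z) := ⟨_, rfl⟩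
  have hA1 : ‖A - 1‖ < δ := by rw [hA]; exact H z hz
  have hAn : ‖A‖ ≤ 5/4 := by
    have := norm_sub_norm_le A 1
    rw [norm_one] at this; linarith
  have hyn : ‖y‖ ≤ 1/2 := by
    have : ‖y‖ ≤ ‖A‖/4 := by
      rw [hy, hA, norm_mul, norm_mul]
      have := mul_le_mul_of_nonneg_right (hle z hz) (norm_nonneg (Complex.exp (-h0 z)))
      linarith
    linarith
  obtain ⟨ℓ, hℓ⟩ : ∃ ℓ, ℓ = Complex.logTaylor (n+1) y := ⟨_, rfl⟩
  have hlog : ‖Complex.log (1 + y) - ℓ‖ ≤ δ := by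
    have h1 := Complex.norm_log_sub_logTaylor_le n (z := y) (by linarith)
    rw [← hℓ] at h1
    have h2 : (1 - ‖y‖)⁻¹ ≤ 2 := by
      rw [inv_le_comm₀ (by linarith) (by norm_num)]; linarith
    have h3 : ‖y‖^(n+1) ≤ (1/2)^(n+1) := by gcongr
    calc _ ≤ _ := h1
      _ ≤ ‖y‖^(n+1) * (1 - ‖y‖)⁻¹ := by
          apply div_le_self
          · have : 0 ≤ (1 - ‖y‖)⁻¹ := inv_nonneg.2 (by linarith)
            positivity
          · have : (0:ℝ) ≤ n := Nat.cast_nonneg n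
            linarith
      _ ≤ (1/2)^(n+1) * 2 := by
          have : 0 ≤ (1 - ‖y‖)⁻¹ := inv_nonneg.2 (by linarith)
          exact mul_le_mul h3 h2 this (by positivity)
      _ = (1/2)^n := by rw [pow_succ]; ring
      _ ≤ δ := hn.le
  have h1y : (1 + y) ≠ 0 := by
    intro h
    have : y = -1 := by linear_combination h
    rw [this] at hyn; norm_num at hyn
  have h1yn : 1/2 ≤ ‖1 + y‖ := by
    have := norm_sub_norm_le (1:ℂ) (-y)
    rw [norm_one, norm_neg, sub_neg_eq_add] at this; linarith
  obtain ⟨E, hE⟩ : ∃ E, E = Complex.exp (Complex.log (1+y) - ℓ) := ⟨_, rfl⟩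
  have hE1 : ‖E - 1‖ ≤ 2 * δ := by
    rw [hE]
    refine (Complex.norm_exp_sub_one_le (by linarith)).trans ?_
    linarith
  have hEe : Complex.exp (-ℓ) = E / (1 + y) := by
    rw [hE, Complex.exp_sub, Complex.exp_log h1y, Complex.exp_neg]
    field_simp
  have hEn : ‖E‖ ≤ 3/2 := by
    have := norm_sub_norm_le E 1
    rw [norm_one] at this; linarith
  have key : (b z + y0 z) * Complex.exp (-(h0 z + Complex.logTaylor (n+1) (y0 z * Complex.exp (-h0 z)))) - 1 
      = (A - 1) * (E / (1+y)) + (E - 1) := by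
    rw [← hy, ← hℓ, neg_add, Complex.exp_add, hEe]
    have : (b z + y0 z) * (Complex.exp (-h0 z) * (E / (1 + y))) = (A + y) * (E / (1+y)) := by rw [hA, hy]; ring
    rw [this]
    field_simp
    ring
  show ‖(b z + y0 z) * Complex.exp (-(h0 z + Complex.logTaylor (n+1) (y0 z * Complex.exp (-h0 z)))) - 1‖ < ε
  rw [key]
  have h5 : ‖E / (1+y)‖ ≤ 3 := by
    rw [norm_div, div_le_iff₀ (by linarith)]; linarith
  calc _ ≤ ‖(A - 1) * (E / (1+y))‖ + ‖E - 1‖ := norm_add_le _ _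
    _ ≤ δ * 3 + 2 * δ := by
        rw [norm_mul]
        gcongr
    _ < ε := by linarith

theorem good_sub {K : Set ℂ} (hK : IsCompact K) 
    (hfill : ∀ V, IsOpen V → Bornology.IsBounded V → Disjoint V K → frontier V ⊆ K → V = ∅)
    {x : ℂ} (hx : x ∉ K) : Good K (fun z => x - z) := by
  obtain ⟨R, hR⟩ := hK.isBounded.exists_norm_le
  have hfar : ∀ x : ℂ, 4 * |R| + 1 ≤ ‖x‖ → Good K (fun z => x - z) := by
    intro x hx
    have hx0 : x ≠ 0 := by
      intro h; rw [h, norm_zero] at hx; have := abs_nonneg R; linarith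
    have := good_add (K := K) (good_const hx0) (y0 := fun z => -z) differentiable_id.neg 
      (fun z hz => by rw [norm_neg]; have := hR z hz; have := le_abs_self R; linarith)
    simpa [sub_eq_add_neg] using this
  -- stability
  have hnear : ∀ x x0 : ℂ, (∀ z ∈ K, ‖x - x0‖ ≤ ‖x0 - z‖ / 4) → Good K (fun z => x0 - z) → Good K (fun z => x - z) := by
    intro x x0 h hg
    have := good_add hg (y0 := fun z => x - x0) (differentiable_const _) h
    convert this using 2
    ring
  have hdist : ∀ x0 ∉ K, ∃ d : ℝ, 0 < d ∧ ∀ z ∈ K, d ≤ ‖x0 - z‖ := by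
    intro x0 h0
    have := hK.isClosed.isOpen_compl.mem_nhds h0
    obtain ⟨d, hd, hb⟩ := Metric.mem_nhds_iff.1 this
    refine ⟨d, hd, fun z hz => ?_⟩
    by_contra hlt
    push Not at hlt
    have : z ∈ Metric.ball x0 d := by rw [Metric.mem_ball, dist_comm, dist_eq_norm]; exact hlt
    exact hb this hz
  obtain ⟨V, hV⟩ : ∃ V : Set ℂ, V = {x | x ∉ K ∧ ¬ Good K (fun z => x - z)} := ⟨_, rfl⟩
  have hmem : ∀ x, x ∈ V ↔ x ∉ K ∧ ¬ Good K (fun z => x - z) := fun x => by rw [hV]; rfl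
  have hloc : ∀ x0 ∉ K, ∀ᶠ x in 𝓝 x0, x ∉ K ∧ (Good K (fun z => x - z) ↔ Good K (fun z => x0 - z)) := by
    intro x0 h0
    obtain ⟨d, hd, hdz⟩ := hdist x0 h0
    filter_upwards [Metric.ball_mem_nhds x0 (by positivity : 0 < d/8), hK.isClosed.isOpen_compl.mem_nhds h0] with x hx hxK
    rw [Metric.mem_ball, dist_eq_norm] at hx
    refine ⟨hxK, ?_, ?_⟩
    · refine hnear x0 x fun z hz => ?_
      have h1 := hdz z hz
      have h2 : ‖x0 - z‖ ≤ ‖x0 - x‖ + ‖x - z‖ := norm_sub_le_norm_sub_add_norm_sub _ _ _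
      rw [norm_sub_rev x0 x] at h2 ⊢
      linarith
    · refine hnear x x0 fun z hz => ?_
      have h1 := hdz z hz
      linarith
  have hempty : V = ∅ := by
    apply hfill
    · rw [isOpen_iff_mem_nhds]
      intro x0 h0
      rw [hmem] at h0
      filter_upwards [hloc x0 h0.1] with x hx
      rw [hmem]
      exact ⟨hx.1, fun h => h0.2 (hx.2.1 h)⟩
    · refine (Metric.isBounded_ball (x := (0:ℂ)) (r := 4 * |R| + 1)).subset fun x hx => ?_
      rw [hmem] at hx
      rw [mem_ball_zero_iff]
      by_contra h
      push Not at h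
      exact hx.2 (hfar x h)
    · rw [Set.disjoint_left]
      intro x hx
      rw [hmem] at hx
      exact hx.1
    · intro x0 hx0
      by_contra h0
      rw [frontier_eq_closure_inter_closure] at hx0
      have h1 := mem_closure_iff_frequently.1 hx0.1
      have h2 := mem_closure_iff_frequently.1 hx0.2
      have hl := hloc x0 h0
      obtain ⟨x1, hx1, hy1⟩ := (h1.and_eventually hl).exists
      obtain ⟨x2, hx2, hy2⟩ := (h2.and_eventually hl).exists
      rw [hmem] at hx1
      rw [Set.mem_compl_iff, hmem] at hx2
      exact hx2 ⟨hy2.1, fun h => hx1.2 (hy1.2.2 (hy2.2.1 h))⟩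
  by_contra hg
  have : x ∈ V := (hmem x).2 ⟨hx, hg⟩
  rw [hempty] at this
  exact this

theorem log_approx {K : Set ℂ} (hK : IsCompact K) 
    (hfill : ∀ V, IsOpen V → Bornology.IsBounded V → Disjoint V K → frontier V ⊆ K → V = ∅)
    {x : ℂ} (hx : x ∉ K) {ε : ℝ} (hε : 0 < ε) : 
    ∃ h : ℂ → ℂ, Differentiable ℂ h ∧ ∀ z ∈ K, |log ‖x - z‖ - (h z).re| ≤ ε := by
  obtain ⟨h, hh, H⟩ := good_sub hK hfill hx (min (1/2) (ε/2)) (by positivity)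
  refine ⟨h, hh, fun z hz => ?_⟩
  have h1 := H z hz
  have hxz : x - z ≠ 0 := fun h => hx (by rw [sub_eq_zero.1 h]; exact hz)
  obtain ⟨t, ht⟩ : ∃ t, t = ‖(x - z) * Complex.exp (-h z)‖ := ⟨_, rfl⟩
  have e : log ‖x - z‖ - (h z).re = log t := by
    rw [ht, norm_mul, Complex.norm_exp, log_mul (by simpa using hxz) (exp_pos _).ne', log_exp]
    simp; ring
  have ht1 : |t - 1| < min (1/2) (ε/2) := by
    have := abs_norm_sub_norm_le ((x - z) * Complex.exp (-h z)) 1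
    rw [norm_one, ← ht] at this
    exact this.trans_lt h1
  have ha := ht1.trans_le (min_le_left _ _)
  have hb := ht1.trans_le (min_le_right _ _)
  rw [abs_lt] at ha hb
  have ht0 : 0 < t := by linarith
  rw [e, abs_le]
  constructor
  · have h3 := log_le_sub_one_of_pos (inv_pos.2 ht0)
    rw [log_inv] at h3
    have h4 : t⁻¹ - 1 ≤ ε := by
      have : t⁻¹ ≤ 1 + ε := by
        rw [inv_le_iff_one_le_mul₀ ht0]
        nlinarith
      linarith
    linarith
  · have := log_le_sub_one_of_pos ht0
    linarith

end MF

namespace MF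
open Complex (I)
open Filter Topology

theorem hb_sep {K : Set ℂ} [CompactSpace K] {w g : C(K,ℝ)} (hg : ∀ z, 0 < g z) (P : Submodule ℝ C(K,ℝ)) 
    (hno : ∀ p ∈ P, ∃ z, g z < |w z - p z|) : 
    ∃ (L : C(K,ℝ) →L[ℝ] ℝ) (s : ℝ), 0 < s ∧ (∀ p ∈ P, L p = 0) ∧ 
      (∀ c, 0 ≤ c → ∀ φ : C(K,ℝ), (∀ z, |φ z| ≤ c * g z) → L φ ≤ c * s) ∧ s ≤ L w := by
  obtain ⟨gi, hgi⟩ : ∃ gi : C(K,ℝ), ∀ z, gi z = (g z)⁻¹ := 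
    ⟨⟨fun z => (g z)⁻¹, g.continuous.inv₀ (fun z => (hg z).ne')⟩, fun z => rfl⟩
  obtain ⟨S, hS⟩ : ∃ S : Set C(K,ℝ), S = {φ | ∀ z, |φ z| < g z} := ⟨_, rfl⟩
  have hmem : ∀ φ, φ ∈ S ↔ ∀ z, |φ z| < g z := fun φ => by rw [hS]; rfl
  have hS' : S = (LinearMap.mulRight ℝ gi) ⁻¹' (Metric.ball 0 1) := by
    ext φ
    rw [hmem, Set.mem_preimage, mem_ball_zero_iff, ContinuousMap.norm_lt_iff _ one_pos]
    refine forall_congr' fun z => ?_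
    simp only [LinearMap.mulRight_apply, ContinuousMap.mul_apply, hgi, norm_mul, Real.norm_eq_abs, abs_inv, abs_of_pos (hg z)]
    rw [← div_eq_mul_inv, div_lt_one (hg z)]
  have hc : Convex ℝ S := by
    rw [hS']; exact (convex_ball _ _).linear_preimage _
  have ho : IsOpen S := by
    rw [hS']
    refine Metric.isOpen_ball.preimage ?_
    show Continuous (fun φ : C(K,ℝ) => φ * gi)
    fun_prop
  obtain ⟨T, hT⟩ : ∃ T : Set C(K,ℝ), T = {φ | w - φ ∈ P} := ⟨_, rfl⟩
  have hmT : ∀ φ, φ ∈ T ↔ w - φ ∈ P := fun φ => by rw [hT]; rfl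
  have hTc : Convex ℝ T := by
    intro a ha b hb c d _ _ hcd
    rw [hmT] at *
    have : w - (c • a + d • b) = c • (w - a) + d • (w - b) := by
      have : w = (c + d) • w := by rw [hcd, one_smul]
      conv_lhs => rw [this]
      module
    rw [this]
    exact P.add_mem (P.smul_mem _ ha) (P.smul_mem _ hb)
  have hdis : Disjoint S T := by
    rw [Set.disjoint_left]
    intro φ h1 h2
    rw [hmem] at h1; rw [hmT] at h2
    obtain ⟨z, hz⟩ := hno _ h2
    have := h1 z
    simp at hz
    linarith
  obtain ⟨L, s, h1, h2⟩ := geometric_hahn_banach_open hc ho hTc hdis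
  have hs : 0 < s := by
    have := h1 0 ((hmem 0).2 (fun z => by simpa using hg z))
    simpa using this
  have hw : s ≤ L w := h2 w ((hmT w).2 (by simp))
  refine ⟨L, s, hs, fun p hp => ?_, fun c hc φ hφ => ?_, hw⟩
  · have : ∀ t : ℝ, s ≤ L w - t * L p := by
      intro t
      have := h2 (w - t • p) ((hmT _).2 (by simpa using P.smul_mem t hp))
      simpa using this
    by_contra hne
    have h3 := this ((L w - s + 1) / L p)
    rw [div_mul_cancel₀ _ hne] at h3
    linarith
  · refine le_of_forall_pos_le_add fun ε hε => ?_
    have hc' : 0 < c + ε / s := by positivity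
    have h3 := h1 ((c + ε/s)⁻¹ • φ) ((hmem _).2 (fun z => by
      simp only [ContinuousMap.smul_apply, smul_eq_mul, abs_mul, abs_inv, abs_of_pos hc']
      rw [inv_mul_lt_iff₀ hc']
      have := hφ z
      have : 0 < ε/s * g z := mul_pos (by positivity) (hg z)
      linarith))
    rw [map_smul, smul_eq_mul, inv_mul_lt_iff₀ hc'] at h3
    have : (c + ε/s) * s = c * s + ε := by field_simp
    linarith

/-- potential estimate -/
theorem pot_est {g U : ℂ → ℝ} (hg : ContDiff ℝ 2 g) (hU : ContDiff ℝ 2 U) (hc : HasCompactSupport U) 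
    (hpos : ∀ x ∈ tsupport U, 0 < g x) {κ : ℝ} (hκ : 0 < κ) :
    ∫ x, (√(U x^2 + κ) - √κ) * (-Lp g x) ≤ - ∫ x, (g x * (U x / √(U x^2 + κ))) * Lp U x := by
  have hk : ∀ x, 0 < U x^2 + κ := fun x => by positivity
  have hU1 : ContDiff ℝ 1 U := hU.of_le (by norm_num)
  have hg1 : ContDiff ℝ 1 g := hg.of_le (by norm_num)
  have hrt : ContDiff ℝ 1 (fun x => √(U x^2 + κ)) := ((hU1.pow 2).add contDiff_const).sqrt (fun x => (hk x).ne')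
  have hj : ContDiff ℝ 1 (fun x => √(U x^2 + κ) - √κ) := hrt.sub contDiff_const
  have hs : ContDiff ℝ 1 (fun x => U x / √(U x^2 + κ)) := hU1.div hrt (fun x => (sqrt_pos.2 (hk x)).ne')
  have hjc : HasCompactSupport (fun x => √(U x^2 + κ) - √κ) := by
    refine hc.mono' ?_
    intro x hx
    apply subset_tsupport
    intro h
    apply hx
    simp [h]
  have hsc : HasCompactSupport (fun x => U x / √(U x^2 + κ)) := by
    refine hc.mono' ?_
    intro x hx
    apply subset_tsupport
    intro h
    apply hx
    simp [h]
  have hd : ∀ x, HasFDerivAt U (fderiv ℝ U x) x := fun x => (hU1.differentiable (by norm_num) x).hasFDerivAt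
  have hdrt : ∀ x, HasFDerivAt (fun x => √(U x^2 + κ)) ((U x / √(U x^2 + κ)) • fderiv ℝ U x) x := by
    intro x
    have := (((hd x).pow 2).add_const κ).sqrt (hk x).ne'
    refine this.congr_fderiv ?_
    ext v
    simp
    field_simp
  have hds : ∀ x, HasFDerivAt (fun x => U x / √(U x^2 + κ)) ((κ / (√(U x^2 + κ))^3) • fderiv ℝ U x) x := by
    intro x
    have hp := sqrt_pos.2 (hk x)
    have h2 := (hd x).fun_mul ((hasDerivAt_inv hp.ne').comp_hasFDerivAt x (hdrt x))
    refine HasFDerivAt.congr_fderiv (f := fun x => U x * (√(U x^2+κ))⁻¹) h2 ?_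
    ext v
    simp only [ContinuousLinearMap.add_apply, ContinuousLinearMap.smul_apply, smul_eq_mul, Function.comp]
    have hsq := sq_sqrt (hk x).le
    obtain ⟨r, hr⟩ : ∃ r, r = √(U x^2 + κ) := ⟨_, rfl⟩
    rw [← hr] at hp hsq ⊢
    have hκ' : κ = r^2 - U x^2 := by linarith
    rw [hκ']
    field_simp
    ring
  have e1 := green hj hjc hg
  have e2 := green (hg1.mul hs) hsc.mul_left hU
  have e3 : ∫ x, gr (fun x => √(U x^2 + κ) - √κ) g x ≤ ∫ x, gr (fun x => g x * (U x / √(U x^2 + κ))) U x := by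
    have c1 := continuous_gr hj hg1
    have c2 := continuous_gr (hg1.mul hs) hU1
    have hz : ∀ x ∉ tsupport U, fderiv ℝ U x = 0 := fun x hx => by
      by_contra h
      exact hx (tsupport_fderiv_subset (𝕜 := ℝ) (subset_tsupport _ h))
    have f1 : ∀ x v, fderiv ℝ (fun x => √(U x^2 + κ) - √κ) x v = (U x / √(U x^2 + κ)) * fderiv ℝ U x v := fun x v => by
      rw [((hdrt x).sub_const (√κ)).fderiv]; simp
    have f2 : ∀ x v, fderiv ℝ (fun x => g x * (U x / √(U x^2 + κ))) x v = 
       (U x / √(U x^2 + κ)) * fderiv ℝ g x v + g x * (κ / (√(U x^2 + κ))^3) * fderiv ℝ U x v := fun x v => by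
      rw [((hg1.differentiable (by norm_num) x).hasFDerivAt.fun_mul (hds x)).fderiv]; simp; ring
    refine integral_mono (c1.integrable_of_hasCompactSupport ?_) (c2.integrable_of_hasCompactSupport ?_) ?_
    · refine HasCompactSupport.intro hc fun x hx => ?_
      unfold gr; rw [f1, f1, hz x hx]; simp
    · refine HasCompactSupport.intro hc fun x hx => ?_
      unfold gr; rw [hz x hx]; simp
    · intro x
      unfold gr
      simp only [f1, f2]
      by_cases hx : x ∈ tsupport U
      · have h0 := hpos x hx
        have h1 : 0 ≤ g x * (κ / (√(U x^2 + κ))^3) := by positivity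
        nlinarith [mul_nonneg h1 (mul_self_nonneg (fderiv ℝ U x 1)), mul_nonneg h1 (mul_self_nonneg (fderiv ℝ U x I))]
      · rw [hz x hx]; simp
  rw [e1, e2] at e3
  simp_rw [mul_neg]
  rw [integral_neg]
  exact e3

end MF

namespace MF
open Complex (I)
open Filter Topology

/-- entire real parts as a submodule -/
def entRe (K : Set ℂ) : Submodule ℝ C(K,ℝ) where
  carrier := {p | ∃ h : ℂ → ℂ, Differentiable ℂ h ∧ ∀ z : K, p z = (h z).re}
  add_mem' := by
    rintro a b ⟨h, hh, e⟩ ⟨h', hh', e'⟩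
    exact ⟨fun z => h z + h' z, hh.add hh', fun z => by simp [e, e']⟩
  zero_mem' := ⟨fun _ => 0, differentiable_const _, fun z => by simp⟩
  smul_mem' := by
    rintro c a ⟨h, hh, e⟩
    exact ⟨fun z => (c:ℂ) * h z, hh.const_mul _, fun z => by simp [e]⟩

theorem conv_est {f χ : ℂ → ℝ} (hf : Continuous f) (hχ : Continuous χ) (hχc : HasCompactSupport χ) 
    (h0 : ∀ x, 0 ≤ χ x) {ρ C : ℝ} (hsup : ∀ x, ρ ≤ ‖x‖ → χ x = 0) {z : ℂ} {m : ℝ} 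
    (hb : ∀ x, ‖x - z‖ ≤ ρ → |f x - m| ≤ C) :
    |(∫ x, f x * χ (x - z)) - m * ∫ x, χ x| ≤ C * ∫ x, χ x := by
  have i0 : Integrable χ := hχ.integrable_of_hasCompactSupport hχc
  have i1 : Integrable (fun x => χ (x - z)) := i0.comp_sub_right z
  have i2 : Integrable (fun x => f x * χ (x - z)) := by
    apply Continuous.integrable_of_hasCompactSupport (by fun_prop)
    have : HasCompactSupport (fun x => χ (x - z)) := hχc.comp_homeomorph (Homeomorph.subRight z)
    exact this.mul_left
  have e : ∫ x, χ x = ∫ x, χ (x - z) := (integral_sub_right_eq_self χ z).symm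
  rw [e, ← integral_const_mul, ← integral_sub i2 (i1.const_mul _), ← integral_const_mul, ← Real.norm_eq_abs]
  refine norm_integral_le_of_norm_le (i1.const_mul _) (ae_of_all _ fun x => ?_)
  rw [← sub_mul, norm_mul, Real.norm_eq_abs, Real.norm_eq_abs, abs_of_nonneg (h0 _)]
  by_cases hx : ‖x - z‖ ≤ ρ
  · exact mul_le_mul_of_nonneg_right (hb x hx) (h0 _)
  · rw [hsup _ (not_le.1 hx).le]; simp

theorem approx {K : Set ℂ} (hK : IsCompact K) 
    (hfill : ∀ V, IsOpen V → Bornology.IsBounded V → Disjoint V K → frontier V ⊆ K → V = ∅)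
    {w g : ℂ → ℝ} (hw : ContDiff ℝ 2 w) (hg : ContDiff ℝ 2 g)
    (hwg : ∀ z ∈ K, 0 < g z ∧ |Lp w z| < -Lp g z) : 
    ∃ h : ℂ → ℂ, Differentiable ℂ h ∧ ∀ z ∈ K, |w z - (h z).re| ≤ g z := by
  by_contra hcon
  push Not at hcon
  rcases K.eq_empty_or_nonempty with hKe | hKne
  · obtain ⟨z, hz, _⟩ := hcon (fun _ => 0) (differentiable_const _)
    rw [hKe] at hz; exact hz
  haveI : CompactSpace K := isCompact_iff_compactSpace.1 hK
  have hwc := hw.continuous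
  have hgc := hg.continuous
  have hLw := continuous_Lp hw
  have hLg := continuous_Lp hg
  obtain ⟨L, s, hs, hP, hbd, hsw⟩ := hb_sep (K := K) (w := ⟨fun z => w z, by fun_prop⟩) 
    (g := ⟨fun z => g z, by fun_prop⟩) (fun z => (hwg z z.2).1) (entRe K) (by
      rintro p ⟨h, hh, e⟩
      obtain ⟨z, hz, hlt⟩ := hcon h hh
      refine ⟨⟨z, hz⟩, ?_⟩
      rw [e]
      exact hlt)
  simp only [ContinuousMap.coe_mk] at hbd
  obtain ⟨wK, hwK⟩ : ∃ wK : C(K,ℝ), wK = ⟨fun z => w z, by fun_prop⟩ := ⟨_, rfl⟩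
  rw [← hwK] at hsw
  have hwKa : ∀ z : K, wK z = w z := fun z => by rw [hwK]; rfl
  -- neighborhood
  have hNo : IsOpen {x | 0 < g x ∧ |Lp w x| < -Lp g x} := 
    (isOpen_lt continuous_const hgc).inter (isOpen_lt hLw.abs hLg.neg)
  obtain ⟨ρ0, hρ0, hsub⟩ := hK.exists_cthickening_subset_open hNo (fun z hz => hwg z hz)
  have hK0 : IsCompact (Metric.cthickening ρ0 K) := hK.cthickening
  have hK0ne : (Metric.cthickening ρ0 K).Nonempty := hKne.mono (Metric.self_subset_cthickening K)
  have hN : ∀ x ∈ Metric.cthickening ρ0 K, 0 < g x ∧ |Lp w x| < -Lp g x := fun x hx => hsub hx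
  obtain ⟨τ, hτ0, hτ1, hτ⟩ : ∃ τ : ℝ, 0 < τ ∧ τ ≤ 1 ∧ ∀ x ∈ Metric.cthickening ρ0 K, |Lp w x| ≤ (1 - τ) * (-Lp g x) := by
    obtain ⟨x0, hx0, hmin⟩ := hK0.exists_isMinOn hK0ne (f := fun x => 1 - |Lp w x| / (-Lp g x)) 
      (continuousOn_const.sub (hLw.abs.continuousOn.div hLg.neg.continuousOn (fun x hx => by
        have := (hN x hx).2; have := abs_nonneg (Lp w x); linarith)))
    have hp : ∀ x ∈ Metric.cthickening ρ0 K, 0 < - Lp g x := fun x hx => by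
      have := (hN x hx).2; have := abs_nonneg (Lp w x); linarith
    refine ⟨1 - |Lp w x0| / (-Lp g x0), ?_, ?_, fun x hx => ?_⟩
    · rw [sub_pos, div_lt_one (hp _ hx0)]; exact (hN x0 hx0).2
    · have := div_nonneg (abs_nonneg (Lp w x0)) (hp _ hx0).le
      linarith
    · have := hmin hx
      simp only [Set.mem_ofPred_eq] at this
      have h2 : |Lp w x| / (-Lp g x) ≤ 1 - (1 - |Lp w x0| / (-Lp g x0)) := by linarith
      rwa [div_le_iff₀ (hp x hx)] at h2
  obtain ⟨m, hm0, hm⟩ : ∃ m : ℝ, 0 < m ∧ ∀ x ∈ Metric.cthickening ρ0 K, m ≤ g x := by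
    obtain ⟨x0, hx0, hmin⟩ := hK0.exists_isMinOn hK0ne hgc.continuousOn
    exact ⟨g x0, (hN x0 hx0).1, fun x hx => hmin hx⟩
  obtain ⟨ρ, hρ, hρρ, hwu, hgu⟩ : ∃ ρ : ℝ, 0 < ρ ∧ ρ ≤ ρ0 ∧ 
     (∀ z ∈ K, ∀ x, ‖x - z‖ ≤ ρ → |w x - w z| ≤ τ/2 * m) ∧ (∀ z ∈ K, ∀ x, ‖x - z‖ ≤ ρ → |g x - g z| ≤ τ/2 * m) := by
    have hη : 0 < τ/2*m := by positivity
    obtain ⟨δ1, hδ1, h1⟩ := Metric.uniformContinuousOn_iff.1 (hK0.uniformContinuousOn_of_continuous hwc.continuousOn) _ hη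
    obtain ⟨δ2, hδ2, h2⟩ := Metric.uniformContinuousOn_iff.1 (hK0.uniformContinuousOn_of_continuous hgc.continuousOn) _ hη
    refine ⟨min ρ0 (min (δ1/2) (δ2/2)), by positivity, min_le_left _ _, fun z hz x hx => ?_, fun z hz x hx => ?_⟩
    all_goals
      have ha := hx.trans (min_le_left _ _)
      have hb := hx.trans ((min_le_right _ _).trans (min_le_left _ _))
      have hc := hx.trans ((min_le_right _ _).trans (min_le_right _ _))
      have hxK : x ∈ Metric.cthickening ρ0 K := Metric.mem_cthickening_of_dist_le x z ρ0 K hz (by rwa [dist_eq_norm])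
      have hzK : z ∈ Metric.cthickening ρ0 K := Metric.self_subset_cthickening K hz
    · have := h1 x hxK z hzK (by rw [dist_eq_norm]; linarith)
      rw [Real.dist_eq] at this; exact this.le
    · have := h2 x hxK z hzK (by rw [dist_eq_norm]; linarith)
      rw [Real.dist_eq] at this; exact this.le
  have hmK : ∀ z ∈ K, m ≤ g z := fun z hz => hm z (Metric.self_subset_cthickening K hz)
  obtain ⟨J, hJ, hJlog, hχ0, hχs, x1, hx1⟩ := exists_J hρ
  have hχ := continuous_Lp hJ
  have hχc : HasCompactSupport (Lp J) := by
    refine HasCompactSupport.intro (isCompact_closedBall (0:ℂ) ρ) fun x hx => hχs x ?_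
    rw [mem_closedBall_zero_iff, not_le] at hx; exact hx.le
  have hM : 0 < ∫ x, Lp J x := 
    hχ.integral_pos_of_hasCompactSupport_nonneg_nonzero hχc hχ0 hx1.ne'
  obtain ⟨M, hMd⟩ : ∃ M, M = ∫ x, Lp J x := ⟨_, rfl⟩
  rw [← hMd] at hM
  obtain ⟨U, hUd⟩ : ∃ U : ℂ → ℝ, U = fun x => L (tr K J hJ.continuous x) := ⟨_, rfl⟩
  have hU : ContDiff ℝ 2 U := by rw [hUd]; exact tr_contDiff2 hJ L
  have hULp : ∀ x, Lp U x = L (tr K (Lp J) hχ x) := fun x => by rw [hUd]; exact tr_Lp hJ L x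
  have hU0 : ∀ x ∉ Metric.cthickening ρ K, U x = 0 := by
    intro x hx
    have hxK : x ∉ K := fun h => hx (Metric.self_subset_cthickening K h)
    have hfar : ∀ z ∈ K, ρ ≤ ‖x - z‖ := by
      intro z hz
      by_contra h
      exact hx (Metric.mem_cthickening_of_dist_le x z ρ K hz (by rw [dist_eq_norm]; linarith))
    have : |U x| ≤ 0 := by
      refine le_of_forall_pos_le_add fun ε hε => ?_
      obtain ⟨h, hh, H⟩ := log_approx hK hfill hxK (ε := ε / (‖L‖ + 1)) (by positivity)
      have hhc := hh.continuous
      obtain ⟨p, hp⟩ : ∃ p : C(K,ℝ), ∀ z : K, p z = (h z).re - Real.log ρ := 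
        ⟨⟨fun z => (h z).re - Real.log ρ, by fun_prop⟩, fun z => rfl⟩
      have hpP : p ∈ entRe K := ⟨fun z => h z - (Real.log ρ : ℝ), hh.sub_const _, fun z => by rw [hp]; simp⟩
      have e : U x = L (tr K J hJ.continuous x - p) := by
        rw [map_sub, hP p hpP, sub_zero, hUd]
      rw [e, zero_add]
      have hn : ‖tr K J hJ.continuous x - p‖ ≤ ε / (‖L‖ + 1) := by
        rw [ContinuousMap.norm_le _ (by positivity)]
        intro z
        have := H z z.2
        simp only [ContinuousMap.sub_apply, hp, tr, ContinuousMap.coe_mk, hJlog _ (hfar z z.2)]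
        rw [Real.norm_eq_abs]
        convert this using 2
        ring
      calc |L (tr K J hJ.continuous x - p)| ≤ ‖L‖ * ‖tr K J hJ.continuous x - p‖ := L.le_opNorm _
        _ ≤ (‖L‖ + 1) * (ε / (‖L‖ + 1)) := by gcongr; linarith
        _ = ε := by field_simp
    exact abs_eq_zero.1 (le_antisymm this (abs_nonneg _))
  have hρK : IsCompact (Metric.cthickening ρ K) := hK.cthickening
  have hρsub : Metric.cthickening ρ K ⊆ Metric.cthickening ρ0 K := Metric.cthickening_mono hρρ K
  have hUc : HasCompactSupport U := HasCompactSupport.intro hρK hU0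
  have hUts : tsupport U ⊆ Metric.cthickening ρ K := by
    apply closure_minimal _ hρK.isClosed
    intro x hx
    by_contra h
    exact hx (hU0 x h)
  have hUcont := hU.continuous
  -- (i)
  have step1 : M * s ≤ (∫ x, U x * Lp w x) + τ/2 * M * s := by
    obtain ⟨c, hc, hcL⟩ := tr_integral hχ hχc L hwc
    have e1 := green2 hU hUc hw
    simp_rw [hULp] at e1
    rw [← e1, hcL]
    have := hbd (τ/2*M) (by positivity) (M • wK - c) (fun z => by
      have h1 := conv_est hwc hχ hχc hχ0 hχs (fun x hx => hwu z z.2 x hx)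
      rw [← hMd, ← hc z] at h1
      rw [ContinuousMap.sub_apply, ContinuousMap.smul_apply, hwKa, abs_sub_comm, smul_eq_mul, mul_comm M]
      refine h1.trans ?_
      have := hmK z z.2
      calc τ/2*m*M = τ/2*M*m := by ring
        _ ≤ _ := by gcongr)
    rw [map_sub, map_smul, smul_eq_mul] at this
    have := mul_le_mul_of_nonneg_left hsw hM.le
    linarith
  -- (ii)
  have step2 : ∀ κ : ℝ, 0 < κ → ∫ x, (√(U x^2 + κ) - √κ) * (-Lp g x) ≤ (1 + τ/2) * M * s := by
    intro κ hκ
    refine (pot_est hg hU hUc (fun x hx => (hN x (hρsub (hUts hx))).1) hκ).trans ?_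
    have hk : ∀ x, 0 < U x^2 + κ := fun x => by positivity
    have hfc : Continuous (fun x => g x * (U x / √(U x^2 + κ))) := by
      refine hgc.mul (hUcont.div (by fun_prop) (fun x => (sqrt_pos.2 (hk x)).ne'))
    obtain ⟨c, hc, hcL⟩ := tr_integral hχ hχc L hfc
    simp_rw [hULp]
    rw [hcL, ← map_neg]
    refine hbd ((1+τ/2)*M) (by positivity) (-c) fun z => ?_
    rw [ContinuousMap.neg_apply, abs_neg, hc]
    have h1 := conv_est hfc hχ hχc hχ0 hχs (z := z) (m := 0) (C := (1 + τ/2) * g z) (fun x hx => ?_)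
    · rw [← hMd, zero_mul, sub_zero] at h1
      linarith
    · rw [sub_zero, abs_mul]
      have hxK : x ∈ Metric.cthickening ρ0 K := Metric.mem_cthickening_of_dist_le x z ρ0 K z.2 (by rw [dist_eq_norm]; linarith)
      have hgx := (hN x hxK).1
      have h2 : |U x / √(U x^2 + κ)| ≤ 1 := by
        rw [abs_div, abs_of_pos (sqrt_pos.2 (hk x)), div_le_one (sqrt_pos.2 (hk x))]
        exact abs_le_sqrt (by linarith)
      have h3 := hgu z z.2 x hx
      have h4 := hmK z z.2
      have h5 := (abs_le.1 h3).2
      rw [abs_of_pos hgx]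
      calc g x * |U x / √(U x^2 + κ)| ≤ g x * 1 := by gcongr
        _ ≤ g z + τ/2 * m := by linarith
        _ ≤ g z + τ/2 * g z := by gcongr
        _ = _ := by ring
  have iU : Integrable (fun x => |U x| * (-Lp g x)) := by
    apply Continuous.integrable_of_hasCompactSupport (by fun_prop)
    exact (hUc.norm : HasCompactSupport (fun x => ‖U x‖)).mul_right
  have step3 : ∫ x, |U x| * (-Lp g x) ≤ (1 + τ/2) * M * s := by
    obtain ⟨B, hB⟩ : ∃ B, B = ∫ x in Metric.cthickening ρ K, (-Lp g x) := ⟨_, rfl⟩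
    have h : ∀ κ : ℝ, 0 < κ → ∫ x, |U x| * (-Lp g x) ≤ (1 + τ/2) * M * s + √κ * B := by
      intro κ hκ
      have hsc : HasCompactSupport (fun x => √(U x^2 + κ) - √κ) := 
        HasCompactSupport.intro hρK fun x hx => by simp [hU0 x hx]
      have i1 : Integrable (fun x => (√(U x^2 + κ) - √κ) * (-Lp g x)) := by
        apply Continuous.integrable_of_hasCompactSupport (by fun_prop)
        exact hsc.mul_right
      have iB : IntegrableOn (fun x => -Lp g x) (Metric.cthickening ρ K) := hLg.neg.continuousOn.integrableOn_compact hρK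
      have i2 : Integrable (fun x => √κ * (Metric.cthickening ρ K).indicator (fun x => -Lp g x) x) := 
        (iB.integrable_indicator hρK.measurableSet).const_mul _
      have := integral_mono iU (i1.add i2) (fun x => by
        simp only [Pi.add_apply]
        by_cases hx : x ∈ Metric.cthickening ρ K
        · rw [Set.indicator_of_mem hx, ← add_mul, sub_add_cancel]
          have h1 := (hN x (hρsub hx)).2
          have h2 : 0 ≤ -Lp g x := by have := abs_nonneg (Lp w x); linarith
          refine mul_le_mul_of_nonneg_right (abs_le_sqrt (by linarith)) h2
        · rw [Set.indicator_of_notMem hx]; simp [hU0 x hx])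
      simp only [Pi.add_apply] at this
      rw [integral_add i1 i2, integral_const_mul, integral_indicator hρK.measurableSet, ← hB] at this
      linarith [step2 κ hκ]
    have hlim : Tendsto (fun κ : ℝ => (1 + τ/2) * M * s + √κ * B) (𝓝[>] 0) (𝓝 ((1 + τ/2) * M * s + √0 * B)) := by
      apply Tendsto.mono_left _ nhdsWithin_le_nhds
      apply Continuous.tendsto
      fun_prop
    rw [sqrt_zero, zero_mul, add_zero] at hlim
    exact ge_of_tendsto hlim (by filter_upwards [self_mem_nhdsWithin] with κ hκ using h κ hκ)
  have step4 : ∫ x, U x * Lp w x ≤ (1 - τ) * ∫ x, |U x| * (-Lp g x) := by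
    rw [← integral_const_mul]
    refine integral_mono ?_ (iU.const_mul _) fun x => ?_
    · apply Continuous.integrable_of_hasCompactSupport (by fun_prop)
      exact hUc.mul_right
    · show U x * Lp w x ≤ (1 - τ) * (|U x| * (-Lp g x))
      by_cases hx : x ∈ Metric.cthickening ρ K
      · have h1 := hτ x (hρsub hx)
        calc U x * Lp w x ≤ |U x * Lp w x| := le_abs_self _
          _ = |U x| * |Lp w x| := abs_mul _ _
          _ ≤ |U x| * ((1 - τ) * (-Lp g x)) := by gcongr
          _ = _ := by ring
      · simp [hU0 x hx]
  have h5 : (1 - τ) * (∫ x, |U x| * (-Lp g x)) ≤ (1 - τ) * ((1 + τ/2) * M * s) := by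
    apply mul_le_mul_of_nonneg_left step3; linarith
  have h6 : 0 < M * s * τ^2 := by positivity
  nlinarith

end MF

namespace MF
open Complex (I)
open Filter Topology

theorem line_deriv {f : ℂ → ℝ} (hf : Differentiable ℝ f) (x v : ℂ) (s : ℝ) : 
    HasDerivAt (fun s : ℝ => f (x + s • v)) (fderiv ℝ f (x + s • v) v) s := by
  have h1 : HasDerivAt (fun s : ℝ => x + s • v) v s := by
    simpa using ((hasDerivAt_id s).smul_const v).const_add x
  exact (hf (x + s • v)).hasFDerivAt.comp_hasDerivAt s h1

theorem second_test {f : ℂ → ℝ} (hf : ContDiff ℝ 2 f) {x : ℂ} (hx : IsLocalMin f x) (v : ℂ) :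
    0 ≤ fderiv ℝ (fun y => fderiv ℝ f y v) x v := by
  by_contra hneg
  push Not at hneg
  have hf1 : Differentiable ℝ f := hf.differentiable (by norm_num)
  have hf2 : Differentiable ℝ (fun y => fderiv ℝ f y v) := (contDiff_fderiv_apply hf v).differentiable (by norm_num)
  obtain ⟨φ, hφ⟩ : ∃ φ : ℝ → ℝ, φ = fun s => f (x + s • v) := ⟨_, rfl⟩
  have d1 : deriv φ = fun s => fderiv ℝ f (x + s • v) v := by
    funext s; rw [hφ]; exact (line_deriv hf1 x v s).deriv
  have d2 : deriv (deriv φ) 0 = fderiv ℝ (fun y => fderiv ℝ f y v) x v := by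
    rw [d1]
    have := (line_deriv hf2 x v 0).deriv
    simpa using this
  have hcont : Continuous φ := by rw [hφ]; have := hf.continuous; fun_prop
  have hmin : IsLocalMin φ 0 := by
    have hc : Tendsto (fun s : ℝ => x + s • v) (𝓝 0) (𝓝 x) := by
      have : Continuous (fun s : ℝ => x + s • v) := by fun_prop
      simpa using this.tendsto 0
    have := hc.eventually hx
    rw [hφ]
    show ∀ᶠ s in 𝓝 (0:ℝ), f (x + (0:ℝ) • v) ≤ f (x + s • v)
    simpa using this
  have hmax : IsLocalMax φ 0 := isLocalMax_of_deriv_deriv_neg (by rw [d2]; exact hneg) hmin.deriv_eq_zero hcont.continuousAt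
  have hev : φ =ᶠ[𝓝 0] fun _ => φ 0 := by
    filter_upwards [hmin, hmax] with s h1 h2
    exact le_antisymm h2 h1
  have h3 : deriv φ =ᶠ[𝓝 0] fun _ => 0 := by
    have := hev.deriv
    simpa using this
  have h4 := h3.deriv_eq
  rw [d2] at h4
  simp at h4
  linarith

theorem Lp_nonneg_of_min {f : ℂ → ℝ} (hf : ContDiff ℝ 2 f) {x : ℂ} (hx : IsLocalMin f x) : 0 ≤ Lp f x :=
  add_nonneg (second_test hf hx 1) (second_test hf hx I)

theorem Lp_normSq (x : ℂ) : Lp (fun z => Complex.normSq z) x = 4 := by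
  have := Lp_radial (k := fun t => t) (k1 := fun _ => 1) (k2 := fun _ => 0) (fun t _ => hasDerivAt_id t) 
    (fun t _ => hasDerivAt_const t 1) x
  simpa using this

/-- weak minimum principle, strict version -/
theorem min_strict {f : ℂ → ℝ} (hf : ContDiff ℝ 2 f) {V : Set ℂ} (hV : IsOpen V) (hVb : Bornology.IsBounded V) {t : ℝ}
    (hL : ∀ x ∈ V, Lp f x < 0) (hfr : ∀ x ∈ frontier V, t ≤ f x) : ∀ x ∈ V, t ≤ f x := by
  intro x hx
  have hc : IsCompact (closure V) := hVb.isCompact_closure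
  obtain ⟨y, hy, hmin⟩ := hc.exists_isMinOn ⟨x, subset_closure hx⟩ hf.continuous.continuousOn
  refine le_trans ?_ (hmin (subset_closure hx))
  by_cases hyV : y ∈ V
  · have hloc : IsLocalMin f y := by
      filter_upwards [hV.mem_nhds hyV] with z hz using hmin (subset_closure hz)
    have := Lp_nonneg_of_min hf hloc
    have := hL y hyV
    linarith
  · exact hfr y (by rw [hV.frontier_eq]; exact ⟨hy, hyV⟩)

theorem min_weak {f : ℂ → ℝ} (hf : ContDiff ℝ 2 f) {V : Set ℂ} (hV : IsOpen V) (hVb : Bornology.IsBounded V) {t : ℝ}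
    (hL : ∀ x ∈ V, Lp f x ≤ 0) (hfr : ∀ x ∈ frontier V, t ≤ f x) : ∀ x ∈ V, t ≤ f x := by
  intro x hx
  obtain ⟨R, hR⟩ := hVb.closure.exists_norm_le
  refine le_of_forall_pos_le_add fun ε hε => ?_
  have hη : 0 < ε / (R^2 + 1) := by positivity
  obtain ⟨η, hηd⟩ : ∃ η, η = ε / (R^2 + 1) := ⟨_, rfl⟩
  rw [← hηd] at hη
  have hR2 : η * R^2 ≤ ε := by
    rw [hηd, div_mul_eq_mul_div, div_le_iff₀ (by positivity)]; nlinarith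
  have hn : ∀ z ∈ closure V, Complex.normSq z ≤ R^2 := fun z hz => by
    rw [Complex.normSq_eq_norm_sq]
    have := hR z hz
    have := norm_nonneg z
    gcongr
  have hq : ContDiff ℝ 2 (fun z => η * Complex.normSq z) := contDiff_const.mul contDiff_normSq
  have key := min_strict (f := fun z => f z - η * Complex.normSq z) (hf.sub hq) hV hVb (t := t - η * R^2) 
    (fun z hz => by
      rw [Lp_sub hf hq, Lp_const_mul contDiff_normSq, Lp_normSq]
      have := hL z hz
      linarith) 
    (fun z hz => by
      have h1 := hfr z hz
      have h2 := hn z (frontier_subset_closure hz)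
      have := mul_le_mul_of_nonneg_left h2 hη.le
      linarith) x hx
  have h3 := mul_nonneg hη.le (Complex.normSq_nonneg x)
  linarith

theorem Lp_comp_sub (f : ℂ → ℝ) (c x : ℂ) : Lp (fun z => f (z - c)) x = Lp f (x - c) := by
  unfold Lp
  have : ∀ (f : ℂ → ℝ) (x : ℂ), fderiv ℝ (fun z => f (z - c)) x = fderiv ℝ f (x - c) := fun f x => by
    simpa [sub_eq_add_neg] using fderiv_comp_add_right (𝕜 := ℝ) (f := f) (x := x) (-c)
  simp_rw [this f]
  rw [this (fun y => fderiv ℝ f y 1), this (fun y => fderiv ℝ f y I)]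

/-- Hopf lemma -/
theorem hopf {f : ℂ → ℝ} (hf : ContDiff ℝ 2 f) {c y : ℂ} {r : ℝ} (hr : 0 < r) (hy : ‖y - c‖ = r) (hfy : f y = 0)
    (hpos : ∀ x, ‖x - c‖ < r → 0 < f x) (hL : ∀ x, ‖x - c‖ < r → Lp f x ≤ 0) : 0 < fderiv ℝ f y (c - y) := by
  obtain ⟨α, hα⟩ : ∃ α : ℝ, α = 8 / r^2 := ⟨_, rfl⟩
  have hα0 : 0 < α := by rw [hα]; positivity
  have hαr : α * r^2 = 8 := by rw [hα]; field_simp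
  -- barrier
  obtain ⟨k, hk⟩ : ∃ k : ℝ → ℝ, k = fun t => exp (-α * t) := ⟨_, rfl⟩
  have dk : ∀ t, HasDerivAt k (-α * exp (-α * t)) t := fun t => by
    rw [hk]
    have := ((hasDerivAt_id t).const_mul (-α)).exp
    simp only [id] at this
    exact this.congr_deriv (by ring)
  have dk1 : ∀ t, HasDerivAt (fun t => -α * exp (-α * t)) (α^2 * exp (-α * t)) t := fun t => by
    have := (((hasDerivAt_id t).const_mul (-α)).exp).const_mul (-α)
    simp only [id] at this
    exact this.congr_deriv (by ring)
  obtain ⟨h, hh⟩ : ∃ h : ℂ → ℝ, h = fun z => k (Complex.normSq (z - c)) - k (r^2) := ⟨_, rfl⟩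
  have hnsc : ContDiff ℝ 2 (fun z => Complex.normSq (z - c)) := contDiff_normSq.comp (contDiff_id.sub contDiff_const)
  have hk2 : ContDiff ℝ 2 k := by rw [hk]; fun_prop
  have hh2 : ContDiff ℝ 2 h := by rw [hh]; exact (hk2.comp hnsc).sub contDiff_const
  have hLh : ∀ x, Lp h x = 4 * exp (-α * Complex.normSq (x - c)) * α * (α * Complex.normSq (x - c) - 1) := by
    intro x
    have e1 : Lp h x = Lp (fun z => k (Complex.normSq (z - c))) x := by
      rw [hh, Lp_sub (f := fun z => k (Complex.normSq (z - c))) (hk2.comp hnsc) contDiff_const]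
      simp [Lp_const]
    rw [e1, Lp_comp_sub (fun z => k (Complex.normSq z)) c x, Lp_radial (fun t _ => dk t) (fun t _ => dk1 t)]
    ring
  -- minimum on inner sphere
  have hcs : IsCompact (Metric.sphere c (r/2)) := isCompact_sphere c (r/2)
  have hnes : (Metric.sphere c (r/2)).Nonempty := NormedSpace.sphere_nonempty.2 (by positivity)
  obtain ⟨x0, hx0, hmin⟩ := hcs.exists_isMinOn hnes hf.continuous.continuousOn
  have hx0' : ‖x0 - c‖ = r/2 := by rwa [← mem_sphere_iff_norm]
  have hm : 0 < f x0 := hpos x0 (by rw [hx0']; linarith)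
  have hk1 : ∀ t, 0 ≤ t → k t ≤ 1 := fun t ht => by
    rw [hk]; simp only
    rw [exp_le_one_iff]
    nlinarith
  have hk0 : ∀ t, 0 < k t := fun t => by rw [hk]; exact exp_pos _
  have hfcl : ∀ x, ‖x - c‖ ≤ r → 0 ≤ f x := by
    intro x hx
    have hx' : x ∈ closure (Metric.ball c r) := by
      rw [closure_ball c hr.ne', Metric.mem_closedBall, dist_eq_norm]; exact hx
    have hcl : IsClosed {x | 0 ≤ f x} := isClosed_le continuous_const hf.continuous
    exact closure_minimal (fun z hz => (hpos z (by rwa [Metric.mem_ball, dist_eq_norm] at hz)).le) hcl hx'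
  have hε2 : ContDiff ℝ 2 (fun z => f x0 * h z) := contDiff_const.mul hh2
  have hnc : Continuous (fun x : ℂ => ‖x - c‖) := by fun_prop
  -- comparison on annulus
  have hcomp : ∀ x, r/2 < ‖x - c‖ → ‖x - c‖ < r → 0 ≤ f x - f x0 * h x := by
    intro x hx1 hx2
    have hVo : IsOpen {x : ℂ | r/2 < ‖x - c‖ ∧ ‖x - c‖ < r} := 
      (isOpen_lt continuous_const hnc).inter (isOpen_lt hnc continuous_const)
    have hVb : Bornology.IsBounded {x : ℂ | r/2 < ‖x - c‖ ∧ ‖x - c‖ < r} := by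
      refine (Metric.isBounded_ball (x := c) (r := r)).subset fun z hz => ?_
      rw [Metric.mem_ball, dist_eq_norm]; exact hz.2
    refine min_strict (f := fun x => f x - f x0 * h x) (hf.sub hε2) hVo hVb (t := 0) (fun z hz => ?_) (fun z hz => ?_) x ⟨hx1, hx2⟩
    · rw [Lp_sub hf hε2, Lp_const_mul hh2, hLh]
      have h1 := hL z hz.2
      have h2 : 1 < α * Complex.normSq (z - c) := by
        rw [Complex.normSq_eq_norm_sq]
        have : (r/2)^2 < ‖z - c‖^2 := by
          have := hz.1
          gcongr
        nlinarith
      have h3 : 0 < 4 * exp (-α * Complex.normSq (z - c)) * α * (α * Complex.normSq (z - c) - 1) := by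
        have : 0 < α * Complex.normSq (z - c) - 1 := by linarith
        positivity
      have := mul_pos hm h3
      linarith
    · rw [hVo.frontier_eq] at hz
      obtain ⟨hz1, hz2⟩ := hz
      have hcl : IsClosed {x : ℂ | r/2 ≤ ‖x - c‖ ∧ ‖x - c‖ ≤ r} := 
        (isClosed_le continuous_const hnc).inter (isClosed_le hnc continuous_const)
      have hz3 : r/2 ≤ ‖z - c‖ ∧ ‖z - c‖ ≤ r := 
        closure_minimal (show {x : ℂ | r/2 < ‖x - c‖ ∧ ‖x - c‖ < r} ⊆ {x : ℂ | r/2 ≤ ‖x - c‖ ∧ ‖x - c‖ ≤ r} from fun w hw => ⟨hw.1.le, hw.2.le⟩) hcl hz1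
      have hhz : h z = k (Complex.normSq (z - c)) - k (r^2) := by rw [hh]
      show 0 ≤ f z - f x0 * h z
      rcases hz3.1.eq_or_lt with he | hlt
      · have h1 := hmin (show z ∈ Metric.sphere c (r/2) by rw [mem_sphere_iff_norm]; exact he.symm)
        have h1' : f x0 ≤ f z := h1
        have h2 : h z ≤ 1 := by
          rw [hhz]; have := hk1 (Complex.normSq (z-c)) (Complex.normSq_nonneg _); have := hk0 (r^2); linarith
        nlinarith
      · have he : ‖z - c‖ = r := by
          refine le_antisymm hz3.2 ?_
          by_contra hlt2
          exact hz2 ⟨hlt, not_le.1 hlt2⟩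
        have : h z = 0 := by rw [hhz, Complex.normSq_eq_norm_sq, he]; ring
        rw [this, mul_zero, sub_zero]
        exact hfcl z hz3.2
  -- derivative comparison
  have hhy : h y = 0 := by rw [hh]; simp only; rw [Complex.normSq_eq_norm_sq, hy]; ring
  have hline : ∀ s : ℝ, ‖y + s • (c - y) - c‖ = |1 - s| * r := fun s => by
    have : y + s • (c - y) - c = (1 - s) • (y - c) := by module
    rw [this, norm_smul, hy, Real.norm_eq_abs]
  have hdf := line_deriv (hf.differentiable (by norm_num)) y (c - y) 0
  rw [zero_smul, add_zero] at hdf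
  -- derivative of h along the line
  have hdh : HasDerivAt (fun s : ℝ => h (y + s • (c - y))) (2 * α * r^2 * exp (-α * r^2)) 0 := by
    have e : (fun s : ℝ => h (y + s • (c - y))) = fun s => k ((1 - s)^2 * r^2) - k (r^2) := by
      funext s
      rw [hh]; simp only
      rw [Complex.normSq_eq_norm_sq, hline, mul_pow, sq_abs]
    rw [e]
    have h1 : HasDerivAt (fun s : ℝ => (1 - s)^2 * r^2) (-2 * r^2) 0 := by
      have := (((hasDerivAt_id (0:ℝ)).const_sub 1).pow 2).mul_const (r^2)
      refine this.congr_deriv ?_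
      simp
    have h2 := ((dk ((1 - 0)^2 * r^2)).comp (0:ℝ) h1).sub_const (k (r^2))
    refine h2.congr_deriv ?_
    simp; ring
  have hnn : 0 ≤ fderiv ℝ f y (c - y) - f x0 * (2 * α * r^2 * exp (-α * r^2)) := by
    have hd := hdf.sub (hdh.const_mul (f x0))
    have hsl := hd.tendsto_slope_zero_right
    refine ge_of_tendsto hsl ?_
    have : ∀ᶠ s : ℝ in 𝓝[>] 0, s ∈ Set.Ioo (0:ℝ) (1/2) := Ioo_mem_nhdsGT (by norm_num)
    filter_upwards [this] with s hs
    have h1 := hcomp (y + s • (c - y)) (by rw [hline, abs_of_pos (by linarith [hs.2])]; nlinarith [hs.2])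
      (by rw [hline, abs_of_pos (by linarith [hs.2])]; nlinarith [hs.1])
    simp only [Pi.sub_apply, zero_add, zero_smul, add_zero, hfy, hhy, mul_zero, sub_zero, smul_eq_mul]
    exact mul_nonneg (inv_nonneg.2 hs.1.le) h1
  have : 0 < f x0 * (2 * α * r^2 * exp (-α * r^2)) := by positivity
  linarith

/-- strong minimum principle on convex open sets -/
theorem strong_min {f : ℂ → ℝ} (hf : ContDiff ℝ 2 f) {G : Set ℂ} (hG : IsOpen G) (hGc : Convex ℝ G)
    (h0 : ∀ x ∈ G, 0 ≤ f x) (hL : ∀ x ∈ G, Lp f x ≤ 0) {x0 : ℂ} (hx0 : x0 ∈ G) (hfx : f x0 = 0) : 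
    ∀ x ∈ G, f x = 0 := by
  intro x1 hx1
  by_contra hne
  have hfc := hf.continuous
  obtain ⟨γ, hγ⟩ : ∃ γ : ℝ → ℂ, γ = fun s => x1 + s • (x0 - x1) := ⟨_, rfl⟩
  have hγc : Continuous γ := by rw [hγ]; fun_prop
  have hγ0 : γ 0 = x1 := by rw [hγ]; simp
  have hγ1 : γ 1 = x0 := by rw [hγ]; simp
  have hγG : ∀ s ∈ Set.Icc (0:ℝ) 1, γ s ∈ G := fun s hs => by
    rw [hγ]; exact hGc.add_smul_sub_mem hx1 hx0 hs
  have hTc : IsCompact (Set.Icc (0:ℝ) 1 ∩ {s | f (γ s) = 0}) := 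
    isCompact_Icc.inter_right (isClosed_eq (by fun_prop) continuous_const)
  obtain ⟨t, ht, hmin⟩ := hTc.exists_isLeast ⟨1, ⟨by norm_num, by norm_num⟩, show f (γ 1) = 0 by rw [hγ1, hfx]⟩
  have htG := hγG t ht.1
  have ht0 : 0 < t := by
    rcases ht.1.1.eq_or_lt with h | h
    · exfalso
      apply hne
      have := ht.2
      rw [← h] at this
      have h2 : f (γ 0) = 0 := this
      rwa [hγ0] at h2
    · exact h
  obtain ⟨δ, hδ, hball⟩ := Metric.isOpen_iff.1 hG _ htG
  obtain ⟨s, hs0, hst, hsd⟩ : ∃ s, 0 ≤ s ∧ s < t ∧ ‖γ s - γ t‖ < δ/2 := by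
    obtain ⟨η, hη, hη2⟩ := Metric.continuous_iff.1 hγc t (δ/2) (by positivity)
    refine ⟨max 0 (t - η/2), le_max_left _ _, max_lt ht0 (by linarith), ?_⟩
    rw [← dist_eq_norm]
    apply hη2
    rw [Real.dist_eq, abs_sub_comm, abs_of_nonneg (by have := max_lt ht0 (by linarith : t - η/2 < t); linarith)]
    have := le_max_right 0 (t - η/2)
    linarith
  obtain ⟨c, hc⟩ : ∃ c, c = γ s := ⟨_, rfl⟩
  obtain ⟨d, hd⟩ : ∃ d, d = ‖γ s - γ t‖ := ⟨_, rfl⟩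
  have hs1 : s ∈ Set.Icc (0:ℝ) 1 := ⟨hs0, hst.le.trans ht.1.2⟩
  have hfcne : f c ≠ 0 := by
    intro h
    have := hmin ⟨hs1, show f (γ s) = 0 by rw [← hc, h]⟩
    linarith
  have hsub : ∀ z, ‖z - c‖ ≤ d → z ∈ G := by
    intro z hz
    apply hball
    rw [Metric.mem_ball, dist_eq_norm]
    have : ‖z - γ t‖ ≤ ‖z - c‖ + ‖c - γ t‖ := norm_sub_le_norm_sub_add_norm_sub _ _ _
    rw [hc, ← hd] at this
    rw [hc] at hz
    linarith
  have hZc : IsCompact (Metric.closedBall c d ∩ {z | f z = 0}) := 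
    (isCompact_closedBall c d).inter_right (isClosed_eq hfc continuous_const)
  have hZne : (Metric.closedBall c d ∩ {z | f z = 0}).Nonempty := 
    ⟨γ t, by rw [Metric.mem_closedBall, dist_comm, dist_eq_norm, hc, hd], ht.2⟩
  have hncc : Continuous (fun z : ℂ => ‖z - c‖) := by fun_prop
  obtain ⟨y, hy, hymin⟩ := hZc.exists_isMinOn hZne hncc.continuousOn
  have hy1 : ‖y - c‖ ≤ d := by have := hy.1; rwa [Metric.mem_closedBall, dist_eq_norm] at this
  have hy2 : f y = 0 := hy.2
  have hr : 0 < ‖y - c‖ := by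
    rw [norm_pos_iff, sub_ne_zero]
    intro h; rw [h] at hy2; exact hfcne hy2
  have hhopf := hopf hf hr rfl hy2 (fun x hx => by
    have hxG := hsub x (hx.le.trans hy1)
    refine lt_of_le_of_ne (h0 x hxG) fun h => ?_
    have : ‖y - c‖ ≤ ‖x - c‖ := hymin ⟨by rw [Metric.mem_closedBall, dist_eq_norm]; exact hx.le.trans hy1, h.symm⟩
    linarith) (fun x hx => hL x (hsub x (hx.le.trans hy1)))
  have hloc : IsLocalMin f y := by
    filter_upwards [hG.mem_nhds (hsub y hy1)] with z hz
    rw [hy2]; exact h0 z hz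
  rw [hloc.fderiv_eq_zero] at hhopf
  simp at hhopf

end MF

namespace MF
open Complex (I)
open Filter Topology

/-- a bounded union of complementary components of `K` -/
def IsHole (K V : Set ℂ) : Prop := IsOpen V ∧ Bornology.IsBounded V ∧ Disjoint V K ∧ frontier V ⊆ K

/-- `K` with its holes filled -/
def fill (K : Set ℂ) : Set ℂ := K ∪ {x | ∃ V, IsHole K V ∧ x ∈ V}

theorem clopen_bdd {V : Set ℂ} (hV : IsOpen V) (hb : Bornology.IsBounded V) (hc : closure V ⊆ V) : V = ∅ := by
  have hcl : IsClopen V := ⟨closure_subset_iff_isClosed.1 hc, hV⟩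
  rcases isClopen_iff.1 hcl with h | h
  · exact h
  · exfalso
    rw [h] at hb
    exact NormedSpace.unbounded_univ ℝ ℂ hb

theorem hole_closure {K V : Set ℂ} (h : IsHole K V) : closure V ⊆ V ∪ K := by
  rw [closure_eq_self_union_frontier]
  exact Set.union_subset_union_right _ h.2.2.2

theorem conn_sub {K V C : Set ℂ} (h : IsHole K V) (hC : IsPreconnected C) (hCK : Disjoint C K) (hne : (C ∩ V).Nonempty) : C ⊆ V := by
  refine hC.subset_of_closure_inter_subset h.1 hne ?_
  rintro x ⟨hx, hxC⟩
  rcases hole_closure h hx with h1 | h1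
  · exact h1
  · exact absurd h1 (Set.disjoint_left.1 hCK hxC)

theorem fill_mono {K K' : Set ℂ} (hK' : IsClosed K') (h : K ⊆ K') : fill K ⊆ fill K' := by
  rintro x (hx | ⟨V, hV, hx⟩)
  · exact Or.inl (h hx)
  · by_cases hxK : x ∈ K'
    · exact Or.inl hxK
    · right
      refine ⟨V \ K', ⟨hV.1.sdiff hK', hV.2.1.subset Set.sdiff_subset, Set.disjoint_sdiff_left, ?_⟩, hx, hxK⟩
      intro p hp
      by_contra hpK
      have hpcl : p ∈ closure V := closure_mono Set.sdiff_subset (frontier_subset_closure hp)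
      rw [(hV.1.sdiff hK').frontier_eq] at hp
      rcases hole_closure hV hpcl with h1 | h1
      · exact hp.2 ⟨h1, hpK⟩
      · exact hpK (h h1)

theorem fill_sub {K K' V : Set ℂ} (hK : IsClosed K) (hV : IsHole K V) (h : K' ⊆ V) : fill K' ⊆ fill K := by
  rintro x (hx | ⟨V', hV', hx⟩)
  · exact Or.inr ⟨V, hV, h hx⟩
  · by_cases hxK : x ∈ K
    · exact Or.inl hxK
    · right
      have ho : IsOpen ((V' ∪ V) \ K) := (hV'.1.union hV.1).sdiff hK
      refine ⟨(V' ∪ V) \ K, ⟨ho, (hV'.2.1.union hV.2.1).subset Set.sdiff_subset, Set.disjoint_sdiff_left, ?_⟩, Or.inl hx, hxK⟩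
      intro p hp
      by_contra hpK
      have hpcl : p ∈ closure (V' ∪ V) := closure_mono Set.sdiff_subset (frontier_subset_closure hp)
      rw [ho.frontier_eq] at hp
      rw [closure_union] at hpcl
      rcases hpcl with h1 | h1
      · rcases hole_closure hV' h1 with h2 | h2
        · exact hp.2 ⟨Or.inl h2, hpK⟩
        · exact hp.2 ⟨Or.inr (h h2), hpK⟩
      · rcases hole_closure hV h1 with h2 | h2
        · exact hp.2 ⟨Or.inr h2, hpK⟩
        · exact hpK h2

theorem hole_disj {K K' V V' O : Set ℂ} (hV : IsHole K V) (h : K' ⊆ V) (hV' : IsHole K' V') (hO : IsPreconnected O)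
    (hKO : K ⊆ O) (hOK' : Disjoint O K') : Disjoint O V' := by
  rw [Set.disjoint_iff_inter_eq_empty]
  by_contra hne
  have hsub := conn_sub hV' hO hOK' (Set.nonempty_iff_ne_empty.2 hne)
  have := clopen_bdd (hV.1.union hV'.1) (hV.2.1.union hV'.2.1) (by
    rw [closure_union]
    rintro p (hp | hp)
    · rcases hole_closure hV hp with h1 | h1
      · exact Or.inl h1
      · exact Or.inr (hsub (hKO h1))
    · rcases hole_closure hV' hp with h1 | h1
      · exact Or.inr h1
      · exact Or.inl (h h1))
  obtain ⟨x, hx⟩ := Set.nonempty_iff_ne_empty.2 hne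
  have hx2 : x ∈ V ∪ V' := Or.inr hx.2
  rw [this] at hx2
  exact hx2

theorem hole_disj2 {K K' V V' : Set ℂ} (hV : IsHole K V) (hV' : IsHole K' V') (h1 : Disjoint K V') (h2 : Disjoint K' V)
    (h3 : Disjoint K K') : Disjoint V V' := by
  rw [Set.disjoint_iff_inter_eq_empty]
  apply clopen_bdd (hV.1.inter hV'.1) (hV.2.1.subset Set.inter_subset_left)
  intro p hp
  have ha := hole_closure hV (closure_mono Set.inter_subset_left hp)
  have hb := hole_closure hV' (closure_mono Set.inter_subset_right hp)
  rcases ha with ha | ha <;> rcases hb with hb | hb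
  · exact ⟨ha, hb⟩
  · exact absurd ha (Set.disjoint_left.1 h2 hb)
  · exact absurd hb (Set.disjoint_left.1 h1 ha)
  · exact absurd hb (Set.disjoint_left.1 h3 ha)

theorem hole_in_ball {K V : Set ℂ} (hV : IsHole K V) {R : ℝ} (hK : ∀ x ∈ K, ‖x‖ < R) : ∀ x ∈ V, ‖x‖ < R := by
  intro x hx
  have hc : IsCompact (closure V) := hV.2.1.isCompact_closure
  obtain ⟨y, hy, hmax⟩ := hc.exists_isMaxOn ⟨x, subset_closure hx⟩ continuous_norm.continuousOn
  have hxy : ‖x‖ ≤ ‖y‖ := hmax (subset_closure hx)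
  rcases hole_closure hV hy with h1 | h1
  · exfalso
    obtain ⟨ε, hε, hb⟩ := Metric.isOpen_iff.1 hV.1 y h1
    by_cases hy0 : y = 0
    · have : ((ε/2 : ℝ) : ℂ) ∈ V := hb (by
        rw [hy0, mem_ball_zero_iff, Complex.norm_real, Real.norm_eq_abs, abs_of_pos (by positivity)]; linarith)
      have h2 : ‖((ε/2 : ℝ) : ℂ)‖ ≤ ‖y‖ := hmax (subset_closure this)
      rw [hy0, norm_zero, Complex.norm_real, Real.norm_eq_abs, abs_of_pos (by positivity)] at h2
      linarith
    · have hyn : 0 < ‖y‖ := norm_pos_iff.2 hy0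
      obtain ⟨s, hs⟩ : ∃ s, s = ε / (2 * ‖y‖) := ⟨_, rfl⟩
      have hs0 : 0 < s := by rw [hs]; positivity
      have hsy : s * ‖y‖ = ε/2 := by rw [hs]; field_simp
      have : y + s • y ∈ V := hb (by
        rw [Metric.mem_ball, dist_eq_norm, add_sub_cancel_left, norm_smul, Real.norm_eq_abs, abs_of_pos hs0, hsy]; linarith)
      have h2 : ‖y + s • y‖ ≤ ‖y‖ := hmax (subset_closure this)
      have e : y + s • y = (1 + s) • y := by module
      rw [e, norm_smul, Real.norm_eq_abs, abs_of_pos (by linarith)] at h2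
      nlinarith
  · exact hxy.trans_lt (hK y h1)

/-- nodal set complement in the disc -/
def Nod (v : ℂ → ℝ) : Set ℂ := {x | ‖x‖ < 1 ∧ v x ≠ 0}

/-- nodal components -/
def Cmp (v : ℂ → ℝ) : Set (Set ℂ) := {O | ∃ x ∈ Nod v, O = connectedComponentIn (Nod v) x}

/-- superlevel sets -/
def Kt (v : ℂ → ℝ) (O : Set ℂ) (t : ℝ) : Set ℂ := O ∩ {x | t ≤ |v x|}

/-- hull -/
def Hul (v : ℂ → ℝ) (O : Set ℂ) : Set ℂ := {x | ∃ t : ℝ, 0 < t ∧ x ∈ fill (Kt v O t)}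

section
variable {v : ℂ → ℝ} 

theorem nod_open (hv : Continuous v) : IsOpen (Nod v) := 
  (isOpen_lt continuous_norm continuous_const).inter (isOpen_ne_fun hv continuous_const)

theorem cmp_open (hv : Continuous v) {O : Set ℂ} (hO : O ∈ Cmp v) : IsOpen O := by
  obtain ⟨x, hx, rfl⟩ := hO
  exact (nod_open hv).connectedComponentIn

theorem cmp_conn {O : Set ℂ} (hO : O ∈ Cmp v) : IsPreconnected O := by
  obtain ⟨x, hx, rfl⟩ := hO
  exact isPreconnected_connectedComponentIn

theorem cmp_ne {O : Set ℂ} (hO : O ∈ Cmp v) : O.Nonempty := by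
  obtain ⟨x, hx, rfl⟩ := hO
  exact ⟨x, mem_connectedComponentIn hx⟩

theorem cmp_sub {O : Set ℂ} (hO : O ∈ Cmp v) : O ⊆ Nod v := by
  obtain ⟨x, hx, rfl⟩ := hO
  exact connectedComponentIn_subset _ _

theorem cmp_max {O C : Set ℂ} (hO : O ∈ Cmp v) (hC : IsPreconnected C) (hCN : C ⊆ Nod v) (hne : (C ∩ O).Nonempty) : C ⊆ O := by
  obtain ⟨x, hx, rfl⟩ := hO
  obtain ⟨y, hyC, hyO⟩ := hne
  rw [connectedComponentIn_eq hyO]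
  exact hC.subset_connectedComponentIn hyC hCN

theorem cmp_eq {O O' : Set ℂ} (hO : O ∈ Cmp v) (hO' : O' ∈ Cmp v) (hne : (O ∩ O').Nonempty) : O = O' :=
  Set.Subset.antisymm (cmp_max hO' (cmp_conn hO) (cmp_sub hO) hne)
    (cmp_max hO (cmp_conn hO') (cmp_sub hO') (by rwa [Set.inter_comm]))

theorem cmp_disj {O O' : Set ℂ} (hO : O ∈ Cmp v) (hO' : O' ∈ Cmp v) (hne : O ≠ O') : Disjoint O O' := by
  rw [Set.disjoint_iff_inter_eq_empty]
  by_contra h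
  exact hne (cmp_eq hO hO' (Set.nonempty_iff_ne_empty.2 h))

theorem cmp_exists {x : ℂ} (hx : x ∈ Nod v) : ∃ O ∈ Cmp v, x ∈ O := 
  ⟨_, ⟨x, hx, rfl⟩, mem_connectedComponentIn hx⟩

theorem cmp_sign (hv : Continuous v) {O : Set ℂ} (hO : O ∈ Cmp v) : (∀ x ∈ O, 0 < v x) ∨ (∀ x ∈ O, v x < 0) := by
  by_contra hcon
  push Not at hcon
  obtain ⟨⟨x, hx, hx0⟩, y, hy, hy0⟩ := hcon
  have h := (cmp_conn hO).intermediate_value hx hy hv.continuousOn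
  obtain ⟨z, hz, hz0⟩ := h ⟨hx0, hy0⟩
  exact (cmp_sub hO hz).2 hz0

theorem kt_closed (hv : Continuous v) (hb : ∀ x, ‖x‖ = 1 → v x = 0) {O : Set ℂ} (hO : O ∈ Cmp v) {t : ℝ} (ht : 0 < t) : 
    IsClosed (Kt v O t) := by
  rw [← closure_subset_iff_isClosed]
  intro p hp
  have h1 : t ≤ |v p| := closure_minimal (s := Kt v O t) (t := {x | t ≤ |v x|}) Set.inter_subset_right 
    (isClosed_le continuous_const hv.abs) hp
  have h2 : ‖p‖ ≤ 1 := closure_minimal (s := Kt v O t) (t := {x | ‖x‖ ≤ 1}) (fun x hx => (cmp_sub hO hx.1).1.le) 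
    (isClosed_le continuous_norm continuous_const) hp
  have hv0 : v p ≠ 0 := by intro h; rw [h, abs_zero] at h1; linarith
  have hpN : p ∈ Nod v := ⟨lt_of_le_of_ne h2 (fun h => hv0 (hb p h)), hv0⟩
  obtain ⟨O', hO', hpO'⟩ := cmp_exists hpN
  obtain ⟨q, hq1, hq2⟩ := mem_closure_iff.1 hp O' (cmp_open hv hO') hpO'
  have : O' = O := cmp_eq hO' hO ⟨q, hq1, hq2.1⟩
  exact ⟨this ▸ hpO', h1⟩

theorem cmp_bdd {O : Set ℂ} (hO : O ∈ Cmp v) : Bornology.IsBounded O := 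
  (Metric.isBounded_ball (x := (0:ℂ)) (r := 1)).subset fun x hx => by
    rw [mem_ball_zero_iff]; exact (cmp_sub hO hx).1

theorem kt_compact (hv : Continuous v) (hb : ∀ x, ‖x‖ = 1 → v x = 0) {O : Set ℂ} (hO : O ∈ Cmp v) {t : ℝ} (ht : 0 < t) : 
    IsCompact (Kt v O t) := 
  Metric.isCompact_of_isClosed_isBounded (kt_closed hv hb hO ht) ((cmp_bdd hO).subset Set.inter_subset_left)

theorem kt_frontier (hv : Continuous v) (hb : ∀ x, ‖x‖ = 1 → v x = 0) {O : Set ℂ} (hO : O ∈ Cmp v) {t : ℝ} (ht : 0 < t) 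
    {x : ℂ} (hx : x ∈ frontier (Kt v O t)) : |v x| = t := by
  have hxK : x ∈ Kt v O t := (kt_closed hv hb hO ht).frontier_subset hx
  by_contra hne
  have hlt : t < |v x| := lt_of_le_of_ne hxK.2 (Ne.symm hne)
  apply hx.2
  rw [mem_interior_iff_mem_nhds]
  filter_upwards [(cmp_open hv hO).mem_nhds hxK.1, hv.abs.continuousAt.eventually (lt_mem_nhds hlt)] with y hy1 hy2
  exact ⟨hy1, le_of_lt hy2⟩

theorem sub_hul {O : Set ℂ} (hO : O ∈ Cmp v) : O ⊆ Hul v O := fun x hx => 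
  ⟨|v x|, abs_pos.2 (cmp_sub hO hx).2, Or.inl ⟨hx, le_refl |v x|⟩⟩

theorem hul_rel (hv : Continuous v) (hb : ∀ x, ‖x‖ = 1 → v x = 0) {O O' : Set ℂ} (hO : O ∈ Cmp v) (hO' : O' ∈ Cmp v) 
    (hne : O' ≠ O) (hme : (O' ∩ Hul v O).Nonempty) : Hul v O' ⊆ Hul v O ∧ Disjoint O (Hul v O') := by
  obtain ⟨x, hxO', t, ht, hx⟩ := hme
  have hdis := cmp_disj hO' hO hne
  rcases hx with hx | ⟨V, hV, hx⟩
  · exact absurd hx.1 (Set.disjoint_left.1 hdis hxO')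
  have hsub : O' ⊆ V := conn_sub hV (cmp_conn hO') (hdis.mono_right Set.inter_subset_left) ⟨x, hxO', hx⟩
  constructor
  · rintro y ⟨s, hs, hy⟩
    exact ⟨t, ht, fill_sub (kt_closed hv hb hO ht) hV (Set.inter_subset_left.trans hsub) hy⟩
  · rw [Set.disjoint_left]
    rintro y hyO ⟨s, hs, hy | ⟨V', hV', hy⟩⟩
    · exact Set.disjoint_left.1 hdis hy.1 hyO
    · exact Set.disjoint_left.1 (hole_disj hV (Set.inter_subset_left.trans hsub) hV' (cmp_conn hO) Set.inter_subset_left 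
        (hdis.symm.mono_right Set.inter_subset_left)) hyO hy

theorem exists_leaf (hv : Continuous v) (hb : ∀ x, ‖x‖ = 1 → v x = 0) (hfin : (Cmp v).Finite) {O : Set ℂ} (hO : O ∈ Cmp v) :
    ∃ O' ∈ Cmp v, Hul v O' ⊆ Hul v O ∧ ∀ P ∈ Cmp v, P ≠ O' → Disjoint P (Hul v O') := by
  have hf : ({O' ∈ Cmp v | Hul v O' ⊆ Hul v O}).Finite := hfin.subset (Set.sep_subset _ _)
  obtain ⟨O', hO', hmin⟩ := hf.exists_minimalFor (Hul v) _ ⟨O, hO, Set.Subset.rfl⟩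
  refine ⟨O', hO'.1, hO'.2, fun P hP hne => ?_⟩
  rw [Set.disjoint_iff_inter_eq_empty]
  by_contra h
  obtain ⟨h1, h2⟩ := hul_rel hv hb hO'.1 hP hne (Set.nonempty_iff_ne_empty.2 h)
  have h3 := hmin (j := P) ⟨hP, h1.trans hO'.2⟩ h1
  obtain ⟨x, hx⟩ := cmp_ne hO'.1
  exact Set.disjoint_left.1 h2 hx (h3 (sub_hul hO'.1 hx))

theorem hul_disj (hv : Continuous v) (hb : ∀ x, ‖x‖ = 1 → v x = 0) {O O' : Set ℂ} (hO : O ∈ Cmp v) (hO' : O' ∈ Cmp v) 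
    (hne : O ≠ O') {y : ℂ} (hy : y ∉ Nod v) (hyO : y ∈ closure O) (hyO' : y ∈ closure O') {W : Set ℂ} (hW : IsPreconnected W) 
    (hWb : ¬ Bornology.IsBounded W) (hyW : y ∈ closure W) (hWN : Disjoint W (Nod v)) : Disjoint (Hul v O) (Hul v O') := by
  -- separation
  have key : ∀ P Q : Set ℂ, P ∈ Cmp v → Q ∈ Cmp v → P ≠ Q → y ∈ closure Q → ∀ t V, IsHole (Kt v P t) V → Disjoint Q V := by
    intro P Q hP hQ hPQ hyQ t V hV
    have h1 : IsPreconnected (insert y Q) := (cmp_conn hQ).subset_closure (Set.subset_insert _ _) 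
      (Set.insert_subset hyQ subset_closure)
    have h2 : IsPreconnected (insert y W) := hW.subset_closure (Set.subset_insert _ _) (Set.insert_subset hyW subset_closure)
    have h3 : IsPreconnected (insert y Q ∪ insert y W) := h1.union y (Set.mem_insert _ _) (Set.mem_insert _ _) h2
    have hd : Disjoint (insert y Q ∪ insert y W) (Kt v P t) := by
      rw [Set.disjoint_left]
      rintro x ((rfl | hx) | (rfl | hx)) hxK
      · exact hy (cmp_sub hP hxK.1)
      · exact Set.disjoint_left.1 (cmp_disj hP hQ hPQ) hxK.1 hx
      · exact hy (cmp_sub hP hxK.1)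
      · exact Set.disjoint_left.1 hWN hx (cmp_sub hP hxK.1)
    rw [Set.disjoint_left]
    intro x hxQ hxV
    have := conn_sub hV h3 hd ⟨x, Or.inl (Or.inr hxQ), hxV⟩
    exact hWb (hV.2.1.subset ((Set.subset_insert _ _).trans (Set.subset_union_right.trans this)))
  rw [Set.disjoint_left]
  rintro x ⟨t, ht, hx⟩ ⟨t', ht', hx'⟩
  have hdd := cmp_disj hO hO' hne
  rcases hx with hx | ⟨V, hV, hx⟩ <;> rcases hx' with hx' | ⟨V', hV', hx'⟩
  · exact Set.disjoint_left.1 hdd hx.1 hx'.1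
  · exact Set.disjoint_left.1 (key O' O hO' hO hne.symm hyO t' V' hV') hx.1 hx'
  · exact Set.disjoint_left.1 (key O O' hO hO' hne hyO' t V hV) hx'.1 hx
  · refine Set.disjoint_left.1 (hole_disj2 hV hV' ?_ ?_ ?_) hx hx'
    · exact (key O' O hO' hO hne.symm hyO t' V' hV').mono_left Set.inter_subset_left
    · exact (key O O' hO hO' hne hyO' t V hV).mono_left Set.inter_subset_left
    · exact hdd.mono Set.inter_subset_left Set.inter_subset_left

end

end MF

namespace MF
open Complex (I)
open Filter Topology

theorem cmp_area_pos {v : ℂ → ℝ} (hv : ContDiff ℝ 2 v) (hb : ∀ x, ‖x‖ = 1 → v x = 0) {C : ℝ} (hC : 0 < C)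
    (hL : ∀ x, ‖x‖ < 1 → |Lp v x| ≤ C * |v x|) {O : Set ℂ} (hO : O ∈ Cmp v) (hpos : ∀ x ∈ O, 0 < v x) :
    ENNReal.ofReal (π / (4 * C)) ≤ volume O := by
  have hvc : Continuous v := hv.continuous
  have hOo := cmp_open hvc hO
  obtain ⟨x0, hx0⟩ := cmp_ne hO
  have hv0 := hpos x0 hx0
  -- the maximum
  obtain ⟨xM, hxM, hmax⟩ : ∃ xM ∈ O, ∀ x ∈ O, v x ≤ v xM := by
    obtain ⟨xM, hxM, hm⟩ := (kt_compact hvc hb hO (t := v x0) hv0).exists_isMaxOn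
      ⟨x0, hx0, show v x0 ≤ |v x0| from le_abs_self _⟩ hvc.continuousOn
    refine ⟨xM, hxM.1, fun x hx => ?_⟩
    by_cases h : v x0 ≤ v x
    · exact hm ⟨hx, show v x0 ≤ |v x| from h.trans (le_abs_self _)⟩
    · have := hm (a := x0) ⟨hx0, show v x0 ≤ |v x0| from le_abs_self _⟩
      have h3 : v x0 ≤ v xM := this
      linarith
  obtain ⟨M, hM⟩ : ∃ M, M = v xM := ⟨_, rfl⟩
  have hMp : 0 < M := by rw [hM]; exact hpos _ hxM
  have hM8 : 0 < M / 8 := by positivity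
  obtain ⟨K, hK⟩ : ∃ K, K = Kt v O (M/8) := ⟨_, rfl⟩
  have hKc : IsCompact K := hK ▸ kt_compact hvc hb hO hM8
  have hKO : K ⊆ O := by rw [hK]; exact fun x hx => hx.1
  have hfr : ∀ x ∈ frontier K, v x < M/4 := by
    intro x hx
    rw [hK] at hx
    have := kt_frontier hvc hb hO hM8 hx
    have := le_abs_self (v x)
    linarith
  obtain ⟨s, hs⟩ : ∃ s : ℕ → ℝ, s = fun j => M/4 + M/2 * (1 - (1/2)^j) := ⟨_, rfl⟩
  have hs4 : ∀ j, M/4 ≤ s j := by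
    intro j
    have : ((1:ℝ)/2)^j ≤ 1 := pow_le_one₀ (by norm_num) (by norm_num)
    rw [hs]; simp only
    have : 0 ≤ M/2 * (1 - (1/2:ℝ)^j) := mul_nonneg (by positivity) (by linarith)
    linarith
  have hs34 : ∀ j, s j ≤ 3*M/4 := by
    intro j
    have : 0 < ((1:ℝ)/2)^j := by positivity
    rw [hs]; simp only
    nlinarith
  have hsd : ∀ j, s (j+1) - s j = M/4 * (1/2)^j := by
    intro j; rw [hs]; simp only [pow_succ]; ring
  obtain ⟨a, ha⟩ : ∃ a : ℕ → ℝ, a = fun j => volume.real (K ∩ {x | s j < v x}) := ⟨_, rfl⟩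
  have hfin : ∀ S : Set ℂ, volume (K ∩ S) ≠ ⊤ := fun S =>
    ((measure_mono Set.inter_subset_left).trans_lt hKc.measure_lt_top).ne
  have hstep : ∀ j, a (j+1) ≤ C/π * 2^j * (a j)^2 := by
    intro j
    have hlt : s j < s (j+1) := by
      have := hsd j
      have : 0 < M/4 * (1/2)^j := by positivity
      linarith
    have := layer_ineq hKc hv hlt (fun x hx => (hfr x hx).trans_le (hs4 j)) (ρ := fun _ => C * M) continuous_const
      (fun x _ _ => by positivity)
      (fun x hx _ => by
        have hxO := hKO hx
        have h1 := hL x (cmp_sub hO hxO).1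
        rw [abs_of_pos (hpos x hxO)] at h1
        have h2 := neg_abs_le (Lp v x)
        have h3 := hmax x hxO
        have h4 : C * v x ≤ C * M := by rw [hM]; gcongr
        linarith)
      (F := fun z => z) (G := fun _ => 1) (fun z => hasDerivAt_id z) (differentiable_const _) (fun _ => one_ne_zero)
    simp only [norm_one, one_pow, setIntegral_const, smul_eq_mul, mul_one] at this
    have h1 : a (j+1) ≤ volume.real (K ∩ {x | s (j+1) ≤ v x}) := by
      rw [ha]
      exact measureReal_mono (fun x hx => ⟨hx.1, show s (j+1) ≤ v x from le_of_lt hx.2⟩) (hfin _)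
    have h2 : volume.real (K ∩ {x | s j < v x ∧ v x < s (j+1)}) ≤ a j := by
      rw [ha]
      exact measureReal_mono (fun x hx => ⟨hx.1, hx.2.1⟩) (hfin _)
    have h3 : volume.real (K ∩ {x | s j < v x}) = a j := by rw [ha]
    rw [h3, hsd] at this
    have ha0 : 0 ≤ a j := by rw [ha]; exact measureReal_nonneg
    have hp : 0 < ((1:ℝ)/2)^j := by positivity
    have hpi := Real.pi_pos
    have e1 : 4*π*(M/4*(1/2)^j) * a (j+1) ≤ a j * (C*M) * a j := by
      refine le_trans ?_ (this.trans ?_)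
      · gcongr
      · gcongr
    have e2 : a (j+1) ≤ (a j * (C*M) * a j) / (4*π*(M/4*(1/2)^j)) := by
      rw [le_div_iff₀ (by positivity)]; linarith
    refine e2.trans (le_of_eq ?_)
    rw [one_div, inv_pow]
    field_simp
  by_contra hcon
  push Not at hcon
  have hpi := Real.pi_pos
  have hbase : a 0 ≤ π/(4*C) := by
    have h1 : volume.real (K ∩ {x | s 0 < v x}) ≤ volume.real O :=
      measureReal_mono (fun x hx => hKO hx.1) (hcon.trans ENNReal.ofReal_lt_top).ne
    have h2 : volume.real O ≤ π/(4*C) := ENNReal.toReal_le_of_le_ofReal (by positivity) hcon.le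
    rw [ha]; exact h1.trans h2
  have hind : ∀ j, a j ≤ π/(4*C) * (1/4)^j := by
    intro j
    induction j with
    | zero => simpa using hbase
    | succ j ih =>
      have ha0 : 0 ≤ a j := by rw [ha]; exact measureReal_nonneg
      have hq : (a j)^2 ≤ (π/(4*C) * (1/4)^j)^2 := by gcongr
      have h1 := hstep j
      have h2 : C/π * 2^j * (a j)^2 ≤ C/π*2^j * (π/(4*C) * (1/4)^j)^2 := by gcongr
      have h3 : C/π*2^j * (π/(4*C) * (1/4)^j)^2 = (π/(4*C) * (1/4)^(j+1)) * (1/2)^j := by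
        have : ((1:ℝ)/2)^j = 2^j * (1/4)^j := by rw [← mul_pow]; norm_num
        rw [this, pow_succ ((1:ℝ)/4) j]
        generalize ((1:ℝ)/4)^j = q
        generalize (2:ℝ)^j = r
        field_simp
      have h4 : ((1:ℝ)/2)^j ≤ 1 := pow_le_one₀ (by norm_num) (by norm_num)
      have h5 : 0 < π/(4*C) * (1/4)^(j+1) := by positivity
      nlinarith
  have hc : 0 < volume.real (O ∩ {x | 3*M/4 < v x}) := by
    refine ENNReal.toReal_pos ?_ ?_
    · have : IsOpen (O ∩ {x | 3*M/4 < v x}) := hOo.inter (isOpen_lt continuous_const hvc)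
      exact (this.measure_pos volume ⟨xM, hxM, show 3*M/4 < v xM by rw [← hM]; linarith⟩).ne'
    · exact ((measure_mono Set.inter_subset_left).trans_lt (hcon.trans ENNReal.ofReal_lt_top)).ne
  have hlow : ∀ j, volume.real (O ∩ {x | 3*M/4 < v x}) ≤ a j := by
    intro j
    rw [ha]
    refine measureReal_mono (fun x hx => ⟨?_, show s j < v x from (hs34 j).trans_lt hx.2⟩) (hfin _)
    rw [hK]
    have h1 : 3*M/4 < v x := hx.2
    exact ⟨hx.1, show M/8 ≤ |v x| from by have := le_abs_self (v x); linarith⟩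
  have hlim : Tendsto (fun j : ℕ => π/(4*C) * ((1:ℝ)/4)^j) atTop (𝓝 (π/(4*C) * 0)) :=
    (tendsto_pow_atTop_nhds_zero_of_lt_one (by norm_num) (by norm_num)).const_mul _
  rw [mul_zero] at hlim
  obtain ⟨j, hj⟩ := (hlim.eventually (gt_mem_nhds hc)).exists
  have := hlow j
  have := hind j
  linarith

theorem nod_neg (v : ℂ → ℝ) : Nod (fun x => - v x) = Nod v := by
  ext x; simp [Nod]

theorem cmp_neg (v : ℂ → ℝ) : Cmp (fun x => - v x) = Cmp v := by
  unfold Cmp; rw [nod_neg]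

theorem kt_neg (v : ℂ → ℝ) (O : Set ℂ) (t : ℝ) : Kt (fun x => - v x) O t = Kt v O t := by
  unfold Kt; simp only [abs_neg]

theorem hul_neg (v : ℂ → ℝ) (O : Set ℂ) : Hul (fun x => - v x) O = Hul v O := by
  unfold Hul; simp only [kt_neg]

theorem Lp_neg' {v : ℂ → ℝ} (hv : ContDiff ℝ 2 v) (x : ℂ) : Lp (fun x => - v x) x = - Lp v x := by
  have := Lp_const_mul (f := v) hv (-1) x
  simp only [neg_mul, one_mul] at this
  exact this

theorem cmp_finite {v : ℂ → ℝ} (hv : ContDiff ℝ 2 v) (hb : ∀ x, ‖x‖ = 1 → v x = 0) {C : ℝ} (hC : 0 < C)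
    (hL : ∀ x, ‖x‖ < 1 → |Lp v x| ≤ C * |v x|) : (Cmp v).Finite := by
  have harea : ∀ O ∈ Cmp v, ENNReal.ofReal (π / (4 * C)) ≤ volume O := by
    intro O hO
    rcases cmp_sign hv.continuous hO with h | h
    · exact cmp_area_pos hv hb hC hL hO h
    · refine cmp_area_pos (v := fun x => - v x) hv.neg (fun x hx => by simp [hb x hx]) hC (fun x hx => ?_)
        (by rw [cmp_neg]; exact hO) (fun x hx => by have := h x hx; linarith)
      rw [Lp_neg' hv, abs_neg, abs_neg]; exact hL x hx
  have hpi := Real.pi_pos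
  have key := MeasureTheory.Measure.finite_const_le_meas_of_disjoint_iUnion (volume : Measure ℂ)
    (ε := ENNReal.ofReal (π / (4 * C))) (ENNReal.ofReal_pos.2 (by positivity))
    (As := fun O : Cmp v => (O : Set ℂ)) (fun O => (cmp_open hv.continuous O.2).measurableSet)
    (fun O O' hne => cmp_disj O.2 O'.2 (fun h => hne (Subtype.ext h)))
    (by
      refine ((measure_mono (t := Metric.ball (0:ℂ) 1) ?_).trans_lt Metric.isBounded_ball.measure_lt_top).ne
      intro x hx
      obtain ⟨O, hO⟩ := Set.mem_iUnion.1 hx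
      simpa using (cmp_sub O.2 hO).1)
  have h2 : (Set.univ : Set (Cmp v)).Finite := key.subset (fun O _ => harea O O.2)
  exact Set.finite_coe_iff.1 (Set.finite_univ_iff.1 h2)

/-- a leaf nodal domain has no holes in its superlevel sets -/
theorem leaf_fill {v : ℂ → ℝ} (hv : ContDiff ℝ 2 v) (hb : ∀ x, ‖x‖ = 1 → v x = 0) {O : Set ℂ} (hO : O ∈ Cmp v)
    (hpos : ∀ x ∈ O, 0 < v x) (hL : ∀ x, ‖x‖ < 1 → 0 ≤ v x → Lp v x ≤ 0)
    (hleaf : ∀ P ∈ Cmp v, P ≠ O → Disjoint P (Hul v O)) {t : ℝ} (ht : 0 < t) :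
    ∀ V, IsOpen V → Bornology.IsBounded V → Disjoint V (Kt v O t) → frontier V ⊆ Kt v O t → V = ∅ := by
  intro V hV hVb hVd hVf
  have hvc := hv.continuous
  by_contra hne
  obtain ⟨x, hx⟩ := Set.nonempty_iff_ne_empty.2 hne
  have hole : IsHole (Kt v O t) V := ⟨hV, hVb, hVd, hVf⟩
  have hball := hole_in_ball hole (R := 1) (fun x hx => (cmp_sub hO hx.1).1)
  have hnn : ∀ y ∈ V, 0 ≤ v y := by
    intro y hy
    by_contra hneg
    push Not at hneg
    have hyN : y ∈ Nod v := ⟨hball y hy, hneg.ne⟩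
    obtain ⟨P, hP, hyP⟩ := cmp_exists hyN
    have hPO : P ≠ O := by
      rintro rfl; have := hpos y hyP; linarith
    exact Set.disjoint_left.1 (hleaf P hP hPO) hyP ⟨t, ht, Or.inr ⟨V, hole, hy⟩⟩
  have h1 := min_weak hv hV hVb (t := t) (fun y hy => hL y (hball y hy) (hnn y hy)) (fun y hy => by
    have h := hVf hy
    have h2 : t ≤ |v y| := h.2
    rwa [abs_of_pos (hpos y h.1)] at h2) x hx
  have hxN : x ∈ Nod v := ⟨hball x hx, by linarith⟩
  obtain ⟨P, hP, hxP⟩ := cmp_exists hxN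
  by_cases hPO : P = O
  · rw [hPO] at hxP
    exact Set.disjoint_left.1 hVd hx ⟨hxP, show t ≤ |v x| from h1.trans (le_abs_self _)⟩
  · exact Set.disjoint_left.1 (hleaf P hP hPO) hxP ⟨t, ht, Or.inr ⟨V, hole, hx⟩⟩

/-- mass of a positive leaf -/
theorem leaf_big {w1 w2 f : ℂ → ℝ} (hw1 : ContDiff ℝ 2 w1) (hw2 : ContDiff ℝ 2 w2) {k : ℝ} (hk0 : 0 ≤ k) (hk1 : k < 1)
    (hb : ∀ x, ‖x‖ = 1 → w2 x - w1 x = 0)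
    (hL1 : ∀ x, ‖x‖ < 1 → Lp w1 x = f x - exp (2 * w1 x)) (hL2 : ∀ x, ‖x‖ < 1 → Lp w2 x = f x - exp (2 * w2 x))
    (hkf : ∀ x, ‖x‖ < 1 → (1-k) * exp (2 * w1 x) ≤ f x) {O : Set ℂ} (hO : O ∈ Cmp (fun x => w2 x - w1 x))
    (hpos : ∀ x ∈ O, 0 < w2 x - w1 x) 
    (hleaf : ∀ P ∈ Cmp (fun x => w2 x - w1 x), P ≠ O → Disjoint P (Hul (fun x => w2 x - w1 x) O)) :
    ∃ t > 0, 4 * π < (∫ x in Kt (fun x => w2 x - w1 x) O t, exp (2 * w1 x)) + ∫ x in Kt (fun x => w2 x - w1 x) O t, exp (2 * w2 x) := by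
  obtain ⟨v, hv⟩ : ∃ v, v = fun x => w2 x - w1 x := ⟨_, rfl⟩
  have hvx : ∀ x, w2 x - w1 x = v x := fun x => by rw [hv]
  have hvC : ContDiff ℝ 2 v := by rw [hv]; exact hw2.sub hw1
  have hKt : ∀ t, O ∩ {x | t ≤ w2 x - w1 x} = Kt v O t := by
    intro t
    ext x
    constructor
    · rintro ⟨h1, h2⟩
      have h3 : t ≤ w2 x - w1 x := h2
      rw [hvx] at h3
      exact ⟨h1, show t ≤ |v x| from h3.trans (le_abs_self _)⟩
    · rintro ⟨h1, h2⟩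
      have h3 : t ≤ |v x| := h2
      rw [← hvx, abs_of_pos (hpos x h1)] at h3
      exact ⟨h1, h3⟩
  have hb' : ∀ x, ‖x‖ = 1 → v x = 0 := fun x hx => by rw [← hvx]; exact hb x hx
  rw [← hv] at hO hleaf ⊢
  have hpos' : ∀ x ∈ O, 0 < v x := fun x hx => by rw [← hvx]; exact hpos x hx
  have hLv : ∀ x, ‖x‖ < 1 → 0 ≤ v x → Lp v x ≤ 0 := by
    intro x hx h0
    rw [hv, Lp_sub (f := w2) (g := w1) hw2 hw1, hL1 x hx, hL2 x hx]
    rw [← hvx] at h0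
    have : exp (2 * w1 x) ≤ exp (2 * w2 x) := by apply Real.exp_le_exp.2; linarith
    linarith
  have hin : ∀ x ∈ O, ‖x‖ < 1 := fun x hx => (cmp_sub hO hx).1
  have := leaf_mass (cmp_open hvC.continuous hO) (cmp_ne hO) hw1 hw2 (f := f) hk0 hk1 hpos (cmp_bdd hO)
    (fun t ht => by rw [hKt]; exact kt_compact hvC.continuous hb' hO ht)
    (fun t ht x hx => by
      rw [hKt] at hx
      have h := kt_frontier hvC.continuous hb' hO ht hx
      have hxO : x ∈ O := ((kt_closed hvC.continuous hb' hO ht).frontier_subset hx).1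
      rw [abs_of_pos (hpos' x hxO)] at h
      rw [hvx]; exact h)
    (fun x hx => hL1 x (hin x hx)) (fun x hx => hL2 x (hin x hx)) (fun x hx => hkf x (hin x hx))
    (fun t ht g hg h => by
      rw [hKt] at h ⊢
      exact approx (kt_compact hvC.continuous hb' hO ht) (leaf_fill hvC hb' hO hpos' hLv hleaf ht) hw1 hg h)
  simpa only [hKt] using this

end MF

namespace MF
open Complex (I)
open Filter Topology

theorem near_zero_pos {v : ℂ → ℝ} (hv : ContDiff ℝ 2 v) (hb : ∀ x, ‖x‖ = 1 → v x = 0)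
    (hP : ∀ x, ‖x‖ < 1 → 0 ≤ v x → Lp v x ≤ 0) {p : ℂ} (hp : ‖p‖ = 1) (hd : fderiv ℝ v p = 0) {ε : ℝ} (hε : 0 < ε)
    (h0 : ∀ x, ‖x‖ < 1 → ‖x - p‖ < ε → 0 ≤ v x) : ∀ x, ‖x‖ < 1 → ‖x - p‖ < ε → v x = 0 := by
  by_cases hz : ∃ x0, ‖x0‖ < 1 ∧ ‖x0 - p‖ < ε ∧ v x0 = 0
  · obtain ⟨x0, h1, h2, h3⟩ := hz
    have := strong_min hv (G := Metric.ball 0 1 ∩ Metric.ball p ε) (Metric.isOpen_ball.inter Metric.isOpen_ball)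
      ((convex_ball _ _).inter (convex_ball _ _))
      (fun x hx => h0 x (by simpa using hx.1) (by simpa [dist_eq_norm] using hx.2))
      (fun x hx => hP x (by simpa using hx.1) (h0 x (by simpa using hx.1) (by simpa [dist_eq_norm] using hx.2)))
      (x0 := x0) ⟨by simpa using h1, by simpa [dist_eq_norm] using h2⟩ h3
    exact fun x hx hx2 => this x ⟨by simpa using hx, by simpa [dist_eq_norm] using hx2⟩
  · exfalso
    push Not at hz
    obtain ⟨s, hs⟩ : ∃ s : ℝ, s = min (ε/2) (1/2) := ⟨_, rfl⟩
    have hs0 : 0 < s := by rw [hs]; positivity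
    have hs1 : s ≤ ε/2 := hs ▸ min_le_left _ _
    have hs2 : s ≤ 1/2 := hs ▸ min_le_right _ _
    obtain ⟨c, hc⟩ : ∃ c : ℂ, c = ((1 - s : ℝ) : ℂ) * p := ⟨_, rfl⟩
    have hcn : ‖c‖ = 1 - s := by
      rw [hc, norm_mul, hp, Complex.norm_real, mul_one, Real.norm_eq_abs, abs_of_pos (by linarith)]
    have hcp : ‖p - c‖ = s := by
      have : p - c = (s : ℂ) * p := by rw [hc]; push_cast; ring
      rw [this, norm_mul, hp, Complex.norm_real, mul_one, Real.norm_eq_abs, abs_of_pos hs0]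
    have hin : ∀ x, ‖x - c‖ < s → ‖x‖ < 1 ∧ ‖x - p‖ < ε := by
      intro x hx
      have h1 : ‖x‖ ≤ ‖x - c‖ + ‖c‖ := by simpa using norm_add_le (x - c) c
      have h2 : ‖x - p‖ ≤ ‖x - c‖ + ‖p - c‖ := by
        have := norm_sub_le (x - c) (p - c)
        simpa using this
      constructor <;> linarith
    have hpos : ∀ x, ‖x - c‖ < s → 0 < v x := fun x hx =>
      lt_of_le_of_ne (h0 x (hin x hx).1 (hin x hx).2) (fun h => hz x (hin x hx).1 (hin x hx).2 h.symm)
    have := hopf hv hs0 hcp (hb p hp) hpos (fun x hx => hP x (hin x hx).1 (hpos x hx).le)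
    rw [hd] at this
    simp at this

theorem near_zero {v : ℂ → ℝ} (hv : ContDiff ℝ 2 v) (hb : ∀ x, ‖x‖ = 1 → v x = 0)
    (hP : ∀ x, ‖x‖ < 1 → 0 ≤ v x → Lp v x ≤ 0) (hN : ∀ x, ‖x‖ < 1 → v x ≤ 0 → 0 ≤ Lp v x)
    {p : ℂ} (hp : ‖p‖ = 1) (hd : fderiv ℝ v p = 0) {ε : ℝ} (hε : 0 < ε)
    (h0 : (∀ x, ‖x‖ < 1 → ‖x - p‖ < ε → 0 ≤ v x) ∨ (∀ x, ‖x‖ < 1 → ‖x - p‖ < ε → v x ≤ 0)) :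
    ∀ x, ‖x‖ < 1 → ‖x - p‖ < ε → v x = 0 := by
  rcases h0 with h0 | h0
  · exact near_zero_pos hv hb hP hp hd hε h0
  · have := near_zero_pos (v := fun x => - v x) hv.neg (fun x hx => by simp [hb x hx])
      (fun x hx h => by rw [Lp_neg' hv]; have := hN x hx (by linarith); linarith) hp
      (by rw [fderiv_fun_neg, hd, neg_zero]) hε (fun x hx hx2 => by have := h0 x hx hx2; linarith)
    intro x hx hx2
    have := this x hx hx2
    linarith

theorem interior_zero {v : ℂ → ℝ} (hv : ContDiff ℝ 2 v) 
    (hP : ∀ x, ‖x‖ < 1 → 0 ≤ v x → Lp v x ≤ 0) (hN : ∀ x, ‖x‖ < 1 → v x ≤ 0 → 0 ≤ Lp v x)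
    {y : ℂ} (hy : v y = 0) {ε : ℝ} (hε : 0 < ε) (hin : ∀ x, ‖x - y‖ < ε → ‖x‖ < 1)
    (h0 : (∀ x, ‖x - y‖ < ε → 0 ≤ v x) ∨ (∀ x, ‖x - y‖ < ε → v x ≤ 0)) :
    ∀ x, ‖x - y‖ < ε → v x = 0 := by
  have hm : ∀ x, x ∈ Metric.ball y ε ↔ ‖x - y‖ < ε := fun x => by rw [Metric.mem_ball, dist_eq_norm]
  rcases h0 with h0 | h0
  · have := strong_min hv Metric.isOpen_ball (convex_ball y ε) (fun x hx => h0 x ((hm x).1 hx)) 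
      (fun x hx => hP x (hin x ((hm x).1 hx)) (h0 x ((hm x).1 hx))) (Metric.mem_ball_self hε) hy
    exact fun x hx => this x ((hm x).2 hx)
  · have := strong_min (f := fun x => - v x) hv.neg Metric.isOpen_ball (convex_ball y ε) 
      (fun x hx => by have := h0 x ((hm x).1 hx); linarith) 
      (fun x hx => by rw [Lp_neg' hv]; have := hN x (hin x ((hm x).1 hx)) (h0 x ((hm x).1 hx)); linarith)
      (Metric.mem_ball_self hε) (by simp [hy])
    intro x hx
    have := this x ((hm x).2 hx)
    linarith

theorem ray_conn (p : ℂ) (S : Set ℝ) (hS : IsPreconnected S) : IsPreconnected ((fun τ : ℝ => (τ : ℂ) * p) '' S) :=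
  hS.image _ (by fun_prop)

theorem ray_unbdd {p : ℂ} (hp : ‖p‖ = 1) : ¬ Bornology.IsBounded ((fun τ : ℝ => (τ : ℂ) * p) '' Set.Ioi 1) := by
  intro h
  obtain ⟨R, hR⟩ := h.exists_norm_le
  have := hR (((|R| + 2 : ℝ) : ℂ) * p) ⟨|R| + 2, show 1 < |R| + 2 by have := abs_nonneg R; linarith, rfl⟩
  rw [norm_mul, hp, Complex.norm_real, mul_one, Real.norm_eq_abs, abs_of_pos (by positivity)] at this
  have := le_abs_self R
  linarith

theorem find_y {v : ℂ → ℝ} (hv : ContDiff ℝ 2 v) (hb : ∀ x, ‖x‖ = 1 → v x = 0)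
    (hP : ∀ x, ‖x‖ < 1 → 0 ≤ v x → Lp v x ≤ 0) (hN : ∀ x, ‖x‖ < 1 → v x ≤ 0 → 0 ≤ Lp v x)
    {p : ℂ} (hp : ‖p‖ = 1) (hd : fderiv ℝ v p = 0) {x1 : ℂ} (hx1 : ‖x1‖ < 1) (hvx1 : v x1 ≠ 0) :
    ∃ (y : ℂ) (W : Set ℂ), y ∉ Nod v ∧ IsPreconnected W ∧ ¬ Bornology.IsBounded W ∧ y ∈ closure W ∧ Disjoint W (Nod v) ∧
      y ∈ closure {x | ‖x‖ < 1 ∧ 0 < v x} ∧ y ∈ closure {x | ‖x‖ < 1 ∧ v x < 0} := by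
  have hvc := hv.continuous
  have hnear : ∀ y, y ∉ closure {x | ‖x‖ < 1 ∧ 0 < v x} ∨ y ∉ closure {x | ‖x‖ < 1 ∧ v x < 0} → ∃ ε > 0, 
      (∀ x, ‖x‖ < 1 → ‖x - y‖ < ε → 0 ≤ v x) ∨ (∀ x, ‖x‖ < 1 → ‖x - y‖ < ε → v x ≤ 0) := by
    intro y hy
    rcases hy with h | h
    · rw [Metric.mem_closure_iff] at h
      push Not at h
      obtain ⟨ε, hε, h⟩ := h
      refine ⟨ε, hε, Or.inr fun x hx hxy => ?_⟩
      by_contra hc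
      push Not at hc
      have := h x ⟨hx, hc⟩
      rw [dist_comm, dist_eq_norm] at this
      linarith
    · rw [Metric.mem_closure_iff] at h
      push Not at h
      obtain ⟨ε, hε, h⟩ := h
      refine ⟨ε, hε, Or.inl fun x hx hxy => ?_⟩
      by_contra hc
      push Not at hc
      have := h x ⟨hx, hc⟩
      rw [dist_comm, dist_eq_norm] at this
      linarith
  by_cases hA : p ∈ closure {x | ‖x‖ < 1 ∧ 0 < v x} ∧ p ∈ closure {x | ‖x‖ < 1 ∧ v x < 0}
  · refine ⟨p, _, fun h => absurd h.1 (by rw [hp]; exact lt_irrefl _), ray_conn p (Set.Ioi 1) isPreconnected_Ioi, ray_unbdd hp, ?_, ?_, hA⟩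
    · have h1 : (1:ℝ) ∈ closure (Set.Ioi (1:ℝ)) := by rw [closure_Ioi]; exact Set.self_mem_Ici
      have hcont : Continuous (fun τ : ℝ => (τ : ℂ) * p) := by fun_prop
      have := image_closure_subset_closure_image hcont ⟨1, h1, rfl⟩
      simpa using this
    · rw [Set.disjoint_left]
      rintro _ ⟨τ, hτ, rfl⟩ hh
      have h2 : 1 < τ := hτ
      have := hh.1
      rw [norm_mul, hp, Complex.norm_real, mul_one, Real.norm_eq_abs, abs_of_pos (by linarith)] at this
      linarith
  · rw [not_and_or] at hA
    obtain ⟨ε, hε, hs⟩ := hnear p hA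
    have hz := near_zero hv hb hP hN hp hd hε hs
    have hNo := nod_open hvc
    obtain ⟨Z, hZ⟩ : ∃ Z, Z = interior (Nod v)ᶜ := ⟨_, rfl⟩
    have hZo : IsOpen Z := hZ ▸ isOpen_interior
    have hZN : closure Z ⊆ (Nod v)ᶜ := by
      rw [hZ]; exact closure_minimal interior_subset hNo.isClosed_compl
    have hball : Metric.ball p ε ⊆ Z := by
      rw [hZ]
      refine interior_maximal ?_ Metric.isOpen_ball
      intro x hx hxN
      rw [Metric.mem_ball, dist_eq_norm] at hx
      exact hxN.2 (hz x hxN.1 hx)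
    have hpZ : p ∈ Z := hball (Metric.mem_ball_self hε)
    have hout : {x : ℂ | 1 < ‖x‖} ⊆ Z := by
      rw [hZ]
      refine interior_maximal ?_ (isOpen_lt continuous_const continuous_norm)
      intro x hx hxN
      have h1 : 1 < ‖x‖ := hx
      have := hxN.1
      linarith
    obtain ⟨W, hW⟩ : ∃ W, W = connectedComponentIn Z p := ⟨_, rfl⟩
    have hWo : IsOpen W := hW ▸ hZo.connectedComponentIn
    have hWZ : W ⊆ Z := hW ▸ connectedComponentIn_subset _ _
    have hpW : p ∈ W := hW ▸ mem_connectedComponentIn hpZ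
    have hWp : IsPreconnected W := hW ▸ isPreconnected_connectedComponentIn
    have hray : (fun τ : ℝ => (τ : ℂ) * p) '' Set.Ici 1 ⊆ W := by
      rw [hW]
      refine (ray_conn p (Set.Ici 1) isPreconnected_Ici).subset_connectedComponentIn ⟨1, Set.self_mem_Ici, by simp⟩ ?_
      rintro _ ⟨τ, hτ, rfl⟩
      have h1 : 1 ≤ τ := hτ
      rcases h1.eq_or_lt with h | h
      · simpa [← h] using hpZ
      · refine hout (show 1 < ‖(τ:ℂ) * p‖ from ?_)
        rw [norm_mul, hp, Complex.norm_real, mul_one, Real.norm_eq_abs, abs_of_pos (by linarith)]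
        exact h
    have hWu : ¬ Bornology.IsBounded W := fun h => ray_unbdd hp (h.subset ((Set.image_mono Set.Ioi_subset_Ici_self).trans hray))
    have hD : IsPreconnected (Metric.ball (0:ℂ) 1) := (convex_ball _ _).isPreconnected
    have hWD : (Metric.ball (0:ℂ) 1 ∩ W).Nonempty := by
      have hpc : p ∈ closure (Metric.ball (0:ℂ) 1) := by
        rw [closure_ball _ one_ne_zero]; simp [hp]
      obtain ⟨z, hz1, hz2⟩ := mem_closure_iff.1 hpc W hWo hpW
      exact ⟨z, hz2, hz1⟩
    have hx1W : x1 ∉ W := fun h => hZN (subset_closure (hWZ h)) ⟨hx1, hvx1⟩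
    obtain ⟨y, hyD, hyW⟩ : ∃ y, ‖y‖ < 1 ∧ y ∈ frontier W := by
      by_contra hcon
      push Not at hcon
      have := hD.subset_of_closure_inter_subset hWo hWD (fun x hx => by
        by_contra hxW
        refine hcon x (by simpa using hx.2) ?_
        rw [hWo.frontier_eq]; exact ⟨hx.1, hxW⟩)
      exact hx1W (this (by simpa using hx1))
    rw [hWo.frontier_eq] at hyW
    have hyN : y ∉ Nod v := hZN (closure_mono hWZ hyW.1)
    have hvy : v y = 0 := by
      by_contra h; exact hyN ⟨hyD, h⟩
    refine ⟨y, W, hyN, hWp, hWu, hyW.1, ?_, ?_⟩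
    · rw [Set.disjoint_left]; exact fun x hx => hZN (subset_closure (hWZ hx))
    · by_contra hcon
      rw [not_and_or] at hcon
      obtain ⟨δ, hδ, hs⟩ := hnear y hcon
      obtain ⟨r, hr⟩ : ∃ r, r = min δ (1 - ‖y‖) := ⟨_, rfl⟩
      have hr0 : 0 < r := by rw [hr]; exact lt_min hδ (by linarith)
      have hr1 : r ≤ δ := hr ▸ min_le_left _ _
      have hr2 : r ≤ 1 - ‖y‖ := hr ▸ min_le_right _ _
      have hin : ∀ x, ‖x - y‖ < r → ‖x‖ < 1 := by
        intro x hx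
        have h1 : ‖x‖ ≤ ‖x - y‖ + ‖y‖ := by simpa using norm_add_le (x - y) y
        linarith
      have hz0 := interior_zero hv hP hN hvy hr0 hin (hs.imp 
        (fun h x hx => h x (hin x hx) (by linarith)) (fun h x hx => h x (hin x hx) (by linarith)))
      have hBZ : Metric.ball y r ⊆ Z := by
        rw [hZ]
        refine interior_maximal ?_ Metric.isOpen_ball
        intro x hx hxN
        rw [Metric.mem_ball, dist_eq_norm] at hx
        exact hxN.2 (hz0 x hx)
      obtain ⟨z, hz1, hz2⟩ := mem_closure_iff.1 hyW.1 _ Metric.isOpen_ball (Metric.mem_ball_self hr0)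
      have h1 := (convex_ball y r).isPreconnected.subset_connectedComponentIn hz1 hBZ
      rw [hW] at hz2
      rw [← connectedComponentIn_eq hz2, ← hW] at h1
      exact hyW.2 (h1 (Metric.mem_ball_self hr0))

theorem leaf_any {w1 w2 f : ℂ → ℝ} (hw1 : ContDiff ℝ 2 w1) (hw2 : ContDiff ℝ 2 w2) {k : ℝ} (hk0 : 0 ≤ k) (hk1 : k < 1)
    (hb : ∀ x, ‖x‖ = 1 → w2 x - w1 x = 0)
    (hL1 : ∀ x, ‖x‖ < 1 → Lp w1 x = f x - exp (2 * w1 x)) (hL2 : ∀ x, ‖x‖ < 1 → Lp w2 x = f x - exp (2 * w2 x))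
    (hkf1 : ∀ x, ‖x‖ < 1 → (1-k) * exp (2 * w1 x) ≤ f x) (hkf2 : ∀ x, ‖x‖ < 1 → (1-k) * exp (2 * w2 x) ≤ f x)
    {O : Set ℂ} (hO : O ∈ Cmp (fun x => w2 x - w1 x))
    (hleaf : ∀ P ∈ Cmp (fun x => w2 x - w1 x), P ≠ O → Disjoint P (Hul (fun x => w2 x - w1 x) O)) :
    4 * π < ∫ x in O, (exp (2 * w1 x) + exp (2 * w2 x)) := by
  have hc1 : Continuous (fun x => exp (2 * w1 x)) := by have := hw1.continuous; fun_prop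
  have hc2 : Continuous (fun x => exp (2 * w2 x)) := by have := hw2.continuous; fun_prop
  have hi : ∀ {g : ℂ → ℝ}, Continuous g → ∀ S ⊆ O, IntegrableOn g S := fun hg S hS => 
    (hg.continuousOn.integrableOn_compact (isCompact_closedBall (0:ℂ) 1)).mono_set (fun x hx => by
      have := (cmp_sub hO (hS hx)).1; simpa using this.le)
  have hfin : ∀ K ⊆ O, 4*π < (∫ x in K, exp (2 * w1 x)) + ∫ x in K, exp (2 * w2 x) → 
      4 * π < ∫ x in O, (exp (2 * w1 x) + exp (2 * w2 x)) := by
    intro K hK h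
    refine h.trans_le ?_
    rw [← integral_add (hi hc1 K hK) (hi hc2 K hK)]
    exact setIntegral_mono_set (hi (hc1.add hc2) O subset_rfl) (Eventually.of_forall fun x => by 
      show 0 ≤ exp (2 * w1 x) + exp (2 * w2 x); positivity) (HasSubset.Subset.eventuallyLE hK)
  have hvc : Continuous (fun x => w2 x - w1 x) := hw2.continuous.sub hw1.continuous
  rcases cmp_sign hvc hO with h | h
  · obtain ⟨t, ht, hm⟩ := leaf_big hw1 hw2 hk0 hk1 hb hL1 hL2 hkf1 hO h hleaf
    exact hfin _ (fun x hx => hx.1) hm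
  · have hneg : (fun x => w1 x - w2 x) = fun x => -(w2 x - w1 x) := by funext x; ring
    have hC : Cmp (fun x => w1 x - w2 x) = Cmp (fun x => w2 x - w1 x) := by rw [hneg]; exact cmp_neg _
    have hH : Hul (fun x => w1 x - w2 x) O = Hul (fun x => w2 x - w1 x) O := by rw [hneg]; exact hul_neg _ _
    obtain ⟨t, ht, hm⟩ := leaf_big hw2 hw1 hk0 hk1 (fun x hx => by have := hb x hx; linarith) hL2 hL1 hkf2 
      (hC ▸ hO) (fun x hx => by have := h x hx; linarith) (by rw [hC, hH]; exact hleaf)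
    rw [add_comm] at hm
    exact hfin _ (fun x hx => hx.1) hm

theorem exists_cmp_closure {v : ℂ → ℝ} (hfin : (Cmp v).Finite) {y : ℂ} {S : Set ℂ} (hS : S ⊆ Nod v) (hy : y ∈ closure S) :
    ∃ O ∈ Cmp v, y ∈ closure (O ∩ S) := by
  have h1 : S ⊆ ⋃ O ∈ Cmp v, O ∩ S := by
    intro x hx
    obtain ⟨O, hO, hxO⟩ := cmp_exists (hS hx)
    exact Set.mem_biUnion hO ⟨hxO, hx⟩
  have h2 := closure_mono h1 hy
  rw [hfin.closure_biUnion] at h2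
  simpa using h2

theorem core {w1 w2 f : ℂ → ℝ} (hw1 : ContDiff ℝ 2 w1) (hw2 : ContDiff ℝ 2 w2) {k : ℝ} (hk0 : 0 ≤ k) (hk1 : k < 1)
    (hb : ∀ x, ‖x‖ = 1 → w2 x - w1 x = 0)
    (hL1 : ∀ x, ‖x‖ < 1 → Lp w1 x = f x - exp (2 * w1 x)) (hL2 : ∀ x, ‖x‖ < 1 → Lp w2 x = f x - exp (2 * w2 x))
    (hkf1 : ∀ x, ‖x‖ < 1 → (1-k) * exp (2 * w1 x) ≤ f x) (hkf2 : ∀ x, ‖x‖ < 1 → (1-k) * exp (2 * w2 x) ≤ f x)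
    (hmass : ∫ x in Metric.ball (0:ℂ) 1, (exp (2 * w1 x) + exp (2 * w2 x)) ≤ 8 * π)
    {p : ℂ} (hp : ‖p‖ = 1) (hd : fderiv ℝ (fun x => w2 x - w1 x) p = 0) : ∀ x, ‖x‖ < 1 → w2 x = w1 x := by
  obtain ⟨v, hv⟩ : ∃ v, v = fun x => w2 x - w1 x := ⟨_, rfl⟩
  have hvx : ∀ x, w2 x - w1 x = v x := fun x => by rw [hv]
  have hvC : ContDiff ℝ 2 v := by rw [hv]; exact hw2.sub hw1
  have hvc := hvC.continuous
  have hb' : ∀ x, ‖x‖ = 1 → v x = 0 := fun x hx => by rw [← hvx]; exact hb x hx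
  have hLv : ∀ x, ‖x‖ < 1 → Lp v x = exp (2 * w1 x) - exp (2 * w2 x) := by
    intro x hx
    rw [hv, Lp_sub (f := w2) (g := w1) hw2 hw1, hL1 x hx, hL2 x hx]; ring
  have hP : ∀ x, ‖x‖ < 1 → 0 ≤ v x → Lp v x ≤ 0 := by
    intro x hx h0
    rw [hLv x hx]
    rw [← hvx] at h0
    have : exp (2 * w1 x) ≤ exp (2 * w2 x) := by apply Real.exp_le_exp.2; linarith
    linarith
  have hN : ∀ x, ‖x‖ < 1 → v x ≤ 0 → 0 ≤ Lp v x := by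
    intro x hx h0
    rw [hLv x hx]
    rw [← hvx] at h0
    have : exp (2 * w2 x) ≤ exp (2 * w1 x) := by apply Real.exp_le_exp.2; linarith
    linarith
  by_contra hcon
  push Not at hcon
  obtain ⟨x1, hx1, hne⟩ := hcon
  have hvx1 : v x1 ≠ 0 := by rw [← hvx]; exact sub_ne_zero.2 hne
  have hc12 : Continuous (fun x => exp (2 * w1 x) + exp (2 * w2 x)) := by 
    have := hw1.continuous; have := hw2.continuous; fun_prop
  obtain ⟨B, hB⟩ := (isCompact_closedBall (0:ℂ) 1).exists_bound_of_continuousOn hc12.continuousOn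
  have hfin : (Cmp v).Finite := by
    refine cmp_finite hvC hb' (C := 2 * (|B| + 1)) (by positivity) (fun x hx => ?_)
    have h1 := hB x (by simpa using hx.le)
    rw [Real.norm_eq_abs, abs_of_pos (by positivity)] at h1
    have hB' := le_abs_self B
    have e1 := Real.exp_pos (2 * w1 x)
    have e2 := Real.exp_pos (2 * w2 x)
    have hexp : ∀ a b : ℝ, exp a ≤ |B| + 1 → exp a - exp b ≤ (|B| + 1) * |a - b| := by
      intro a b ha
      have h2 := Real.add_one_le_exp (b - a)
      have h3 : exp b = exp a * exp (b - a) := by rw [← Real.exp_add]; congr 1; ring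
      have h4 : exp a - exp b ≤ exp a * (a - b) := by
        rw [h3]; nlinarith [Real.exp_pos a]
      have h5 : exp a * (a - b) ≤ exp a * |a - b| := by gcongr; exact le_abs_self _
      have h6 : exp a * |a - b| ≤ (|B| + 1) * |a - b| := by gcongr
      linarith
    have h7 : |2 * w1 x - 2 * w2 x| = 2 * |v x| := by
      rw [← hvx, ← mul_sub, abs_mul, abs_sub_comm]; norm_num
    have h8 : |2 * w2 x - 2 * w1 x| = 2 * |v x| := by rw [abs_sub_comm, h7]
    rw [hLv x hx, abs_le]
    have h9 := hexp (2 * w1 x) (2 * w2 x) (by linarith)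
    have h10 := hexp (2 * w2 x) (2 * w1 x) (by linarith)
    rw [h7] at h9
    rw [h8] at h10
    constructor <;> linarith
  rw [← hv] at hd
  obtain ⟨y, W, hyN, hWp, hWu, hyW, hWN, hyp, hym⟩ := find_y hvC hb' hP hN hp hd hx1 hvx1
  obtain ⟨Op, hOp, hyOp⟩ := exists_cmp_closure hfin (fun x hx => ⟨hx.1, hx.2.ne'⟩) hyp
  obtain ⟨Om, hOm, hyOm⟩ := exists_cmp_closure hfin (fun x hx => ⟨hx.1, hx.2.ne⟩) hym
  have hpm : Op ≠ Om := by
    rintro rfl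
    obtain ⟨a, ha⟩ := closure_nonempty_iff.1 ⟨y, hyOp⟩
    obtain ⟨b, hb⟩ := closure_nonempty_iff.1 ⟨y, hyOm⟩
    have ha2 : 0 < v a := ha.2.2
    have hb2 : v b < 0 := hb.2.2
    rcases cmp_sign hvc hOp with h | h
    · have := h b hb.1; linarith
    · have := h a ha.1; linarith
  have hdis := hul_disj hvc hb' hOp hOm hpm hyN (closure_mono Set.inter_subset_left hyOp) (closure_mono Set.inter_subset_left hyOm) hWp hWu hyW hWN
  obtain ⟨Lp', hLp, hLpH, hLpl⟩ := exists_leaf hvc hb' hfin hOp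
  obtain ⟨Lm, hLm, hLmH, hLml⟩ := exists_leaf hvc hb' hfin hOm
  have hLL : Disjoint Lp' Lm := hdis.mono ((sub_hul hLp).trans hLpH) ((sub_hul hLm).trans hLmH)
  have m1 := leaf_any hw1 hw2 hk0 hk1 hb hL1 hL2 hkf1 hkf2 (O := Lp') (by rw [← hv]; exact hLp) (by rw [← hv]; exact hLpl)
  have m2 := leaf_any hw1 hw2 hk0 hk1 hb hL1 hL2 hkf1 hkf2 (O := Lm) (by rw [← hv]; exact hLm) (by rw [← hv]; exact hLml)
  have hsub : Lp' ∪ Lm ⊆ Metric.ball (0:ℂ) 1 := by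
    rintro x (hx | hx)
    · simpa using (cmp_sub hLp hx).1
    · simpa using (cmp_sub hLm hx).1
  have hintg : IntegrableOn (fun x => exp (2 * w1 x) + exp (2 * w2 x)) (Metric.ball (0:ℂ) 1) :=
    (hc12.continuousOn.integrableOn_compact (isCompact_closedBall (0:ℂ) 1)).mono_set Metric.ball_subset_closedBall
  have h3 := setIntegral_union hLL (cmp_open hvc hLm).measurableSet (hintg.mono_set (Set.subset_union_left.trans hsub)) 
    (hintg.mono_set (Set.subset_union_right.trans hsub))
  have h4 := setIntegral_mono_set hintg (Eventually.of_forall fun x => by 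
      show 0 ≤ exp (2 * w1 x) + exp (2 * w2 x); positivity) (HasSubset.Subset.eventuallyLE hsub)
  linarith

end MF

namespace MF
open Complex (I)
open Filter Topology

theorem clm_split (L : ℂ →L[ℝ] ℝ) (v : ℂ) : L v = v.re * L 1 + v.im * L I := by
  have : v = v.re • (1:ℂ) + v.im • I := by simp
  conv_lhs => rw [this]
  rw [map_add, map_smul, map_smul, smul_eq_mul, smul_eq_mul]

theorem flux_zero {s : ℂ → ℝ} (hs : ContDiff ℝ 2 s) (hr : ∀ z : ℂ, ‖z‖ = 1 → fderiv ℝ s z z = 0) :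
    ∫ z in Metric.ball (0:ℂ) 1, Lp s z = 0 := by
  obtain ⟨S, S', hS'c, hSd, hS'0, hS'1, hS0, hS'z, hS1, hS'o, hSn, hSl⟩ := exists_cutoff (δ := 1) one_pos
  -- radial derivative
  obtain ⟨q, hq⟩ : ∃ q : ℂ → ℝ, q = fun z => fderiv ℝ s z z := ⟨_, rfl⟩
  have hqC : ContDiff ℝ 1 q := by
    rw [hq]; exact (hs.fderiv_right (m := 1) (by norm_num)).clm_apply contDiff_id
  obtain ⟨L, hL⟩ := (isCompact_closedBall (0:ℂ) 1).exists_bound_of_continuousOn (hqC.continuous_fderiv (by norm_num)).continuousOn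
  have hL0 : 0 ≤ L := (norm_nonneg _).trans (hL 0 (by simp))
  have hqb : ∀ z : ℂ, ‖z‖ ≤ 1 → |q z| ≤ L * (1 - ‖z‖) := by
    intro z hz
    by_cases h0 : z = 0
    · rw [h0, hq]; simp [hL0]
    · have hn : 0 < ‖z‖ := norm_pos_iff.2 h0
      obtain ⟨e, he⟩ : ∃ e : ℂ, e = ((‖z‖⁻¹ : ℝ) : ℂ) * z := ⟨_, rfl⟩
      have hen : ‖e‖ = 1 := by
        rw [he, norm_mul, Complex.norm_real, Real.norm_eq_abs, abs_of_pos (by positivity)]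
        field_simp
      have hze : ‖z - e‖ = 1 - ‖z‖ := by
        have h1 : e - z = ((‖z‖⁻¹ - 1 : ℝ) : ℂ) * z := by rw [he]; push_cast; ring
        have h2 : 0 ≤ ‖z‖⁻¹ - 1 := by
          rw [sub_nonneg]; exact (one_le_inv₀ hn).2 hz
        rw [norm_sub_rev, h1, norm_mul, Complex.norm_real, Real.norm_eq_abs, abs_of_nonneg h2]
        field_simp
      have := (convex_closedBall (0:ℂ) 1).norm_image_sub_le_of_norm_fderiv_le (𝕜 := ℝ) (f := q) (C := L)
        (fun x _ => hqC.differentiable (by norm_num) x) hL (x := e) (y := z) (by simp [hen]) (by simpa using hz)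
      rw [hze, Real.norm_eq_abs] at this
      have hqe : q e = 0 := by rw [hq]; exact hr e hen
      rwa [hqe, sub_zero] at this
  obtain ⟨ψ, hψ⟩ : ∃ ψ : ℕ → ℂ → ℝ, ψ = fun (n : ℕ) z => S (((n:ℝ)+1) * (1 - Complex.normSq z)) := ⟨_, rfl⟩
  have hSC : ContDiff ℝ 1 S := by
    rw [contDiff_one_iff_deriv]
    refine ⟨fun x => (hSd x).differentiableAt, ?_⟩
    rw [show deriv S = S' from funext fun x => (hSd x).deriv]; exact hS'c
  have hψC : ∀ n, ContDiff ℝ 1 (ψ n) := by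
    intro n; rw [hψ]
    exact hSC.comp (contDiff_const.mul (contDiff_const.sub contDiff_normSq))
  have hn2 : ∀ z : ℂ, Complex.normSq z = ‖z‖^2 := fun z => Complex.normSq_eq_norm_sq z
  have hψ0 : ∀ n z, 1 ≤ ‖z‖ → ψ n z = 0 := by
    intro n z hz
    rw [hψ]
    refine hS0 _ ?_
    rw [hn2]
    have : 1 ≤ ‖z‖^2 := by nlinarith
    have : (0:ℝ) < (n:ℝ) + 1 := by positivity
    nlinarith
  have hψc : ∀ n, HasCompactSupport (ψ n) := fun n => HasCompactSupport.intro (isCompact_closedBall (0:ℂ) 1) (fun z hz => by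
    refine hψ0 n z ?_
    simp at hz; exact hz.le)
  have hgr : ∀ n z, gr (ψ n) s z = -(((n:ℝ)+1) * S' (((n:ℝ)+1) * (1 - Complex.normSq z))) * 2 * q z := by
    intro n z
    have hk : ∀ t : ℝ, 0 ≤ t → HasDerivAt (fun t => S (((n:ℝ)+1) * (1 - t))) (-(((n:ℝ)+1) * S' (((n:ℝ)+1) * (1 - t)))) t := by
      intro t _
      have h1 : HasDerivAt (fun t : ℝ => ((n:ℝ)+1) * (1 - t)) (-((n:ℝ)+1)) t := by
        have := ((hasDerivAt_id t).const_sub 1).const_mul ((n:ℝ)+1)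
        simpa using this
      exact ((hSd _).comp t h1).congr_deriv (by ring)
    have h1 := fderiv_radial hk z
    have e : ψ n = fun z => S (((n:ℝ)+1) * (1 - Complex.normSq z)) := by rw [hψ]
    unfold gr
    rw [e, h1, h1, hq]
    simp only
    rw [clm_split (fderiv ℝ s z) z]
    simp; ring
  have hgrb : ∀ n z, ‖gr (ψ n) s z‖ ≤ (Metric.closedBall (0:ℂ) 1).indicator (fun _ => 4 * L) z := by
    intro n z
    rw [hgr]
    have hnp : (0:ℝ) < (n:ℝ) + 1 := by positivity
    by_cases hz : ‖z‖ ≤ 1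
    · rw [Set.indicator_of_mem (by simpa using hz)]
      by_cases hx : 1 ≤ ((n:ℝ)+1) * (1 - Complex.normSq z)
      · rw [hS'o _ hx]; simp [hL0]
      · push Not at hx
        have hb := hqb z hz
        have h1 := hS'1 (((n:ℝ)+1) * (1 - Complex.normSq z))
        have h2 := hS'0 (((n:ℝ)+1) * (1 - Complex.normSq z))
        rw [norm_mul, norm_mul, norm_neg, norm_mul, Real.norm_eq_abs, Real.norm_eq_abs, Real.norm_eq_abs, Real.norm_eq_abs,
          abs_of_pos hnp, abs_of_nonneg h2, abs_of_pos (by norm_num : (0:ℝ) < 2)]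
        have hnn := norm_nonneg z
        have h3 : 1 - ‖z‖ ≤ 1 - Complex.normSq z := by rw [hn2]; nlinarith
        have h4 : ((n:ℝ)+1) * (1 - ‖z‖) ≤ 1 := (mul_le_mul_of_nonneg_left h3 hnp.le).trans hx.le
        have h5 : 0 ≤ 1 - ‖z‖ := by linarith
        calc ((n:ℝ)+1) * S' (((n:ℝ)+1) * (1 - Complex.normSq z)) * 2 * |q z| 
            ≤ ((n:ℝ)+1) * (1 + 1) * 2 * (L * (1 - ‖z‖)) := by gcongr
          _ = 4 * L * (((n:ℝ)+1) * (1 - ‖z‖)) := by ring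
          _ ≤ 4 * L * 1 := by gcongr
          _ = 4 * L := by ring
    · rw [Set.indicator_of_notMem (by simpa using hz)]
      push Not at hz
      rw [hS'z]
      · simp
      · rw [hn2]
        have : 1 ≤ ‖z‖^2 := by nlinarith
        nlinarith
  have hlim : ∀ z : ℂ, ‖z‖ < 1 → ∀ᶠ n : ℕ in atTop, 1 ≤ ((n:ℝ)+1) * (1 - Complex.normSq z) := by
    intro z hz
    have hp : 0 < 1 - Complex.normSq z := by rw [hn2]; nlinarith [norm_nonneg z]
    obtain ⟨N, hN⟩ := exists_nat_gt (1 / (1 - Complex.normSq z))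
    filter_upwards [eventually_ge_atTop N] with n hn
    have : (N:ℝ) ≤ n := by exact_mod_cast hn
    rw [div_lt_iff₀ hp] at hN
    nlinarith
  have l1 : Tendsto (fun n => ∫ z, gr (ψ n) s z) atTop (𝓝 (∫ z : ℂ, (0:ℝ))) := by
    refine tendsto_integral_of_dominated_convergence _ (fun n => (continuous_gr (hψC n) (hs.of_le (by norm_num))).aestronglyMeasurable)
      ?_ (fun n => Eventually.of_forall (hgrb n)) (Eventually.of_forall fun z => ?_)
    · exact (integrable_indicator_iff Metric.isClosed_closedBall.measurableSet).2 (integrableOn_const (isCompact_closedBall (0:ℂ) 1).measure_lt_top.ne)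
    · by_cases hz : ‖z‖ < 1
      · refine tendsto_const_nhds.congr' ?_
        filter_upwards [hlim z hz] with n hn
        rw [hgr, hS'o _ hn]; simp
      · refine tendsto_const_nhds.congr (fun n => ?_)
        rw [hgr, hS'z]
        · simp
        · rw [hn2]
          push Not at hz
          have : 1 ≤ ‖z‖^2 := by nlinarith
          have : (0:ℝ) < (n:ℝ) + 1 := by positivity
          nlinarith
  have l2 : Tendsto (fun n => ∫ z, ψ n z * Lp s z) atTop (𝓝 (∫ z : ℂ, (Metric.ball (0:ℂ) 1).indicator (Lp s) z)) := by
    refine tendsto_integral_of_dominated_convergence ((Metric.closedBall (0:ℂ) 1).indicator (fun z => ‖Lp s z‖))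
      (fun n => ((hψC n).continuous.mul (continuous_Lp hs)).aestronglyMeasurable)
      ?_ (fun n => Eventually.of_forall fun z => ?_) (Eventually.of_forall fun z => ?_)
    · exact (integrable_indicator_iff Metric.isClosed_closedBall.measurableSet).2 
        ((continuous_Lp hs).norm.continuousOn.integrableOn_compact (isCompact_closedBall (0:ℂ) 1))
    · by_cases hz : ‖z‖ ≤ 1
      · rw [Set.indicator_of_mem (by simpa using hz), norm_mul]
        have h1 : ‖ψ n z‖ ≤ 1 := by
          rw [hψ, Real.norm_eq_abs, abs_of_nonneg (hSn _)]; exact hSl _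
        have := norm_nonneg (Lp s z)
        nlinarith
      · rw [hψ0 n z (by linarith)]
        simp only [zero_mul, norm_zero]
        exact Set.indicator_nonneg (fun z _ => norm_nonneg _) z
    · by_cases hz : ‖z‖ < 1
      · rw [Set.indicator_of_mem (by simpa using hz)]
        refine tendsto_const_nhds.congr' ?_
        filter_upwards [hlim z hz] with n hn
        rw [hψ]; simp only
        rw [hS1 _ hn, one_mul]
      · rw [Set.indicator_of_notMem (by simpa using hz)]
        refine tendsto_const_nhds.congr (fun n => ?_)
        rw [hψ0 n z (by linarith), zero_mul]
  have l3 : Tendsto (fun n => ∫ z, gr (ψ n) s z) atTop (𝓝 (- ∫ z : ℂ, (Metric.ball (0:ℂ) 1).indicator (Lp s) z)) := by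
    refine l2.neg.congr (fun n => ?_)
    rw [green (hψC n) (hψc n) hs]
  have := tendsto_nhds_unique l1 l3
  rw [integral_zero, integral_indicator Metric.isOpen_ball.measurableSet] at this
  linarith

theorem disc_area : ∫ z in Metric.ball (0:ℂ) 1, 1 / (1 + Complex.normSq z)^2 = π / 2 := by
  rw [← integral_indicator Metric.isOpen_ball.measurableSet]
  have e : (Metric.ball (0:ℂ) 1).indicator (fun z => 1 / (1 + Complex.normSq z)^2) = 
      fun z => (fun r : ℝ => (Set.Iio (1:ℝ)).indicator (fun r => 1 / (1 + r^2)^2) r) ‖z‖ := by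
    funext z
    by_cases h : ‖z‖ < 1
    · rw [Set.indicator_of_mem (by simpa using h)]
      simp only
      rw [Set.indicator_of_mem (show ‖z‖ ∈ Set.Iio (1:ℝ) from h), Complex.normSq_eq_norm_sq]
    · rw [Set.indicator_of_notMem (by simpa using h)]
      simp only
      rw [Set.indicator_of_notMem (show ‖z‖ ∉ Set.Iio (1:ℝ) from h)]
  rw [e, integral_fun_norm_addHaar]
  simp only [Complex.finrank_real_complex, Measure.real, Complex.volume_ball]
  have h2 : ∫ y in Set.Ioi (0:ℝ), y^(2-1) • (Set.Iio (1:ℝ)).indicator (fun r => 1 / (1 + r^2)^2) y = 1/4 := by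
    have : ∀ y : ℝ, y^(2-1) • (Set.Iio (1:ℝ)).indicator (fun r => 1 / (1 + r^2)^2) y = 
        (Set.Iio (1:ℝ)).indicator (fun r => r / (1 + r^2)^2) y := by
      intro y
      by_cases h : y < 1
      · rw [Set.indicator_of_mem (show y ∈ Set.Iio (1:ℝ) from h), Set.indicator_of_mem (show y ∈ Set.Iio (1:ℝ) from h)]
        simp; ring
      · rw [Set.indicator_of_notMem (show y ∉ Set.Iio (1:ℝ) from h), Set.indicator_of_notMem (show y ∉ Set.Iio (1:ℝ) from h)]
        simp
    simp_rw [this]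
    rw [setIntegral_indicator measurableSet_Iio, Set.Ioi_inter_Iio, ← integral_Ioc_eq_integral_Ioo, 
      ← intervalIntegral.integral_of_le zero_le_one]
    have hd : ∀ x ∈ Set.uIcc (0:ℝ) 1, HasDerivAt (fun r : ℝ => -(1/2) * (1 + r^2)⁻¹) (x / (1 + x^2)^2) x := by
      intro x _
      have h1 : HasDerivAt (fun r : ℝ => 1 + r^2) (2 * x) x := by
        have := (hasDerivAt_pow 2 x).const_add 1
        simpa using this
      have h0 : 1 + x^2 ≠ 0 := by positivity
      refine ((h1.fun_inv h0).const_mul (-(1/2))).congr_deriv ?_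
      field_simp
    rw [intervalIntegral.integral_eq_sub_of_hasDerivAt hd]
    · norm_num
    · refine ContinuousOn.intervalIntegrable (Continuous.continuousOn ?_)
      refine Continuous.div (by fun_prop) (by fun_prop) (fun x => by positivity)
  rw [h2]
  simp
  ring

end MF

namespace MF
open Complex (I)
open Filter Topology

/-- a solution written in the two charts, on `ℂ` -/
structure Sol (lam : ℝ) (a b : ℂ → ℝ) : Prop where
  ca : ContDiff ℝ 2 a
  cb : ContDiff ℝ 2 b
  la : ∀ z, Lp a z = 4 * lam * (1 - exp (a z)) / (1 + Complex.normSq z)^2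
  lb : ∀ z, Lp b z = 4 * lam * (1 - exp (b z)) / (1 + Complex.normSq z)^2
  ab : ∀ z, z ≠ 0 → b z = a (((starRingEnd ℂ) z)⁻¹)

theorem Sol.symm {lam : ℝ} {a b : ℂ → ℝ} (h : Sol lam a b) : Sol lam b a where
  ca := h.cb
  cb := h.ca
  la := h.lb
  lb := h.la
  ab := fun z hz => by
    rw [h.ab _ (by simpa using hz)]
    simp

theorem hasFDerivAt_cinv {z : ℂ} (hz : z ≠ 0) : HasFDerivAt (fun w : ℂ => ((starRingEnd ℂ) w)⁻¹) 
    (((ContinuousLinearMap.toSpanSingleton ℂ (-(((starRingEnd ℂ) z)^2)⁻¹)).restrictScalars ℝ).comp 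
      (Complex.conjCLE : ℂ →L[ℝ] ℂ)) z := by
  have h0 : (starRingEnd ℂ) z ≠ 0 := by simpa using hz
  have h1 : HasFDerivAt (fun w : ℂ => w⁻¹) ((ContinuousLinearMap.toSpanSingleton ℂ (-(((starRingEnd ℂ) z)^2)⁻¹)).restrictScalars ℝ) 
    ((Complex.conjCLE : ℂ →L[ℝ] ℂ) z) := ((hasDerivAt_inv h0).hasFDerivAt).restrictScalars ℝ
  exact h1.comp z (Complex.conjCLE : ℂ →L[ℝ] ℂ).hasFDerivAt

theorem Sol.fderiv_b {lam : ℝ} {a b : ℂ → ℝ} (h : Sol lam a b) {z : ℂ} (hz : z ≠ 0) (v : ℂ) :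
    fderiv ℝ b z v = fderiv ℝ a (((starRingEnd ℂ) z)⁻¹) (-((starRingEnd ℂ) v / ((starRingEnd ℂ) z)^2)) := by
  have h1 : b =ᶠ[𝓝 z] fun w => a (((starRingEnd ℂ) w)⁻¹) := by
    filter_upwards [isOpen_ne.mem_nhds hz] with w hw
    exact h.ab w hw
  have h2 : HasFDerivAt (fun w => a (((starRingEnd ℂ) w)⁻¹)) _ z := 
    HasFDerivAt.comp z ((h.ca.differentiable (by norm_num) _).hasFDerivAt) (hasFDerivAt_cinv hz)
  rw [h1.fderiv_eq, h2.fderiv]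
  simp [ContinuousLinearMap.toSpanSingleton_apply, div_eq_mul_inv]

theorem cinv_unit {z : ℂ} (hz : ‖z‖ = 1) : ((starRingEnd ℂ) z)⁻¹ = z := by
  have h0 : z ≠ 0 := by rintro rfl; simp at hz
  have h1 : z * (starRingEnd ℂ) z = 1 := by rw [Complex.mul_conj, Complex.normSq_eq_norm_sq, hz]; simp
  exact (eq_inv_of_mul_eq_one_left h1).symm

theorem one_add_normSq_pos (z : ℂ) : 0 < 1 + Complex.normSq z := by
  have := Complex.normSq_nonneg z; linarith

theorem Sol.mass {lam : ℝ} (hl : lam ≠ 0) {a b : ℂ → ℝ} (h : Sol lam a b) : 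
    ∫ z in Metric.ball (0:ℂ) 1, (exp (a z) + exp (b z)) * (4 / (1 + Complex.normSq z)^2) = 4 * π := by
  have hC := h.ca.add h.cb
  have h1 := flux_zero (s := fun z => a z + b z) hC (fun z hz => by
    have h0 : z ≠ 0 := by rintro rfl; simp at hz
    have hcz : (starRingEnd ℂ) z ≠ 0 := by simpa using h0
    rw [fderiv_fun_add (h.ca.differentiable (by norm_num) z) (h.cb.differentiable (by norm_num) z)]
    rw [ContinuousLinearMap.add_apply, h.fderiv_b h0, cinv_unit hz]
    have : -((starRingEnd ℂ) z / ((starRingEnd ℂ) z)^2) = - z := by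
      rw [pow_two, div_mul_cancel_left₀ hcz, cinv_unit hz]
    rw [this, map_neg]; ring)
  have hca := h.ca.continuous
  have hcb := h.cb.continuous
  have hns : Continuous (fun z : ℂ => Complex.normSq z) := Complex.continuous_normSq
  have c1 : Continuous (fun z : ℂ => 1 / (1 + Complex.normSq z)^2) := 
    Continuous.div (by fun_prop) (by fun_prop) (fun x => by have := one_add_normSq_pos x; positivity)
  have c2 : Continuous (fun z : ℂ => (exp (a z) + exp (b z)) * (4 / (1 + Complex.normSq z)^2)) := by
    refine Continuous.mul (by fun_prop) (Continuous.div (by fun_prop) (by fun_prop) (fun x => by have := one_add_normSq_pos x; positivity))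
  have hi : ∀ {g : ℂ → ℝ}, Continuous g → IntegrableOn g (Metric.ball (0:ℂ) 1) := fun hg => 
    (hg.continuousOn.integrableOn_compact (isCompact_closedBall (0:ℂ) 1)).mono_set Metric.ball_subset_closedBall
  have h2 : ∀ z, Lp (fun z => a z + b z) z = lam * (8 * (1 / (1 + Complex.normSq z)^2) - (exp (a z) + exp (b z)) * (4 / (1 + Complex.normSq z)^2)) := by
    intro z
    rw [Lp_add (f := a) (g := b) h.ca h.cb, h.la, h.lb]
    have := one_add_normSq_pos z
    field_simp; ring
  simp_rw [h2] at h1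
  rw [integral_const_mul, integral_sub ((hi c1).const_mul 8) (hi c2), integral_const_mul, disc_area] at h1
  have := (mul_eq_zero.1 h1).resolve_left hl
  linarith

/-- conformal factor -/
def sg (z : ℂ) : ℝ := Real.log 2 - Real.log (1 + Complex.normSq z)

theorem sg_contDiff {n} : ContDiff ℝ n sg := by
  unfold sg
  exact contDiff_const.sub ((contDiff_const.add contDiff_normSq).log (fun z => (one_add_normSq_pos z).ne'))

theorem exp_sg (z : ℂ) : exp (2 * sg z) = 4 / (1 + Complex.normSq z)^2 := by
  have := one_add_normSq_pos z
  unfold sg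
  rw [two_mul, Real.exp_add, Real.exp_sub, Real.exp_log this, Real.exp_log two_pos]
  field_simp; norm_num

theorem Lp_sg (z : ℂ) : Lp sg z = - (4 / (1 + Complex.normSq z)^2) := by
  have h := Lp_radial (k := fun t => Real.log 2 - Real.log (1 + t)) (k1 := fun t => - (1 + t)⁻¹) (k2 := fun t => ((1 + t)^2)⁻¹)
    (fun t ht => by
      have h1 : HasDerivAt (fun t : ℝ => 1 + t) 1 t := by simpa using (hasDerivAt_id t).const_add 1
      refine ((h1.log (by positivity)).const_sub _).congr_deriv ?_
      ring)
    (fun t ht => by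
      have h1 : HasDerivAt (fun t : ℝ => 1 + t) 1 t := by simpa using (hasDerivAt_id t).const_add 1
      refine (h1.fun_inv (by positivity)).fun_neg.congr_deriv ?_
      field_simp) z
  have := one_add_normSq_pos z
  change Lp sg z = _ at h
  rw [h]
  field_simp; ring

theorem Sol.reflect {lam : ℝ} (h2 : 2 < lam) (h4 : lam ≤ 4) {a b : ℂ → ℝ} (h : Sol lam a b) {p : ℂ} (hp : ‖p‖ = 1) 
    (hd : fderiv ℝ a p = 0) : ∀ z, a z = b z := by
  have hp0 : p ≠ 0 := by rintro rfl; simp at hp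
  have hdb : fderiv ℝ b p = 0 := by
    ext v
    rw [h.fderiv_b hp0, cinv_unit hp, hd]; simp
  obtain ⟨w, hw⟩ : ∃ w : (ℂ → ℝ) → ℂ → ℝ, w = fun c z => (1/2) * c z + ((1/2) * Real.log (lam/2) + sg z) := ⟨_, rfl⟩
  have hwx : ∀ c z, w c z = (1/2) * c z + ((1/2) * Real.log (lam/2) + sg z) := fun c z => by rw [hw]
  have hsg : ContDiff ℝ 2 (fun z => (1/2) * Real.log (lam/2) + sg z) := contDiff_const.add sg_contDiff
  have hwC : ∀ c, ContDiff ℝ 2 c → ContDiff ℝ 2 (w c) := by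
    intro c hc; rw [hw]
    exact (contDiff_const.mul hc).add hsg
  have hexp : ∀ c z, exp (2 * w c z) = (lam/2) * exp (c z) * (4 / (1 + Complex.normSq z)^2) := by
    intro c z
    rw [hwx, ← exp_sg, show 2 * ((1/2) * c z + ((1/2) * Real.log (lam/2) + sg z)) = Real.log (lam/2) + c z + 2 * sg z by ring,
      Real.exp_add, Real.exp_add, Real.exp_log (by linarith)]
  have hLw : ∀ c, ContDiff ℝ 2 c → (∀ z, Lp c z = 4 * lam * (1 - exp (c z)) / (1 + Complex.normSq z)^2) → 
      ∀ z, Lp (w c) z = (lam/2 - 1) * (4 / (1 + Complex.normSq z)^2) - exp (2 * w c z) := by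
    intro c hc hL z
    rw [hexp]
    rw [hw]; simp only
    rw [Lp_add (f := fun z => (1/2) * c z) (g := fun z => (1/2) * Real.log (lam/2) + sg z) (contDiff_const.mul hc) hsg, 
      Lp_const_mul hc, hL, Lp_add (f := fun _ => (1/2) * Real.log (lam/2)) (g := sg) contDiff_const sg_contDiff, Lp_const, Lp_sg]
    have := one_add_normSq_pos z
    field_simp; ring
  have hcw : Continuous (fun z => exp (a z) + exp (b z)) := by
    have := h.ca.continuous; have := h.cb.continuous; fun_prop
  obtain ⟨B, hB⟩ := (isCompact_closedBall (0:ℂ) 1).exists_bound_of_continuousOn hcw.continuousOn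
  have hB' : ∀ z, ‖z‖ < 1 → exp (a z) ≤ |B| ∧ exp (b z) ≤ |B| := by
    intro z hz
    have h1 := hB z (by simpa using hz.le)
    have e1 := Real.exp_pos (a z)
    have e2 := Real.exp_pos (b z)
    rw [Real.norm_eq_abs, abs_of_pos (by positivity)] at h1
    have := le_abs_self B
    constructor <;> linarith
  obtain ⟨κ, hκ⟩ : ∃ κ : ℝ, κ = min 1 ((lam/2 - 1) / ((lam/2) * (|B| + 1))) := ⟨_, rfl⟩
  have hκ0 : 0 < κ := by
    rw [hκ]
    refine lt_min one_pos (div_pos (by linarith) (mul_pos (by linarith) (by positivity)))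
  have hκ1 : κ ≤ 1 := hκ ▸ min_le_left _ _
  have hκ2 : κ * ((lam/2) * (|B| + 1)) ≤ lam/2 - 1 := by
    rw [← le_div_iff₀ (mul_pos (by linarith) (by positivity))]
    exact hκ ▸ min_le_right _ _
  have hkf : ∀ c, (∀ z, ‖z‖ < 1 → exp (c z) ≤ |B|) → ∀ z, ‖z‖ < 1 → 
      (1 - (1 - κ)) * exp (2 * w c z) ≤ (lam/2 - 1) * (4 / (1 + Complex.normSq z)^2) := by
    intro c hc z hz
    rw [hexp]
    have h1 := hc z hz
    have h3 := one_add_normSq_pos z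
    have h5 : κ * ((lam/2) * exp (c z)) ≤ κ * ((lam/2) * (|B| + 1)) := by
      gcongr
      linarith
    calc (1 - (1 - κ)) * (lam / 2 * exp (c z) * (4 / (1 + Complex.normSq z)^2)) 
        = κ * ((lam/2) * exp (c z)) * (4 / (1 + Complex.normSq z)^2) := by ring
      _ ≤ (lam/2 - 1) * (4 / (1 + Complex.normSq z)^2) := by gcongr; linarith
  have hfin : ∀ z, ‖z‖ < 1 → w a z = w b z := by
    refine core (w1 := w b) (w2 := w a) (f := fun z => (lam/2 - 1) * (4 / (1 + Complex.normSq z)^2)) (hwC b h.cb) (hwC a h.ca) 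
      (k := 1 - κ) (by linarith) (by linarith) ?_ (fun z _ => hLw b h.cb h.lb z) (fun z _ => hLw a h.ca h.la z)
      (hkf b (fun z hz => (hB' z hz).2)) (hkf a (fun z hz => (hB' z hz).1)) ?_ hp ?_
    · intro z hz
      have h0 : z ≠ 0 := by rintro rfl; simp at hz
      rw [hwx, hwx, h.ab z h0, cinv_unit hz]; ring
    · have : ∀ z, exp (2 * w b z) + exp (2 * w a z) = (lam/2) * ((exp (a z) + exp (b z)) * (4 / (1 + Complex.normSq z)^2)) := by
        intro z; rw [hexp, hexp]; ring
      simp_rw [this]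
      rw [integral_const_mul, h.mass (by linarith)]
      nlinarith [Real.pi_pos]
    · have : (fun z => w a z - w b z) = fun z => (1/2) * (a z - b z) := by
        funext z; rw [hwx, hwx]; ring
      have hA := (h.ca.differentiable (by norm_num) p)
      have hBd := (h.cb.differentiable (by norm_num) p)
      rw [this, fderiv_const_mul (hA.fun_sub hBd), fderiv_fun_sub hA hBd, hd, hdb]
      simp
  have hlt : ∀ z, ‖z‖ < 1 → a z = b z := by
    intro z hz
    have := hfin z hz
    rw [hwx, hwx] at this
    linarith
  intro z
  rcases lt_trichotomy ‖z‖ 1 with hz | hz | hz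
  · exact hlt z hz
  · have h0 : z ≠ 0 := by rintro rfl; simp at hz
    rw [h.ab z h0, cinv_unit hz]
  · have h0 : z ≠ 0 := by rintro rfl; simp at hz; linarith
    rw [h.ab z h0, h.symm.ab z h0]
    refine (hlt _ ?_).symm
    rw [norm_inv, RCLike.norm_conj]
    exact inv_lt_one_of_one_lt₀ hz

end MF

namespace MF
open Complex (I)
open Filter Topology

theorem Lp_congr {f g : ℂ → ℝ} {z : ℂ} (h : f =ᶠ[𝓝 z] g) : Lp f z = Lp g z := by
  have h1 : ∀ v : ℂ, (fun y => fderiv ℝ f y v) =ᶠ[𝓝 z] (fun y => fderiv ℝ g y v) := by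
    intro v
    filter_upwards [h.eventuallyEq_nhds] with y hy
    rw [hy.fderiv_eq]
  unfold Lp
  rw [(h1 1).fderiv_eq, (h1 I).fderiv_eq]

/-- conformal covariance of the Laplacian -/
theorem Lp_comp_holo {f : ℂ → ℝ} (hf : ContDiff ℝ 2 f) {M : ℂ → ℂ} {z : ℂ} (hM : AnalyticAt ℂ M z) :
    Lp (fun y => f (M y)) z = Complex.normSq (deriv M z) * Lp f (M z) := by
  have hMe : ∀ᶠ y in 𝓝 z, DifferentiableAt ℂ M y := by
    filter_upwards [hM.eventually_analyticAt] with y hy using hy.differentiableAt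
  have hfd : ∀ y, HasFDerivAt f (fderiv ℝ f y) y := fun y => (hf.differentiable (by norm_num) y).hasFDerivAt
  have hMr : ∀ {y}, DifferentiableAt ℂ M y → HasFDerivAt M ((ContinuousLinearMap.toSpanSingleton ℂ (deriv M y)).restrictScalars ℝ) y := by
    intro y hy
    exact hy.hasDerivAt.hasFDerivAt.restrictScalars ℝ
  have h1 : ∀ v : ℂ, (fun y => fderiv ℝ (fun y => f (M y)) y v) =ᶠ[𝓝 z] 
      fun y => (v * deriv M y).re * fderiv ℝ f (M y) 1 + (v * deriv M y).im * fderiv ℝ f (M y) I := by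
    intro v
    filter_upwards [hMe] with y hy
    have hcc : HasFDerivAt (fun y => f (M y)) _ y := (hfd (M y)).comp y (hMr hy)
    rw [hcc.fderiv]
    simp only [ContinuousLinearMap.comp_apply, ContinuousLinearMap.coe_restrictScalars', ContinuousLinearMap.toSpanSingleton_apply, smul_eq_mul]
    exact clm_split _ _
  have hN : HasDerivAt (deriv M) (deriv (deriv M) z) z := hM.deriv.differentiableAt.hasDerivAt
  have hNr : HasFDerivAt (deriv M) ((ContinuousLinearMap.toSpanSingleton ℂ (deriv (deriv M) z)).restrictScalars ℝ) z := 
    hN.hasFDerivAt.restrictScalars ℝ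
  have h2 : ∀ v : ℂ, HasFDerivAt (fun y => fderiv ℝ f (M y) v) _ z := fun v =>
    HasFDerivAt.comp z (((contDiff_fderiv_apply hf v).differentiable (by norm_num) (M z)).hasFDerivAt) (hMr hM.differentiableAt)
  have hre : ∀ v : ℂ, HasFDerivAt (fun y => (v * deriv M y).re) _ z := fun v =>
    HasFDerivAt.comp z Complex.reCLM.hasFDerivAt (hNr.const_mul v)
  have him : ∀ v : ℂ, HasFDerivAt (fun y => (v * deriv M y).im) _ z := fun v =>
    HasFDerivAt.comp z Complex.imCLM.hasFDerivAt (hNr.const_mul v)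
  have h3 : ∀ v : ℂ, fderiv ℝ (fun y => fderiv ℝ (fun y => f (M y)) y v) z v = _ := fun v => by
    rw [(h1 v).fderiv_eq, (((hre v).fun_mul (h2 1)).fun_add ((him v).fun_mul (h2 I))).fderiv]
  unfold Lp
  rw [h3, h3]
  simp only [ContinuousLinearMap.add_apply, ContinuousLinearMap.smul_apply, ContinuousLinearMap.comp_apply, smul_eq_mul,
    ContinuousLinearMap.coe_restrictScalars', ContinuousLinearMap.toSpanSingleton_apply, Complex.reCLM_apply, Complex.imCLM_apply]
  rw [clm_split (fderiv ℝ (fun y => fderiv ℝ f y 1) (M z)) (1 * deriv M z), clm_split (fderiv ℝ (fun y => fderiv ℝ f y 1) (M z)) (I * deriv M z),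
    clm_split (fderiv ℝ (fun y => fderiv ℝ f y I) (M z)) (1 * deriv M z), clm_split (fderiv ℝ (fun y => fderiv ℝ f y I) (M z)) (I * deriv M z)]
  simp only [Complex.normSq_apply, Complex.mul_re, Complex.mul_im, Complex.I_re, Complex.I_im, Complex.one_re, Complex.one_im]
  ring

theorem Lp_comp_conj {f : ℂ → ℝ} (hf : ContDiff ℝ 2 f) (z : ℂ) :
    Lp (fun y => f ((starRingEnd ℂ) y)) z = Lp f ((starRingEnd ℂ) z) := by
  have hc : ∀ z : ℂ, HasFDerivAt (fun y : ℂ => (starRingEnd ℂ) y) (Complex.conjCLE : ℂ →L[ℝ] ℂ) z := fun z =>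
    (Complex.conjCLE : ℂ →L[ℝ] ℂ).hasFDerivAt
  have h1 : ∀ (g : ℂ → ℝ) (y v : ℂ), DifferentiableAt ℝ g ((starRingEnd ℂ) y) → 
      fderiv ℝ (fun y => g ((starRingEnd ℂ) y)) y v = fderiv ℝ g ((starRingEnd ℂ) y) ((starRingEnd ℂ) v) := by
    intro g y v hg
    have hcc : HasFDerivAt (fun y => g ((starRingEnd ℂ) y)) _ y := HasFDerivAt.comp y hg.hasFDerivAt (hc y)
    rw [hcc.fderiv]
    rfl
  unfold Lp
  have h2 : ∀ v : ℂ, (fun y => fderiv ℝ (fun y => f ((starRingEnd ℂ) y)) y v) = 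
    fun y => (fun x => fderiv ℝ f x ((starRingEnd ℂ) v)) ((starRingEnd ℂ) y) := by
    intro v; funext y; exact h1 f y v (hf.differentiable (by norm_num) _)
  rw [h2, h2, h1 _ _ _ ((contDiff_fderiv_apply hf _).differentiable (by norm_num) _), h1 _ _ _ ((contDiff_fderiv_apply hf _).differentiable (by norm_num) _)]
  simp only [map_one, Complex.conj_I, map_neg]
  have : (fun x => - fderiv ℝ f x I) = fun x => -(fun x => fderiv ℝ f x I) x := rfl
  rw [this, fderiv_fun_neg]
  simp

/-- PDE for the pull back by a Moebius rotation -/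
theorem chart_pde {lam κ : ℝ} (hκ : 0 < κ) {g h : ℂ → ℝ} (hg : ContDiff ℝ 2 g) 
    (hp : ∀ z, Lp g z = 4 * lam * (1 - exp (g z)) / (1 + Complex.normSq z)^2) {p1 p2 q1 q2 z : ℂ}
    (hq : q1 * z + q2 ≠ 0) (hh : h =ᶠ[𝓝 z] fun y => g ((p1 * y + p2) / (q1 * y + q2)))
    (hn : Complex.normSq (p1 * z + p2) + Complex.normSq (q1 * z + q2) = κ * (1 + Complex.normSq z))
    (hdet : Complex.normSq (p1 * q2 - p2 * q1) = κ^2) : 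
    ContDiffAt ℝ 2 h z ∧ Lp h z = 4 * lam * (1 - exp (h z)) / (1 + Complex.normSq z)^2 := by
  have hA : AnalyticAt ℂ (fun y => (p1 * y + p2) / (q1 * y + q2)) z := by
    have e1 : AnalyticAt ℂ (fun y => p1 * y + p2) z := by fun_prop
    have e2 : AnalyticAt ℂ (fun y => q1 * y + q2) z := by fun_prop
    exact e1.fun_div e2 hq
  have hD : HasDerivAt (fun y => (p1 * y + p2) / (q1 * y + q2)) ((p1 * q2 - p2 * q1) / (q1 * z + q2)^2) z := by
    have e1 : HasDerivAt (fun y => p1 * y + p2) p1 z := by simpa using ((hasDerivAt_id z).const_mul p1).add_const p2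
    have e2 : HasDerivAt (fun y => q1 * y + q2) q1 z := by simpa using ((hasDerivAt_id z).const_mul q1).add_const q2
    refine (e1.fun_div e2 hq).congr_deriv ?_
    congr 1; ring
  constructor
  · refine ContDiffAt.congr_of_eventuallyEq ?_ hh
    exact hg.contDiffAt.comp z ((hA.restrictScalars (𝕜 := ℝ)).contDiffAt)
  · rw [Lp_congr hh, Lp_comp_holo hg hA, hD.deriv, hp, hh.self_of_nhds]
    have hq' : 0 < Complex.normSq (q1 * z + q2) := Complex.normSq_pos.2 hq
    have hz := one_add_normSq_pos z
    simp only [map_div₀, map_pow, hdet]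
    have : 1 + Complex.normSq (p1 * z + p2) / Complex.normSq (q1 * z + q2) = κ * (1 + Complex.normSq z) / Complex.normSq (q1 * z + q2) := by
      rw [← hn, add_div, div_self hq'.ne']; ring
    rw [this]
    generalize Complex.normSq (q1 * z + q2) = Q at *
    generalize 1 + Complex.normSq z = R at *
    field_simp

/-- homogeneous form of the solution -/
def Uh (a b : ℂ → ℝ) (x y : ℂ) : ℝ := open Classical in if y ≠ 0 then a (x / y) else b ((starRingEnd ℂ) (y / x))

theorem Sol.Uh_b {lam : ℝ} {a b : ℂ → ℝ} (h : Sol lam a b) {x y : ℂ} (hx : x ≠ 0) : Uh a b x y = b ((starRingEnd ℂ) (y / x)) := by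
  unfold Uh
  by_cases hy : y = 0
  · simp [hy]
  · rw [if_pos hy, h.ab _ (by simp [hx, hy])]
    simp

theorem Uh_a (a b : ℂ → ℝ) {x y : ℂ} (hy : y ≠ 0) : Uh a b x y = a (x / y) := by
  unfold Uh; rw [if_pos hy]

theorem Uh_smul (a b : ℂ → ℝ) {c : ℂ} (hc : c ≠ 0) (x y : ℂ) : Uh a b (c * x) (c * y) = Uh a b x y := by
  unfold Uh
  rw [mul_div_mul_left _ _ hc, mul_div_mul_left _ _ hc]
  simp [hc]

theorem Sol.rot1 {lam κ : ℝ} (hκ : 0 < κ) {a b : ℂ → ℝ} (h : Sol lam a b) {p1 p2 q1 q2 : ℂ}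
    (hn : ∀ s t, Complex.normSq (p1 * s + p2 * t) + Complex.normSq (q1 * s + q2 * t) = κ * (Complex.normSq s + Complex.normSq t))
    (hdet : Complex.normSq (p1 * q2 - p2 * q1) = κ^2) (z : ℂ) : 
    ContDiffAt ℝ 2 (fun z => Uh a b (p1 * z + p2) (q1 * z + q2)) z ∧ 
    Lp (fun z => Uh a b (p1 * z + p2) (q1 * z + q2)) z = 4 * lam * (1 - exp (Uh a b (p1 * z + p2) (q1 * z + q2))) / (1 + Complex.normSq z)^2 := by
  have hnz : Complex.normSq (p1 * z + p2) + Complex.normSq (q1 * z + q2) = κ * (1 + Complex.normSq z) := by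
    have := hn z 1
    simp only [mul_one, map_one] at this
    rw [this]; ring
  by_cases hq : q1 * z + q2 = 0
  · have hp : p1 * z + p2 ≠ 0 := by
      intro hp
      rw [hq, hp] at hnz
      simp at hnz
      have := one_add_normSq_pos z
      rcases hnz with h | h <;> linarith
    refine chart_pde (g := fun y => b ((starRingEnd ℂ) y)) (p1 := q1) (p2 := q2) (q1 := p1) (q2 := p2) hκ (h.cb.comp (Complex.conjCLE : ℂ →L[ℝ] ℂ).contDiff) (fun z => ?_) hp ?_ (by rw [← hnz]; ring) 
      (by rw [← hdet, ← Complex.normSq_neg]; congr 1; ring)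
    · rw [Lp_comp_conj h.cb, h.lb, Complex.normSq_conj]
    · have : ∀ᶠ y in 𝓝 z, p1 * y + p2 ≠ 0 := 
        ContinuousAt.eventually_ne (by fun_prop) hp
      filter_upwards [this] with y hy
      rw [h.Uh_b hy]
  · refine chart_pde hκ h.ca h.la hq ?_ hnz hdet
    have : ∀ᶠ y in 𝓝 z, q1 * y + q2 ≠ 0 := 
      ContinuousAt.eventually_ne (by fun_prop) hq
    filter_upwards [this] with y hy
    rw [Uh_a _ _ hy]

theorem Sol.rot {lam κ : ℝ} (hκ : 0 < κ) {a b : ℂ → ℝ} (h : Sol lam a b) {p1 p2 q1 q2 : ℂ}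
    (hn : ∀ s t, Complex.normSq (p1 * s + p2 * t) + Complex.normSq (q1 * s + q2 * t) = κ * (Complex.normSq s + Complex.normSq t))
    (hdet : Complex.normSq (p1 * q2 - p2 * q1) = κ^2) : 
    Sol lam (fun z => Uh a b (p1 * z + p2) (q1 * z + q2)) 
      (fun z => Uh a b (p2 * (starRingEnd ℂ) z + p1) (q2 * (starRingEnd ℂ) z + q1)) := by
  have h1 := h.rot1 hκ hn hdet
  have h2 := h.rot1 (p1 := p2) (p2 := p1) (q1 := q2) (q2 := q1) hκ (fun s t => by
    rw [add_comm (p2 * s), add_comm (q2 * s), hn]; ring) (by rw [← hdet, ← Complex.normSq_neg]; congr 1; ring)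
  have h2C : ContDiff ℝ 2 (fun z => Uh a b (p2 * z + p1) (q2 * z + q1)) := contDiff_iff_contDiffAt.2 fun z => (h2 z).1
  refine ⟨contDiff_iff_contDiffAt.2 fun z => (h1 z).1, h2C.comp (Complex.conjCLE : ℂ →L[ℝ] ℂ).contDiff, fun z => (h1 z).2, fun z => ?_, fun z hz => ?_⟩
  · rw [Lp_comp_conj h2C, (h2 _).2, Complex.normSq_conj]
  · have hz' : (starRingEnd ℂ) z ≠ 0 := by simpa using hz
    rw [← Uh_smul a b hz' (p1 * _ + p2)]
    congr 1 <;> field_simp <;> ring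

end MF

namespace MF
open Complex (I)
open Filter Topology

theorem Sol.Uh_fderiv {lam : ℝ} {a b : ℂ → ℝ} (h : Sol lam a b) (p1 p2 q1 q2 : ℂ) {z : ℂ} (hq : q1 * z + q2 ≠ 0) (v : ℂ) :
    fderiv ℝ (fun z => Uh a b (p1 * z + p2) (q1 * z + q2)) z v = 
      fderiv ℝ a ((p1 * z + p2) / (q1 * z + q2)) (v * ((p1 * q2 - p2 * q1) / (q1 * z + q2)^2)) := by
  have hD : HasDerivAt (fun y => (p1 * y + p2) / (q1 * y + q2)) ((p1 * q2 - p2 * q1) / (q1 * z + q2)^2) z := by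
    have e1 : HasDerivAt (fun y => p1 * y + p2) p1 z := by simpa using ((hasDerivAt_id z).const_mul p1).add_const p2
    have e2 : HasDerivAt (fun y => q1 * y + q2) q1 z := by simpa using ((hasDerivAt_id z).const_mul q1).add_const q2
    refine (e1.fun_div e2 hq).congr_deriv ?_
    congr 1; ring
  have h1 : (fun z => Uh a b (p1 * z + p2) (q1 * z + q2)) =ᶠ[𝓝 z] fun y => a ((p1 * y + p2) / (q1 * y + q2)) := by
    have : ∀ᶠ y in 𝓝 z, q1 * y + q2 ≠ 0 := ContinuousAt.eventually_ne (by fun_prop) hq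
    filter_upwards [this] with y hy
    rw [Uh_a _ _ hy]
  have h2 : HasFDerivAt (fun y => a ((p1 * y + p2) / (q1 * y + q2))) _ z := 
    HasFDerivAt.comp z ((h.ca.differentiable (by norm_num) _).hasFDerivAt) (hD.hasFDerivAt.restrictScalars ℝ)
  rw [h1.fderiv_eq, h2.fderiv]
  simp

theorem Sol.radial {lam : ℝ} (h2 : 2 < lam) (h4 : lam ≤ 4) {a b : ℂ → ℝ} (h : Sol lam a b) (hd : fderiv ℝ a 0 = 0) :
    ∀ w w' : ℂ, ‖w‖ = ‖w'‖ → a w = a w' := by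
  have key : ∀ e w : ℂ, ‖e‖ = 1 → w ≠ e → a w = a (-(e^2 * (starRingEnd ℂ) w)) := by
    intro e w he hwe
    have hee : e * (starRingEnd ℂ) e = 1 := by rw [Complex.mul_conj, Complex.normSq_eq_norm_sq, he]; simp
    have he0 : e ≠ 0 := by rintro rfl; simp at he
    have heN : Complex.normSq e = 1 := by rw [Complex.normSq_eq_norm_sq, he]; norm_num
    have hs := h.rot (κ := 2) (by norm_num) (p1 := e) (p2 := -e) (q1 := 1) (q2 := 1) (fun s t => by
      rw [show e * s + -e * t = e * (s - t) by ring, map_mul, heN]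
      simp only [Complex.normSq_apply, Complex.add_re, Complex.add_im, Complex.sub_re, Complex.sub_im, one_mul]
      ring) (by
      rw [show e * 1 - -e * 1 = 2 * e by ring, map_mul, heN]; norm_num [Complex.normSq_apply])
    have h1 := hs.reflect h2 h4 (p := 1) (by simp) (by
      ext v
      rw [h.Uh_fderiv _ _ _ _ (by norm_num)]
      rw [show (e * 1 + -e) / (1 * 1 + 1) = 0 by ring, hd]
      simp) ((e + w) / (e - w))
    have hew : e - w ≠ 0 := sub_ne_zero.2 (Ne.symm hwe)
    have hcew : (starRingEnd ℂ) e - (starRingEnd ℂ) w ≠ 0 := by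
      rw [← map_sub]; exact (map_ne_zero _).2 hew
    have hce0 : (starRingEnd ℂ) e ≠ 0 := by simpa using he0
    have hq1 : 1 * ((e + w) / (e - w)) + 1 = 2 * e / (e - w) := by field_simp; ring
    have hq2 : 1 * (starRingEnd ℂ) ((e + w) / (e - w)) + 1 = 2 * (starRingEnd ℂ) e / ((starRingEnd ℂ) e - (starRingEnd ℂ) w) := by 
      simp only [map_div₀, map_add, map_sub]; field_simp; ring
    have hp1 : e * ((e + w) / (e - w)) + -e = e * (2 * w) / (e - w) := by field_simp; ring
    have hp2 : -e * (starRingEnd ℂ) ((e + w) / (e - w)) + e = -e * (2 * (starRingEnd ℂ) w) / ((starRingEnd ℂ) e - (starRingEnd ℂ) w) := by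
      simp only [map_div₀, map_add, map_sub]; field_simp; ring
    simp only [hq1, hq2, hp1, hp2] at h1
    rw [Uh_a _ _ (by simp [he0, hew]), Uh_a _ _ (by simp [hce0, hcew])] at h1
    rw [show e * (2 * w) / (e - w) / (2 * e / (e - w)) = w by field_simp] at h1
    rw [h1]; congr 1
    field_simp
    first | linear_combination (-(starRingEnd ℂ) w ) * hee | linear_combination ((starRingEnd ℂ) w ) * hee
  intro w w' hw
  by_cases h0 : w = 0
  · subst h0
    have : w' = 0 := by simpa using hw.symm
    rw [this]
  have hcw : (starRingEnd ℂ) w ≠ 0 := by simpa using h0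
  obtain ⟨e, he⟩ := IsAlgClosed.exists_pow_nat_eq (-(w' / (starRingEnd ℂ) w)) (n := 2) (by norm_num)
  have hen : ‖e‖ = 1 := by
    have : ‖e‖^2 = 1 := by
      rw [← norm_pow, he, norm_neg, norm_div, RCLike.norm_conj, ← hw, div_self (by simpa using h0)]
    have h5 := norm_nonneg e
    nlinarith
  have hfin : -(e^2 * (starRingEnd ℂ) w) = w' := by rw [he]; field_simp
  by_cases hwe : w = e
  · have := key (-e) w (by simpa using hen) (by
      rw [hwe]; intro hh
      have : e = 0 := by linear_combination (1/2) * hh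
      exact h0 (hwe.trans this))
    rw [this, neg_sq, hfin]
  · rw [key e w hen hwe, hfin]

theorem radial_fderiv {a : ℂ → ℝ} (ha : Differentiable ℝ a) (hr : ∀ w w' : ℂ, ‖w‖ = ‖w'‖ → a w = a w') (z : ℂ) :
    fderiv ℝ a z (I * z) = 0 := by
  have h1 : HasDerivAt (fun t : ℝ => Complex.exp (t * I) * z) (I * z) 0 := by
    have : HasDerivAt (fun t : ℝ => (t : ℂ) * I) I 0 := by simpa using (Complex.ofRealCLM.hasDerivAt (x := (0:ℝ))).mul_const I
    have := (this.cexp).mul_const z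
    simpa using this
  have h2 : HasFDerivAt a (fderiv ℝ a z) (Complex.exp (((0:ℝ):ℂ) * I) * z) := by
    simpa using (ha z).hasFDerivAt
  have h3 := h2.comp_hasDerivAt (0:ℝ) h1
  have h4 : (a ∘ fun t : ℝ => Complex.exp (t * I) * z) = fun _ => a z := by
    funext t
    apply hr
    simp [Complex.norm_exp_ofReal_mul_I]
  rw [h4] at h3
  exact h3.unique (hasDerivAt_const _ _)

theorem Sol.const_zero {lam : ℝ} (h0 : lam ≠ 0) {a b : ℂ → ℝ} (h : Sol lam a b) {c : ℝ} (hc : ∀ z, a z = c) : ∀ z, a z = 0 := by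
  have : a = fun _ => c := funext hc
  have h1 := h.la 0
  rw [this, Lp_const] at h1
  have : 1 - exp c = 0 := by
    have : 4 * lam ≠ 0 := by simpa using h0
    simp at h1
    rcases h1 with h1 | h1
    · exact absurd h1 h0
    · linarith
  have : c = 0 := by
    have : exp c = 1 := by linarith
    simpa using this
  intro z; rw [hc, this]

theorem Sol.rotP {lam : ℝ} {a b : ℂ → ℝ} (h : Sol lam a b) (p : ℂ) : 
    Sol lam (fun z => Uh a b (1 * z + p) (-(starRingEnd ℂ) p * z + 1)) 
      (fun z => Uh a b (p * (starRingEnd ℂ) z + 1) (1 * (starRingEnd ℂ) z + -(starRingEnd ℂ) p)) := by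
  refine h.rot (κ := 1 + Complex.normSq p) (one_add_normSq_pos p) (fun s t => ?_) ?_
  · simp only [Complex.normSq_apply, Complex.add_re, Complex.add_im, Complex.mul_re, Complex.mul_im, Complex.neg_re, Complex.neg_im, Complex.conj_re, Complex.conj_im,
      one_mul]
    ring
  · rw [show (1:ℂ) * 1 - p * -(starRingEnd ℂ) p = ((1 + Complex.normSq p : ℝ) : ℂ) by push_cast; rw [← Complex.mul_conj]; ring, Complex.normSq_ofReal]
    ring

theorem Sol.rotP_crit {lam : ℝ} {a b : ℂ → ℝ} (h : Sol lam a b) {p : ℂ} (hp : fderiv ℝ a p = 0) : 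
    fderiv ℝ (fun z => Uh a b (1 * z + p) (-(starRingEnd ℂ) p * z + 1)) 0 = 0 := by
  ext v
  rw [h.Uh_fderiv _ _ _ _ (by simp)]
  simp [hp]

theorem Sol.two_axes {lam : ℝ} (h2 : 2 < lam) (h4 : lam ≤ 4) {a b : ℂ → ℝ} (h : Sol lam a b) (hd : fderiv ℝ a 0 = 0) 
    {p : ℂ} (hp0 : p ≠ 0) (hp : fderiv ℝ a p = 0) : ∀ z, a z = 0 := by
  have hr := h.radial h2 h4 hd
  have hs := h.rotP p
  have hr' := hs.radial h2 h4 (h.rotP_crit hp)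
  have k1 : ∀ z, fderiv ℝ a z (I * z) = 0 := radial_fderiv (h.ca.differentiable (by norm_num)) hr
  have k2 := radial_fderiv (hs.ca.differentiable (by norm_num)) hr'
  have hN := one_add_normSq_pos p
  have hNN : ((1 + Complex.normSq p : ℝ) : ℂ) ≠ 0 := by exact_mod_cast hN.ne'
  have hNe : ((1 + Complex.normSq p : ℝ) : ℂ) = 1 + p * (starRingEnd ℂ) p := by push_cast; rw [← Complex.mul_conj]
  have k3 : ∀ z, 1 + (starRingEnd ℂ) p * z ≠ 0 → fderiv ℝ a z (I * ((z - p) * (1 + (starRingEnd ℂ) p * z))) = 0 := by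
    intro z hz
    have := k2 ((z - p) / (1 + (starRingEnd ℂ) p * z))
    have hq : -(starRingEnd ℂ) p * ((z - p) / (1 + (starRingEnd ℂ) p * z)) + 1 = ((1 + Complex.normSq p : ℝ) : ℂ) / (1 + (starRingEnd ℂ) p * z) := by
      rw [eq_div_iff hz, hNe, add_mul, mul_assoc, div_mul_cancel₀ _ hz]; ring
    have hpp : 1 * ((z - p) / (1 + (starRingEnd ℂ) p * z)) + p = z * ((1 + Complex.normSq p : ℝ) : ℂ) / (1 + (starRingEnd ℂ) p * z) := by
      rw [eq_div_iff hz, hNe, add_mul, mul_assoc, div_mul_cancel₀ _ hz]; ring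
    rw [h.Uh_fderiv _ _ _ _ (by rw [hq]; exact div_ne_zero hNN hz), hq, hpp] at this
    rw [show z * ((1 + Complex.normSq p : ℝ) : ℂ) / (1 + (starRingEnd ℂ) p * z) / (((1 + Complex.normSq p : ℝ) : ℂ) / (1 + (starRingEnd ℂ) p * z)) = z by
      rw [div_div_div_cancel_right₀ hz, mul_div_cancel_right₀ _ hNN]] at this
    rw [show (1:ℂ) * 1 - p * -(starRingEnd ℂ) p = ((1 + Complex.normSq p : ℝ) : ℂ) by rw [hNe]; ring] at this
    have e : I * ((z - p) * (1 + (starRingEnd ℂ) p * z)) = (1 + Complex.normSq p) • (I * ((z - p) / (1 + (starRingEnd ℂ) p * z)) * (((1 + Complex.normSq p : ℝ) : ℂ) / (((1 + Complex.normSq p : ℝ) : ℂ) / (1 + (starRingEnd ℂ) p * z))^2)) := by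
      rw [Complex.real_smul]
      generalize ((1 + Complex.normSq p : ℝ) : ℂ) = N at *
      generalize 1 + (starRingEnd ℂ) p * z = D at *
      field_simp
    rw [e, map_smul, this, smul_zero]
  have k4 : ∀ t : ℝ, fderiv ℝ a (t * (I * p)) (I * p) = 0 := by
    intro t
    by_cases ht : t = 0
    · rw [ht]; simp [hd]
    have e1 : fderiv ℝ a (t * (I * p)) p = 0 := by
      have := k1 (t * (I * p))
      rw [show I * (t * (I * p)) = (-t) • p by rw [Complex.real_smul]; push_cast; linear_combination (t * p) * Complex.I_mul_I, map_smul] at this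
      simpa [ht] using this
    have hz : (1 + (starRingEnd ℂ) p * (t * (I * p))) = 1 + ((t * Complex.normSq p : ℝ) : ℂ) * I := by
      push_cast; rw [← Complex.mul_conj]; ring
    have := k3 (t * (I * p)) (by
      rw [hz]; intro hh
      have := congrArg Complex.re hh
      simp at this)
    rw [hz, show I * ((t * (I * p) - p) * (1 + ((t * Complex.normSq p : ℝ) : ℂ) * I)) = (-t * (1 - Complex.normSq p)) • p + (-(1 + t^2 * Complex.normSq p)) • (I * p) by
      rw [Complex.real_smul, Complex.real_smul]; push_cast
      linear_combination (t * p - p * t * Complex.normSq p + t^2 * Complex.normSq p * p * I) * Complex.I_mul_I, map_add, map_smul, map_smul, e1] at this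
    have hpos : 0 < 1 + t^2 * Complex.normSq p := by have := Complex.normSq_nonneg p; positivity
    simp only [smul_eq_mul, mul_zero, zero_add] at this
    rcases mul_eq_zero.1 this with h | h
    · linarith
    · exact h
  have k5 : ∀ t : ℝ, HasDerivAt (fun t : ℝ => a (t * (I * p))) 0 t := by
    intro t
    have e1 : HasDerivAt (fun t : ℝ => (t:ℂ) * (I * p)) (I * p) t := by
      simpa using (Complex.ofRealCLM.hasDerivAt (x := t)).mul_const (I * p)
    have := ((h.ca.differentiable (by norm_num) (t * (I * p))).hasFDerivAt).comp_hasDerivAt t e1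
    rwa [k4] at this
  refine h.const_zero (by linarith) (c := a 0) (fun z => ?_)
  have k6 := is_const_of_deriv_eq_zero (f := fun t : ℝ => a (t * (I * p))) (fun t => (k5 t).differentiableAt) (fun t => (k5 t).deriv) (‖z‖ / ‖p‖) 0
  have : a z = a (((‖z‖ / ‖p‖ : ℝ) : ℂ) * (I * p)) := by
    apply hr
    have : ‖p‖ ≠ 0 := by simpa using hp0
    rw [norm_mul, norm_mul, Complex.norm_I, Complex.norm_real, Real.norm_eq_abs, abs_of_nonneg (by positivity)]
    field_simp
  rw [this]
  simpa using k6

end MF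

namespace MF
open Complex (I)
open Filter Topology

/-- `tanh` and `sech^2` written with exponentials -/
def Tt (s : ℝ) : ℝ := (exp s - exp (-s)) / (exp s + exp (-s))
def Sh (s : ℝ) : ℝ := 4 / (exp s + exp (-s))^2

theorem Tt_deriv (s : ℝ) : HasDerivAt Tt (Sh s) s := by
  have h1 := Real.hasDerivAt_exp s
  have h2 : HasDerivAt (fun s : ℝ => exp (-s)) (-exp (-s)) s := by simpa using (hasDerivAt_neg s).exp
  have hp : exp s + exp (-s) ≠ 0 := by positivity
  refine ((h1.fun_sub h2).fun_div (h1.fun_add h2) hp).congr_deriv ?_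
  unfold Sh
  congr 1
  have : exp s * exp (-s) = 1 := by rw [← Real.exp_add]; simp
  linear_combination 4 * this

theorem Sh_deriv (s : ℝ) : HasDerivAt Sh (-2 * Tt s * Sh s) s := by
  have h1 := Real.hasDerivAt_exp s
  have h2 : HasDerivAt (fun s : ℝ => exp (-s)) (-exp (-s)) s := by simpa using (hasDerivAt_neg s).exp
  have hp : exp s + exp (-s) ≠ 0 := by positivity
  refine ((hasDerivAt_const s (4:ℝ)).fun_div ((h1.fun_add h2).fun_pow 2) (pow_ne_zero 2 hp)).congr_deriv ?_
  unfold Sh Tt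
  generalize exp s = E at *
  generalize exp (-s) = F at *
  field_simp
  push_cast
  ring

theorem Tt_neg (s : ℝ) : Tt (-s) = - Tt s := by
  unfold Tt; rw [neg_neg, add_comm (exp (-s)), ← neg_div]; congr 1; ring
theorem Sh_neg (s : ℝ) : Sh (-s) = Sh s := by
  unfold Sh; rw [neg_neg, add_comm (exp (-s))]
theorem Sh_pos (s : ℝ) : 0 < Sh s := by unfold Sh; positivity
theorem Tt_abs (s : ℝ) : |Tt s| ≤ 1 := by
  have h1 := Real.exp_pos s
  have h2 := Real.exp_pos (-s)
  unfold Tt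
  rw [abs_div, abs_of_pos (add_pos h1 h2), div_le_one (add_pos h1 h2), abs_le]
  constructor <;> linarith
theorem Tt_pos {s : ℝ} (hs : 0 < s) : 0 < Tt s := by
  have h1 := Real.exp_pos s
  have h2 := Real.exp_pos (-s)
  have : exp (-s) < exp s := Real.exp_lt_exp.2 (by linarith)
  exact div_pos (by linarith) (by linarith)
theorem Sh_top : Tendsto Sh atTop (𝓝 0) := by
  have h1 : Tendsto (fun s => exp s + exp (-s)) atTop atTop := by
    refine tendsto_atTop_mono (fun s => ?_) Real.tendsto_exp_atTop
    linarith [Real.exp_pos (-s)]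
  have h2 : Tendsto (fun s => (exp s + exp (-s))^2) atTop atTop := (tendsto_pow_atTop (by norm_num)).comp h1
  exact h2.const_div_atTop 4

def Wf (lam : ℝ) (f f1 : ℝ → ℝ) (s : ℝ) : ℝ := (f1 s)^2/2 - lam * (f s - exp (f s)) * Sh s - lam * (f1 s * Tt s - f s * Sh s) - lam^2/2 * Sh s

theorem Wf_deriv {lam : ℝ} {f f1 : ℝ → ℝ} (hf : ∀ s, HasDerivAt f (f1 s) s) (hf1 : ∀ s, HasDerivAt f1 (lam * (1 - exp (f s)) * Sh s) s) (s : ℝ) :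
    HasDerivAt (Wf lam f f1) (lam * (lam - 2) * Sh s * Tt s * exp (f s)) s := by
  have h := (((((hf1 s).fun_pow 2).div_const 2).fun_sub ((((hf s).fun_sub (hf s).exp).const_mul lam).fun_mul (Sh_deriv s))).fun_sub 
    ((((hf1 s).fun_mul (Tt_deriv s)).fun_sub ((hf s).fun_mul (Sh_deriv s))).const_mul lam)).fun_sub ((Sh_deriv s).const_mul (lam^2/2))
  refine h.congr_deriv ?_
  simp only [Nat.cast_ofNat, Nat.add_one_sub_one, pow_one]
  ring

theorem Wf_top {lam : ℝ} {f f1 : ℝ → ℝ} {L : ℝ} (hf : Tendsto f atTop (𝓝 L)) (hf1 : Tendsto f1 atTop (𝓝 0)) : 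
    Tendsto (Wf lam f f1) atTop (𝓝 0) := by
  have hT : Tendsto (fun s => f1 s * Tt s) atTop (𝓝 0) := by
    refine squeeze_zero_norm (a := fun s => |f1 s|) (fun s => ?_) (by simpa using hf1.abs)
    rw [Real.norm_eq_abs, abs_mul]
    exact mul_le_of_le_one_right (abs_nonneg _) (Tt_abs s)
  have h := ((((hf1.pow 2).div_const 2).sub (((hf.sub ((Real.continuous_exp.tendsto L).comp hf)).const_mul lam).mul Sh_top)).sub 
    ((hT.sub (hf.mul Sh_top)).const_mul lam)).sub (Sh_top.const_mul (lam^2/2))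
  refine (h.congr (fun s => ?_)).trans (by simp)
  simp only [Wf, Function.comp]

theorem ode_contra {lam : ℝ} (h2 : 2 < lam) {f f1 g g1 : ℝ → ℝ} (hf : ∀ s, HasDerivAt f (f1 s) s) (hf1 : ∀ s, HasDerivAt f1 (lam * (1 - exp (f s)) * Sh s) s)
    (hg : ∀ s, HasDerivAt g (g1 s) s) (hg1 : ∀ s, HasDerivAt g1 (lam * (1 - exp (g s)) * Sh s) s) (hgf : ∀ s, g s = f (-s))
    {L M : ℝ} (hL : Tendsto f atTop (𝓝 L)) (hM : Tendsto g atTop (𝓝 M)) (hL1 : Tendsto f1 atTop (𝓝 0)) (hM1 : Tendsto g1 atTop (𝓝 0))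
    (hmono : StrictMono f) : False := by
  have hV : ∀ s, HasDerivAt (fun s => Wf lam f f1 s - Wf lam g g1 s) (lam * (lam - 2) * Sh s * Tt s * (exp (f s) - exp (g s))) s := by
    intro s
    refine ((Wf_deriv hf hf1 s).fun_sub (Wf_deriv hg hg1 s)).congr_deriv ?_
    ring
  have hV0 : Wf lam f f1 0 - Wf lam g g1 0 = 0 := by
    have e : g 0 = f 0 := by simpa using hgf 0
    have e1 : g1 0 = - f1 0 := by
      have a1 : HasDerivAt g (- f1 0) 0 := by
        have e3 : HasDerivAt f (f1 0) (-0) := by simpa using hf 0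
        have e2 : HasDerivAt (fun s : ℝ => f (-s)) (f1 0 * (-1)) 0 := HasDerivAt.comp (0:ℝ) e3 (hasDerivAt_neg 0)
        have : g = fun s => f (-s) := funext hgf
        rw [this]
        exact e2.congr_deriv (by ring)
      exact (hg 0).unique a1
    have e0 : Tt 0 = 0 := by simp [Tt]
    unfold Wf
    rw [e, e1, e0]; ring
  have hSM : StrictMonoOn (fun s => Wf lam f f1 s - Wf lam g g1 s) (Set.Ici 0) := by
    refine strictMonoOn_of_deriv_pos (convex_Ici 0) (fun s _ => (hV s).continuousAt.continuousWithinAt) (fun s hs => ?_)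
    rw [interior_Ici] at hs
    have hs : 0 < s := hs
    rw [(hV s).deriv]
    have h1 : g s < f s := by rw [hgf]; exact hmono (by linarith)
    have h3 : exp (g s) < exp (f s) := Real.exp_lt_exp.2 h1
    have := Sh_pos s
    have := Tt_pos hs
    have h5 : 0 < lam - 2 := by linarith
    have h6 : 0 < exp (f s) - exp (g s) := by linarith
    have h7 : 0 < lam := by linarith
    positivity
  have hlim : Tendsto (fun s => Wf lam f f1 s - Wf lam g g1 s) atTop (𝓝 0) := by
    simpa using (Wf_top (lam := lam) hL hL1).sub (Wf_top (lam := lam) hM hM1)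
  have h1 : 0 < Wf lam f f1 1 - Wf lam g g1 1 := by
    have := hSM (show (0:ℝ) ∈ Set.Ici 0 by simp) (show (1:ℝ) ∈ Set.Ici 0 by simp) one_pos
    simp only [hV0] at this
    exact this
  have h3 : Wf lam f f1 1 - Wf lam g g1 1 ≤ 0 := by
    refine ge_of_tendsto hlim ?_
    filter_upwards [eventually_ge_atTop 1] with s hs
    exact hSM.monotoneOn (show (1:ℝ) ∈ Set.Ici 0 by simp) (show s ∈ Set.Ici 0 from (by linarith : (0:ℝ) ≤ s)) hs
  linarith

theorem Sol.ode {lam : ℝ} {a b : ℂ → ℝ} (h : Sol lam a b) (hr : ∀ w w' : ℂ, ‖w‖ = ‖w'‖ → a w = a w') :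
    ∃ f1 : ℝ → ℝ, (∀ s, HasDerivAt (fun s : ℝ => a (exp s)) (f1 s) s) ∧ (∀ s, HasDerivAt f1 (lam * (1 - exp (a (exp s))) * Sh s) s) ∧
      Tendsto f1 atBot (𝓝 0) ∧ Tendsto (fun s : ℝ => a (exp s)) atBot (𝓝 (a 0)) ∧ ∀ s, f1 s = fderiv ℝ a (exp s) (exp s) := by
  obtain ⟨f1, hf1⟩ : ∃ f1 : ℝ → ℝ, f1 = fun s : ℝ => fderiv ℝ a (exp s) (exp s) := ⟨_, rfl⟩
  have hexp : ∀ s : ℝ, HasDerivAt (fun s : ℝ => ((exp s : ℝ) : ℂ)) ((exp s : ℝ) : ℂ) s := fun s => (Real.hasDerivAt_exp s).ofReal_comp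
  have d1 : ∀ s, HasDerivAt (fun s : ℝ => a (exp s)) (f1 s) s := by
    intro s
    have := ((h.ca.differentiable (by norm_num) (exp s)).hasFDerivAt).comp_hasDerivAt s (hexp s)
    rw [hf1]; exact this
  have hG : ∀ y : ℂ, a (Complex.exp y) = a (exp y.re) := by
    intro y; apply hr
    rw [Complex.norm_exp, Complex.norm_real, Real.norm_eq_abs, abs_of_pos (Real.exp_pos _)]
  have hGd : ∀ (k k1 : ℝ → ℝ), (∀ s, HasDerivAt k (k1 s) s) → ∀ y : ℂ, HasFDerivAt (fun y : ℂ => k y.re) (k1 y.re • Complex.reCLM) y := by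
    intro k k1 hk y
    have := (hk y.re).comp_hasFDerivAt y (Complex.reCLM.hasFDerivAt (x := y))
    exact this
  have hdiff : Differentiable ℝ f1 := by
    rw [hf1]
    intro s
    have e1 : DifferentiableAt ℝ (fun s : ℝ => ((exp s : ℝ) : ℂ)) s := (hexp s).differentiableAt
    have e2 : DifferentiableAt ℝ (fderiv ℝ a) ((exp s : ℝ) : ℂ) := (h.ca.fderiv_right (m := 1) (by norm_num)).differentiable (by norm_num) _
    have e3 : DifferentiableAt ℝ (fun s : ℝ => fderiv ℝ a ((exp s : ℝ) : ℂ)) s := DifferentiableAt.comp s e2 e1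
    exact e3.clm_apply e1
  refine ⟨f1, d1, fun s => ?_, ?_, ?_, fun s => by rw [hf1]⟩
  · have h1 := hdiff s |>.hasDerivAt
    refine h1.congr_deriv ?_
    have h2 := Lp_comp_holo h.ca (M := Complex.exp) (z := s) (by fun_prop)
    have h3 : (fun y => a (Complex.exp y)) = fun y => (fun s : ℝ => a (exp s)) y.re := funext hG
    rw [h3] at h2
    unfold Lp at h2
    have h4 : ∀ v : ℂ, (fun y => fderiv ℝ (fun y : ℂ => (fun s : ℝ => a (exp s)) y.re) y v) = fun y => (fun t => v.re * f1 t) y.re := by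
      intro v; funext y
      rw [(hGd _ _ d1 y).fderiv]
      simp [mul_comm]
    have h5 : ∀ v : ℂ, fderiv ℝ (fun y : ℂ => (fun t => v.re * f1 t) y.re) s v = v.re * deriv f1 s * v.re := by
      intro v
      rw [(hGd _ (fun t => v.re * deriv f1 t) (fun t => (hdiff t).hasDerivAt.const_mul _) s).fderiv]
      simp
    rw [h4, h4, h5, h5] at h2
    simp only [Complex.one_re, Complex.I_re] at h2
    rw [show (1:ℝ) * deriv f1 s * 1 + 0 * deriv f1 s * 0 = deriv f1 s by ring] at h2
    rw [h2]
    have h6 := h.la (Complex.exp s)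
    unfold Lp at h6
    rw [h6, hG, Complex.deriv_exp, Complex.normSq_eq_norm_sq, Complex.norm_exp]
    simp only [Complex.ofReal_re]
    unfold Sh
    have : exp s * exp (-s) = 1 := by rw [← Real.exp_add]; simp
    have hE := Real.exp_pos s
    rw [Real.exp_neg]
    generalize exp s = E at *
    field_simp
    ring
  · have e0 : Tendsto (fun s : ℝ => ((exp s : ℝ) : ℂ)) atBot (𝓝 0) := by
      have := (Complex.continuous_ofReal.tendsto 0).comp Real.tendsto_exp_atBot
      rw [Complex.ofReal_zero] at this
      exact this
    have e1 : Continuous (fun z : ℂ => fderiv ℝ a z z) := (h.ca.continuous_fderiv (by norm_num)).clm_apply continuous_id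
    have e2 := (e1.tendsto 0).comp e0
    rw [map_zero] at e2
    rw [hf1]
    exact e2
  · have e0 : Tendsto (fun s : ℝ => ((exp s : ℝ) : ℂ)) atBot (𝓝 0) := by
      have := (Complex.continuous_ofReal.tendsto 0).comp Real.tendsto_exp_atBot
      rw [Complex.ofReal_zero] at this
      exact this
    exact (h.ca.continuous.tendsto 0).comp e0

theorem Sol.crit_zero {lam : ℝ} (h2 : 2 < lam) (h4 : lam ≤ 4) {a b : ℂ → ℝ} (h : Sol lam a b) (hd : fderiv ℝ a 0 = 0) :
    ∀ z, a z = 0 := by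
  by_cases hc : ∃ p : ℂ, p ≠ 0 ∧ fderiv ℝ a p = 0
  · obtain ⟨p, hp0, hp⟩ := hc
    exact h.two_axes h2 h4 hd hp0 hp
  exfalso
  push Not at hc
  have hr := h.radial h2 h4 hd
  have hrb : ∀ w w' : ℂ, ‖w‖ = ‖w'‖ → b w = b w' := by
    intro w w' hw
    by_cases h0 : w = 0
    · subst h0
      have : w' = 0 := by simpa using hw.symm
      rw [this]
    · have h0' : w' ≠ 0 := by rintro rfl; exact h0 (by simpa using hw)
      rw [h.ab w h0, h.ab w' h0']
      apply hr
      simp [hw]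
  obtain ⟨f1, hf, hf1, hfl1, hfl, hfe⟩ := h.ode hr
  obtain ⟨g1, hg, hg1, hgl1, hgl, hge⟩ := h.symm.ode hrb
  have hgf : ∀ s : ℝ, b (exp s) = a (exp (-s)) := by
    intro s
    rw [h.ab _ (by exact_mod_cast (Real.exp_pos s).ne'), Complex.conj_ofReal, Real.exp_neg]; push_cast; rfl
  have hg1f : ∀ s : ℝ, g1 s = - f1 (-s) := by
    intro s
    have e2 : HasDerivAt (fun s : ℝ => a (exp (-s))) (f1 (-s) * (-1)) s := HasDerivAt.comp s (hf (-s)) (hasDerivAt_neg s)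
    have e3 : (fun s : ℝ => b (exp s)) = fun s : ℝ => a (exp (-s)) := funext hgf
    have e4 := hg s
    rw [e3] at e4
    rw [e4.unique e2]; ring
  have hne : ∀ s, f1 s ≠ 0 := by
    intro s hs
    rw [hfe] at hs
    have hE := Real.exp_pos s
    have hEn : ((exp s : ℝ) : ℂ) ≠ 0 := by exact_mod_cast hE.ne'
    refine hc _ hEn ?_
    have k := radial_fderiv (h.ca.differentiable (by norm_num)) hr ((exp s : ℝ) : ℂ)
    have e1 : fderiv ℝ a ((exp s : ℝ) : ℂ) 1 = 0 := by
      rw [show ((exp s : ℝ) : ℂ) = (exp s) • (1:ℂ) by rw [Complex.real_smul, mul_one]] at hs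
      rw [map_smul] at hs
      rw [show ((exp s) • (1:ℂ)) = ((exp s : ℝ) : ℂ) by rw [Complex.real_smul, mul_one]] at hs
      simpa using hs
    have e2 : fderiv ℝ a ((exp s : ℝ) : ℂ) I = 0 := by
      have e : I * ((exp s : ℝ) : ℂ) = (exp s) • I := by rw [Complex.real_smul, mul_comm]
      rw [e, map_smul] at k
      simpa using k
    ext v
    rw [clm_split, e1, e2]; simp
  have hinj : Function.Injective (fun s : ℝ => a (exp s)) := by
    intro x y hxy
    by_contra hne'
    rcases lt_or_gt_of_ne hne' with hlt | hlt
    · obtain ⟨c, _, hc⟩ := exists_hasDerivAt_eq_zero hlt (fun s _ => (hf s).continuousAt.continuousWithinAt) hxy (fun s _ => hf s)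
      exact hne c hc
    · obtain ⟨c, _, hc⟩ := exists_hasDerivAt_eq_zero hlt (fun s _ => (hf s).continuousAt.continuousWithinAt) hxy.symm (fun s _ => hf s)
      exact hne c hc
  have hcont : Continuous (fun s : ℝ => a (exp s)) := continuous_iff_continuousAt.2 fun s => (hf s).continuousAt
  have hLf : Tendsto (fun s : ℝ => a (exp s)) atTop (𝓝 (b 0)) := by
    refine (hgl.comp tendsto_neg_atTop_atBot).congr fun s => ?_
    simp only [Function.comp]; rw [hgf, neg_neg]
  have hLg : Tendsto (fun s : ℝ => b (exp s)) atTop (𝓝 (a 0)) := by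
    refine (hfl.comp tendsto_neg_atTop_atBot).congr fun s => ?_
    simp only [Function.comp]; rw [hgf]
  have hLf1 : Tendsto f1 atTop (𝓝 0) := by
    have := (hgl1.comp tendsto_neg_atTop_atBot).neg
    rw [neg_zero] at this
    refine this.congr fun s => ?_
    simp only [Function.comp]; rw [hg1f, neg_neg, neg_neg]
  have hLg1 : Tendsto g1 atTop (𝓝 0) := by
    have := (hfl1.comp tendsto_neg_atTop_atBot).neg
    rw [neg_zero] at this
    refine this.congr fun s => ?_
    simp only [Function.comp]; rw [hg1f]
  rcases hcont.strictMono_of_inj hinj with hm | hm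
  · exact ode_contra h2 hf hf1 hg hg1 hgf hLf hLg hLf1 hLg1 hm
  · refine ode_contra h2 hg hg1 hf hf1 (fun s => ?_) hLg hLf hLg1 hLf1 (fun x y hxy => ?_)
    · simp only [hgf, neg_neg]
    · simp only [hgf]
      exact hm (by linarith)

theorem Sol.zero_b {lam : ℝ} {a b : ℂ → ℝ} (h : Sol lam a b) (ha : ∀ z, a z = 0) : ∀ z, b z = 0 := by
  have : b = fun _ => 0 := by
    refine Continuous.ext_on (dense_compl_singleton (0:ℂ)) h.cb.continuous continuous_const (fun z hz => ?_)
    rw [h.ab z hz, ha]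
  intro z; rw [this]

theorem Sol.crit_zero' {lam : ℝ} (h2 : 2 < lam) (h4 : lam ≤ 4) {a b : ℂ → ℝ} (h : Sol lam a b) {p : ℂ} (hd : fderiv ℝ a p = 0) :
    ∀ z, a z = 0 := by
  have h1 := (h.rotP p).crit_zero h2 h4 (h.rotP_crit hd)
  have : a = fun _ => 0 := by
    refine Continuous.ext_on (dense_compl_singleton (-((starRingEnd ℂ) p)⁻¹)) h.ca.continuous continuous_const (fun w hw => ?_)
    have hw1 : 1 + (starRingEnd ℂ) p * w ≠ 0 := by
      intro h0
      by_cases hp : (starRingEnd ℂ) p = 0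
      · rw [hp] at h0; simp at h0
      · refine hw (show w = -((starRingEnd ℂ) p)⁻¹ from ?_)
        field_simp
        linear_combination h0
    have hN := one_add_normSq_pos p
    have hNN : ((1 + Complex.normSq p : ℝ) : ℂ) ≠ 0 := by exact_mod_cast hN.ne'
    have hNe : ((1 + Complex.normSq p : ℝ) : ℂ) = 1 + p * (starRingEnd ℂ) p := by push_cast; rw [← Complex.mul_conj]
    have h3 := h1 ((w - p) / (1 + (starRingEnd ℂ) p * w))
    have hq : -(starRingEnd ℂ) p * ((w - p) / (1 + (starRingEnd ℂ) p * w)) + 1 = ((1 + Complex.normSq p : ℝ) : ℂ) / (1 + (starRingEnd ℂ) p * w) := by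
      rw [eq_div_iff hw1, hNe, add_mul, mul_assoc, div_mul_cancel₀ _ hw1]; ring
    have hpp : 1 * ((w - p) / (1 + (starRingEnd ℂ) p * w)) + p = w * ((1 + Complex.normSq p : ℝ) : ℂ) / (1 + (starRingEnd ℂ) p * w) := by
      rw [eq_div_iff hw1, hNe, add_mul, mul_assoc, div_mul_cancel₀ _ hw1]; ring
    simp only [hq, hpp] at h3
    rw [Uh_a _ _ (div_ne_zero hNN hw1), div_div_div_cancel_right₀ hw1, mul_div_cancel_right₀ _ hNN] at h3
    exact h3
  intro z; rw [this]

theorem Sol.exists_crit {lam : ℝ} {a b : ℂ → ℝ} (h : Sol lam a b) : (∃ p, fderiv ℝ a p = 0) ∨ (∃ p, fderiv ℝ b p = 0) := by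
  have hK := isCompact_closedBall (0:ℂ) 1
  have hKn : (Metric.closedBall (0:ℂ) 1).Nonempty := ⟨0, by simp⟩
  obtain ⟨x, hx, hxm⟩ := hK.exists_isMaxOn hKn h.ca.continuous.continuousOn
  obtain ⟨y, hy, hym⟩ := hK.exists_isMaxOn hKn h.cb.continuous.continuousOn
  have key : ∀ {a b : ℂ → ℝ} (h : Sol lam a b) {x y : ℂ}, IsMaxOn a (Metric.closedBall (0:ℂ) 1) x → IsMaxOn b (Metric.closedBall (0:ℂ) 1) y → 
      b y ≤ a x → fderiv ℝ a x = 0 := by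
    intro a b h x y hx hy hxy
    apply IsLocalMax.fderiv_eq_zero
    refine Filter.Eventually.of_forall fun z => ?_
    by_cases hz : ‖z‖ ≤ 1
    · exact hx (show z ∈ Metric.closedBall (0:ℂ) 1 by simpa using hz)
    · push Not at hz
      have hz0 : z ≠ 0 := by rintro rfl; simp at hz; linarith
      rw [h.symm.ab z hz0]
      refine le_trans (hy (show _ ∈ Metric.closedBall (0:ℂ) 1 from ?_)) hxy
      simp only [Metric.mem_closedBall, dist_zero_right, norm_inv, RCLike.norm_conj]
      exact inv_le_one_of_one_le₀ hz.le
  rcases le_total (b y) (a x) with hh | hh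
  · exact Or.inl ⟨x, key h hxm hym hh⟩
  · exact Or.inr ⟨y, key h.symm hym hxm hh⟩

theorem Sol.main_gt {lam : ℝ} (h2 : 2 < lam) (h4 : lam ≤ 4) {a b : ℂ → ℝ} (h : Sol lam a b) : ∀ z, a z = 0 := by
  rcases h.exists_crit with ⟨p, hp⟩ | ⟨p, hp⟩
  · exact h.crit_zero' h2 h4 hp
  · exact h.symm.zero_b (h.symm.crit_zero' h2 h4 hp)

end MF

namespace MF
open Complex (I)
open Filter Topology

theorem fderiv_symm {f : ℂ → ℝ} (hf : ContDiff ℝ 2 f) (z v w : ℂ) : 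
    fderiv ℝ (fun y => fderiv ℝ f y v) z w = fderiv ℝ (fun y => fderiv ℝ f y w) z v := by
  have h1 : ∀ v w, fderiv ℝ (fun y => fderiv ℝ f y v) z w = fderiv ℝ (fderiv ℝ f) z w v := by
    intro v w
    rw [fderiv_clm_apply ((hf.fderiv_right (m := 1) (by norm_num)).differentiable (by norm_num) z) (by fun_prop)]
    simp
  have h2 : IsSymmSndFDerivAt ℝ f z := hf.contDiffAt.isSymmSndFDerivAt (by simp)
  rw [h1, h1, h2.eq]

theorem ibp {F ζ : ℂ → ℝ} (hF : ContDiff ℝ 1 F) (hζ : ContDiff ℝ 1 ζ) (hc : HasCompactSupport ζ) (v : ℂ) : 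
    Integrable (fun z => fderiv ℝ F z v * ζ z + F z * fderiv ℝ ζ z v) ∧ 
    ∫ z, (fderiv ℝ F z v * ζ z + F z * fderiv ℝ ζ z v) = 0 := by
  have h1 : (fun z => fderiv ℝ F z v * ζ z + F z * fderiv ℝ ζ z v) = fun z => fderiv ℝ (fun y => F y * ζ y) z v := by
    funext z
    rw [fderiv_fun_mul (hF.differentiable (by norm_num) z) (hζ.differentiable (by norm_num) z)]
    simp [ContinuousLinearMap.add_apply, mul_comm]
    ring
  have h2 : ContDiff ℝ 1 (fun y => F y * ζ y) := hF.mul hζ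
  have h3 : HasCompactSupport (fun y => F y * ζ y) := hc.mul_left
  rw [h1]
  exact ⟨(continuous_fderiv_apply h2 v).integrable_of_hasCompactSupport (h3.fderiv_apply (𝕜 := ℝ) v), integral_fderiv_zero' h2 h3 v⟩

theorem param_deriv {u v : ℂ → ℝ} (hu : ContDiff ℝ 1 u) (hv : Continuous v) (hc : HasCompactSupport v) (w : ℂ) :
    HasDerivAt (fun t : ℝ => ∫ z, u (z + t * w) * v z) (∫ z, fderiv ℝ u z w * v z) 0 := by
  have hcu : ∀ t : ℝ, Continuous (fun z : ℂ => u (z + t * w) * v z) := fun t => 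
    (hu.continuous.comp (continuous_id.add continuous_const)).mul hv
  have hK : IsCompact ((fun x : ℂ × ℝ => x.1 + x.2 * w) '' (tsupport v ×ˢ Set.Icc (-1:ℝ) 1)) := by
    refine (IsCompact.prod hc isCompact_Icc).image (by fun_prop)
  obtain ⟨C, hC⟩ := hK.exists_bound_of_continuousOn (continuous_fderiv_apply hu w).continuousOn
  have h := hasDerivAt_integral_of_dominated_loc_of_deriv_le (μ := volume) (F := fun (t : ℝ) (z : ℂ) => u (z + t * w) * v z) 
    (F' := fun (t : ℝ) (z : ℂ) => fderiv ℝ u (z + t * w) w * v z) (x₀ := (0:ℝ)) (s := Metric.ball (0:ℝ) 1) (bound := fun z => C * ‖v z‖) 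
    (Metric.ball_mem_nhds _ one_pos) (Eventually.of_forall fun t => (hcu t).aestronglyMeasurable) 
    ((hcu 0).integrable_of_hasCompactSupport hc.mul_left) 
    ((((continuous_fderiv_apply hu w).comp (continuous_id.add continuous_const)).mul hv).aestronglyMeasurable)
    (Eventually.of_forall fun z t ht => by
      rw [norm_mul]
      by_cases hz : z ∈ tsupport v
      · refine mul_le_mul_of_nonneg_right (hC _ ⟨(z, t), ⟨hz, ?_⟩, rfl⟩) (norm_nonneg _)
        rw [Metric.mem_ball, dist_zero_right, Real.norm_eq_abs, abs_lt] at ht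
        exact ⟨ht.1.le, ht.2.le⟩
      · rw [image_eq_zero_of_notMem_tsupport hz]; simp)
    ((hv.norm.integrable_of_hasCompactSupport hc.norm).const_mul C)
    (Eventually.of_forall fun z t ht => by
      have e1 : HasDerivAt (fun t : ℝ => z + (t:ℂ) * w) w t := by
        simpa using ((Complex.ofRealCLM.hasDerivAt (x := t)).mul_const w).const_add z
      have e2 := ((hu.differentiable (by norm_num) (z + t * w)).hasFDerivAt).comp_hasDerivAt t e1
      exact e2.mul_const (v z))
  simpa using h.2

theorem curl_zero {q ζ : ℂ → ℝ} (hq : ContDiff ℝ 1 q) (hζ : ContDiff ℝ 1 ζ) (hc : HasCompactSupport ζ) :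
    Integrable (fun z => fderiv ℝ q z 1 * fderiv ℝ ζ z I - fderiv ℝ q z I * fderiv ℝ ζ z 1) ∧ 
    ∫ z, (fderiv ℝ q z 1 * fderiv ℝ ζ z I - fderiv ℝ q z I * fderiv ℝ ζ z 1) = 0 := by
  have i1 : ∀ v w : ℂ, Integrable (fun z => fderiv ℝ q z v * fderiv ℝ ζ z w) := fun v w => 
    ((continuous_fderiv_apply hq v).mul (continuous_fderiv_apply hζ w)).integrable_of_hasCompactSupport 
      ((hc.fderiv_apply (𝕜 := ℝ) w).mul_left)
  refine ⟨(i1 1 I).sub (i1 I 1), ?_⟩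
  rw [integral_sub (i1 1 I) (i1 I 1), sub_eq_zero]
  obtain ⟨R, hR⟩ : ∃ R : ℝ, ∀ z, R < ‖z‖ → ζ z = 0 := by
    obtain ⟨R, hR⟩ := hc.isBounded.subset_closedBall (0:ℂ)
    refine ⟨R, fun z hz => image_eq_zero_of_notMem_tsupport fun h => ?_⟩
    have := hR h
    simp at this
    linarith
  obtain ⟨θ, hθ⟩ : ∃ θ : ℂ → ℝ, θ = fun z => max 0 (min 1 (R + 2 - ‖z‖)) := ⟨_, rfl⟩
  have θc : Continuous θ := by rw [hθ]; fun_prop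
  have θ1 : ∀ z, ‖z‖ ≤ R + 1 → θ z = 1 := by
    intro z hz; rw [hθ]; simp only
    rw [min_eq_left (by linarith), max_eq_right (by norm_num)]
  have θ0 : HasCompactSupport θ := by
    refine HasCompactSupport.of_support_subset_isCompact (isCompact_closedBall (0:ℂ) (R+2)) (fun z hz => ?_)
    by_contra hz'
    apply hz
    simp at hz'
    rw [hθ]; simp only
    exact max_eq_left ((min_le_right _ _).trans (by linarith))
  have d1 := param_deriv (v := fun z => θ z * fderiv ℝ q z 1) hζ (θc.mul (continuous_fderiv_apply hq 1)) (θ0.mul_right) I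
  have d2 := param_deriv hq (continuous_fderiv_apply hζ 1) (hc.fderiv_apply (𝕜 := ℝ) 1) (-I)
  have hfz : ∀ z w, R + 1 < ‖z‖ → fderiv ℝ ζ z w = 0 := by
    intro z w hz
    have : ζ =ᶠ[𝓝 z] fun _ => 0 := by
      have : ∀ᶠ y in 𝓝 z, R < ‖y‖ := (isOpen_lt continuous_const continuous_norm).mem_nhds (by show R < ‖z‖; linarith)
      filter_upwards [this] with y hy using hR y hy
    rw [this.fderiv_eq]; simp
  have e1 : ∫ z, fderiv ℝ ζ z I * (θ z * fderiv ℝ q z 1) = ∫ z, fderiv ℝ q z 1 * fderiv ℝ ζ z I := by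
    congr 1; funext z
    by_cases hz : ‖z‖ ≤ R + 1
    · rw [θ1 z hz]; ring
    · rw [hfz z I (not_le.1 hz)]; ring
  have e2 : ∫ z, fderiv ℝ q z (-I) * fderiv ℝ ζ z 1 = - ∫ z, fderiv ℝ q z I * fderiv ℝ ζ z 1 := by
    rw [← integral_neg]
    congr 1; funext z
    rw [map_neg]; ring
  have key : (fun t : ℝ => ∫ z, ζ (z + t * I) * (θ z * fderiv ℝ q z 1)) =ᶠ[𝓝 0] fun t : ℝ => - ∫ z, q (z + t * (-I)) * fderiv ℝ ζ z 1 := by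
    filter_upwards [Metric.ball_mem_nhds (0:ℝ) one_pos] with t ht
    have ht1 : |t| < 1 := by simpa using ht
    have a1 : ∫ z, ζ (z + t * I) * (θ z * fderiv ℝ q z 1) = ∫ z, ζ (z + t * I) * fderiv ℝ q z 1 := by
      congr 1; funext z
      by_cases hz : ‖z‖ ≤ R + 1
      · rw [θ1 z hz]; ring
      · rw [hR (z + t * I)]
        · ring
        · have := norm_sub_le (z + t * I) (t * I)
          rw [add_sub_cancel_right] at this
          have h5 : ‖(t:ℂ) * I‖ = |t| := by simp
          rw [h5] at this
          linarith [not_le.1 hz]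
    have a2 : ∫ z, ζ (z + t * I) * fderiv ℝ q z 1 = ∫ z, ζ z * fderiv ℝ q (z + t * (-I)) 1 := by
      rw [← integral_add_right_eq_self (fun z => ζ z * fderiv ℝ q (z + t * (-I)) 1) (t * I)]
      congr 1; funext z
      congr 3; ring
    have hqt : ContDiff ℝ 1 (fun z => q (z + t * (-I))) := hq.comp (contDiff_id.add contDiff_const)
    have a3 := (ibp hqt hζ hc 1).2
    have a4 : ∀ z, fderiv ℝ (fun z => q (z + t * (-I))) z 1 = fderiv ℝ q (z + t * (-I)) 1 := by
      intro z; rw [fderiv_comp_add_right]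
    simp only [a4] at a3
    have hq1c : Continuous (fun z => fderiv ℝ q (z + t * (-I)) 1) := (continuous_fderiv_apply hq 1).comp (continuous_id.add continuous_const)
    have b1 : Integrable (fun z => fderiv ℝ q (z + t * (-I)) 1 * ζ z) := (hq1c.mul hζ.continuous).integrable_of_hasCompactSupport hc.mul_left
    have b2 : Integrable (fun z => q (z + t * (-I)) * fderiv ℝ ζ z 1) := 
      (hqt.continuous.mul (continuous_fderiv_apply hζ 1)).integrable_of_hasCompactSupport ((hc.fderiv_apply (𝕜 := ℝ) 1).mul_left)
    rw [integral_add b1 b2] at a3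
    rw [a1, a2]
    have a5 : ∫ z, ζ z * fderiv ℝ q (z + t * (-I)) 1 = ∫ z, fderiv ℝ q (z + t * (-I)) 1 * ζ z := by
      congr 1; funext z; ring
    rw [a5]; linarith
  have := (d1.congr_of_eventuallyEq key.symm).unique d2.neg
  rw [e1] at this
  rw [this, e2, neg_neg]

end MF

namespace MF
open Complex (I)
open Filter Topology

theorem zadd {f g : ℂ → ℝ} (hf : Integrable f ∧ ∫ z, f z = 0) (hg : Integrable g ∧ ∫ z, g z = 0) :
    Integrable (fun z => f z + g z) ∧ ∫ z, (f z + g z) = 0 := 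
  ⟨hf.1.add hg.1, by rw [integral_add hf.1 hg.1, hf.2, hg.2, add_zero]⟩

theorem zmul {f : ℂ → ℝ} (c : ℝ) (hf : Integrable f ∧ ∫ z, f z = 0) :
    Integrable (fun z => c * f z) ∧ ∫ z, (c * f z) = 0 := 
  ⟨hf.1.const_mul c, by rw [integral_const_mul, hf.2, mul_zero]⟩

/-- weighted Obata type inequality with a cutoff -/
theorem obata {lam : ℝ} {s : ℂ → ℝ} (hs : ContDiff ℝ 2 s) 
    (hl : ∀ z, Lp s z = lam / 2 * (1 - exp (2 * s z)) * exp (2 * sg z)) {χ : ℂ → ℝ} (hχ : ContDiff ℝ 1 χ) (hc : HasCompactSupport χ) :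
    (2 - lam) * ∫ z, (χ z)^2 * (exp (-s z) * gr s s z) ≤ ∫ z, exp (-2 * sg z - s z) * gr s s z * gr χ χ z := by
  obtain ⟨p, hp⟩ : ∃ p : ℂ → ℝ, p = fun z => fderiv ℝ s z 1 := ⟨_, rfl⟩
  obtain ⟨q, hq⟩ : ∃ q : ℂ → ℝ, q = fun z => fderiv ℝ s z I := ⟨_, rfl⟩
  obtain ⟨m, hm⟩ : ∃ m : ℂ → ℝ, m = fun z => fderiv ℝ sg z 1 := ⟨_, rfl⟩
  obtain ⟨n, hn⟩ : ∃ n : ℂ → ℝ, n = fun z => fderiv ℝ sg z I := ⟨_, rfl⟩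
  have cp : ContDiff ℝ 1 p := by rw [hp]; exact contDiff_fderiv_apply hs 1
  have cq : ContDiff ℝ 1 q := by rw [hq]; exact contDiff_fderiv_apply hs I
  have cm : ContDiff ℝ 1 m := by rw [hm]; exact contDiff_fderiv_apply sg_contDiff 1
  have cn : ContDiff ℝ 1 n := by rw [hn]; exact contDiff_fderiv_apply sg_contDiff I
  have cs : ContDiff ℝ 1 s := hs.of_le (by norm_num)
  have csg : ContDiff ℝ 1 sg := sg_contDiff
  have px : ∀ z, p z = fderiv ℝ s z 1 := fun z => by rw [hp]
  have qx : ∀ z, q z = fderiv ℝ s z I := fun z => by rw [hq]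
  have mx : ∀ z, m z = fderiv ℝ sg z 1 := fun z => by rw [hm]
  have nx : ∀ z, n z = fderiv ℝ sg z I := fun z => by rw [hn]
  have s1 : ∀ z, fderiv ℝ q z 1 = fderiv ℝ p z I := fun z => by rw [hp, hq]; exact fderiv_symm hs z _ _
  have s2 : ∀ z, fderiv ℝ n z 1 = fderiv ℝ m z I := fun z => by rw [hm, hn]; exact fderiv_symm sg_contDiff z _ _
  have s3 : ∀ z, fderiv ℝ q z I = lam / 2 * (1 - exp (2 * s z)) * exp (2 * sg z) - fderiv ℝ p z 1 := fun z => by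
    rw [← hl, hp, hq]; unfold Lp; ring
  have s4 : ∀ z, fderiv ℝ n z I = - exp (2 * sg z) - fderiv ℝ m z 1 := fun z => by
    rw [exp_sg, ← Lp_sg, hm, hn]; unfold Lp; ring
  -- auxiliary functions
  obtain ⟨W, hW⟩ : ∃ W : ℂ → ℝ, W = fun z => exp (-2 * sg z - s z) := ⟨_, rfl⟩
  have cW : ContDiff ℝ 1 W := by rw [hW]; exact ((contDiff_const.mul csg).sub cs).exp
  obtain ⟨L, hL⟩ : ∃ L : ℂ → ℝ, L = fun z => lam / 2 * (1 - exp (2 * s z)) * exp (2 * sg z) := ⟨_, rfl⟩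
  have cL : ContDiff ℝ 1 L := by 
    rw [hL]; exact (contDiff_const.mul (contDiff_const.sub (contDiff_const.mul cs).exp)).mul (contDiff_const.mul csg).exp
  obtain ⟨R, hR⟩ : ∃ R : ℂ → ℝ, R = fun z => p z * p z - q z * q z + 2 * (m z * p z - n z * q z) := ⟨_, rfl⟩
  have cR : ContDiff ℝ 1 R := by 
    rw [hR]; exact ((cp.mul cp).sub (cq.mul cq)).add (contDiff_const.mul ((cm.mul cp).sub (cn.mul cq)))
  obtain ⟨H, hH⟩ : ∃ H : ℂ → ℝ, H = fun z => (-2) * (p z * q z + m z * q z + n z * p z) := ⟨_, rfl⟩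
  have cH : ContDiff ℝ 1 H := by 
    rw [hH]; exact contDiff_const.mul (((cp.mul cq).add (cm.mul cq)).add (cn.mul cp))
  obtain ⟨X, hX⟩ : ∃ X : ℂ → ℝ, X = fun z => (-1) * (χ z * χ z * W z * p z) := ⟨_, rfl⟩
  have cX : ContDiff ℝ 1 X := by rw [hX]; exact contDiff_const.mul (((hχ.mul hχ).mul cW).mul cp)
  obtain ⟨Y, hY⟩ : ∃ Y : ℂ → ℝ, Y = fun z => (-1) * (χ z * χ z * W z * q z) := ⟨_, rfl⟩
  have cY : ContDiff ℝ 1 Y := by rw [hY]; exact contDiff_const.mul (((hχ.mul hχ).mul cW).mul cq)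
  have kX : HasCompactSupport X := by rw [hX]; exact (((hc.mul_left).mul_right).mul_right).mul_left
  have kY : HasCompactSupport Y := by rw [hY]; exact (((hc.mul_left).mul_right).mul_right).mul_left
  have D : ∀ {f : ℂ → ℝ}, ContDiff ℝ 1 f → ∀ z, HasFDerivAt f (fderiv ℝ f z) z := fun hf z => 
    (hf.differentiable (by norm_num) z).hasFDerivAt
  have dW : ∀ z v, fderiv ℝ W z v = W z * (-2 * fderiv ℝ sg z v - fderiv ℝ s z v) := by
    intro z v; rw [hW, ((((D csg z).const_mul (-2)).fun_sub (D cs z)).exp).fderiv]; simp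
  have dL : ∀ z v, fderiv ℝ L z v = lam / 2 * (-(exp (2 * s z) * (2 * fderiv ℝ s z v))) * exp (2 * sg z) + 
      lam / 2 * (1 - exp (2 * s z)) * (exp (2 * sg z) * (2 * fderiv ℝ sg z v)) := by
    intro z v; rw [hL, ((((((D cs z).const_mul 2).exp).const_sub 1).const_mul (lam/2)).fun_mul (((D csg z).const_mul 2).exp)).fderiv]
    simp; ring
  have dR : ∀ z v, fderiv ℝ R z v = 2 * p z * fderiv ℝ p z v - 2 * q z * fderiv ℝ q z v + 
      2 * (fderiv ℝ m z v * p z + m z * fderiv ℝ p z v - fderiv ℝ n z v * q z - n z * fderiv ℝ q z v) := by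
    intro z v
    rw [hR, ((((D cp z).fun_mul (D cp z)).fun_sub ((D cq z).fun_mul (D cq z))).fun_add ((((D cm z).fun_mul (D cp z)).fun_sub ((D cn z).fun_mul (D cq z))).const_mul 2)).fderiv]
    simp; ring
  have dH : ∀ z v, fderiv ℝ H z v = (-2) * (fderiv ℝ p z v * q z + p z * fderiv ℝ q z v + fderiv ℝ m z v * q z + m z * fderiv ℝ q z v + fderiv ℝ n z v * p z + n z * fderiv ℝ p z v) := by
    intro z v
    rw [hH, (((((D cp z).fun_mul (D cq z)).fun_add ((D cm z).fun_mul (D cq z))).fun_add ((D cn z).fun_mul (D cp z))).const_mul (-2)).fderiv]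
    simp; ring
  have dXY : ∀ (r : ℂ → ℝ), ContDiff ℝ 1 r → ∀ z v, fderiv ℝ (fun z => (-1) * (χ z * χ z * W z * r z)) z v = 
      -(2 * χ z * fderiv ℝ χ z v * W z * r z + χ z * χ z * fderiv ℝ W z v * r z + χ z * χ z * W z * fderiv ℝ r z v) := by
    intro r hr z v
    rw [(((((D hχ z).fun_mul (D hχ z)).fun_mul (D cW z)).fun_mul (D hr z)).const_mul (-1)).fderiv]
    simp; ring
  have dX : ∀ z v, fderiv ℝ X z v = 
      -(2 * χ z * fderiv ℝ χ z v * W z * p z + χ z * χ z * fderiv ℝ W z v * p z + χ z * χ z * W z * fderiv ℝ p z v) := 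
    fun z v => by rw [hX]; exact dXY p cp z v
  have dY : ∀ z v, fderiv ℝ Y z v = 
      -(2 * χ z * fderiv ℝ χ z v * W z * q z + χ z * χ z * fderiv ℝ W z v * q z + χ z * χ z * W z * fderiv ℝ q z v) := 
    fun z v => by rw [hY]; exact dXY q cq z v
  have t1 := curl_zero cq cX kX
  have t2 := curl_zero cp cY kY
  have t3 := ibp (F := fun z => L z - R z) (cL.sub cR) cX kX 1
  have t4 := ibp cH cX kX I
  have t5 := ibp cH cY kY 1
  have t6 := ibp (F := fun z => L z + R z) (cL.add cR) cY kY I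
  have dS : ∀ z v, fderiv ℝ (fun z => L z - R z) z v = fderiv ℝ L z v - fderiv ℝ R z v := fun z v => by
    rw [((D cL z).fun_sub (D cR z)).fderiv]; rfl
  have dA : ∀ z v, fderiv ℝ (fun z => L z + R z) z v = fderiv ℝ L z v + fderiv ℝ R z v := fun z v => by
    rw [((D cL z).fun_add (D cR z)).fderiv]; rfl
  have hT := zadd (zadd (zadd (zadd (zadd (zmul 2 t1) (zmul (-2) t2)) t3) t4) t5) t6
  have i1 : Integrable (fun z => (χ z)^2 * (exp (-s z) * gr s s z)) := by
    have e1 : Continuous (fun z => (χ z)^2 * (exp (-s z) * gr s s z)) := 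
      (hχ.continuous.pow 2).mul ((Real.continuous_exp.comp cs.continuous.neg).mul (continuous_gr cs cs))
    refine e1.integrable_of_hasCompactSupport ?_
    refine HasCompactSupport.mul_right ?_
    simp only [pow_two]
    exact hc.mul_left
  have i2 : Integrable (fun z => exp (-2 * sg z - s z) * gr s s z * gr χ χ z) := by
    have e0 : Continuous (fun z => exp (-2 * sg z - s z)) := by have := cW.continuous; rwa [hW] at this
    have e1 : Continuous (fun z => exp (-2 * sg z - s z) * gr s s z * gr χ χ z) := 
      (e0.mul (continuous_gr cs cs)).mul (continuous_gr hχ hχ)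
    refine e1.integrable_of_hasCompactSupport ?_
    refine HasCompactSupport.mul_left ?_
    unfold gr
    exact ((hc.fderiv_apply (𝕜 := ℝ) 1).mul_left).add ((hc.fderiv_apply (𝕜 := ℝ) I).mul_left)
  have key : 0 ≤ ∫ z, (exp (-2 * sg z - s z) * gr s s z * gr χ χ z - (2 - lam) * ((χ z)^2 * (exp (-s z) * gr s s z))) := by
    rw [← hT.2]
    refine integral_mono hT.1 (i2.sub (i1.const_mul _)) (fun z => ?_)
    simp only [dS, dA, dL, dR, dH, dX, dY, dW, s1, s2, s3, s4]
    have hWE : exp (-s z) = W z * exp (2 * sg z) := by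
      rw [hW]; simp only; rw [← Real.exp_add]; congr 1; ring
    have hW0 : 0 < W z := by rw [hW]; exact Real.exp_pos _
    have hW1 : exp (-2 * sg z - s z) = W z := by rw [hW]
    have hLz : L z = lam / 2 * (1 - exp (2 * s z)) * exp (2 * sg z) := by rw [hL]
    have hRz : R z = p z * p z - q z * q z + 2 * (m z * p z - n z * q z) := by rw [hR]
    have hHz : H z = (-2) * (p z * q z + m z * q z + n z * p z) := by rw [hH]
    have hXz : X z = (-1) * (χ z * χ z * W z * p z) := by rw [hX]
    have hYz : Y z = (-1) * (χ z * χ z * W z * q z) := by rw [hY]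
    unfold gr
    rw [hW1, hWE, hLz, hRz, hHz, hXz, hYz, ← px, ← qx, ← mx, ← nx]
    generalize hP : fderiv ℝ p z 1 = P1
    generalize fderiv ℝ p z I = P2
    generalize fderiv ℝ m z 1 = M1
    generalize fderiv ℝ m z I = M2
    generalize fderiv ℝ χ z 1 = c1
    generalize fderiv ℝ χ z I = c2
    generalize exp (2 * s z) = A
    generalize exp (2 * sg z) = E
    generalize W z = w at *
    generalize p z = p'
    generalize q z = q'
    generalize m z = m'
    generalize n z = n'
    generalize χ z = c
    have hsq : 0 ≤ w * ((c * (P1 - (lam / 2 * (1 - A) * E - P1) - (p' * p' - q' * q' + 2 * (m' * p' - n' * q'))) + (c1 * p' - c2 * q'))^2 + 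
        (c * (2 * P2 + (-2) * (p' * q' + m' * q' + n' * p')) + (c2 * p' + c1 * q'))^2) := by positivity
    linarith
  rw [integral_sub i2 (i1.const_mul _), integral_const_mul] at key
  linarith

end MF

namespace MF
open Complex (I)
open Filter Topology

theorem integrable_area : Integrable (fun z : ℂ => 4 / (1 + Complex.normSq z)^2) := by
  have h := (integrable_rpow_neg_one_add_norm_sq (E := ℂ) (μ := volume) (r := 4) (by rw [Complex.finrank_real_complex]; norm_num)).const_mul 4
  refine h.congr (Eventually.of_forall fun z => ?_)
  have hp := one_add_normSq_pos z
  simp only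
  rw [← Complex.normSq_eq_norm_sq, show (-4 / 2 : ℝ) = -(2:ℕ) by norm_num, Real.rpow_neg hp.le, Real.rpow_natCast, div_eq_mul_inv]

theorem exists_log_cutoff : ∃ (K : ℝ) (χ : ℝ → ℂ → ℝ), ∀ N, 0 < N → ContDiff ℝ 1 (χ N) ∧ HasCompactSupport (χ N) ∧
    (∀ z, 0 ≤ χ N z) ∧ (∀ M, N ≤ M → ∀ z, χ N z ≤ χ M z) ∧ (∀ z, Real.log 2 - sg z ≤ N → χ N z = 1) ∧
    ∫ z, gr (χ N) (χ N) z ≤ K / N := by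
  obtain ⟨S, S', cS', hS, p0, p1, z0, z0', o1, o1', b0, b1⟩ := exists_cutoff (δ := 1) one_pos
  have dS : deriv S = S' := funext fun x => (hS x).deriv
  have cS : ContDiff ℝ 1 S := contDiff_one_iff_deriv.2 ⟨fun x => (hS x).differentiableAt, by rw [dS]; exact cS'⟩
  have mS : Monotone S := monotone_of_deriv_nonneg (fun x => (hS x).differentiableAt) (fun x => by rw [dS]; exact p0 x)
  have hG : ∀ z, 0 ≤ Real.log 2 - sg z := fun z => by
    unfold sg
    have : 0 ≤ Real.log (1 + Complex.normSq z) := Real.log_nonneg (by linarith [Complex.normSq_nonneg z])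
    linarith
  refine ⟨2 * ∫ z : ℂ, 4 / (1 + Complex.normSq z)^2, fun N z => S (2 - (Real.log 2 - sg z) / N), fun N hN => ?_⟩
  have csg : ContDiff ℝ 1 sg := sg_contDiff
  have cχ : ContDiff ℝ 1 (fun z => S (2 - (Real.log 2 - sg z) / N)) :=
    cS.comp (contDiff_const.sub ((contDiff_const.sub csg).div_const N))
  have hcs : HasCompactSupport (fun z => S (2 - (Real.log 2 - sg z) / N)) := by
    refine HasCompactSupport.intro (isCompact_closedBall (0:ℂ) (exp N)) (fun z hz => z0 _ ?_)
    have hz' : exp N < ‖z‖ := by simpa using hz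
    have : exp (2 * N) ≤ 1 + Complex.normSq z := by
      rw [Complex.normSq_eq_norm_sq, show 2 * N = N + N by ring, exp_add]
      nlinarith [exp_pos N]
    have h2 : 2 * N ≤ Real.log (1 + Complex.normSq z) := by
      rw [← Real.log_exp (2*N)]; exact Real.log_le_log (exp_pos _) this
    have h3 : 2 ≤ (Real.log 2 - sg z) / N := by
      rw [le_div_iff₀ hN]; unfold sg; linarith
    linarith
  have fd : ∀ z v, fderiv ℝ (fun z => S (2 - (Real.log 2 - sg z) / N)) z v = S' (2 - (Real.log 2 - sg z) / N) / N * fderiv ℝ sg z v := by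
    intro z v
    have h1 : HasFDerivAt sg (fderiv ℝ sg z) z := (csg.differentiable (by norm_num) z).hasFDerivAt
    have h2 : HasFDerivAt (fun z => 2 - (Real.log 2 - sg z) * N⁻¹) _ z := ((h1.const_sub (Real.log 2)).mul_const N⁻¹).const_sub 2
    have h3 := (hS (2 - (Real.log 2 - sg z) * N⁻¹)).comp_hasFDerivAt z h2
    have h4 : HasFDerivAt (fun z => S (2 - (Real.log 2 - sg z) / N)) _ z := h3
    rw [h4.fderiv]
    simp [div_eq_mul_inv]
    ring
  refine ⟨cχ, hcs, fun z => b0 _, fun M hM z => mS ?_, fun z hz => o1 _ ?_, ?_⟩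
  · have := div_le_div_of_nonneg_left (hG z) hN hM
    linarith
  · have : (Real.log 2 - sg z) / N ≤ 1 := by rw [div_le_one hN]; exact hz
    linarith
  · have hgreen := green cχ hcs (φ := sg) sg_contDiff
    have hcf : ∀ v, HasCompactSupport (fun x => fderiv ℝ (fun z => S (2 - (Real.log 2 - sg z) / N)) x v) := fun v => hcs.fderiv_apply ℝ v
    have cs2 : ∀ g : ℂ → ℝ, HasCompactSupport (gr (fun z => S (2 - (Real.log 2 - sg z) / N)) g) := fun g =>
      ((hcf 1).mul_right).add ((hcf I).mul_right)
    have i1 : Integrable (gr (fun z => S (2 - (Real.log 2 - sg z) / N)) (fun z => S (2 - (Real.log 2 - sg z) / N))) :=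
      (continuous_gr cχ cχ).integrable_of_hasCompactSupport (cs2 _)
    have i2 : Integrable (gr (fun z => S (2 - (Real.log 2 - sg z) / N)) sg) :=
      (continuous_gr cχ csg).integrable_of_hasCompactSupport (cs2 _)
    have e1 : ∫ z, gr (fun z => S (2 - (Real.log 2 - sg z) / N)) (fun z => S (2 - (Real.log 2 - sg z) / N)) z ≤
        ∫ z, (2 / N) * gr (fun z => S (2 - (Real.log 2 - sg z) / N)) sg z := by
      refine integral_mono i1 (i2.const_mul _) (fun z => ?_)
      unfold gr
      simp only [fd]
      have q0 := p0 (2 - (Real.log 2 - sg z) / N)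
      have q1 := p1 (2 - (Real.log 2 - sg z) / N)
      generalize S' (2 - (Real.log 2 - sg z) / N) = t at *
      generalize fderiv ℝ sg z 1 = x
      generalize fderiv ℝ sg z I = y
      have : 2 / N * (t / N * x * x + t / N * y * y) - (t / N * x * (t / N * x) + t / N * y * (t / N * y)) = t * (2 - t) / N^2 * (x^2 + y^2) := by
        field_simp
      have h2 : 0 ≤ t * (2 - t) / N^2 * (x^2 + y^2) := by
        have : 0 ≤ 2 - t := by linarith
        positivity
      linarith
    refine e1.trans ?_
    rw [integral_const_mul, hgreen, ← integral_neg]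
    have e2 : ∫ z, -(S (2 - (Real.log 2 - sg z) / N) * Lp sg z) ≤ ∫ z : ℂ, 4 / (1 + Complex.normSq z)^2 := by
      have hc3 : HasCompactSupport (fun z => -(S (2 - (Real.log 2 - sg z) / N) * Lp sg z)) := (hcs.mul_right).neg
      refine integral_mono (Continuous.integrable_of_hasCompactSupport ?_ hc3) integrable_area (fun z => ?_)
      · exact (cχ.continuous.mul (continuous_Lp sg_contDiff)).neg
      · simp only [Lp_sg]
        have h4 : 0 < 4 / (1 + Complex.normSq z)^2 := by have := one_add_normSq_pos z; positivity
        nlinarith [b1 (2 - (Real.log 2 - sg z) / N)]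
    have : 2 * (∫ z : ℂ, 4 / (1 + Complex.normSq z)^2) / N = 2 / N * ∫ z : ℂ, 4 / (1 + Complex.normSq z)^2 := by ring
    rw [this]
    exact mul_le_mul_of_nonneg_left e2 (by positivity)

theorem Sol.weight_bound {lam : ℝ} {a b : ℂ → ℝ} (h : Sol lam a b) : 
    ∃ C : ℝ, 0 ≤ C ∧ ∀ z, exp (-2 * sg z - (1/2) * a z) * gr (fun z => (1/2) * a z) (fun z => (1/2) * a z) z ≤ C := by
  have hK := isCompact_closedBall (0:ℂ) 1
  have ca1 : ContDiff ℝ 1 a := h.ca.of_le (by norm_num)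
  have cb1 : ContDiff ℝ 1 b := h.cb.of_le (by norm_num)
  obtain ⟨A1, hA1⟩ := hK.exists_bound_of_continuousOn (f := fun z => exp (-(1/2) * a z) * ‖fderiv ℝ a z‖^2) 
    (by have := h.ca.continuous; have := ca1.continuous_fderiv (by norm_num); fun_prop)
  obtain ⟨A2, hA2⟩ := hK.exists_bound_of_continuousOn (f := fun z => exp (-(1/2) * b z) * ‖fderiv ℝ b z‖^2) 
    (by have := h.cb.continuous; have := cb1.continuous_fderiv (by norm_num); fun_prop)
  have A1p : 0 ≤ A1 := (norm_nonneg _).trans (hA1 0 (by simp))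
  have A2p : 0 ≤ A2 := (norm_nonneg _).trans (hA2 0 (by simp))
  have hgr : ∀ z, gr (fun z => (1/2) * a z) (fun z => (1/2) * a z) z = (1/4) * ‖fderiv ℝ a z‖^2 := by
    intro z
    rw [norm_fderiv_sq]
    unfold gr
    rw [fderiv_const_mul (h.ca.differentiable (by norm_num) z)]
    simp
    ring
  have hexp : ∀ z, exp (-2 * sg z - (1/2) * a z) = (1 + Complex.normSq z)^2 / 4 * exp (-(1/2) * a z) := by
    intro z
    have hp := one_add_normSq_pos z
    rw [show -2 * sg z - (1/2) * a z = -(2 * sg z) + (-(1/2) * a z) by ring, exp_add, exp_neg, exp_sg, inv_div]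
  refine ⟨A1 + A2, by linarith, fun z => ?_⟩
  rw [hgr, hexp]
  rcases le_total ‖z‖ 1 with hz | hz
  · have h1 := (le_abs_self _).trans (hA1 z (by simpa using hz))
    have h2 : (1 + Complex.normSq z)^2 / 4 ≤ 1 := by
      rw [Complex.normSq_eq_norm_sq]
      have : ‖z‖^2 ≤ 1 := by nlinarith [norm_nonneg z]
      nlinarith [sq_nonneg (‖z‖)]
    have h3 : 0 ≤ exp (-(1/2) * a z) * ‖fderiv ℝ a z‖^2 := by positivity
    have := mul_le_mul_of_nonneg_right h2 h3
    nlinarith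
  · have hz0 : z ≠ 0 := by rintro rfl; simp at hz; linarith
    have hn : 0 < ‖z‖ := by linarith
    have hw : ‖((starRingEnd ℂ) z)⁻¹‖ ≤ 1 := by
      rw [norm_inv, RCLike.norm_conj]; exact inv_le_one_of_one_le₀ hz
    have h1 := (le_abs_self _).trans (hA2 _ (show ((starRingEnd ℂ) z)⁻¹ ∈ Metric.closedBall (0:ℂ) 1 by simpa using hw))
    rw [h.symm.ab z hz0]
    have h2 : ‖fderiv ℝ a z‖ ≤ ‖fderiv ℝ b ((starRingEnd ℂ) z)⁻¹‖ / ‖z‖^2 := by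
      refine ContinuousLinearMap.opNorm_le_bound _ (by positivity) (fun v => ?_)
      rw [h.symm.fderiv_b hz0]
      refine (ContinuousLinearMap.le_opNorm _ _).trans (le_of_eq ?_)
      rw [norm_neg, norm_div, norm_pow, RCLike.norm_conj, RCLike.norm_conj]
      ring
    have h3 : ‖fderiv ℝ a z‖^2 ≤ ‖fderiv ℝ b ((starRingEnd ℂ) z)⁻¹‖^2 / ‖z‖^4 := by
      refine (pow_le_pow_left₀ (norm_nonneg _) h2 2).trans (le_of_eq ?_)
      rw [div_pow]; ring
    rw [Complex.normSq_eq_norm_sq]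
    have h4 : (1 + ‖z‖^2)^2 / 4 ≤ ‖z‖^4 := by nlinarith [norm_nonneg z, sq_nonneg (‖z‖^2 - 1), one_le_pow₀ hz (n := 2)]
    have h5 : (1 + ‖z‖^2)^2 / 4 * ‖fderiv ℝ a z‖^2 ≤ ‖fderiv ℝ b ((starRingEnd ℂ) z)⁻¹‖^2 := by
      calc _ ≤ ‖z‖^4 * (‖fderiv ℝ b ((starRingEnd ℂ) z)⁻¹‖^2 / ‖z‖^4) := mul_le_mul h4 h3 (by positivity) (by positivity)
        _ = _ := by field_simp
    have h6 := mul_le_mul_of_nonneg_left h5 (exp_pos (-(1/2) * b ((starRingEnd ℂ) z)⁻¹)).le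
    have h7 : 0 ≤ exp (-(1/2) * b ((starRingEnd ℂ) z)⁻¹) * ((1 + ‖z‖^2)^2 / 4 * ‖fderiv ℝ a z‖^2) := by positivity
    nlinarith

theorem Sol.main_lt {lam : ℝ} (h0 : 0 < lam) (h2 : lam < 2) {a b : ℂ → ℝ} (h : Sol lam a b) : ∀ z, a z = 0 := by
  obtain ⟨C, hC0, hC⟩ := h.weight_bound
  obtain ⟨K, χ, hχ⟩ := exists_log_cutoff
  have hsx : ∀ z, (fun z => (1/2) * a z) z = (1/2) * a z := fun z => rfl
  obtain ⟨s, hs⟩ : ∃ s : ℂ → ℝ, s = fun z => (1/2) * a z := ⟨_, rfl⟩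
  rw [← hs] at hC
  have hsz : ∀ z, s z = (1/2) * a z := fun z => by rw [hs]
  simp only [← hsz] at hC
  have cs : ContDiff ℝ 2 s := by rw [hs]; exact contDiff_const.mul h.ca
  have cs1 : ContDiff ℝ 1 s := cs.of_le (by norm_num)
  have csg : ContDiff ℝ 1 sg := sg_contDiff
  have hl : ∀ z, Lp s z = lam/2*(1-exp (2*s z))*exp (2*sg z) := fun z => by
    rw [exp_sg, hsz, show 2 * ((1/2) * a z) = a z by ring, hs, Lp_const_mul h.ca, h.la]; ring
  have grn : ∀ f z, 0 ≤ gr f f z := fun f z => by rw [← norm_fderiv_sq]; positivity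
  have cI : ∀ N, 0 < N → Continuous (fun z => (χ N z)^2 * (exp (-s z) * gr s s z)) := fun N hN => by
    have := (hχ N hN).1.continuous; have := continuous_gr cs1 cs1; have := cs1.continuous
    fun_prop
  have sI : ∀ N, 0 < N → HasCompactSupport (fun z => (χ N z)^2 * (exp (-s z) * gr s s z)) := fun N hN => by
    have := (hχ N hN).2.1.mul_left (f := χ N) 
    have h3 : HasCompactSupport (fun z => (χ N z)^2) := by
      simp only [pow_two]; exact this
    exact h3.mul_right
  have main : ∀ N, 0 < N → (2 - lam) * ∫ z, (χ N z)^2*(exp (-s z)*gr s s z) ≤ C * (K / N) := by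
    intro N hN
    obtain ⟨c1, c2, c3, c4, c5, c6⟩ := hχ N hN
    refine (obata cs hl c1 c2).trans ?_
    have hcf : ∀ v, HasCompactSupport (fun x => fderiv ℝ (χ N) x v) := fun v => c2.fderiv_apply ℝ v
    have k1 : HasCompactSupport (gr (χ N) (χ N)) := ((hcf 1).mul_right).add ((hcf I).mul_right)
    have k2 := continuous_gr c1 c1
    have k3 : HasCompactSupport (fun z => exp (-2 * sg z - s z) * gr s s z * gr (χ N) (χ N) z) := k1.mul_left
    have k4 : Continuous (fun z => exp (-2 * sg z - s z) * gr s s z * gr (χ N) (χ N) z) := by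
      have := continuous_gr cs1 cs1; have := cs1.continuous; have := csg.continuous
      fun_prop
    have : ∫ z, exp (-2 * sg z - s z) * gr s s z * gr (χ N) (χ N) z ≤ ∫ z, C * gr (χ N) (χ N) z :=
      integral_mono (k4.integrable_of_hasCompactSupport k3) ((k2.integrable_of_hasCompactSupport k1).const_mul C)
        (fun z => mul_le_mul_of_nonneg_right (hC z) (grn _ _))
    refine this.trans ?_
    rw [integral_const_mul]
    exact mul_le_mul_of_nonneg_left c6 hC0
  have fz : ∀ m, 0 < m → ∀ z, (χ m z)^2 * (exp (-s z) * gr s s z) = 0 := by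
    intro m hm
    have hle : (2 - lam) * ∫ z, (χ m z)^2*(exp (-s z)*gr s s z) ≤ 0 := by
      have ht : Tendsto (fun N : ℝ => C * (K / N)) atTop (𝓝 0) := by
        have := (tendsto_const_nhds (x := K) (f := (atTop : Filter ℝ))).div_atTop tendsto_id
        simpa using this.const_mul C
      refine ge_of_tendsto ht ?_
      filter_upwards [eventually_ge_atTop m] with N hN
      have hN0 : 0 < N := by linarith
      refine le_trans (mul_le_mul_of_nonneg_left (integral_mono ((cI m hm).integrable_of_hasCompactSupport (sI m hm)) 
        ((cI N hN0).integrable_of_hasCompactSupport (sI N hN0)) fun z => ?_) (by linarith)) (main N hN0)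
      exact mul_le_mul_of_nonneg_right (pow_le_pow_left₀ ((hχ m hm).2.2.1 z) ((hχ m hm).2.2.2.1 N hN z) 2) 
        (mul_nonneg (exp_pos _).le (grn _ _))
    by_contra hne
    push Not at hne
    obtain ⟨z, hz⟩ := hne
    have := Continuous.integral_pos_of_hasCompactSupport_nonneg_nonzero (μ := (volume : Measure ℂ)) (cI m hm) (sI m hm)
      (fun z => mul_nonneg (sq_nonneg _) (mul_nonneg (exp_pos _).le (grn _ _))) hz
    have h3 : 0 < 2 - lam := by linarith
    have := mul_pos h3 this
    linarith
  have g0 : ∀ z, gr s s z = 0 := by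
    intro z
    have hm : 0 < max 1 (Real.log 2 - sg z) := lt_of_lt_of_le one_pos (le_max_left _ _)
    have := fz _ hm z
    rw [(hχ _ hm).2.2.2.2.1 z (le_max_right _ _)] at this
    have e := (exp_pos (-s z)).ne'
    simpa [e] using this
  have hf : ∀ z, fderiv ℝ s z = 0 := fun z => by
    have := norm_fderiv_sq s z
    rw [g0] at this
    simpa using this
  have hcst := is_const_of_fderiv_eq_zero (cs.differentiable (by norm_num)) hf
  refine h.const_zero h0.ne' (c := a 0) (fun z => ?_)
  have := hcst z 0
  rw [hsz, hsz] at this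
  linarith

end MF

namespace MF
open Complex (I)
open Filter Topology

theorem Lp_chart {w : ℝ × ℝ → ℝ} (hw : ContDiff ℝ 2 w) (z : ℂ) : 
    Lp (fun z => w (Complex.equivRealProdCLM z)) z = lap w (Complex.equivRealProdCLM z) := by
  have h1 : ∀ y v, fderiv ℝ (fun z => w (Complex.equivRealProdCLM z)) y v = fderiv ℝ w (Complex.equivRealProdCLM y) (Complex.equivRealProdCLM v) := by
    intro y v
    have : HasFDerivAt (fun z => w (Complex.equivRealProdCLM z)) _ y := 
      HasFDerivAt.comp y (hw.differentiable (by norm_num) _).hasFDerivAt (Complex.equivRealProdCLM : ℂ →L[ℝ] ℝ × ℝ).hasFDerivAt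
    rw [this.fderiv]; rfl
  have h2 : ∀ v, fderiv ℝ (fun y => fderiv ℝ (fun z => w (Complex.equivRealProdCLM z)) y v) z v = 
      fderiv ℝ (fderiv ℝ w) (Complex.equivRealProdCLM z) (Complex.equivRealProdCLM v) (Complex.equivRealProdCLM v) := by
    intro v
    simp only [h1]
    have hd : HasFDerivAt (fun y => fderiv ℝ w (Complex.equivRealProdCLM y)) _ z := 
      HasFDerivAt.comp z (((hw.fderiv_right (m := 1) (by norm_num)).differentiable (by norm_num) _).hasFDerivAt) 
        (Complex.equivRealProdCLM : ℂ →L[ℝ] ℝ × ℝ).hasFDerivAt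
    have := hd.clm_apply (hasFDerivAt_const (Complex.equivRealProdCLM v) z)
    rw [this.fderiv]
    simp
  unfold Lp lap
  rw [h2, h2, iteratedFDeriv_two_apply, iteratedFDeriv_two_apply]
  simp

theorem stereo_swap {z : ℂ} (hz : z ≠ 0) : stereoN (Complex.equivRealProdCLM (((starRingEnd ℂ) z)⁻¹)) = stereoS (Complex.equivRealProdCLM z) := by
  have hn : z.re ^ 2 + z.im ^ 2 ≠ 0 := by
    have := Complex.normSq_pos.2 hz
    rw [Complex.normSq_apply] at this
    nlinarith
  have e1 : (((starRingEnd ℂ) z)⁻¹).re = z.re / (z.re ^ 2 + z.im ^ 2) := by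
    simp [Complex.inv_re, Complex.normSq_apply, pow_two]
  have e2 : (((starRingEnd ℂ) z)⁻¹).im = z.im / (z.re ^ 2 + z.im ^ 2) := by
    simp [Complex.inv_im, Complex.normSq_apply, pow_two]
  unfold stereoN stereoS
  simp only [Complex.equivRealProdCLM_apply, e1, e2]
  generalize z.re = x at *
  generalize z.im = y at *
  have h1 : 1 + x^2 + y^2 ≠ 0 := by positivity
  have h2 : 1 + (x / (x^2+y^2))^2 + (y / (x^2+y^2))^2 = (1 + x^2 + y^2) / (x^2 + y^2) := by
    field_simp; ring
  rw [h2]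
  have h3 : (x / (x^2+y^2))^2 + (y / (x^2+y^2))^2 = 1 / (x^2 + y^2) := by
    field_simp
  rw [h3]
  congr 1
  · field_simp
  congr 1
  · field_simp
  congr 1
  · field_simp; ring

theorem sol_of_isMF {lam : ℝ} {u : (Fin 3 → ℝ) → ℝ} (hu : IsMFSolution lam u) : 
    Sol lam (fun z => u (stereoN (Complex.equivRealProdCLM z))) (fun z => u (stereoS (Complex.equivRealProdCLM z))) where
  ca := hu.2.1.comp (Complex.equivRealProdCLM : ℂ →L[ℝ] ℝ × ℝ).contDiff
  cb := hu.2.2.1.comp (Complex.equivRealProdCLM : ℂ →L[ℝ] ℝ × ℝ).contDiff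
  la := fun z => by
    rw [Lp_chart (w := fun y => u (stereoN y)) hu.2.1, hu.2.2.2.1, Complex.normSq_apply]
    simp only [Complex.equivRealProdCLM_apply]
    ring_nf
  lb := fun z => by
    rw [Lp_chart (w := fun y => u (stereoS y)) hu.2.2.1, hu.2.2.2.2, Complex.normSq_apply]
    simp only [Complex.equivRealProdCLM_apply]
    ring_nf
  ab := fun z hz => by
    simp only [stereo_swap hz]

end MF

/-- For `0 < λ ≤ 4`, `λ ≠ 2`, the only solution of the mean field
equation `Δu = λ(1 - e^u)` on `S²` is `u ≡ 0`. -/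
theorem small_lambda_solution_is_zero (lam : ℝ)
    (hlam₀ : 0 < lam) (hlam₄ : lam ≤ 4) (hlam₂ : lam ≠ 2)
    (u : (Fin 3 → ℝ) → ℝ) (hu : IsMFSolution lam u) :
    ∀ x ∈ sphere3, u x = 0 := by
  have hs := MF.sol_of_isMF hu
  have ha : ∀ z : ℂ, u (stereoN (Complex.equivRealProdCLM z)) = 0 := by
    rcases lt_or_gt_of_ne hlam₂ with h | h
    · exact hs.main_lt hlam₀ h
    · exact hs.main_gt h hlam₄
  have hb : ∀ z : ℂ, u (stereoS (Complex.equivRealProdCLM z)) = 0 := hs.zero_b ha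
  intro x hx
  have hx' : x 0 ^ 2 + x 1 ^ 2 + x 2 ^ 2 = 1 := hx
  by_cases h2 : x 2 = 1
  · have h0 : x 0 = 0 := by rw [h2] at hx'; nlinarith [sq_nonneg (x 0), sq_nonneg (x 1)]
    have h1 : x 1 = 0 := by rw [h2] at hx'; nlinarith [sq_nonneg (x 0), sq_nonneg (x 1)]
    have e : x = stereoS (Complex.equivRealProdCLM 0) := by
      ext i
      fin_cases i <;> simp [stereoS, h0, h1, h2]
    rw [e]; exact hb 0
  · have h3 : 1 - x 2 ≠ 0 := fun h => h2 (by linarith)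
    have e : x = stereoN (Complex.equivRealProdCLM ⟨x 0 / (1 - x 2), x 1 / (1 - x 2)⟩) := by
      have hd : 1 + (x 0 / (1 - x 2))^2 + (x 1 / (1 - x 2))^2 = 2 / (1 - x 2) := by
        field_simp
        linear_combination hx'
      have hd2 : (x 0 / (1 - x 2))^2 + (x 1 / (1 - x 2))^2 = 2 / (1 - x 2) - 1 := by linarith
      unfold stereoN
      simp only [Complex.equivRealProdCLM_apply, hd, hd2]
      ext i
      fin_cases i
      · simp; field_simp
      · simp; field_simp
      · simp; field_simp; ring
    rw [e]; exact ha _
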